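/- Let D be a bounded pseudoconvex domain in ℂ^n with n ≥ 2, let P be a polydisc with P ⊂ D and ∂P ∩ ∂D ≠ ∅, and let P̃ be a polydisc with P compactly contained in P̃. Assume that for every f ∈ L²_h(D) there exists a bounded holomorphic function f̂ on P̃ with f̂ = f on P. Then for every z ∈ P and every complex (affine) line L passing through z, the set (L ∩ P̃) \ D is a polar subset of L (identified with ℂ). -/

import Mathlib

open MeasureTheory Filter Topology Metric Set
open scoped ENNReal NNReal

/-- Truncated circle average of an `EReal`-valued function: the average over the circle of
center `c` and radius `R` of the function truncated below at `-n`. -/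
noncomputable def circleAvgTrunc (u : ℂ → EReal) (c : ℂ) (R : ℝ) (n : ℕ) : ℝ :=
  (2 * Real.pi)⁻¹ * ∫ θ in (0:ℝ)..(2 * Real.pi),
    (max (u (c + R * Complex.exp (θ * Complex.I))) (-(n : ℝ) : EReal)).toReal

/-- `u` is subharmonic on `Ω ⊆ ℂ`: values in `[-∞, ∞)`, upper semicontinuous on `Ω`, and for
every closed disc contained in `Ω` the value at the center is at most the mean over the
boundary circle (in the extended sense, via decreasing truncations). -/
def SubharmonicOn (u : ℂ → EReal) (Ω : Set ℂ) : Prop :=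
  UpperSemicontinuousOn u Ω ∧ (∀ z ∈ Ω, u z < ⊤) ∧
    ∀ c ∈ Ω, ∀ R : ℝ, 0 < R → Metric.closedBall c R ⊆ Ω →
      u c ≤ ⨅ n : ℕ, (circleAvgTrunc u c R n : EReal)

/-- `u` is plurisubharmonic on `Ω`: values in `[-∞, ∞)`, upper semicontinuous on `Ω`, and its
restriction to every complex line is subharmonic. -/
def PlurisubharmonicOn {E : Type*} [NormedAddCommGroup E] [NormedSpace ℂ E]
    (u : E → EReal) (Ω : Set E) : Prop :=
  UpperSemicontinuousOn u Ω ∧ (∀ z ∈ Ω, u z < ⊤) ∧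
    ∀ a b : E, SubharmonicOn (fun lam : ℂ => u (a + lam • b)) {lam : ℂ | a + lam • b ∈ Ω}

/-- A set `P ⊆ ℂ` is polar. -/
def PolarSet (P : Set ℂ) : Prop :=
  ∀ z ∈ P, ∃ U : Set ℂ, IsOpen U ∧ IsConnected U ∧ z ∈ U ∧
    ∃ u : ℂ → EReal, SubharmonicOn u U ∧ (∃ x ∈ U, u x ≠ ⊥) ∧ ∀ x ∈ P ∩ U, u x = ⊥

/-- A set `P ⊆ ℂⁿ` is pluripolar. -/
def PluripolarSet {E : Type*} [NormedAddCommGroup E] [NormedSpace ℂ E] (P : Set E) : Prop :=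
  ∀ z ∈ P, ∃ U : Set E, IsOpen U ∧ IsConnected U ∧ z ∈ U ∧
    ∃ u : E → EReal, PlurisubharmonicOn u U ∧ (∃ x ∈ U, u x ≠ ⊥) ∧ ∀ x ∈ P ∩ U, u x = ⊥

/-- A domain `D` is pseudoconvex if `z ↦ -log dist(z, ∂D)` is plurisubharmonic on `D`. -/
def IsPseudoconvex {E : Type*} [NormedAddCommGroup E] [NormedSpace ℂ E] (D : Set E) : Prop :=
  PlurisubharmonicOn (fun z => ((- Real.log (Metric.infDist z Dᶜ) : ℝ) : EReal)) D

/-- The square-integrable holomorphic functions on an open set `Ω`. -/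
def L2h {E : Type*} [NormedAddCommGroup E] [NormedSpace ℂ E] [MeasureSpace E]
    (Ω : Set E) : Set (E → ℂ) :=
  {f | DifferentiableOn ℂ f Ω ∧ (∫⁻ z in Ω, (‖f z‖₊ : ℝ≥0∞) ^ 2) < ⊤}

/-- The Bergman kernel of `Ω` on the diagonal,
`K_Ω(z) = sup { |f(z)|²/‖f‖²_{L²(Ω)} : f ∈ L²ₕ(Ω), f ≢ 0 }`. -/
noncomputable def bergmanKernel {E : Type*} [NormedAddCommGroup E] [NormedSpace ℂ E]
    [MeasureSpace E] (Ω : Set E) (z : E) : ℝ≥0∞ :=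
  ⨆ (f : E → ℂ) (_ : f ∈ L2h Ω) (_ : ∃ w ∈ Ω, f w ≠ 0),
    (‖f z‖₊ : ℝ≥0∞) ^ 2 / ∫⁻ w in Ω, (‖f w‖₊ : ℝ≥0∞) ^ 2

/-- `D` is an `L²ₕ`-domain of holomorphy: there are no domains `D₀, D₁` with
`∅ ≠ D₀ ⊆ D₁ ∩ D`, `D₁ ⊄ D`, such that every `f ∈ L²ₕ(D)` extends holomorphically to `D₁`
(agreeing with `f` on `D₀`). -/
def IsL2hDomainOfHolomorphy {E : Type*} [NormedAddCommGroup E] [NormedSpace ℂ E]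
    [MeasureSpace E] (D : Set E) : Prop :=
  ¬ ∃ D0 D1 : Set E, IsOpen D0 ∧ IsConnected D0 ∧ IsOpen D1 ∧ IsConnected D1 ∧
      D0 ⊆ D1 ∩ D ∧ ¬ (D1 ⊆ D) ∧
      ∀ f ∈ L2h D, ∃ F : E → ℂ, DifferentiableOn ℂ F D1 ∧ Set.EqOn F f D0

/-- `w` is a regular boundary point of the domain `D ⊆ ℂ`. -/
def RegularBoundaryPt (D : Set ℂ) (w : ℂ) : Prop :=
  ∃ U : Set ℂ, IsOpen U ∧ w ∈ U ∧ ∃ u : ℂ → EReal, SubharmonicOn u (U ∩ D) ∧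
    (∀ z ∈ U ∩ D, u z < 0) ∧ Tendsto u (𝓝[U ∩ D] w) (𝓝 (0 : EReal))

/-- The (pluricomplex) Green function of a domain `D ⊆ ℂ` with logarithmic pole at `p`. -/
noncomputable def greenFn (D : Set ℂ) (p z : ℂ) : EReal :=
  sSup {v : EReal | ∃ u : ℂ → EReal, SubharmonicOn u D ∧ (∀ x ∈ D, u x < 0) ∧
    (∃ C : ℝ, ∀ᶠ x in 𝓝 p, u x ≤ ((Real.log ‖x - p‖ + C : ℝ) : EReal)) ∧ v = u z}

/-- A polydisc in `ℂⁿ` with centre `c` and multiradius `r`. -/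
def polydisc {n : ℕ} (c : Fin n → ℂ) (r : Fin n → ℝ) : Set (Fin n → ℂ) :=
  {z | ∀ i, ‖z i - c i‖ < r i}

set_option linter.unusedSectionVars false
set_option linter.unusedVariables false
set_option linter.deprecated false

/-! ## Wirtinger calculus -/
section calc1
variable {E : Type*} [NormedAddCommGroup E] [NormedSpace ℂ E]

noncomputable def dz (v : E) (f : E → ℂ) (x : E) : ℂ :=
  (1 / 2) * (fderiv ℝ f x v - Complex.I * fderiv ℝ f x (Complex.I • v))

noncomputable def dzb (v : E) (f : E → ℂ) (x : E) : ℂ :=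
  (1 / 2) * (fderiv ℝ f x v + Complex.I * fderiv ℝ f x (Complex.I • v))

abbrev Sm (f : E → ℂ) : Prop := ContDiff ℝ (⊤ : ℕ∞) f

lemma Sm.da {f : E → ℂ} (hf : Sm f) (x : E) : DifferentiableAt ℝ f x :=
  (hf.differentiable (by simp)).differentiableAt

lemma Sm.fd {f : E → ℂ} (hf : Sm f) (v : E) : Sm (fun x => fderiv ℝ f x v) :=
  (hf.fderiv_right (m := (⊤ : ℕ∞)) (by simp)).clm_apply contDiff_const

lemma Sm.dz {f : E → ℂ} (hf : Sm f) (v : E) : Sm (dz v f) :=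
  contDiff_const.mul ((hf.fd v).sub (contDiff_const.mul (hf.fd _)))

lemma Sm.dzb {f : E → ℂ} (hf : Sm f) (v : E) : Sm (dzb v f) :=
  contDiff_const.mul ((hf.fd v).add (contDiff_const.mul (hf.fd _)))

lemma Sm.conj {f : E → ℂ} (hf : Sm f) : Sm (fun x => (starRingEnd ℂ) (f x)) :=
  Complex.conjCLE.contDiff.comp hf

lemma Sm.mul' {f g : E → ℂ} (hf : Sm f) (hg : Sm g) : Sm (fun x => f x * g x) :=
  ContDiff.mul hf hg

lemma fderiv_conj' {f : E → ℂ} {x : E} (v : E) (hf : DifferentiableAt ℝ f x) :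
    fderiv ℝ (fun y => (starRingEnd ℂ) (f y)) x v = (starRingEnd ℂ) (fderiv ℝ f x v) := by
  have h := (Complex.conjCLE.toContinuousLinearMap.hasFDerivAt (x := f x)).comp x hf.hasFDerivAt
  have h2 : HasFDerivAt (fun y => (starRingEnd ℂ) (f y))
    (Complex.conjCLE.toContinuousLinearMap.comp (fderiv ℝ f x)) x := h
  rw [h2.fderiv]; simp

lemma dz_conj {f : E → ℂ} {x : E} (v : E) (hf : DifferentiableAt ℝ f x) :
    dz v (fun y => (starRingEnd ℂ) (f y)) x = (starRingEnd ℂ) (dzb v f x) := by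
  simp [dz, dzb, fderiv_conj' _ hf, map_ofNat]; ring

lemma dzb_conj {f : E → ℂ} {x : E} (v : E) (hf : DifferentiableAt ℝ f x) :
    dzb v (fun y => (starRingEnd ℂ) (f y)) x = (starRingEnd ℂ) (dz v f x) := by
  simp [dz, dzb, fderiv_conj' _ hf, map_ofNat]

lemma dz_mul {f g : E → ℂ} {x : E} (v : E) (hf : DifferentiableAt ℝ f x)
    (hg : DifferentiableAt ℝ g x) :
    dz v (fun y => f y * g y) x = dz v f x * g x + f x * dz v g x := by
  simp only [dz, fderiv_fun_mul hf hg]; simp; ring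

lemma dzb_mul {f g : E → ℂ} {x : E} (v : E) (hf : DifferentiableAt ℝ f x)
    (hg : DifferentiableAt ℝ g x) :
    dzb v (fun y => f y * g y) x = dzb v f x * g x + f x * dzb v g x := by
  simp only [dzb, fderiv_fun_mul hf hg]; simp; ring

lemma dz_add {f g : E → ℂ} {x : E} (v : E) (hf : DifferentiableAt ℝ f x)
    (hg : DifferentiableAt ℝ g x) :
    dz v (fun y => f y + g y) x = dz v f x + dz v g x := by
  simp only [dz, fderiv_fun_add hf hg]; simp; ring

lemma dzb_add {f g : E → ℂ} {x : E} (v : E) (hf : DifferentiableAt ℝ f x)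
    (hg : DifferentiableAt ℝ g x) :
    dzb v (fun y => f y + g y) x = dzb v f x + dzb v g x := by
  simp only [dzb, fderiv_fun_add hf hg]; simp; ring

lemma dzb_sub {f g : E → ℂ} {x : E} (v : E) (hf : DifferentiableAt ℝ f x)
    (hg : DifferentiableAt ℝ g x) :
    dzb v (fun y => f y - g y) x = dzb v f x - dzb v g x := by
  simp only [dzb, fderiv_fun_sub hf hg]; simp; ring

lemma dz_congr {f g : E → ℂ} {x : E} (v : E) (h : f =ᶠ[𝓝 x] g) : dz v f x = dz v g x := by
  simp only [dz, h.fderiv_eq]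

lemma dzb_congr {f g : E → ℂ} {x : E} (v : E) (h : f =ᶠ[𝓝 x] g) : dzb v f x = dzb v g x := by
  simp only [dzb, h.fderiv_eq]

lemma dz_supp {f : E → ℂ} {x : E} (v : E) (h : x ∉ tsupport f) : dz v f x = 0 := by
  have : f =ᶠ[𝓝 x] fun _ => (0 : ℂ) := notMem_tsupport_iff_eventuallyEq.mp h
  rw [dz_congr v this]; simp [dz]

lemma dzb_supp {f : E → ℂ} {x : E} (v : E) (h : x ∉ tsupport f) : dzb v f x = 0 := by
  have : f =ᶠ[𝓝 x] fun _ => (0 : ℂ) := notMem_tsupport_iff_eventuallyEq.mp h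
  rw [dzb_congr v this]; simp [dzb]

lemma hcs_of_supp {f g : E → ℂ} (hf : HasCompactSupport f) (h : ∀ x, x ∉ tsupport f → g x = 0) :
    HasCompactSupport g :=
  hf.mono' (fun x hx => by by_contra h'; exact hx (h x h'))

lemma tsupport_of_supp {f g : E → ℂ} (h : ∀ x, x ∉ tsupport f → g x = 0) :
    tsupport g ⊆ tsupport f :=
  closure_minimal (fun x hx => by by_contra h'; exact hx (h x h')) (isClosed_tsupport f)

lemma dz_fderiv {f : E → ℂ} (hf : Sm f) (u v w x : E) :
    fderiv ℝ (fun y => fderiv ℝ f y u) x v = fderiv ℝ (fun y => fderiv ℝ f y v) x u := by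
  have h1 : ∀ u v : E, fderiv ℝ (fun y => fderiv ℝ f y u) x v = fderiv ℝ (fderiv ℝ f) x v u := by
    intro u v
    have hd : DifferentiableAt ℝ (fderiv ℝ f) x :=
      ((hf.fderiv_right (m := (⊤ : ℕ∞)) (by simp)).differentiable (by simp)).differentiableAt
    have := hd.hasFDerivAt.clm_apply (hasFDerivAt_const u x)
    rw [this.fderiv]; simp
  rw [h1, h1]
  exact ((hf.contDiffAt (x := x)).isSymmSndFDerivAt (by
    simp only [minSmoothness_of_isRCLikeNormedField]; exact WithTop.coe_le_coe.2 le_top)) v u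

lemma dz_dzb_comm {f : E → ℂ} (hf : Sm f) (v w x : E) :
    dz v (dzb w f) x = dzb w (dz v f) x := by
  have key : ∀ (a b : E), DifferentiableAt ℝ (fun y => fderiv ℝ f y a) x := fun a _ => (hf.fd a).da x
  have e1 : ∀ u, fderiv ℝ (dzb w f) x u = (1/2) * (fderiv ℝ (fun y => fderiv ℝ f y w) x u +
      Complex.I * fderiv ℝ (fun y => fderiv ℝ f y (Complex.I • w)) x u) := by
    intro u
    have : HasFDerivAt (dzb w f) _ x :=
      (((key w w).hasFDerivAt).add (((key (Complex.I • w) w).hasFDerivAt).const_mul Complex.I)).const_mul (1/2)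
    rw [this.fderiv]; simp; ring
  have e2 : ∀ u, fderiv ℝ (dz v f) x u = (1/2) * (fderiv ℝ (fun y => fderiv ℝ f y v) x u -
      Complex.I * fderiv ℝ (fun y => fderiv ℝ f y (Complex.I • v)) x u) := by
    intro u
    have : HasFDerivAt (dz v f) _ x :=
      (((key v v).hasFDerivAt).sub (((key (Complex.I • v) v).hasFDerivAt).const_mul Complex.I)).const_mul (1/2)
    rw [this.fderiv]; simp
  conv_lhs => rw [dz]
  conv_rhs => rw [dzb]
  rw [e1, e1, e2, e2, dz_fderiv hf w v 0, dz_fderiv hf w (Complex.I • v) 0,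
    dz_fderiv hf (Complex.I • w) v 0, dz_fderiv hf (Complex.I • w) (Complex.I • v) 0]
  ring

lemma dz_holo {f : E → ℂ} {x : E} (v : E) (hf : DifferentiableAt ℂ f x) : dzb v f x = 0 := by
  have h : HasFDerivAt f ((fderiv ℂ f x).restrictScalars ℝ) x := hf.hasFDerivAt.restrictScalars ℝ
  rw [dzb, h.fderiv]; simp
  rw [← mul_assoc, Complex.I_mul_I]; ring

end calc1

section ibp
variable {E : Type*} [NormedAddCommGroup E] [NormedSpace ℂ E] [MeasurableSpace E] [BorelSpace E]
  [FiniteDimensional ℝ E] {μ : Measure E} [μ.IsAddHaarMeasure]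

lemma int_cs {f : E → ℂ} (hf : Continuous f) (h : HasCompactSupport f) : Integrable f μ :=
  hf.integrable_of_hasCompactSupport h

lemma ibp_fderiv {f g : E → ℂ} (hf : Sm f) (hg : Sm g) (hc : HasCompactSupport g) (v : E) :
    ∫ x, f x * fderiv ℝ g x v ∂μ = - ∫ x, fderiv ℝ f x v * g x ∂μ := by
  apply integral_mul_fderiv_eq_neg_fderiv_mul_of_integrable
  · exact int_cs ((hf.fd v).mul hg).continuous hc.mul_left
  · refine int_cs (hf.mul (hg.fd v)).continuous (HasCompactSupport.mul_left ?_)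
    exact hc.fderiv_apply ℝ v
  · exact int_cs (hf.mul hg).continuous hc.mul_left
  · exact fun x _ => hf.da x
  · exact fun x _ => hg.da x

lemma hcs_fd {g : E → ℂ} (hc : HasCompactSupport g) (v : E) :
    HasCompactSupport (fun x => fderiv ℝ g x v) := hc.fderiv_apply ℝ v

lemma hcs_dz {g : E → ℂ} (hc : HasCompactSupport g) (v : E) : HasCompactSupport (dz v g) :=
  hcs_of_supp hc (fun _ h => dz_supp v h)

lemma hcs_dzb {g : E → ℂ} (hc : HasCompactSupport g) (v : E) : HasCompactSupport (dzb v g) :=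
  hcs_of_supp hc (fun _ h => dzb_supp v h)

lemma ibp_dz {f g : E → ℂ} (hf : Sm f) (hg : Sm g) (hc : HasCompactSupport g) (v : E) :
    ∫ x, f x * dz v g x ∂μ = - ∫ x, dz v f x * g x ∂μ := by
  have i1 : ∀ v, Integrable (fun x => f x * fderiv ℝ g x v) μ := fun v =>
    int_cs (hf.mul (hg.fd v)).continuous ((hcs_fd hc v).mul_left)
  have i2 : ∀ v, Integrable (fun x => fderiv ℝ f x v * g x) μ := fun v =>
    int_cs ((hf.fd v).mul hg).continuous hc.mul_left
  have e1 : ∀ x, f x * dz v g x = (1/2) * (f x * fderiv ℝ g x v)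
      - (1/2) * Complex.I * (f x * fderiv ℝ g x (Complex.I • v)) := fun x => by rw [dz]; ring
  have e2 : ∀ x, dz v f x * g x = (1/2) * (fderiv ℝ f x v * g x)
      - (1/2) * Complex.I * (fderiv ℝ f x (Complex.I • v) * g x) := fun x => by rw [dz]; ring
  simp_rw [e1, e2]
  rw [integral_sub ((i1 v).const_mul _) ((i1 _).const_mul _),
    integral_sub ((i2 v).const_mul _) ((i2 _).const_mul _)]
  simp only [integral_const_mul]
  rw [ibp_fderiv hf hg hc, ibp_fderiv hf hg hc]; ring

lemma ibp_dzb {f g : E → ℂ} (hf : Sm f) (hg : Sm g) (hc : HasCompactSupport g) (v : E) :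
    ∫ x, f x * dzb v g x ∂μ = - ∫ x, dzb v f x * g x ∂μ := by
  have i1 : ∀ v, Integrable (fun x => f x * fderiv ℝ g x v) μ := fun v =>
    int_cs (hf.mul (hg.fd v)).continuous ((hcs_fd hc v).mul_left)
  have i2 : ∀ v, Integrable (fun x => fderiv ℝ f x v * g x) μ := fun v =>
    int_cs ((hf.fd v).mul hg).continuous hc.mul_left
  have e1 : ∀ x, f x * dzb v g x = (1/2) * (f x * fderiv ℝ g x v)
      + (1/2) * Complex.I * (f x * fderiv ℝ g x (Complex.I • v)) := fun x => by rw [dzb]; ring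
  have e2 : ∀ x, dzb v f x * g x = (1/2) * (fderiv ℝ f x v * g x)
      + (1/2) * Complex.I * (fderiv ℝ f x (Complex.I • v) * g x) := fun x => by rw [dzb]; ring
  simp_rw [e1, e2]
  rw [integral_add ((i1 v).const_mul _) ((i1 _).const_mul _),
    integral_add ((i2 v).const_mul _) ((i2 _).const_mul _)]
  simp only [integral_const_mul]
  rw [ibp_fderiv hf hg hc, ibp_fderiv hf hg hc]; ring

end ibp

section calc2
variable {E : Type*} [NormedAddCommGroup E] [NormedSpace ℂ E]

abbrev cr (f : E → ℝ) : E → ℂ := fun x => (f x : ℂ)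

lemma fderiv_cr {f : E → ℝ} {x : E} (v : E) (hf : DifferentiableAt ℝ f x) :
    fderiv ℝ (cr f) x v = (fderiv ℝ f x v : ℂ) := by
  have h := (Complex.ofRealCLM.hasFDerivAt (x := f x)).comp x hf.hasFDerivAt
  have h2 : HasFDerivAt (cr f) (Complex.ofRealCLM.comp (fderiv ℝ f x)) x := h
  rw [h2.fderiv]; simp

lemma cr_da {f : E → ℝ} {x : E} (hf : DifferentiableAt ℝ f x) : DifferentiableAt ℝ (cr f) x :=
  ((Complex.ofRealCLM.hasFDerivAt (x := f x)).comp x hf.hasFDerivAt).differentiableAt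

lemma cr_sm {f : E → ℝ} (hf : ContDiff ℝ (⊤ : ℕ∞) f) : Sm (cr f) :=
  Complex.ofRealCLM.contDiff.comp hf

lemma dz_comp {f : E → ℝ} {x : E} (v : E) {h : ℝ → ℝ} {h' : ℝ} (hf : DifferentiableAt ℝ f x)
    (hh : HasDerivAt h h' (f x)) :
    dz v (cr (fun y => h (f y))) x = h' * dz v (cr f) x := by
  have h1 : HasFDerivAt (fun y => h (f y)) (h' • fderiv ℝ f x) x :=
    hh.comp_hasFDerivAt x hf.hasFDerivAt
  simp only [dz]
  rw [fderiv_cr _ hf, fderiv_cr _ hf, fderiv_cr _ h1.differentiableAt,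
    fderiv_cr _ h1.differentiableAt, h1.fderiv]
  simp; ring

lemma dzb_comp {f : E → ℝ} {x : E} (v : E) {h : ℝ → ℝ} {h' : ℝ} (hf : DifferentiableAt ℝ f x)
    (hh : HasDerivAt h h' (f x)) :
    dzb v (cr (fun y => h (f y))) x = h' * dzb v (cr f) x := by
  have h1 : HasFDerivAt (fun y => h (f y)) (h' • fderiv ℝ f x) x :=
    hh.comp_hasFDerivAt x hf.hasFDerivAt
  simp only [dzb]
  rw [fderiv_cr _ hf, fderiv_cr _ hf, fderiv_cr _ h1.differentiableAt,
    fderiv_cr _ h1.differentiableAt, h1.fderiv]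
  simp; ring

lemma conj_dz_cr {f : E → ℝ} {x : E} (v : E) (hf : DifferentiableAt ℝ f x) :
    (starRingEnd ℂ) (dz v (cr f) x) = dzb v (cr f) x := by
  rw [← dzb_conj v (cr_da hf)]; simp

noncomputable def dl (v : E) (Ξ : E → ℝ) (g : E → ℂ) (x : E) : ℂ :=
  dz v g x - dz v (cr Ξ) x * g x

lemma dl_sm {Ξ : E → ℝ} (hΞ : ContDiff ℝ (⊤ : ℕ∞) Ξ) {g : E → ℂ} (hg : Sm g) (v : E) :
    Sm (dl v Ξ g) := (hg.dz v).sub (((cr_sm hΞ).dz v).mul hg)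

noncomputable def wt (Ξ : E → ℝ) : E → ℝ := fun x => Real.exp (-Ξ x)

lemma wt_sm {Ξ : E → ℝ} (hΞ : ContDiff ℝ (⊤ : ℕ∞) Ξ) : ContDiff ℝ (⊤ : ℕ∞) (wt Ξ) :=
  Real.contDiff_exp.comp hΞ.neg

lemma dz_wt {Ξ : E → ℝ} {x : E} (v : E) (hf : DifferentiableAt ℝ Ξ x) :
    dz v (cr (wt Ξ)) x = - dz v (cr Ξ) x * wt Ξ x := by
  have : HasDerivAt (fun t : ℝ => Real.exp (-t)) (-Real.exp (-(Ξ x))) (Ξ x) := by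
    simpa using (hasDerivAt_neg (Ξ x)).exp
  have h := dz_comp v hf this
  unfold wt
  rw [h]; push_cast; ring

lemma dl_wt {Ξ : E → ℝ} (hΞ : ContDiff ℝ (⊤ : ℕ∞) Ξ) {g : E → ℂ} (hg : Sm g) (v x : E) :
    dl v Ξ g x * wt Ξ x = dz v (fun y => g y * cr (wt Ξ) y) x := by
  rw [dz_mul v (hg.da x) ((cr_sm (wt_sm hΞ)).da x),
    dz_wt v (hΞ.differentiable (by simp)).differentiableAt, dl]
  simp only [cr]; ring

variable [MeasurableSpace E] [BorelSpace E]
  [FiniteDimensional ℝ E] {μ : Measure E} [μ.IsAddHaarMeasure]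

lemma basic_jk {Ξ : E → ℝ} (hΞ : ContDiff ℝ (⊤ : ℕ∞) Ξ) {g h : E → ℂ} (hg : Sm g) (hh : Sm h)
    (hgc : HasCompactSupport g) (hhc : HasCompactSupport h) (v w : E) :
    ∫ x, dl v Ξ g x * (starRingEnd ℂ) (dl w Ξ h x) * wt Ξ x ∂μ =
      (∫ x, dzb w (dz v (cr Ξ)) x * g x * (starRingEnd ℂ) (h x) * wt Ξ x ∂μ)
      + ∫ x, dzb w g x * (starRingEnd ℂ) (dzb v h x) * wt Ξ x ∂μ := by
  have hd : ∀ x, DifferentiableAt ℝ Ξ x := fun x => (hΞ.differentiable (by simp)).differentiableAt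
  have hW := cr_sm (wt_sm hΞ)
  have hC := cr_sm hΞ
  -- pointwise
  have p1 : ∀ x, dzb v (dl w Ξ h) x = dl w Ξ (dzb v h) x
      - (starRingEnd ℂ) (dzb w (dz v (cr Ξ)) x) * h x := by
    intro x
    have : dl w Ξ h = fun y => dz w h y - dz w (cr Ξ) y * h y := rfl
    rw [this, dzb_sub v ((hh.dz w).da x) (((hC.dz w).mul' hh).da x),
      dzb_mul v ((hC.dz w).da x) (hh.da x), ← dz_dzb_comm hh, dl]
    have : (starRingEnd ℂ) (dzb w (dz v (cr Ξ)) x) = dzb v (dz w (cr Ξ)) x := by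
      rw [← dz_conj w ((hC.dz v).da x), ← dz_dzb_comm hC]
      congr 1; ext y; rw [conj_dz_cr v (hd y)]
    rw [this]; ring
  have s1 : Sm (fun x => (starRingEnd ℂ) (dl w Ξ h x)) := (dl_sm hΞ hh w).conj
  have c1 : HasCompactSupport (fun y => g y * cr (wt Ξ) y) := hgc.mul_right
  calc ∫ x, dl v Ξ g x * (starRingEnd ℂ) (dl w Ξ h x) * wt Ξ x ∂μ
      = ∫ x, (starRingEnd ℂ) (dl w Ξ h x) * dz v (fun y => g y * cr (wt Ξ) y) x ∂μ := by
        congr 1; ext x; rw [← dl_wt hΞ hg]; ring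
    _ = - ∫ x, dz v (fun x => (starRingEnd ℂ) (dl w Ξ h x)) x * (g x * cr (wt Ξ) x) ∂μ :=
        ibp_dz s1 (hg.mul hW) c1 v
    _ = - ∫ x, (g x * (starRingEnd ℂ) (dl w Ξ (dzb v h) x) * wt Ξ x
         - dzb w (dz v (cr Ξ)) x * g x * (starRingEnd ℂ) (h x) * wt Ξ x) ∂μ := by
        congr 2; ext x
        rw [dz_conj v ((dl_sm hΞ hh w).da x), p1]
        simp [cr]; ring
    _ = (∫ x, dzb w (dz v (cr Ξ)) x * g x * (starRingEnd ℂ) (h x) * wt Ξ x ∂μ)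
        - ∫ x, g x * (starRingEnd ℂ) (dl w Ξ (dzb v h) x) * wt Ξ x ∂μ := by
        rw [integral_sub]
        · ring
        · refine int_cs (((hg.mul (dl_sm hΞ (hh.dzb v) w).conj).mul hW).continuous) ?_
          exact (hgc.mul_right).mul_right
        · refine int_cs ((((((hC.dz v).dzb w).mul hg).mul hh.conj).mul hW).continuous) ?_
          exact ((hgc.mul_left).mul_right).mul_right
    _ = _ := by
        rw [sub_eq_add_neg]; congr 1
        have : ∀ x, g x * (starRingEnd ℂ) (dl w Ξ (dzb v h) x) * wt Ξ x =
            g x * dzb w (fun y => (starRingEnd ℂ) (dzb v h y * cr (wt Ξ) y)) x := by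
          intro x
          rw [dzb_conj w (((hh.dzb v).mul' hW).da x), ← dl_wt hΞ (hh.dzb v)]
          simp; ring
        simp_rw [this]
        rw [ibp_dzb hg (((hh.dzb v).mul' hW).conj)]
        · rw [neg_neg]; congr 1; ext x; simp [cr]; ring
        · refine hcs_of_supp hhc (fun x hx => ?_)
          rw [dzb_supp v hx]; simp
end calc2

section basic
variable {n : ℕ}

noncomputable def ee (j : Fin n) : Fin n → ℂ := Pi.single j 1

noncomputable def Lv (Ξ : (Fin n → ℂ) → ℝ) (x ξ : Fin n → ℂ) : ℂ :=
  ∑ j, ∑ k, dzb (ee k) (dz (ee j) (cr Ξ)) x * ξ j * (starRingEnd ℂ) (ξ k)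

lemma alg_ineq (A : Fin n → Fin n → ℂ) :
    0 ≤ (∑ j, ∑ k, A k j * (starRingEnd ℂ) (A j k)).re + (1/2) * ∑ j, ∑ k, ‖A k j - A j k‖ ^ 2 := by
  have h : ∀ j k, ‖A k j - A j k‖ ^ 2 = ‖A k j‖^2 + ‖A j k‖^2 - 2 * (A k j * (starRingEnd ℂ) (A j k)).re := by
    intro j k
    rw [Complex.sq_norm, Complex.sq_norm, Complex.sq_norm, Complex.normSq_sub]
  simp_rw [h, Finset.sum_sub_distrib, Finset.sum_add_distrib, ← Finset.mul_sum, Complex.re_sum]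
  have : 0 ≤ ∑ j, ∑ k, ‖A k j‖^2 := by positivity
  have : 0 ≤ ∑ j, ∑ k, ‖A j k‖^2 := by positivity
  linarith

lemma basic_ineq {Ξ : (Fin n → ℂ) → ℝ} (hΞ : ContDiff ℝ (⊤ : ℕ∞) Ξ) {g : Fin n → (Fin n → ℂ) → ℂ}
    (hg : ∀ j, Sm (g j)) (hc : ∀ j, HasCompactSupport (g j)) :
    ∫ x, (Lv Ξ x (fun j => g j x)).re * wt Ξ x ≤
      (∫ x, ‖∑ j, dl (ee j) Ξ (g j) x‖ ^ 2 * wt Ξ x) +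
      (1/2) * ∫ x, (∑ j, ∑ k, ‖dzb (ee k) (g j) x - dzb (ee j) (g k) x‖ ^ 2) * wt Ξ x := by
  have hW := cr_sm (wt_sm hΞ)
  have hC := cr_sm hΞ
  have hdl : ∀ j, HasCompactSupport (dl (ee j) Ξ (g j)) := fun j => by
    refine hcs_of_supp (hc j) (fun x hx => ?_)
    simp [dl, dz_supp _ hx, image_eq_zero_of_notMem_tsupport hx]
  have i1 : ∀ j k, Integrable (fun x => dl (ee j) Ξ (g j) x * (starRingEnd ℂ) (dl (ee k) Ξ (g k) x) * wt Ξ x) := fun j k =>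
    int_cs (((dl_sm hΞ (hg j) _).mul (dl_sm hΞ (hg k) _).conj).mul hW).continuous
      (((hdl j).mul_right).mul_right)
  have i2 : ∀ j k, Integrable (fun x => dzb (ee k) (dz (ee j) (cr Ξ)) x * g j x * (starRingEnd ℂ) (g k x) * wt Ξ x) := fun j k =>
    int_cs ((((((hC.dz _).dzb _).mul (hg j)).mul (hg k).conj).mul hW).continuous)
      ((((hc j).mul_left).mul_right).mul_right)
  have i3 : ∀ j k, Integrable (fun x => dzb (ee k) (g j) x * (starRingEnd ℂ) (dzb (ee j) (g k) x) * wt Ξ x) := fun j k =>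
    int_cs (((((hg j).dzb _).mul ((hg k).dzb _).conj).mul hW).continuous)
      (((hcs_dzb (hc j) _).mul_right).mul_right)
  have I1 : Integrable (fun x => ∑ j, ∑ k, dl (ee j) Ξ (g j) x * (starRingEnd ℂ) (dl (ee k) Ξ (g k) x) * wt Ξ x) :=
    integrable_finsetSum _ (fun j _ => integrable_finsetSum _ (fun k _ => i1 j k))
  have I2 : Integrable (fun x => ∑ j, ∑ k, dzb (ee k) (dz (ee j) (cr Ξ)) x * g j x * (starRingEnd ℂ) (g k x) * wt Ξ x) :=
    integrable_finsetSum _ (fun j _ => integrable_finsetSum _ (fun k _ => i2 j k))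
  have I3 : Integrable (fun x => ∑ j, ∑ k, dzb (ee k) (g j) x * (starRingEnd ℂ) (dzb (ee j) (g k) x) * wt Ξ x) :=
    integrable_finsetSum _ (fun j _ => integrable_finsetSum _ (fun k _ => i3 j k))
  have I4 : Integrable (fun x => (∑ j, ∑ k, ‖dzb (ee k) (g j) x - dzb (ee j) (g k) x‖ ^ 2) * wt Ξ x) := by
    simp_rw [Finset.sum_mul]
    refine integrable_finsetSum _ (fun j _ => integrable_finsetSum _ (fun k _ => ?_))
    refine Continuous.integrable_of_hasCompactSupport ?_ ?_
    · exact ((((hg j).dzb _).continuous.sub ((hg k).dzb _).continuous).norm.pow 2).mul (wt_sm hΞ).continuous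
    · refine HasCompactSupport.mul_right ?_
      have : HasCompactSupport (fun x => dzb (ee k) (g j) x - dzb (ee j) (g k) x) :=
        (hcs_dzb (hc j) _).sub (hcs_dzb (hc k) _)
      exact this.comp_left (g := fun z : ℂ => ‖z‖ ^ 2) (by simp)
  have key : ∫ x, ∑ j, ∑ k, dl (ee j) Ξ (g j) x * (starRingEnd ℂ) (dl (ee k) Ξ (g k) x) * wt Ξ x =
      (∫ x, ∑ j, ∑ k, dzb (ee k) (dz (ee j) (cr Ξ)) x * g j x * (starRingEnd ℂ) (g k x) * wt Ξ x) +
      ∫ x, ∑ j, ∑ k, dzb (ee k) (g j) x * (starRingEnd ℂ) (dzb (ee j) (g k) x) * wt Ξ x := by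
    simp_rw [integral_finsetSum _ (fun j _ => integrable_finsetSum _ (fun k _ => i1 j k)),
      integral_finsetSum _ (fun j _ => integrable_finsetSum _ (fun k _ => i2 j k)),
      integral_finsetSum _ (fun j _ => integrable_finsetSum _ (fun k _ => i3 j k)),
      integral_finsetSum _ (fun k _ => i1 _ k),
      integral_finsetSum _ (fun k _ => i2 _ k), integral_finsetSum _ (fun k _ => i3 _ k),
      ← Finset.sum_add_distrib]
    exact Finset.sum_congr rfl fun j _ => Finset.sum_congr rfl fun k _ =>
      basic_jk hΞ (hg j) (hg k) (hc j) (hc k) _ _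
  have key2 := congrArg Complex.re key
  rw [Complex.add_re] at key2
  have re_int : ∀ f : (Fin n → ℂ) → ℂ, Integrable f → (∫ x, f x).re = ∫ x, (f x).re :=
    fun f hf => by simpa using (integral_re (𝕜 := ℂ) hf).symm
  rw [re_int _ I1, re_int _ I2, re_int _ I3] at key2
  have e1 : (∫ x, ‖∑ j, dl (ee j) Ξ (g j) x‖ ^ 2 * wt Ξ x) =
     ∫ x, (∑ j, ∑ k, dl (ee j) Ξ (g j) x * (starRingEnd ℂ) (dl (ee k) Ξ (g k) x) * wt Ξ x).re := by
    congr 1; ext x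
    simp_rw [← Finset.sum_mul, ← Finset.mul_sum, ← Finset.sum_mul, ← map_sum]
    rw [Complex.mul_conj, ← Complex.ofReal_mul, Complex.ofReal_re, Complex.normSq_eq_norm_sq]
  have e2 : (∫ x, (Lv Ξ x (fun j => g j x)).re * wt Ξ x) =
     ∫ x, (∑ j, ∑ k, dzb (ee k) (dz (ee j) (cr Ξ)) x * g j x * (starRingEnd ℂ) (g k x) * wt Ξ x).re := by
    congr 1; ext x
    simp_rw [← Finset.sum_mul]
    rw [Complex.re_mul_ofReal]; rfl
  rw [e1, e2, key2]
  have : 0 ≤ ∫ x, ((∑ j, ∑ k, dzb (ee k) (g j) x * (starRingEnd ℂ) (dzb (ee j) (g k) x) * wt Ξ x).re +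
     (1/2) * ((∑ j, ∑ k, ‖dzb (ee k) (g j) x - dzb (ee j) (g k) x‖ ^ 2) * wt Ξ x)) := by
    apply integral_nonneg; intro x
    simp_rw [← Finset.sum_mul]
    rw [Complex.re_mul_ofReal, ← mul_assoc, ← add_mul]
    exact mul_nonneg (alg_ineq (fun k j => dzb (ee k) (g j) x)) (Real.exp_pos _).le
  have I5 := I3.re
  simp only [RCLike.re_to_complex] at I5
  rw [integral_add I5 (I4.const_mul _), integral_const_mul] at this
  linarith
end basic

section mollifier
variable {n : ℕ}

noncomputable def ssq (x : Fin n → ℂ) : ℝ := ∑ i, ‖x i‖ ^ 2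

lemma ssq_sm : ContDiff ℝ (⊤ : ℕ∞) (ssq (n := n)) := by
  unfold ssq
  refine ContDiff.sum (fun i _ => ?_)
  exact (contDiff_apply ℝ ℂ i).norm_sq ℝ

lemma norm_le_ssq (x : Fin n → ℂ) : ‖x‖ ^ 2 ≤ ssq x := by
  have h : ‖x‖ ≤ Real.sqrt (ssq x) := by
    refine (pi_norm_le_iff_of_nonneg (Real.sqrt_nonneg _)).2 (fun i => ?_)
    apply Real.le_sqrt_of_sq_le
    exact Finset.single_le_sum (f := fun i => ‖x i‖ ^ 2) (fun i _ => by positivity) (Finset.mem_univ i)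
  have h0 : 0 ≤ ssq x := Finset.sum_nonneg (fun i _ => by positivity)
  calc ‖x‖ ^ 2 ≤ (Real.sqrt (ssq x)) ^ 2 := by gcongr
    _ = ssq x := Real.sq_sqrt h0

noncomputable def mk0 (ε : ℝ) (x : Fin n → ℂ) : ℝ := Real.smoothTransition (1 - ssq x / ε ^ 2)

lemma mk0_sm (ε : ℝ) : ContDiff ℝ (⊤ : ℕ∞) (mk0 (n := n) ε) :=
  Real.smoothTransition.contDiff.comp (contDiff_const.sub (ssq_sm.div_const _))

lemma mk0_supp {ε : ℝ} (hε : 0 < ε) {x : Fin n → ℂ} (hx : ε ≤ ‖x‖) : mk0 ε x = 0 := by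
  apply Real.smoothTransition.zero_of_nonpos
  have h := norm_le_ssq x
  have : 1 ≤ ssq x / ε ^ 2 := by
    rw [le_div_iff₀ (by positivity)]
    nlinarith
  linarith

lemma mk0_tsupp {ε : ℝ} (hε : 0 < ε) : tsupport (mk0 (n := n) ε) ⊆ closedBall 0 ε := by
  refine closure_minimal (fun x hx => ?_) isClosed_closedBall
  by_contra h
  rw [mem_closedBall_zero_iff, not_le] at h
  exact hx (mk0_supp hε h.le)

lemma mk0_cs {ε : ℝ} (hε : 0 < ε) : HasCompactSupport (mk0 (n := n) ε) :=
  (isCompact_closedBall _ _).of_isClosed_subset (isClosed_tsupport _) (mk0_tsupp hε)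

lemma mk0_int {ε : ℝ} (hε : 0 < ε) : Integrable (mk0 (n := n) ε) :=
  (mk0_sm ε).continuous.integrable_of_hasCompactSupport (mk0_cs hε)

lemma mk0_int_pos {ε : ℝ} (hε : 0 < ε) : 0 < ∫ x, mk0 (n := n) ε x := by
  apply (mk0_sm ε).continuous.integral_pos_of_hasCompactSupport_nonneg_nonzero (mk0_cs hε)
    (fun x => Real.smoothTransition.nonneg _) (x := 0)
  simp [mk0, ssq]

noncomputable def mkn (ε : ℝ) (x : Fin n → ℂ) : ℝ := mk0 ε x / ∫ x, mk0 (n := n) ε x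

lemma mk_sm (ε : ℝ) : ContDiff ℝ (⊤ : ℕ∞) (mkn (n := n) ε) := (mk0_sm ε).div_const _

lemma mk_supp {ε : ℝ} (hε : 0 < ε) {x : Fin n → ℂ} (hx : ε ≤ ‖x‖) : mkn ε x = 0 := by
  simp [mkn, mk0_supp hε hx]

lemma mk_cs {ε : ℝ} (hε : 0 < ε) : HasCompactSupport (mkn (n := n) ε) := by
  unfold mkn; simp_rw [div_eq_mul_inv]; exact (mk0_cs hε).mul_right

lemma mk_nonneg {ε : ℝ} (hε : 0 < ε) (x : Fin n → ℂ) : 0 ≤ mkn ε x :=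
  div_nonneg (Real.smoothTransition.nonneg _) (mk0_int_pos hε).le

lemma mk_int {ε : ℝ} (hε : 0 < ε) : Integrable (mkn (n := n) ε) := (mk0_int hε).div_const _

lemma mk_int1 {ε : ℝ} (hε : 0 < ε) : ∫ x, mkn (n := n) ε x = 1 := by
  unfold mkn; rw [integral_div, div_self (mk0_int_pos hε).ne']

lemma mk_circ (ε : ℝ) (c : ℂ) (hc : ‖c‖ = 1) (x : Fin n → ℂ) : mkn ε (c • x) = mkn ε x := by
  simp [mkn, mk0, ssq, hc]

lemma crmk_cs {ε : ℝ} (hε : 0 < ε) : HasCompactSupport (cr (mkn (n := n) ε)) :=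
  (mk_cs hε).comp_left (g := fun t : ℝ => (t : ℂ)) (by simp)

noncomputable def moll (ε : ℝ) (f : (Fin n → ℂ) → ℂ) : (Fin n → ℂ) → ℂ :=
  convolution f (cr (mkn ε)) (ContinuousLinearMap.mul ℝ ℂ) volume

lemma moll_def (ε : ℝ) (f : (Fin n → ℂ) → ℂ) (x) : moll ε f x = ∫ y, f y * (mkn ε (x - y) : ℂ) := rfl

lemma moll_def' (ε : ℝ) (f : (Fin n → ℂ) → ℂ) (x) : moll ε f x = ∫ y, f (x - y) * (mkn ε y : ℂ) := by
  rw [moll, convolution_eq_swap]; rfl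

lemma moll_sm {ε : ℝ} (hε : 0 < ε) {f : (Fin n → ℂ) → ℂ} (hf : LocallyIntegrable f) :
    Sm (moll ε f) :=
  (crmk_cs hε).contDiff_convolution_right _ hf (cr_sm (mk_sm ε))

lemma moll_integrable {ε : ℝ} (hε : 0 < ε) {f : (Fin n → ℂ) → ℂ} (hf : LocallyIntegrable f) (x) :
    Integrable (fun y => f y * (mkn ε (x - y) : ℂ)) :=
  (crmk_cs hε).convolutionExists_right (ContinuousLinearMap.mul ℝ ℂ) hf (cr_sm (mk_sm ε)).continuous x

lemma locint_mul {f g : (Fin n → ℂ) → ℂ} (hf : LocallyIntegrable f) (hg : Continuous g)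
    (hc : HasCompactSupport g) : Integrable (fun y => f y * g y) := by
  have := hf.integrable_smul_right_of_hasCompactSupport hg hc
  refine this.congr (Eventually.of_forall fun x => ?_)
  simp

lemma moll_fd {ε : ℝ} (hε : 0 < ε) {f : (Fin n → ℂ) → ℂ} (hf : LocallyIntegrable f) (x v) :
    fderiv ℝ (moll ε f) x v = ∫ y, f y * fderiv ℝ (cr (mkn ε)) (x - y) v := by
  have h := (crmk_cs hε).hasFDerivAt_convolution_right (ContinuousLinearMap.mul ℝ ℂ) hf
    ((cr_sm (mk_sm (n := n) ε)).of_le (by exact_mod_cast le_top)) x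
  rw [moll, h.fderiv, convolution_precompR_apply _ hf ((crmk_cs hε).fderiv ℝ)
    ((cr_sm (mk_sm ε)).continuous_fderiv (by simp))]
  rfl

lemma fd_refl {g : (Fin n → ℂ) → ℂ} (hg : Sm g) (x v y : Fin n → ℂ) :
    fderiv ℝ (fun y => g (x - y)) y v = - fderiv ℝ g (x - y) v := by
  have h1 : HasFDerivAt (fun y => x - y) (-(ContinuousLinearMap.id ℝ (Fin n → ℂ))) y :=
    (hasFDerivAt_id y).const_sub x
  have := ((hg.da (x - y)).hasFDerivAt).comp y h1
  have h2 : HasFDerivAt (fun y => g (x - y)) _ y := this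
  rw [h2.fderiv]; simp

lemma cs_refl {g : (Fin n → ℂ) → ℂ} (hg : HasCompactSupport g) (x : Fin n → ℂ) :
    HasCompactSupport (fun y => g (x - y)) :=
  hg.comp_homeomorph (Homeomorph.subLeft x)

lemma sm_refl {g : (Fin n → ℂ) → ℂ} (hg : Sm g) (x : Fin n → ℂ) :
    Sm (fun y => g (x - y)) := hg.comp (contDiff_const.sub contDiff_id)

lemma moll_fd' {ε : ℝ} (hε : 0 < ε) {f : (Fin n → ℂ) → ℂ} (hf : LocallyIntegrable f) (x v) :
    fderiv ℝ (moll ε f) x v = - ∫ y, f y * fderiv ℝ (fun y => cr (mkn ε) (x - y)) y v := by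
  rw [moll_fd hε hf, ← integral_neg]
  congr 1; ext y; rw [fd_refl (cr_sm (mk_sm ε))]; ring

lemma moll_dz {ε : ℝ} (hε : 0 < ε) {f : (Fin n → ℂ) → ℂ} (hf : LocallyIntegrable f) (x v) :
    dz v (moll ε f) x = - ∫ y, f y * dz v (fun y => cr (mkn ε) (x - y)) y := by
  have hs := sm_refl (cr_sm (mk_sm ε)) x
  have i1 : ∀ v, Integrable (fun y => f y * fderiv ℝ (fun y => cr (mkn ε) (x - y)) y v) := fun v =>
    locint_mul hf (hs.fd v).continuous (hcs_fd (cs_refl (crmk_cs hε) x) v)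
  rw [dz, moll_fd' hε hf, moll_fd' hε hf]
  have e1 : ∀ y, f y * dz v (fun y => cr (mkn ε) (x - y)) y = (1/2) * (f y * fderiv ℝ (fun y => cr (mkn ε) (x - y)) y v)
    - (1/2) * Complex.I * (f y * fderiv ℝ (fun y => cr (mkn ε) (x - y)) y (Complex.I • v)) := fun y => by
      rw [dz]; ring
  simp_rw [e1]
  rw [integral_sub ((i1 _).const_mul _) ((i1 _).const_mul _)]
  simp only [integral_const_mul]; ring

lemma moll_dzb {ε : ℝ} (hε : 0 < ε) {f : (Fin n → ℂ) → ℂ} (hf : LocallyIntegrable f) (x v) :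
    dzb v (moll ε f) x = - ∫ y, f y * dzb v (fun y => cr (mkn ε) (x - y)) y := by
  have hs := sm_refl (cr_sm (mk_sm ε)) x
  have i1 : ∀ v, Integrable (fun y => f y * fderiv ℝ (fun y => cr (mkn ε) (x - y)) y v) := fun v =>
    locint_mul hf (hs.fd v).continuous (hcs_fd (cs_refl (crmk_cs hε) x) v)
  rw [dzb, moll_fd' hε hf, moll_fd' hε hf]
  have e1 : ∀ y, f y * dzb v (fun y => cr (mkn ε) (x - y)) y = (1/2) * (f y * fderiv ℝ (fun y => cr (mkn ε) (x - y)) y v)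
    + (1/2) * Complex.I * (f y * fderiv ℝ (fun y => cr (mkn ε) (x - y)) y (Complex.I • v)) := fun y => by
      rw [dzb]; ring
  simp_rw [e1]
  rw [integral_add ((i1 _).const_mul _) ((i1 _).const_mul _)]
  simp only [integral_const_mul]; ring

lemma moll_zero_of {ε : ℝ} (hε : 0 < ε) {f : (Fin n → ℂ) → ℂ} {x} (h : ∀ y ∈ closedBall x ε, f y = 0) :
    moll ε f x = 0 := by
  rw [moll_def]
  apply integral_eq_zero_of_ae
  refine Eventually.of_forall fun y => ?_
  by_cases hy : y ∈ closedBall x ε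
  · simp [h y hy]
  · have : mkn ε (x - y) = 0 := mk_supp hε (by
      rw [mem_closedBall, not_le, dist_comm, dist_eq_norm] at hy; exact hy.le)
    simp [this]

lemma moll_tsupport {ε : ℝ} (hε : 0 < ε) {f : (Fin n → ℂ) → ℂ} {K : Set (Fin n → ℂ)}
    (h : ∀ y, y ∉ K → f y = 0) : tsupport (moll ε f) ⊆ cthickening ε K := by
  refine closure_minimal (fun x hx => ?_) isClosed_cthickening
  by_contra hx'
  apply hx
  apply moll_zero_of hε
  intro y hy
  by_contra hy'
  apply hx'
  have : y ∈ K := by by_contra h'; exact hy' (h y h')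
  rw [mem_closedBall, dist_comm] at hy
  exact mem_cthickening_of_dist_le x y ε K this hy

lemma moll_l2 {ε : ℝ} (hε : 0 < ε) {f : (Fin n → ℂ) → ℂ} (hf : AEStronglyMeasurable f) :
    ∫⁻ x, ‖moll ε f x‖ₑ ^ 2 ≤ ∫⁻ x, ‖f x‖ₑ ^ 2 := by
  have hm : Measurable (fun x : Fin n → ℂ => ENNReal.ofReal (mkn ε x)) :=
    (mk_sm ε).continuous.measurable.ennreal_ofReal
  have h1 : ∫⁻ y, ENNReal.ofReal (mkn (n := n) ε y) = 1 := by
    rw [← ofReal_integral_eq_lintegral_ofReal (mk_int hε) (Eventually.of_forall (mk_nonneg hε)),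
      mk_int1 hε]; simp
  have step : ∀ x, ‖moll ε f x‖ₑ ^ 2 ≤ ∫⁻ y, ‖f (x - y)‖ₑ ^ 2 * ENNReal.ofReal (mkn ε y) := by
    intro x
    have hfx : AEMeasurable (fun y => ‖f (x - y)‖ₑ) :=
      (hf.comp_quasiMeasurePreserving (quasiMeasurePreserving_sub_left volume x)).enorm
    have a1 : ‖moll ε f x‖ₑ ≤ ∫⁻ y, ‖f (x - y)‖ₑ * ENNReal.ofReal (mkn ε y) := by
      rw [moll_def']
      refine (enorm_integral_le_lintegral_enorm _).trans (le_of_eq ?_)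
      congr 1; ext y
      rw [enorm_mul]; congr 1
      rw [← ofReal_norm, Complex.norm_real, Real.norm_of_nonneg (mk_nonneg hε y)]
    have a2 : (∫⁻ y, ‖f (x - y)‖ₑ * ENNReal.ofReal (mkn ε y)) =
        ∫⁻ y, ((fun y => ‖f (x - y)‖ₑ) * (fun _ => 1 : (Fin n → ℂ) → ℝ≥0∞)) y ∂(volume.withDensity (fun y => ENNReal.ofReal (mkn ε y))) := by
      rw [lintegral_withDensity_eq_lintegral_mul₀ hm.aemeasurable (hfx.mul aemeasurable_const)]
      simp [mul_comm]
    have a3 := ENNReal.lintegral_mul_le_Lp_mul_Lq (volume.withDensity (fun y => ENNReal.ofReal (mkn (n := n) ε y)))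
      (Real.HolderConjugate.two_two) (f := fun y => ‖f (x - y)‖ₑ) (g := fun _ => 1)
      (hfx.mono_ac (withDensity_absolutelyContinuous _ _)) aemeasurable_const
    rw [← a2] at a3
    have a4 : (∫⁻ (a : Fin n → ℂ), (1 : ℝ≥0∞) ^ (2:ℝ) ∂(volume.withDensity (fun y => ENNReal.ofReal (mkn (n := n) ε y)))) = 1 := by
      simp [h1]
    rw [a4] at a3
    simp only [ENNReal.one_rpow, mul_one] at a3
    calc ‖moll ε f x‖ₑ ^ 2 ≤ ((∫⁻ a, ‖f (x - a)‖ₑ ^ (2:ℝ) ∂(volume.withDensity (fun y => ENNReal.ofReal (mkn (n := n) ε y)))) ^ (1 / (2:ℝ))) ^ 2 := by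
          gcongr; exact a1.trans a3
      _ = ∫⁻ a, ‖f (x - a)‖ₑ ^ (2:ℝ) ∂(volume.withDensity (fun y => ENNReal.ofReal (mkn (n := n) ε y))) := by
          rw [← ENNReal.rpow_natCast, ← ENNReal.rpow_mul]; norm_num
      _ = _ := by
          rw [lintegral_withDensity_eq_lintegral_mul₀ hm.aemeasurable (hfx.pow_const _)]
          simp [mul_comm]
  calc ∫⁻ x, ‖moll ε f x‖ₑ ^ 2 ≤ ∫⁻ x, ∫⁻ y, ‖f (x - y)‖ₑ ^ 2 * ENNReal.ofReal (mkn ε y) :=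
        lintegral_mono step
    _ = ∫⁻ y, ∫⁻ x, ‖f (x - y)‖ₑ ^ 2 * ENNReal.ofReal (mkn ε y) := by
        apply lintegral_lintegral_swap
        have : AEStronglyMeasurable (fun p : (Fin n → ℂ) × (Fin n → ℂ) => f (p.1 - p.2)) (volume.prod volume) :=
          hf.comp_quasiMeasurePreserving (quasiMeasurePreserving_sub_of_right_invariant volume volume)
        exact (this.enorm.pow_const 2).mul (hm.comp measurable_snd).aemeasurable
    _ = ∫⁻ y, (∫⁻ x, ‖f x‖ₑ ^ 2) * ENNReal.ofReal (mkn ε y) := by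
        congr 1; ext y
        rw [lintegral_mul_const' _ _ ENNReal.ofReal_ne_top]
        congr 1
        exact lintegral_sub_right_eq_self (fun x => ‖f x‖ₑ ^ 2) y
    _ = ∫⁻ x, ‖f x‖ₑ ^ 2 := by
        rw [lintegral_const_mul _ hm, h1, mul_one]
end mollifier

lemma esq_add (a b : ℝ≥0∞) : (a + b) ^ 2 ≤ 2 * a ^ 2 + 2 * b ^ 2 := by
  rcases eq_or_ne a ⊤ with rfl | ha
  · simp
  rcases eq_or_ne b ⊤ with rfl | hb
  · simp
  lift a to ℝ≥0 using ha
  lift b to ℝ≥0 using hb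
  norm_cast
  have : ((a:ℝ) + b) ^ 2 ≤ 2 * a ^ 2 + 2 * b ^ 2 := by nlinarith [sq_nonneg ((a:ℝ) - b)]
  exact_mod_cast this

lemma esq_norm_add {F : Type*} [NormedAddCommGroup F] (a b : F) :
    ‖a + b‖ₑ ^ 2 ≤ 2 * ‖a‖ₑ ^ 2 + 2 * ‖b‖ₑ ^ 2 :=
  (pow_le_pow_left' (enorm_add_le a b) 2).trans (esq_add _ _)

section mollifier
variable {n : ℕ}

lemma memLp_locint {f : (Fin n → ℂ) → ℂ} (hf : MemLp f 2) : LocallyIntegrable f :=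
  hf.locallyIntegrable (by norm_num)

lemma l2_lt_top {f : (Fin n → ℂ) → ℂ} (hf : MemLp f 2) : ∫⁻ x, ‖f x‖ₑ ^ 2 < ⊤ := by
  have h := hf.2
  rw [eLpNorm_lt_top_iff_lintegral_rpow_enorm_lt_top (by norm_num) (by norm_num)] at h
  simpa using h

lemma memLp2_of {f : (Fin n → ℂ) → ℂ} (hm : AEStronglyMeasurable f) (hf : ∫⁻ x, ‖f x‖ₑ ^ 2 < ⊤) : MemLp f 2 := by
  refine ⟨hm, ?_⟩
  rw [eLpNorm_lt_top_iff_lintegral_rpow_enorm_lt_top (by norm_num) (by norm_num)]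
  simpa using hf

lemma moll_memLp {ε : ℝ} (hε : 0 < ε) {f : (Fin n → ℂ) → ℂ} (hf : MemLp f 2) : MemLp (moll ε f) 2 :=
  memLp2_of (moll_sm hε (memLp_locint hf)).continuous.aestronglyMeasurable
    ((moll_l2 hε hf.1).trans_lt (l2_lt_top hf))

lemma moll_sub {ε : ℝ} (hε : 0 < ε) {f g : (Fin n → ℂ) → ℂ} (hf : LocallyIntegrable f)
    (hg : LocallyIntegrable g) (x) : moll ε (fun y => f y - g y) x = moll ε f x - moll ε g x := by
  rw [moll_def, moll_def, moll_def, ← integral_sub (moll_integrable hε hf x) (moll_integrable hε hg x)]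
  congr 1; ext y; ring

lemma moll_dist {ε η : ℝ} (hε : 0 < ε) {g : (Fin n → ℂ) → ℂ} (hg : LocallyIntegrable g)
    (x) (h : ∀ y ∈ closedBall x ε, ‖g y - g x‖ ≤ η) : ‖moll ε g x - g x‖ ≤ η := by
  have h1 : g x = ∫ y, g x * (mkn ε (x - y) : ℂ) := by
    rw [integral_const_mul, integral_complex_ofReal, integral_sub_left_eq_self (fun y => mkn ε y) volume x, mk_int1 hε]; simp
  have i2 : Integrable (fun y => g x * (mkn ε (x - y) : ℂ)) :=
    (((mk_int hε).comp_sub_left x).ofReal).const_mul _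
  conv_lhs => rw [h1, moll_def]
  rw [← integral_sub (moll_integrable hε hg x) i2]
  have i3 := (mk_int hε).comp_sub_left x
  calc ‖∫ y, (g y * (mkn ε (x - y) : ℂ) - g x * (mkn ε (x - y) : ℂ))‖ ≤ ∫ y, η * mkn ε (x - y) := by
        refine norm_integral_le_of_norm_le (i3.const_mul _) (Eventually.of_forall fun y => ?_)
        rw [← sub_mul, norm_mul, Complex.norm_real, Real.norm_of_nonneg (mk_nonneg hε _)]
        by_cases hy : y ∈ closedBall x ε
        · exact mul_le_mul_of_nonneg_right (h y hy) (mk_nonneg hε _)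
        · have : mkn ε (x - y) = 0 := mk_supp hε (by
            rw [mem_closedBall, not_le, dist_comm, dist_eq_norm] at hy; exact hy.le)
          simp [this]
    _ = η := by
        rw [integral_const_mul, integral_sub_left_eq_self (fun y => mkn ε y) volume x, mk_int1 hε, mul_one]

lemma moll_conv_cc {g : (Fin n → ℂ) → ℂ} (hg : Continuous g) (hc : HasCompactSupport g) :
    Tendsto (fun ε => ∫⁻ x, ‖moll ε g x - g x‖ₑ ^ 2) (𝓝[>] 0) (𝓝 0) := by
  have hu : UniformContinuous g := hc.uniformContinuous_of_continuous hg
  set K := cthickening 1 (tsupport g) with hK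
  have hKc : IsCompact K := hc.isCompact.cthickening
  have hlt : volume K ≠ ⊤ := hKc.measure_lt_top.ne
  rw [ENNReal.tendsto_nhds_zero]
  intro η hη
  obtain ⟨δ, hδ, hδ2⟩ : ∃ δ : ℝ≥0, 0 < δ ∧ (δ : ℝ≥0∞) ^ 2 * volume K ≤ η := by
    have ht : Tendsto (fun δ : ℝ≥0 => (δ : ℝ≥0∞) ^ 2 * volume K) (𝓝 0) (𝓝 0) := by
      have h1 : Tendsto (fun δ : ℝ≥0 => (δ : ℝ≥0∞) ^ 2) (𝓝 0) (𝓝 0) := by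
        have : Continuous (fun δ : ℝ≥0 => (δ : ℝ≥0∞) ^ 2) := by fun_prop
        simpa using this.tendsto 0
      simpa using ENNReal.Tendsto.mul_const h1 (Or.inr hlt)
    have h2 : ∀ᶠ δ : ℝ≥0 in 𝓝[>] 0, (δ : ℝ≥0∞) ^ 2 * volume K ≤ η :=
      (ht.mono_left nhdsWithin_le_nhds).eventually (ge_mem_nhds hη)
    obtain ⟨δ, h, h'⟩ := (h2.and self_mem_nhdsWithin).exists
    exact ⟨δ, h', h⟩
  obtain ⟨r, hr, hr2⟩ := Metric.uniformContinuous_iff.1 hu δ (by exact_mod_cast hδ)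
  filter_upwards [Ioo_mem_nhdsGT (show (0:ℝ) < min r 1 by positivity)] with ε hε
  have hε0 := hε.1
  have hεr : ε < r := hε.2.trans_le (min_le_left _ _)
  have hε1 : ε ≤ 1 := (hε.2.trans_le (min_le_right _ _)).le
  calc ∫⁻ x, ‖moll ε g x - g x‖ₑ ^ 2 ≤ ∫⁻ x, K.indicator (fun _ => (δ : ℝ≥0∞) ^ 2) x := by
        refine lintegral_mono fun x => ?_
        by_cases hx : x ∈ K
        · rw [indicator_of_mem hx]
          gcongr
          have : ‖moll ε g x - g x‖ ≤ δ := by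
            refine moll_dist hε0 hg.locallyIntegrable x (fun y hy => ?_)
            rw [← dist_eq_norm]
            exact (hr2 (lt_of_le_of_lt hy hεr)).le
          rw [enorm_le_coe]
          exact_mod_cast this
        · rw [indicator_of_notMem hx]
          have h1 : moll ε g x = 0 := by
            apply moll_zero_of hε0
            intro y hy
            by_contra hy'
            apply hx
            have : y ∈ tsupport g := subset_tsupport _ hy'
            rw [mem_closedBall, dist_comm] at hy
            exact mem_cthickening_of_dist_le x y 1 _ this (hy.trans hε1)
          have h2 : g x = 0 := by
            by_contra hy'
            exact hx (self_subset_cthickening _ (subset_tsupport _ hy'))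
          simp [h1, h2]
    _ = (δ : ℝ≥0∞) ^ 2 * volume K := by
        rw [lintegral_indicator_const hKc.measurableSet]
    _ ≤ η := hδ2

lemma moll_conv {f : (Fin n → ℂ) → ℂ} (hf : MemLp f 2) :
    Tendsto (fun ε => ∫⁻ x, ‖moll ε f x - f x‖ₑ ^ 2) (𝓝[>] 0) (𝓝 0) := by
  rw [ENNReal.tendsto_nhds_zero]
  intro η hη
  obtain ⟨δ, hδ, hδ2⟩ : ∃ δ : ℝ≥0∞, δ ≠ 0 ∧ 2 * δ ^ 2 + 2 * (2 * δ^2 + 2 * δ ^ 2) ≤ η := by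
    have ht : Tendsto (fun δ : ℝ≥0 => (2 * (δ:ℝ≥0∞) ^ 2 + 2 * (2 * (δ:ℝ≥0∞)^2 + 2 * (δ:ℝ≥0∞) ^ 2) : ℝ≥0∞)) (𝓝 0) (𝓝 0) := by
      have : Continuous (fun δ : ℝ≥0 => ((2 * δ ^ 2 + 2 * (2 * δ^2 + 2 * δ ^ 2) : ℝ≥0) : ℝ≥0∞)) := by fun_prop
      have h := this.tendsto 0
      push_cast at h
      simpa using h
    have h2 := (ht.mono_left (nhdsWithin_le_nhds (s := Ioi 0))).eventually (ge_mem_nhds hη)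
    obtain ⟨δ, h, h'⟩ := (h2.and self_mem_nhdsWithin).exists
    exact ⟨δ, by simpa using h'.ne', h⟩
  obtain ⟨g, hgc, hfg, hg, hgm⟩ := hf.exists_hasCompactSupport_eLpNorm_sub_le (by norm_num) hδ
  have hfg2 : ∫⁻ x, ‖f x - g x‖ₑ ^ 2 ≤ δ ^ 2 := by
    have : (eLpNorm (f - g) 2 volume) ^ 2 = ∫⁻ x, ‖f x - g x‖ₑ ^ 2 := by
      rw [eLpNorm_eq_lintegral_rpow_enorm_toReal (by norm_num) (by norm_num), ← ENNReal.rpow_natCast, ← ENNReal.rpow_mul]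
      norm_num
    rw [← this]; gcongr
  have hev := (moll_conv_cc hg hgc).eventually (ge_mem_nhds (show (0:ℝ≥0∞) < δ ^ 2 by positivity))
  filter_upwards [hev, self_mem_nhdsWithin] with ε h1 hε
  have hε : 0 < ε := hε
  have hfl := memLp_locint hf
  have hgl : LocallyIntegrable g := hg.locallyIntegrable
  have hm1 : AEMeasurable (fun x => ‖moll ε (fun y => f y - g y) x‖ₑ ^ 2) :=
    (moll_sm hε (hfl.sub hgl)).continuous.aestronglyMeasurable.enorm.pow_const 2
  have hm2 : AEMeasurable (fun x => ‖moll ε g x - g x‖ₑ ^ 2) :=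
    ((moll_sm hε hgl).continuous.sub hg).aestronglyMeasurable.enorm.pow_const 2
  calc ∫⁻ x, ‖moll ε f x - f x‖ₑ ^ 2 ≤ ∫⁻ x, (2 * ‖moll ε (fun y => f y - g y) x‖ₑ ^ 2 +
        2 * (2 * ‖moll ε g x - g x‖ₑ ^ 2 + 2 * ‖f x - g x‖ₑ ^ 2)) := by
        refine lintegral_mono fun x => ?_
        have e : moll ε f x - f x = moll ε (fun y => f y - g y) x + ((moll ε g x - g x) + (g x - f x)) := by
          rw [moll_sub hε hfl hgl]; ring
        rw [e]
        refine (esq_norm_add _ _).trans ?_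
        gcongr
        refine (esq_norm_add _ _).trans ?_
        rw [← enorm_neg (g x - f x), neg_sub]
    _ = 2 * (∫⁻ x, ‖moll ε (fun y => f y - g y) x‖ₑ ^ 2) + 2 * (2 * (∫⁻ x, ‖moll ε g x - g x‖ₑ ^ 2) + 2 * ∫⁻ x, ‖f x - g x‖ₑ ^ 2) := by
        rw [lintegral_add_left' (hm1.const_mul _), lintegral_const_mul' _ _ (by norm_num),
          lintegral_const_mul' _ _ (by norm_num), lintegral_add_left' (hm2.const_mul _),
          lintegral_const_mul' _ _ (by norm_num), lintegral_const_mul' _ _ (by norm_num)]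
    _ ≤ 2 * δ ^ 2 + 2 * (2 * δ^2 + 2 * δ ^ 2) := by
        gcongr
        exact (moll_l2 hε (hf.1.sub hgm.1)).trans hfg2
    _ ≤ η := hδ2
end mollifier

section weyl
variable {n : ℕ}

lemma circ_mp (c : ℂ) (hc : ‖c‖ = 1) : MeasurePreserving (fun x : Fin n → ℂ => c • x) := by
  have h1 : MeasurePreserving (fun z : ℂ => c * z) := by
    have := (rotation ⟨c, by simpa [Submonoid.unitSphere] using hc⟩).measurePreserving
    exact this
  exact volume_preserving_pi (f := fun _ z => c * z) (fun _ => h1)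

lemma circ_avg {H : (Fin n → ℂ) → ℂ} {U : Set (Fin n → ℂ)} (hU : IsOpen U)
    (hH : DifferentiableOn ℂ H U) {x y : Fin n → ℂ} {r : ℝ} (hr : closedBall x r ⊆ U) (hy : ‖y‖ ≤ r) :
    ∫ θ in (0:ℝ)..(2 * Real.pi), H (x - Complex.exp (θ * Complex.I) • y) = 2 * Real.pi * H x := by
  have hm : ∀ z ∈ closedBall (0:ℂ) 1, x - z • y ∈ U := by
    intro z hz
    apply hr
    rw [mem_closedBall, dist_eq_norm]
    have : x - z • y - x = -(z • y) := by abel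
    rw [this, norm_neg, norm_smul]
    rw [mem_closedBall_zero_iff] at hz
    nlinarith [norm_nonneg y, norm_nonneg z]
  have hd : DifferentiableOn ℂ (fun z : ℂ => H (x - z • y)) (closedBall 0 1) := by
    refine hH.comp (t := U) ?_ hm
    fun_prop
  have := DiffContOnCl.circleAverage (f := fun z : ℂ => H (x - z • y)) (c := 0) (R := 1) (by
    rw [abs_one]
    refine DifferentiableOn.diffContOnCl ?_
    rwa [closure_ball _ one_ne_zero])
  rw [Real.circleAverage_def] at this
  simp only [circleMap, zero_smul, sub_zero, Complex.ofReal_one, one_mul, zero_add] at this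
  rw [← this, Complex.real_smul]
  push_cast
  rw [← mul_assoc, mul_inv_cancel₀, one_mul]
  simp [Real.pi_ne_zero]

lemma mean_value {H : (Fin n → ℂ) → ℂ} {U : Set (Fin n → ℂ)} (hU : IsOpen U)
    (hH : DifferentiableOn ℂ H U) {x : Fin n → ℂ} {r : ℝ} (hr : closedBall x r ⊆ U)
    {m : (Fin n → ℂ) → ℝ} (hm : Integrable m) (hm0 : ∀ y, r < ‖y‖ → m y = 0)
    (hmc : ∀ c : ℂ, ‖c‖ = 1 → ∀ y, m (c • y) = m y) :
    ∫ y, H (x - y) * (m y : ℂ) = H x * (∫ y, m y : ℝ) := by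
  have hce : ∀ θ : ℝ, ‖Complex.exp (θ * Complex.I)‖ = 1 := Complex.norm_exp_ofReal_mul_I
  have hrot : ∀ θ : ℝ, ∫ y, H (x - y) * (m y : ℂ) = ∫ y, H (x - Complex.exp (θ * Complex.I) • y) * (m y : ℂ) := by
    intro θ
    have hne : Complex.exp (θ * Complex.I) ≠ 0 := Complex.exp_ne_zero _
    rw [← (circ_mp (n := n) _ (hce θ)).integral_comp
      (Homeomorph.smulOfNeZero (α := Fin n → ℂ) _ hne).measurableEmbedding (fun y => H (x - y) * (m y : ℂ))]
    simp_rw [hmc _ (hce θ)]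
  have hset : ∀ g : (Fin n → ℂ) → ℂ, ∫ y, g y * (m y : ℂ) = ∫ y in closedBall 0 r, g y * (m y : ℂ) := by
    intro g
    symm
    apply setIntegral_eq_integral_of_forall_compl_eq_zero
    intro y hy
    rw [mem_closedBall_zero_iff, not_le] at hy
    simp [hm0 y hy]
  have hpi : (0:ℝ) ≤ 2 * Real.pi := by positivity
  have e1 : ∫ θ in (0:ℝ)..(2 * Real.pi), ∫ y, H (x - Complex.exp (θ * Complex.I) • y) * (m y : ℂ)
      = 2 * Real.pi * ∫ y, H (x - y) * (m y : ℂ) := by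
    simp_rw [← hrot]
    simp
  have hmemU : ∀ (θ : ℝ) (y : Fin n → ℂ), y ∈ closedBall (0 : Fin n → ℂ) r →
      x - Complex.exp (θ * Complex.I) • y ∈ closedBall x r := by
    intro θ y hy
    rw [mem_closedBall, dist_eq_norm]
    have : x - Complex.exp (θ * Complex.I) • y - x = -(Complex.exp (θ * Complex.I) • y) := by abel
    rw [this, norm_neg, norm_smul, hce, one_mul]
    simpa using hy
  obtain ⟨C, hC⟩ := (isCompact_closedBall x r).exists_bound_of_continuousOn (hH.continuousOn.mono hr)
  have hint : Integrable (Function.uncurry fun (θ : ℝ) (y : Fin n → ℂ) => H (x - Complex.exp (θ * Complex.I) • y) * (m y : ℂ))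
      ((volume.restrict (Ioc (0:ℝ) (2 * Real.pi))).prod (volume.restrict (closedBall 0 r))) := by
    have hmm : Integrable (fun p : ℝ × (Fin n → ℂ) => (m p.2 : ℂ))
        ((volume.restrict (Ioc (0:ℝ) (2 * Real.pi))).prod (volume.restrict (closedBall 0 r))) :=
      (Integrable.ofReal (𝕜 := ℂ) hm.restrict).comp_snd _
    refine Integrable.bdd_mul (c := C) hmm ?_ ?_
    · rw [Measure.prod_restrict]
      refine ContinuousOn.aestronglyMeasurable ?_ (measurableSet_Ioc.prod isClosed_closedBall.measurableSet)
      refine (hH.continuousOn.mono hr).comp (by fun_prop) ?_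
      rintro ⟨θ, y⟩ ⟨_, hy⟩
      exact hmemU θ y hy
    · rw [Measure.prod_restrict]
      refine (ae_restrict_iff' (measurableSet_Ioc.prod isClosed_closedBall.measurableSet)).2 (Eventually.of_forall ?_)
      rintro ⟨θ, y⟩ ⟨_, hy⟩
      exact hC _ (hmemU θ y hy)
  have e2 : ∫ θ in (0:ℝ)..(2 * Real.pi), ∫ y, H (x - Complex.exp (θ * Complex.I) • y) * (m y : ℂ)
      = 2 * Real.pi * (H x * (∫ y, m y : ℝ)) := by
    rw [intervalIntegral.integral_of_le hpi]
    have : ∀ θ : ℝ, ∫ y, H (x - Complex.exp (θ * Complex.I) • y) * (m y : ℂ) =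
        ∫ y in closedBall 0 r, H (x - Complex.exp (θ * Complex.I) • y) * (m y : ℂ) :=
      fun θ => hset (fun y => H (x - Complex.exp (θ * Complex.I) • y))
    simp_rw [this]
    rw [integral_integral_swap hint]
    have e3 : ∫ y in closedBall 0 r, ∫ θ in Ioc (0:ℝ) (2 * Real.pi), H (x - Complex.exp (θ * Complex.I) • y) * (m y : ℂ)
       = ∫ y in closedBall 0 r, (2 * Real.pi * H x) * (m y : ℂ) := by
      refine setIntegral_congr_fun isClosed_closedBall.measurableSet (fun y hy => ?_)
      rw [integral_mul_const, ← intervalIntegral.integral_of_le hpi, circ_avg hU hH hr (by simpa using hy)]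
    rw [e3, ← hset (fun y => 2 * Real.pi * H x), integral_const_mul, integral_complex_ofReal]
    ring
  rw [e1] at e2
  have : (2 * Real.pi : ℂ) ≠ 0 := by simp [Real.pi_ne_zero]
  exact mul_left_cancel₀ this e2

lemma mean_value_sq {H : (Fin n → ℂ) → ℂ} {U : Set (Fin n → ℂ)} (hU : IsOpen U)
    (hH : DifferentiableOn ℂ H U) {x : Fin n → ℂ} {r : ℝ} (hr : closedBall x r ⊆ U)
    {m : (Fin n → ℂ) → ℝ} (hm : Integrable m) (hm0 : ∀ y, r < ‖y‖ → m y = 0) (hmn : ∀ y, 0 ≤ m y)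
    (hmc : ∀ c : ℂ, ‖c‖ = 1 → ∀ y, m (c • y) = m y) :
    ‖H x‖ ^ 2 * ∫ y, m y ≤ ∫ y, ‖H (x - y)‖ ^ 2 * m y := by
  have h := mean_value hU (hH.pow 2) hr hm hm0 hmc
  have h2 := norm_integral_le_integral_norm (μ := volume) (fun y => (H ^ 2) (x - y) * (m y : ℂ))
  have e : ∀ y, ‖(H ^ 2) (x - y) * (m y : ℂ)‖ = ‖H (x - y)‖ ^ 2 * m y := by
    intro y; simp [abs_of_nonneg (hmn y)]
  simp_rw [e] at h2
  rw [h] at h2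
  have h3 : 0 ≤ ∫ y, m y := integral_nonneg (fun y => hmn y)
  simpa [abs_of_nonneg h3] using h2

lemma holo_of_dzb {f : (Fin n → ℂ) → ℂ} {x : Fin n → ℂ} (hf : DifferentiableAt ℝ f x)
    (h : ∀ j, dzb (ee j) f x = 0) : DifferentiableAt ℂ f x := by
  have hI : ∀ v, fderiv ℝ f x (Complex.I • v) = Complex.I * fderiv ℝ f x v := by
    have h1 : ∀ j, fderiv ℝ f x (Complex.I • ee j) = Complex.I * fderiv ℝ f x (ee j) := by
      intro j
      have := h j
      rw [dzb] at this
      have h2 : fderiv ℝ f x (ee j) + Complex.I * fderiv ℝ f x (Complex.I • ee j) = 0 := by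
        simpa using this
      linear_combination (-Complex.I) * h2 + (fderiv ℝ f x (Complex.I • ee j)) * Complex.I_mul_I
    intro v
    have hv : v = ∑ j, ((v j).re • (ee j : Fin n → ℂ) + (v j).im • (Complex.I • (ee j : Fin n → ℂ))) := by
      ext i
      simp [ee, Finset.sum_apply, Pi.single_apply, Finset.sum_add_distrib]
    conv_lhs => rw [hv]
    conv_rhs => rw [hv]
    simp only [Finset.smul_sum, map_sum, Finset.mul_sum, smul_add, map_add]
    refine Finset.sum_congr rfl (fun j _ => ?_)
    rw [smul_comm Complex.I (v j).re, smul_comm Complex.I (v j).im, smul_smul Complex.I Complex.I, Complex.I_mul_I]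
    simp only [map_smul, h1, neg_smul, one_smul, map_neg, Complex.real_smul]
    linear_combination (-(v j).im * fderiv ℝ f x (ee j)) * Complex.I_mul_I
  let L : (Fin n → ℂ) →L[ℂ] ℂ :=
    { toFun := fderiv ℝ f x
      map_add' := map_add _
      map_smul' := by
        intro c v
        have : c • v = c.re • v + c.im • (Complex.I • v) := by
          ext i; simp only [Pi.smul_apply, Pi.add_apply, smul_eq_mul, Complex.real_smul]
          conv_lhs => rw [← Complex.re_add_im c]
          ring
        rw [this, map_add, map_smul, map_smul, hI]
        simp only [Complex.real_smul, smul_eq_mul, RingHom.id_apply]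
        conv_rhs => rw [← Complex.re_add_im c]
        ring
      cont := (fderiv ℝ f x).cont }
  have : HasFDerivAt f L x := by
    refine HasFDerivAt.of_isLittleO ?_
    exact hf.hasFDerivAt.isLittleO
  exact this.differentiableAt

def WkHol (F : (Fin n → ℂ) → ℂ) (U : Set (Fin n → ℂ)) : Prop :=
  ∀ j, ∀ ψ : (Fin n → ℂ) → ℂ, Sm ψ → HasCompactSupport ψ → tsupport ψ ⊆ U →
    ∫ y, F y * dzb (ee j) ψ y = 0

lemma refl_mk_supp {ε : ℝ} (hε : 0 < ε) (x : Fin n → ℂ) :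
    tsupport (fun y => cr (mkn ε) (x - y)) ⊆ closedBall x ε := by
  refine closure_minimal (fun y hy => ?_) isClosed_closedBall
  by_contra h
  rw [mem_closedBall, not_le, dist_comm, dist_eq_norm] at h
  exact hy (by simp [cr, mk_supp hε h.le])

lemma moll_holo {F : (Fin n → ℂ) → ℂ} {U : Set (Fin n → ℂ)} (hF : LocallyIntegrable F) (hw : WkHol F U)
    {ε : ℝ} (hε : 0 < ε) {x} (hx : closedBall x ε ⊆ U) : DifferentiableAt ℂ (moll ε F) x := by
  refine holo_of_dzb ((moll_sm hε hF).da x) (fun j => ?_)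
  rw [moll_dzb hε hF, hw j _ (sm_refl (cr_sm (mk_sm ε)) x) (cs_refl (crmk_cs hε) x)
    ((refl_mk_supp hε x).trans hx), neg_zero]

lemma moll_of_holo {H : (Fin n → ℂ) → ℂ} {U : Set (Fin n → ℂ)} (hU : IsOpen U)
    (hH : DifferentiableOn ℂ H U) {x : Fin n → ℂ} {ε : ℝ} (hε : 0 < ε) (hr : closedBall x ε ⊆ U) :
    moll ε H x = H x := by
  rw [moll_def', mean_value hU hH hr (mk_int hε) (fun y hy => mk_supp hε hy.le) (fun c hc y => mk_circ ε c hc y),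
    mk_int1 hε]; simp

lemma moll_comm {F : (Fin n → ℂ) → ℂ} (hF : LocallyIntegrable F) {ε δ : ℝ} (hε : 0 < ε) (hδ : 0 < δ) (x) :
    moll ε (moll δ F) x = moll δ (moll ε F) x := by
  have key : ∀ ε δ : ℝ, 0 < ε → 0 < δ → moll ε (moll δ F) x = convolution F
      (convolution (cr (mkn δ)) (cr (mkn ε)) (ContinuousLinearMap.mul ℝ ℂ) volume) (ContinuousLinearMap.mul ℝ ℂ) volume x := by
    intro ε δ hε hδ
    have c1 := (cr_sm (mk_sm (n := n) ε)).continuous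
    have c2 := (cr_sm (mk_sm (n := n) δ)).continuous
    have hFn : LocallyIntegrable (fun x => ‖F x‖) := fun x => (hF x).norm
    have h1 : HasCompactSupport (convolution (fun x => ‖cr (mkn (n := n) δ) x‖) (fun x => ‖cr (mkn (n := n) ε) x‖) (ContinuousLinearMap.mul ℝ ℝ) volume) :=
      HasCompactSupport.convolution _ (crmk_cs hδ).norm (crmk_cs hε).norm
    have h2 : Continuous (convolution (fun x => ‖cr (mkn (n := n) δ) x‖) (fun x => ‖cr (mkn (n := n) ε) x‖) (ContinuousLinearMap.mul ℝ ℝ) volume) :=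
      HasCompactSupport.continuous_convolution_right _ (crmk_cs hε).norm (c2.norm.locallyIntegrable) c1.norm
    refine convolution_assoc _ _ _ _ (fun a b c => mul_assoc a b c) hF.aestronglyMeasurable
      c2.aestronglyMeasurable c1.aestronglyMeasurable ?_ ?_ ?_
    · exact Eventually.of_forall fun y => (crmk_cs hδ).convolutionExists_right _ hF c2 y
    · exact Eventually.of_forall fun y => (crmk_cs hε).norm.convolutionExists_right _
        (c2.norm.locallyIntegrable) c1.norm y
    · exact HasCompactSupport.convolutionExists_right _ h1 hFn h2 x
  rw [key ε δ hε hδ, key δ ε hδ hε]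
  congr 1
  rw [← convolution_flip]
  congr 1
  ext a; simp

lemma moll_eq {F : (Fin n → ℂ) → ℂ} {U : Set (Fin n → ℂ)} (hU : IsOpen U) (hF : LocallyIntegrable F) (hw : WkHol F U)
    {ε δ : ℝ} (hε : 0 < ε) (hδ : 0 < δ) {x} (hx : closedBall x (ε + δ) ⊆ U) : moll ε F x = moll δ F x := by
  have key : ∀ ε δ : ℝ, 0 < ε → 0 < δ → closedBall x (ε + δ) ⊆ U → moll ε (moll δ F) x = moll δ F x := by
    intro ε δ hε hδ hx
    set V := {y | ∃ δ' > δ, closedBall y δ' ⊆ U}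
    have hVo : IsOpen V := by
      rw [Metric.isOpen_iff]
      rintro y ⟨d, hd, hy⟩
      refine ⟨(d - δ) / 2, by linarith, fun z hz => ⟨(d + δ) / 2, by linarith, ?_⟩⟩
      refine (closedBall_subset_closedBall' ?_).trans hy
      rw [mem_ball] at hz; linarith
    have hV : ∀ y ∈ V, DifferentiableAt ℂ (moll δ F) y := by
      rintro y ⟨d, hd, hy⟩
      exact moll_holo hF hw hδ ((closedBall_subset_closedBall hd.le).trans hy)
    refine moll_of_holo hVo (fun y hy => (hV y hy).differentiableWithinAt) hε ?_
    obtain ⟨d, hd, hd2⟩ := (isCompact_closedBall x (ε + δ)).exists_cthickening_subset_open hU hx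
    intro y hy
    refine ⟨δ + d, by linarith, fun z hz => hd2 ?_⟩
    rw [cthickening_closedBall hd.le (by linarith)]
    rw [mem_closedBall] at *
    linarith [dist_triangle z y x]
  rw [← key δ ε hδ hε (by rwa [add_comm]), moll_comm hF hδ hε, key ε δ hε hδ hx]

lemma weyl {F : (Fin n → ℂ) → ℂ} {U : Set (Fin n → ℂ)} (hU : IsOpen U) (hF : MemLp F 2) (hw : WkHol F U) :
    ∃ G : (Fin n → ℂ) → ℂ, DifferentiableOn ℂ G U ∧ (∀ᵐ x, x ∈ U → G x = F x) ∧
      ∀ ε x, 0 < ε → closedBall x (2 * ε) ⊆ U → G x = moll ε F x := by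
  have hFl := memLp_locint hF
  have hex : ∀ x, ∃ c : ℂ, ∀ ε, 0 < ε → closedBall x (2 * ε) ⊆ U → c = moll ε F x := by
    intro x
    by_cases h : ∃ ε, 0 < ε ∧ closedBall x (2 * ε) ⊆ U
    · obtain ⟨ε, hε, h⟩ := h
      refine ⟨moll ε F x, fun δ hδ h2 => moll_eq hU hFl hw hε hδ ?_⟩
      rcases le_total ε δ with h3 | h3
      · exact (closedBall_subset_closedBall (by linarith)).trans h2
      · exact (closedBall_subset_closedBall (by linarith)).trans h
    · push Not at h
      exact ⟨0, fun ε hε h2 => absurd h2 (h ε hε)⟩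
  choose G hG using hex
  have hloc : ∀ x ∈ U, ∃ d > 0, ∀ y ∈ ball x d, ∀ ε, 0 < ε → ε ≤ d → closedBall y (2 * ε) ⊆ U := by
    intro x hx
    obtain ⟨d, hd, h⟩ := Metric.isOpen_iff.1 hU x hx
    refine ⟨d / 3, by linarith, fun y hy ε hε he z hz => h ?_⟩
    rw [mem_ball] at *; rw [mem_closedBall] at hz
    linarith [dist_triangle z y x]
  refine ⟨G, ?_, ?_, fun ε x hε h => hG x ε hε h⟩
  · intro x hx
    obtain ⟨d, hd, h⟩ := hloc x hx
    have h1 : G =ᶠ[𝓝 x] moll d F := by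
      filter_upwards [ball_mem_nhds x hd] with y hy
      exact hG y d hd (h y hy d hd le_rfl)
    refine (DifferentiableAt.congr_of_eventuallyEq ?_ h1).differentiableWithinAt
    refine moll_holo hFl hw hd ((closedBall_subset_closedBall (by linarith)).trans (h x (mem_ball_self hd) d hd le_rfl))
  · rw [← ae_restrict_iff' hU.measurableSet]
    have : ∀ x ∈ U, ∃ u ∈ 𝓝[U] x, ∀ᵐ y ∂(volume.restrict u), G y = F y := by
      intro x hx
      obtain ⟨d, hd, h⟩ := hloc x hx
      refine ⟨ball x d, mem_nhdsWithin_of_mem_nhds (ball_mem_nhds x hd), ?_⟩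
      have hz : ∫⁻ y in ball x d, ‖G y - F y‖ₑ ^ 2 = 0 := by
        refine le_antisymm (ge_of_tendsto (moll_conv hF) ?_) zero_le
        filter_upwards [Ioc_mem_nhdsGT hd] with ε hε
        refine le_trans ?_ (setLIntegral_le_lintegral (ball x d) _)
        refine setLIntegral_mono_ae' measurableSet_ball (Eventually.of_forall fun y hy => ?_)
        rw [hG y ε hε.1 (h y hy ε hε.1 hε.2)]
      have hcont : AEStronglyMeasurable G (volume.restrict (ball x d)) := by
        refine (moll_sm hd hFl).continuous.aestronglyMeasurable.congr ?_
        refine (ae_restrict_iff' measurableSet_ball).2 (Eventually.of_forall fun y hy => ?_)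
        exact (hG y d hd (h y hy d hd le_rfl)).symm
      have hz := (lintegral_eq_zero_iff' (((hcont.sub hF.1.restrict).enorm).pow_const 2)).1 hz
      filter_upwards [hz] with y hy
      simpa [sub_eq_zero] using hy
    rw [ae_restrict_iff' hU.measurableSet]
    refine measure_null_of_locally_null _ (fun x hx => ?_)
    have hxU : x ∈ U := by by_contra h; exact hx (fun h2 => absurd h2 h)
    obtain ⟨u, hu, hu2⟩ := this x hxU
    rw [hU.nhdsWithin_eq hxU] at hu
    obtain ⟨v, hv, hvo, hxv⟩ := _root_.mem_nhds_iff.1 hu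
    have : ∀ᵐ y ∂volume.restrict v, G y = F y := ae_mono (Measure.restrict_mono hv le_rfl) hu2
    rw [ae_restrict_iff' hvo.measurableSet] at this
    refine ⟨_, inter_mem_nhdsWithin _ (hvo.mem_nhds hxv), measure_mono_null ?_ this⟩
    rintro y ⟨hy, hyv⟩ h
    exact hy (fun _ => h hyv)
end weyl

section star
variable {n : ℕ}

lemma esq_ofReal (z : ℂ) : ‖z‖ₑ ^ 2 = ENNReal.ofReal (‖z‖ ^ 2) := by
  rw [← ofReal_norm, ENNReal.ofReal_pow (norm_nonneg _)]

lemma esq_sum {ι : Type*} (s : Finset ι) (z : ι → ℂ) : ‖∑ j ∈ s, z j‖ₑ ^ 2 ≤ s.card * ∑ j ∈ s, ‖z j‖ₑ ^ 2 := by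
  simp_rw [esq_ofReal]
  rw [← ENNReal.ofReal_sum_of_nonneg (fun j _ => by positivity), ← ENNReal.ofReal_natCast, ← ENNReal.ofReal_mul (by positivity)]
  apply ENNReal.ofReal_le_ofReal
  calc ‖∑ j ∈ s, z j‖ ^ 2 ≤ (∑ j ∈ s, ‖z j‖) ^ 2 := by gcongr; exact norm_sum_le _ _
    _ ≤ _ := sq_sum_le_card_mul_sum_sq

def Hyp (Ξ Φ a b : (Fin n → ℂ) → ℝ) (J : Finset (Fin n)) (x : Fin n → ℂ) : Prop :=
  ∀ (ξ : Fin n → ℂ) (S : ℂ),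
    ‖S - ∑ j, ξ j * (dz (ee j) (cr Ξ) x - dz (ee j) (cr Φ) x)‖ ^ 2 * wt Ξ x + b x * ∑ j ∈ J, ‖ξ j‖ ^ 2
      ≤ a x * ‖S‖ ^ 2 + (Lv Ξ x ξ).re * wt Ξ x

lemma Lv_cont {Ξ : (Fin n → ℂ) → ℝ} (hΞ : ContDiff ℝ (⊤ : ℕ∞) Ξ) {g : Fin n → (Fin n → ℂ) → ℂ}
    (hg : ∀ j, Continuous (g j)) : Continuous (fun x => Lv Ξ x (fun j => g j x)) := by
  unfold Lv
  refine continuous_finsetSum _ (fun j _ => continuous_finsetSum _ (fun k _ => ?_))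
  exact (((((cr_sm hΞ).dz (ee j)).dzb (ee k)).continuous.mul (hg j)).mul (Complex.continuous_conj.comp (hg k)))

lemma star {Ξ Φ : (Fin n → ℂ) → ℝ} (hΞ : ContDiff ℝ (⊤ : ℕ∞) Ξ) (hΦ : ContDiff ℝ (⊤ : ℕ∞) Φ)
    {a b : (Fin n → ℂ) → ℝ} {K : Set (Fin n → ℂ)} (hK : IsCompact K) (ha : ContinuousOn a K) (hb : ContinuousOn b K)
    (a0 : ∀ x ∈ K, 0 ≤ a x) (b0 : ∀ x ∈ K, 0 ≤ b x) (J : Finset (Fin n)) (hyp : ∀ x ∈ K, Hyp Ξ Φ a b J x)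
    {g : Fin n → (Fin n → ℂ) → ℂ} (hg : ∀ j, Sm (g j)) (hgK : ∀ j x, x ∉ K → g j x = 0) :
    ∫⁻ x in K, ENNReal.ofReal (b x) * ∑ j ∈ J, ‖g j x‖ₑ ^ 2 ≤
      (∫⁻ x in K, ENNReal.ofReal (a x) * ‖∑ j, dl (ee j) Φ (g j) x‖ₑ ^ 2) +
      ∫⁻ x in K, ENNReal.ofReal (wt Ξ x) * ∑ j, ∑ k, ‖dzb (ee k) (g j) x - dzb (ee j) (g k) x‖ₑ ^ 2 := by
  have hts : ∀ j, tsupport (g j) ⊆ K := fun j =>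
    closure_minimal (fun x hx => by by_contra h; exact hx (hgK j x h)) hK.isClosed
  have hc : ∀ j, HasCompactSupport (g j) := fun j => hK.of_isClosed_subset (isClosed_tsupport _) (hts j)
  have hzz : ∀ j x v, x ∉ K → dz v (g j) x = 0 := fun j x v hx => dz_supp v (fun h => hx (hts j h))
  have hzb : ∀ j x v, x ∉ K → dzb v (g j) x = 0 := fun j x v hx => dzb_supp v (fun h => hx (hts j h))
  have B := basic_ineq hΞ hg hc
  have r1 : ∫ x, (Lv Ξ x (fun j => g j x)).re * wt Ξ x = ∫ x in K, (Lv Ξ x (fun j => g j x)).re * wt Ξ x := by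
    symm; apply setIntegral_eq_integral_of_forall_compl_eq_zero
    intro x hx
    simp [Lv, hgK _ x hx]
  have r2 : ∫ x, ‖∑ j, dl (ee j) Ξ (g j) x‖ ^ 2 * wt Ξ x = ∫ x in K, ‖∑ j, dl (ee j) Ξ (g j) x‖ ^ 2 * wt Ξ x := by
    symm; apply setIntegral_eq_integral_of_forall_compl_eq_zero
    intro x hx
    simp [dl, hgK _ x hx, hzz _ x _ hx]
  have r3 : ∫ x, (∑ j, ∑ k, ‖dzb (ee k) (g j) x - dzb (ee j) (g k) x‖ ^ 2) * wt Ξ x =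
      ∫ x in K, (∑ j, ∑ k, ‖dzb (ee k) (g j) x - dzb (ee j) (g k) x‖ ^ 2) * wt Ξ x := by
    symm; apply setIntegral_eq_integral_of_forall_compl_eq_zero
    intro x hx
    simp [hzb _ x _ hx]
  rw [r1, r2, r3] at B
  have cw : Continuous (wt Ξ) := (wt_sm hΞ).continuous
  have cL : Continuous (fun x => (Lv Ξ x (fun j => g j x)).re * wt Ξ x) :=
    (Complex.continuous_re.comp (Lv_cont hΞ (fun j => (hg j).continuous))).mul cw
  have cdl : ∀ Ξ : (Fin n → ℂ) → ℝ, ContDiff ℝ (⊤ : ℕ∞) Ξ → Continuous (fun x => ‖∑ j, dl (ee j) Ξ (g j) x‖ ^ 2) := fun Ξ h =>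
    (continuous_finsetSum _ (fun j _ => (dl_sm h (hg j) (ee j)).continuous)).norm.pow 2
  have cgJ : Continuous (fun x => ∑ j ∈ J, ‖g j x‖ ^ 2) :=
    continuous_finsetSum _ (fun j _ => (hg j).continuous.norm.pow 2)
  have cc : Continuous (fun x => (∑ j, ∑ k, ‖dzb (ee k) (g j) x - dzb (ee j) (g k) x‖ ^ 2) * wt Ξ x) :=
    (continuous_finsetSum _ (fun j _ => continuous_finsetSum _ (fun k _ =>
      ((((hg j).dzb (ee k)).continuous.sub ((hg k).dzb (ee j)).continuous).norm.pow 2)))).mul cw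
  have i0 : IntegrableOn (fun x => (Lv Ξ x (fun j => g j x)).re * wt Ξ x) K := cL.continuousOn.integrableOn_compact hK
  have i1 : IntegrableOn (fun x => ‖∑ j, dl (ee j) Ξ (g j) x‖ ^ 2 * wt Ξ x) K := ((cdl Ξ hΞ).mul cw).continuousOn.integrableOn_compact hK
  have i2 : IntegrableOn (fun x => a x * ‖∑ j, dl (ee j) Φ (g j) x‖ ^ 2) K := (ha.mul (cdl Φ hΦ).continuousOn).integrableOn_compact hK
  have i3 : IntegrableOn (fun x => b x * ∑ j ∈ J, ‖g j x‖ ^ 2) K := (hb.mul cgJ.continuousOn).integrableOn_compact hK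
  have i4 := cc.continuousOn.integrableOn_compact (μ := volume) hK
  have hpt : ∀ x ∈ K, ‖∑ j, dl (ee j) Ξ (g j) x‖ ^ 2 * wt Ξ x + b x * ∑ j ∈ J, ‖g j x‖ ^ 2 ≤
      a x * ‖∑ j, dl (ee j) Φ (g j) x‖ ^ 2 + (Lv Ξ x (fun j => g j x)).re * wt Ξ x := by
    intro x hx
    have := hyp x hx (fun j => g j x) (∑ j, dl (ee j) Φ (g j) x)
    convert this using 5
    rw [← Finset.sum_sub_distrib]
    refine Finset.sum_congr rfl (fun j _ => ?_)
    simp only [dl]; ring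
  have hI := setIntegral_mono_on (i1.add i3) (i2.add i0) hK.measurableSet hpt
  have e1 : ∫ x in K, ((fun x => ‖∑ j, dl (ee j) Ξ (g j) x‖ ^ 2 * wt Ξ x) + fun x => b x * ∑ j ∈ J, ‖g j x‖ ^ 2) x
    = (∫ x in K, ‖∑ j, dl (ee j) Ξ (g j) x‖ ^ 2 * wt Ξ x) + ∫ x in K, b x * ∑ j ∈ J, ‖g j x‖ ^ 2 := integral_add i1 i3
  have e2 : ∫ x in K, ((fun x => a x * ‖∑ j, dl (ee j) Φ (g j) x‖ ^ 2) + fun x => (Lv Ξ x (fun j => g j x)).re * wt Ξ x) x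
    = (∫ x in K, a x * ‖∑ j, dl (ee j) Φ (g j) x‖ ^ 2) + ∫ x in K, (Lv Ξ x (fun j => g j x)).re * wt Ξ x := integral_add i2 i0
  rw [e1, e2] at hI
  have p4 : 0 ≤ ∫ x in K, (∑ j, ∑ k, ‖dzb (ee k) (g j) x - dzb (ee j) (g k) x‖ ^ 2) * wt Ξ x :=
    integral_nonneg fun x => mul_nonneg (Finset.sum_nonneg fun j _ => Finset.sum_nonneg fun k _ => by positivity) (Real.exp_pos _).le
  have fin : ∫ x in K, b x * ∑ j ∈ J, ‖g j x‖ ^ 2 ≤ (∫ x in K, a x * ‖∑ j, dl (ee j) Φ (g j) x‖ ^ 2)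
     + ∫ x in K, (∑ j, ∑ k, ‖dzb (ee k) (g j) x - dzb (ee j) (g k) x‖ ^ 2) * wt Ξ x := by linarith
  have conv : ∀ f : (Fin n → ℂ) → ℝ, IntegrableOn f K → (∀ x ∈ K, 0 ≤ f x) → ENNReal.ofReal (∫ x in K, f x) = ∫⁻ x in K, ENNReal.ofReal (f x) :=
    fun f hf h0 => ofReal_integral_eq_lintegral_ofReal hf ((ae_restrict_iff' hK.measurableSet).2 (Eventually.of_forall h0))
  have := ENNReal.ofReal_le_ofReal fin
  rw [ENNReal.ofReal_add (setIntegral_nonneg hK.measurableSet fun x hx => mul_nonneg (a0 x hx) (by positivity)) p4,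
    conv _ i3 (fun x hx => mul_nonneg (b0 x hx) (Finset.sum_nonneg fun j _ => by positivity)),
    conv _ i2 (fun x hx => mul_nonneg (a0 x hx) (by positivity)),
    conv _ i4 (fun x hx => mul_nonneg (Finset.sum_nonneg fun j _ => Finset.sum_nonneg fun k _ => by positivity) (Real.exp_pos _).le)] at this
  refine le_trans (le_of_eq ?_) (this.trans (le_of_eq ?_))
  · refine setLIntegral_congr_fun hK.measurableSet (fun x hx => ?_)
    rw [ENNReal.ofReal_mul (b0 x hx), ENNReal.ofReal_sum_of_nonneg (fun j _ => by positivity)]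
    simp_rw [esq_ofReal]
  congr 1
  · refine setLIntegral_congr_fun hK.measurableSet (fun x hx => ?_)
    rw [ENNReal.ofReal_mul (a0 x hx)]
    simp_rw [esq_ofReal]
  · refine setLIntegral_congr_fun hK.measurableSet (fun x hx => ?_)
    rw [mul_comm, ENNReal.ofReal_mul (show 0 ≤ wt Ξ x from (Real.exp_pos _).le),
      ENNReal.ofReal_sum_of_nonneg (fun j _ => Finset.sum_nonneg fun k _ => by positivity)]
    congr 1
    refine Finset.sum_congr rfl (fun j _ => ?_)
    rw [ENNReal.ofReal_sum_of_nonneg (fun k _ => by positivity)]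
    simp_rw [esq_ofReal]

lemma wl2 {K : Set (Fin n → ℂ)} (hK : IsCompact K) {c : (Fin n → ℂ) → ℝ} (hc : ContinuousOn c K)
    {A : ℝ} (hA : ∀ x ∈ K, c x ≤ A) {f g : (Fin n → ℂ) → ℂ} (hf : AEStronglyMeasurable f) (hg : AEStronglyMeasurable g) :
    ∫⁻ x in K, ENNReal.ofReal (c x) * ‖f x‖ₑ ^ 2 ≤ 2 * (∫⁻ x in K, ENNReal.ofReal (c x) * ‖g x‖ₑ ^ 2)
      + 2 * (ENNReal.ofReal A * ∫⁻ x in K, ‖f x - g x‖ₑ ^ 2) := by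
  have mc : AEMeasurable (fun x => ENNReal.ofReal (c x)) (volume.restrict K) :=
    (hc.aemeasurable hK.measurableSet).ennreal_ofReal
  have mg : AEMeasurable (fun x => ENNReal.ofReal (c x) * ‖g x‖ₑ ^ 2) (volume.restrict K) :=
    mc.mul (hg.restrict.enorm.pow_const 2)
  have md : AEMeasurable (fun x => ‖f x - g x‖ₑ ^ 2) (volume.restrict K) := (hf.sub hg).restrict.enorm.pow_const 2
  rw [← lintegral_const_mul'' _ mg, ← lintegral_const_mul'' _ md, ← lintegral_const_mul'' _ (md.const_mul _),
    ← lintegral_add_left' (mg.const_mul _)]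
  refine setLIntegral_mono_ae' hK.measurableSet (Eventually.of_forall fun x hx => ?_)
  have h1 : ‖f x‖ₑ ^ 2 ≤ 2 * ‖g x‖ₑ ^ 2 + 2 * ‖f x - g x‖ₑ ^ 2 := by
    have := esq_norm_add (g x) (f x - g x); rwa [add_sub_cancel] at this
  have h2 : ENNReal.ofReal (c x) ≤ ENNReal.ofReal A := ENNReal.ofReal_le_ofReal (hA x hx)
  calc _ ≤ ENNReal.ofReal (c x) * (2 * ‖g x‖ₑ ^ 2 + 2 * ‖f x - g x‖ₑ ^ 2) := by gcongr
    _ = 2 * (ENNReal.ofReal (c x) * ‖g x‖ₑ ^ 2) + 2 * (ENNReal.ofReal (c x) * ‖f x - g x‖ₑ ^ 2) := by ring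
    _ ≤ _ := by gcongr
end star

section star2
variable {n : ℕ}

lemma memLp_bdd_mul {K : Set (Fin n → ℂ)} (hK : IsCompact K) {p c : (Fin n → ℂ) → ℂ} (hp : MemLp p 2)
    (hp0 : ∀ x, x ∉ K → p x = 0) (hc : ContinuousOn c K) : MemLp (fun x => p x * c x) 2 := by
  obtain ⟨C, hC⟩ := hK.exists_bound_of_continuousOn hc
  have e : (fun x => p x * c x) = fun x => p x * K.indicator c x := by
    ext x; by_cases hx : x ∈ K
    · simp [hx]
    · simp [hp0 x hx]
  rw [e]
  refine MemLp.mono' (g := fun x => ‖p x‖ * max C 0) (hp.norm.mul_const _) ?_ ?_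
  · exact hp.1.mul ((aestronglyMeasurable_indicator_iff hK.measurableSet).2 (hc.aestronglyMeasurable hK.measurableSet))
  · refine Eventually.of_forall fun x => ?_
    rw [norm_mul]
    gcongr
    by_cases hx : x ∈ K
    · simp only [indicator_of_mem hx]; exact (hC x hx).trans (le_max_left _ _)
    · simp [hx]

lemma moll_zero_off {K0 : Set (Fin n → ℂ)} {d ε : ℝ} (hε : 0 < ε) (hd : ε ≤ d) {p : (Fin n → ℂ) → ℂ}
    (hp0 : ∀ x, x ∉ K0 → p x = 0) (x) (hx : x ∉ cthickening d K0) : moll ε p x = 0 := by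
  by_contra h
  exact hx (cthickening_mono hd _ (moll_tsupport hε hp0 (subset_tsupport _ h)))

lemma starL2 {Ξ Φ : (Fin n → ℂ) → ℝ} (hΞ : ContDiff ℝ (⊤ : ℕ∞) Ξ) (hΦ : ContDiff ℝ (⊤ : ℕ∞) Φ)
    {a b : (Fin n → ℂ) → ℝ} {K0 K : Set (Fin n → ℂ)} (hK0 : IsCompact K0) {d : ℝ} (hd : 0 < d)
    (hKd : K = cthickening d K0) (ha : ContinuousOn a K) (hb : ContinuousOn b K)
    (a0 : ∀ x ∈ K, 0 ≤ a x) (b0 : ∀ x ∈ K, 0 ≤ b x) (J : Finset (Fin n)) (hyp : ∀ x ∈ K, Hyp Ξ Φ a b J x)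
    {p : Fin n → (Fin n → ℂ) → ℂ} (hp : ∀ j, MemLp (p j) 2) (hp0 : ∀ j x, x ∉ K0 → p j x = 0)
    {R : (Fin n → ℂ) → ℂ} (hR : MemLp R 2)
    {q : Fin n → Fin n → (Fin n → ℂ) → ℂ} (hq : ∀ j k, MemLp (q j k) 2)
    (hdiv : ∀ ψ, Sm ψ → HasCompactSupport ψ → -∑ j, ∫ x, p j x * dz (ee j) ψ x =
      ∫ x, (R x + ∑ j, p j x * dz (ee j) (cr Φ) x) * ψ x)
    (hcurl : ∀ j k ψ, Sm ψ → HasCompactSupport ψ →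
      -(∫ x, p j x * dzb (ee k) ψ x) + ∫ x, p k x * dzb (ee j) ψ x = ∫ x, q j k x * ψ x) :
    ∫⁻ x in K, ENNReal.ofReal (b x) * ∑ j ∈ J, ‖p j x‖ₑ ^ 2 ≤
      4 * (∫⁻ x in K, ENNReal.ofReal (a x) * ‖R x‖ₑ ^ 2) +
      4 * ∫⁻ x in K, ENNReal.ofReal (wt Ξ x) * ∑ j, ∑ k, ‖q j k x‖ₑ ^ 2 := by
  have hK : IsCompact K := hKd ▸ hK0.cthickening
  have hKK : K0 ⊆ K := hKd ▸ self_subset_cthickening _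
  obtain ⟨A, hA⟩ := hK.exists_bound_of_continuousOn ha
  obtain ⟨B, hB⟩ := hK.exists_bound_of_continuousOn hb
  have cw : ContinuousOn (wt Ξ) K := (wt_sm hΞ).continuous.continuousOn
  obtain ⟨W, hW⟩ := hK.exists_bound_of_continuousOn cw
  have hA' : ∀ x ∈ K, a x ≤ A := fun x hx => (le_abs_self _).trans (hA x hx)
  have hB' : ∀ x ∈ K, b x ≤ B := fun x hx => (le_abs_self _).trans (hB x hx)
  have hW' : ∀ x ∈ K, wt Ξ x ≤ W := fun x hx => (le_abs_self _).trans (hW x hx)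
  have cΦ : ∀ j : Fin n, ContinuousOn (dz (ee j) (cr Φ)) K := fun j => ((cr_sm hΦ).dz (ee j)).continuous.continuousOn
  choose F hF using fun j => hK.exists_bound_of_continuousOn (cΦ j)
  have hFΦ : ∀ j, MemLp (fun x => p j x * dz (ee j) (cr Φ) x) 2 := fun j =>
    memLp_bdd_mul hK (hp j) (fun x hx => hp0 j x (fun h => hx (hKK h))) (cΦ j)
  set V : (Fin n → ℂ) → ℂ := fun x => R x + ∑ j, p j x * dz (ee j) (cr Φ) x with hVdef
  have hV : MemLp V 2 := hR.add (memLp_finsetSum _ (fun j _ => hFΦ j))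
  have mc : ∀ {c : (Fin n → ℂ) → ℝ}, ContinuousOn c K → AEMeasurable (fun x => ENNReal.ofReal (c x)) (volume.restrict K) :=
    fun hc => (hc.aemeasurable hK.measurableSet).ennreal_ofReal
  have sumform : ∀ {c : (Fin n → ℂ) → ℝ}, ContinuousOn c K → ∀ {ι : Type} (s : Finset ι) (f : ι → (Fin n → ℂ) → ℂ),
      (∀ i, AEStronglyMeasurable (f i)) → ∫⁻ x in K, ENNReal.ofReal (c x) * ∑ j ∈ s, ‖f j x‖ₑ ^ 2 =
        ∑ j ∈ s, ∫⁻ x in K, ENNReal.ofReal (c x) * ‖f j x‖ₑ ^ 2 := by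
    intro c hc ι s f hf
    simp_rw [Finset.mul_sum]
    exact lintegral_finsetSum' _ (fun i _ => (mc hc).mul ((hf i).restrict.enorm.pow_const 2))
  -- error
  set X : ℝ → (Fin n → ℂ) → ℂ := fun ε x => ∑ j, dl (ee j) Φ (moll ε (p j)) x with hX
  set er : ℝ → ℝ≥0∞ := fun ε =>
    2 * ∑ j ∈ J, ENNReal.ofReal B * (∫⁻ x, ‖moll ε (p j) x - p j x‖ₑ ^ 2)
    + 4 * (ENNReal.ofReal A * (2 * (∫⁻ x, ‖moll ε V x - V x‖ₑ ^ 2) + 2 * (n * ∑ j, ENNReal.ofReal (F j ^ 2) * ∫⁻ x, ‖moll ε (p j) x - p j x‖ₑ ^ 2)))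
    + 4 * ∑ j, ∑ k, ENNReal.ofReal W * ∫⁻ x, ‖moll ε (q j k) x - q j k x‖ₑ ^ 2 with her
  have her0 : Tendsto er (𝓝[>] 0) (𝓝 0) := by
    have t0 : Tendsto er (𝓝[>] 0) (𝓝 (2 * ∑ j ∈ J, ENNReal.ofReal B * 0
      + 4 * (ENNReal.ofReal A * (2 * 0 + 2 * (n * ∑ j : Fin n, ENNReal.ofReal (F j ^ 2) * 0)))
      + 4 * ∑ j : Fin n, ∑ k : Fin n, ENNReal.ofReal W * 0)) := by
      have cm : ∀ {c : ℝ≥0∞} {u : ℝ → ℝ≥0∞} {l}, c ≠ ⊤ → Tendsto u (𝓝[>] 0) (𝓝 l) → Tendsto (fun ε => c * u ε) (𝓝[>] 0) (𝓝 (c * l)) :=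
        fun hc h => ENNReal.Tendsto.const_mul h (Or.inr hc)
      refine Tendsto.add (Tendsto.add ?_ ?_) ?_
      · refine cm (by simp) (tendsto_finsetSum _ fun j _ => cm (by simp) (moll_conv (hp j)))
      · refine cm (by simp) (cm (by simp) (Tendsto.add (cm (by simp) (moll_conv hV)) (cm (by simp) (cm (by simp) ?_))))
        exact tendsto_finsetSum _ fun j _ => cm (by simp) (moll_conv (hp j))
      · refine cm (by simp) (tendsto_finsetSum _ fun j _ => tendsto_finsetSum _ fun k _ => cm (by simp) (moll_conv (hq j k)))
    simpa using t0
  have main : ∀ ε ∈ Ioc 0 d, ∫⁻ x in K, ENNReal.ofReal (b x) * ∑ j ∈ J, ‖p j x‖ₑ ^ 2 ≤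
      4 * (∫⁻ x in K, ENNReal.ofReal (a x) * ‖R x‖ₑ ^ 2) +
      4 * (∫⁻ x in K, ENNReal.ofReal (wt Ξ x) * ∑ j, ∑ k, ‖q j k x‖ₑ ^ 2) + er ε := by
    intro ε ⟨hε, hεd⟩
    have hsm : ∀ j, Sm (moll ε (p j)) := fun j => moll_sm hε (memLp_locint (hp j))
    have S := star hΞ hΦ hK ha hb a0 b0 J hyp (g := fun j => moll ε (p j)) hsm
      (fun j x hx => moll_zero_off hε hεd (hp0 j) x (hKd ▸ hx))
    have hcu : ∀ j k x, dzb (ee k) (moll ε (p j)) x - dzb (ee j) (moll ε (p k)) x = moll ε (q j k) x := by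
      intro j k x
      rw [moll_dzb hε (memLp_locint (hp j)), moll_dzb hε (memLp_locint (hp k)), sub_neg_eq_add,
        hcurl j k _ (sm_refl (cr_sm (mk_sm ε)) x) (cs_refl (crmk_cs hε) x)]
      rfl
    have hdv : ∀ x, X ε x = moll ε V x - ∑ j, dz (ee j) (cr Φ) x * moll ε (p j) x := by
      intro x
      simp only [hX, dl, Finset.sum_sub_distrib]
      congr 1
      simp_rw [fun j => moll_dz hε (memLp_locint (hp j)) x]
      rw [Finset.sum_neg_distrib, hdiv _ (sm_refl (cr_sm (mk_sm ε)) x) (cs_refl (crmk_cs hε) x)]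
      rfl
    have mX : AEStronglyMeasurable (X ε) := by
      refine Continuous.aestronglyMeasurable ?_
      exact continuous_finsetSum _ (fun j _ => (dl_sm hΦ (hsm j) (ee j)).continuous)
    have mm : ∀ {f}, MemLp f 2 → AEStronglyMeasurable (moll (n := n) ε f) := fun h => (moll_memLp hε h).1
    -- step 1
    have s1 : ∫⁻ x in K, ENNReal.ofReal (b x) * ∑ j ∈ J, ‖p j x‖ₑ ^ 2 ≤
       2 * (∫⁻ x in K, ENNReal.ofReal (b x) * ∑ j ∈ J, ‖moll ε (p j) x‖ₑ ^ 2) +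
        2 * ∑ j ∈ J, ENNReal.ofReal B * (∫⁻ x, ‖moll ε (p j) x - p j x‖ₑ ^ 2) := by
      rw [sumform hb J p (fun j => (hp j).1), sumform hb J _ (fun j => mm (hp j)), Finset.mul_sum, Finset.mul_sum, ← Finset.sum_add_distrib]
      refine Finset.sum_le_sum (fun j _ => (wl2 hK hb hB' (hp j).1 (mm (hp j))).trans ?_)
      gcongr
      · exact Measure.restrict_le_self
      · exact le_of_eq (enorm_sub_rev _ _)
    have s2 : ∫⁻ x in K, ENNReal.ofReal (a x) * ‖X ε x‖ₑ ^ 2 ≤ 2 * (∫⁻ x in K, ENNReal.ofReal (a x) * ‖R x‖ₑ ^ 2) +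
        2 * (ENNReal.ofReal A * (2 * (∫⁻ x, ‖moll ε V x - V x‖ₑ ^ 2) + 2 * (n * ∑ j, ENNReal.ofReal (F j ^ 2) * ∫⁻ x, ‖moll ε (p j) x - p j x‖ₑ ^ 2))) := by
      refine (wl2 hK ha hA' mX hR.1).trans ?_
      gcongr
      have m1 : AEMeasurable (fun x => ‖moll ε V x - V x‖ₑ ^ 2) := ((mm hV).sub hV.1).enorm.pow_const 2
      have m2 : ∀ j, AEMeasurable (fun x => ‖moll ε (p j) x - p j x‖ₑ ^ 2) := fun j => ((mm (hp j)).sub (hp j).1).enorm.pow_const 2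
      simp_rw [← fun j => lintegral_const_mul'' (ENNReal.ofReal (F j ^ 2)) (m2 j)]
      rw [← lintegral_finsetSum' _ (fun j _ => (m2 j).const_mul _),
        ← lintegral_const_mul'' _ (Finset.aemeasurable_fun_sum _ (fun j _ => (m2 j).const_mul _)),
        ← lintegral_const_mul'' _ m1, ← lintegral_const_mul'' _ ((Finset.aemeasurable_fun_sum _ (fun j _ => (m2 j).const_mul _)).const_mul _),
        ← lintegral_add_left' (m1.const_mul _)]
      refine (setLIntegral_mono_ae' hK.measurableSet (Eventually.of_forall fun x hx => ?_)).trans (setLIntegral_le_lintegral K _)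
      have e : X ε x - R x = (moll ε V x - V x) + ∑ j, (- (dz (ee j) (cr Φ) x * (moll ε (p j) x - p j x))) := by
        rw [hdv x, hVdef]
        simp only [mul_sub, neg_sub, Finset.sum_sub_distrib]
        have : ∀ j, p j x * dz (ee j) (cr Φ) x = dz (ee j) (cr Φ) x * p j x := fun j => mul_comm _ _
        simp_rw [this]; ring
      rw [e]
      refine (esq_norm_add _ _).trans ?_
      gcongr
      refine (esq_sum _ _).trans ?_
      rw [Finset.card_univ, Fintype.card_fin]
      gcongr with j _
      rw [enorm_neg, enorm_mul, mul_pow]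
      gcongr
      rw [esq_ofReal]
      apply ENNReal.ofReal_le_ofReal
      gcongr
      exact hF j x hx
    have s3 : ∫⁻ x in K, ENNReal.ofReal (wt Ξ x) * ∑ j, ∑ k, ‖moll ε (q j k) x‖ₑ ^ 2 ≤
       2 * (∫⁻ x in K, ENNReal.ofReal (wt Ξ x) * ∑ j, ∑ k, ‖q j k x‖ₑ ^ 2) +
        2 * ∑ j, ∑ k, ENNReal.ofReal W * (∫⁻ x, ‖moll ε (q j k) x - q j k x‖ₑ ^ 2) := by
      simp_rw [← Finset.sum_product', Finset.univ_product_univ]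
      rw [sumform cw _ (fun i : Fin n × Fin n => q i.1 i.2) (fun j => (hq _ _).1),
        sumform cw _ (fun i : Fin n × Fin n => moll ε (q i.1 i.2)) (fun j => mm (hq _ _)), Finset.mul_sum, Finset.mul_sum, ← Finset.sum_add_distrib]
      refine Finset.sum_le_sum (fun j _ => (wl2 hK cw hW' (mm (hq j.1 j.2)) (hq j.1 j.2).1).trans ?_)
      gcongr
      exact Measure.restrict_le_self
    simp_rw [hcu] at S
    refine s1.trans ((add_le_add_left (mul_le_mul_right (S.trans (add_le_add s2 s3)) 2) _).trans (le_of_eq ?_))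
    simp only [her]
    ring
  have t := (tendsto_const_nhds (x := 4 * (∫⁻ x in K, ENNReal.ofReal (a x) * ‖R x‖ₑ ^ 2) +
      4 * (∫⁻ x in K, ENNReal.ofReal (wt Ξ x) * ∑ j, ∑ k, ‖q j k x‖ₑ ^ 2))).add her0
  rw [add_zero] at t
  refine ge_of_tendsto t ?_
  filter_upwards [Ioc_mem_nhdsGT hd] with ε hε
  exact main ε hε
end star2

section helpers

lemma cutoff {E : Type*} [NormedAddCommGroup E] [NormedSpace ℝ E] [FiniteDimensional ℝ E] {s t : Set E}
    (hs : IsClosed s) (ht : IsClosed t) (hd : Disjoint s t) :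
    ∃ χ : E → ℝ, ContDiff ℝ (⊤ : ℕ∞) χ ∧ (∀ᶠ x in 𝓝ˢ s, χ x = 0) ∧ (∀ᶠ x in 𝓝ˢ t, χ x = 1) ∧ ∀ x, χ x ∈ Icc (0:ℝ) 1 := by
  obtain ⟨f, h0, h1, hf⟩ := exists_contMDiffMap_zero_one_nhds_of_isClosed (n := (⊤ : ℕ∞)) (modelWithCornersSelf ℝ E) hs ht hd
  exact ⟨f, contMDiff_iff_contDiff.1 f.contMDiff, h0, h1, hf⟩

lemma ext_sm {E F : Type*} [NormedAddCommGroup E] [NormedSpace ℝ E] [FiniteDimensional ℝ E]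
    [NormedAddCommGroup F] [NormedSpace ℝ F] {K U : Set E}
    (hK : IsCompact K) (hU : IsOpen U) (hKU : K ⊆ U) {f : E → F} (hf : ContDiffOn ℝ (⊤ : ℕ∞) f U) :
    ∃ f' : E → F, ContDiff ℝ (⊤ : ℕ∞) f' ∧ ∀ x ∈ K, f' =ᶠ[𝓝 x] f := by
  obtain ⟨χ, hχ, h0, h1, h01⟩ := cutoff hU.isClosed_compl hK.isClosed (by
    rw [disjoint_compl_left_iff_subset]; exact hKU)
  refine ⟨fun x => χ x • f x, ?_, ?_⟩
  · rw [contDiff_iff_contDiffAt]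
    intro x
    by_cases hx : x ∈ U
    · exact hχ.contDiffAt.smul (hf.contDiffAt (hU.mem_nhds hx))
    · have : (fun x => χ x • f x) =ᶠ[𝓝 x] fun _ => 0 := by
        rw [eventually_nhdsSet_iff_forall] at h0
        filter_upwards [h0 x hx] with y hy
        simp [hy]
      exact contDiffAt_const.congr_of_eventuallyEq this
  · intro x hx
    rw [eventually_nhdsSet_iff_forall] at h1
    filter_upwards [h1 x hx] with y hy
    simp [hy]

lemma proj_abs {H : Type*} [NormedAddCommGroup H] [InnerProductSpace ℂ H] [CompleteSpace H] (S : Set H) (g : H) :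
    ∃ g1 : H, (∀ s ∈ S, inner ℂ s g1 = 0) ∧ ∀ t, (∀ s ∈ S, inner ℂ s t = 0) → inner ℂ t g1 = inner ℂ t g := by
  set N := (Submodule.span ℂ S)ᗮ
  have hN : ∀ t, (∀ s ∈ S, inner ℂ s t = 0) → t ∈ N := by
    intro t ht
    rw [Submodule.mem_orthogonal]
    intro u hu
    induction hu using Submodule.span_induction with
    | mem x h => exact ht x h
    | zero => simp
    | add x y _ _ h1 h2 => rw [inner_add_left, h1, h2, add_zero]
    | smul c x _ h => rw [inner_smul_left, h, mul_zero]
  refine ⟨N.starProjection g, ?_, ?_⟩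
  · intro s hs
    have h1 : N.starProjection g ∈ N := Submodule.starProjection_apply_mem _ _
    exact (Submodule.mem_orthogonal _ _).1 h1 s (Submodule.subset_span hs)
  · intro t ht
    have h2 := N.sub_starProjection_mem_orthogonal g
    have h3 := (Submodule.mem_orthogonal _ _).1 h2 t (hN t ht)
    rw [inner_sub_right, sub_eq_zero] at h3
    exact h3.symm

variable {n : ℕ}

lemma inner_lp {f g : (Fin n → ℂ) → ℂ} (hf : MemLp f 2) (hg : MemLp g 2) :
    inner ℂ (hf.toLp f) (hg.toLp g) = ∫ x, g x * (starRingEnd ℂ) (f x) := by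
  rw [MeasureTheory.L2.inner_def]
  refine integral_congr_ae ?_
  filter_upwards [hf.coeFn_toLp, hg.coeFn_toLp] with x h1 h2
  rw [h1, h2]; rfl

lemma proj_fun (S : Set (Fin n → (Fin n → ℂ) → ℂ)) (hS : ∀ s ∈ S, ∀ j, MemLp (s j) 2)
    (g : Fin n → (Fin n → ℂ) → ℂ) (hg : ∀ j, MemLp (g j) 2) :
    ∃ f : Fin n → (Fin n → ℂ) → ℂ, (∀ j, MemLp (f j) 2) ∧
      (∀ s ∈ S, ∑ j, ∫ x, f j x * (starRingEnd ℂ) (s j x) = 0) ∧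
      ∀ t : Fin n → (Fin n → ℂ) → ℂ, (∀ j, MemLp (t j) 2) →
        (∀ s ∈ S, ∑ j, ∫ x, t j x * (starRingEnd ℂ) (s j x) = 0) →
        ∑ j, ∫ x, f j x * (starRingEnd ℂ) (t j x) = ∑ j, ∫ x, g j x * (starRingEnd ℂ) (t j x) := by
  let emb : ∀ (t : Fin n → (Fin n → ℂ) → ℂ), (∀ j, MemLp (t j) 2) → PiLp 2 (fun _ : Fin n => Lp ℂ 2 (volume : Measure (Fin n → ℂ))) :=
    fun t ht => WithLp.toLp 2 (fun j => (ht j).toLp (t j))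
  have key : ∀ (s t : Fin n → (Fin n → ℂ) → ℂ) (hs : ∀ j, MemLp (s j) 2) (ht : ∀ j, MemLp (t j) 2),
      inner ℂ (emb s hs) (emb t ht) = ∑ j, ∫ x, t j x * (starRingEnd ℂ) (s j x) := by
    intro s t hs ht
    rw [PiLp.inner_apply]
    exact Finset.sum_congr rfl (fun j _ => inner_lp (hs j) (ht j))
  obtain ⟨g1, h1, h2⟩ := proj_abs {u | ∃ s, ∃ h : s ∈ S, u = emb s (hS s h)} (emb g hg)
  have he : emb (fun j => g1 j) (fun j => Lp.memLp _) = g1 := by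
    ext j; simp [emb]
  refine ⟨fun j => g1 j, fun j => Lp.memLp _, ?_, ?_⟩
  · intro s hs
    rw [← key s _ (hS s hs) (fun j => Lp.memLp _), he]
    exact h1 _ ⟨s, hs, rfl⟩
  · intro t ht hts
    rw [← key t _ ht (fun j => Lp.memLp _), he, ← key t g ht hg]
    apply h2
    rintro _ ⟨s, hs, rfl⟩
    rw [key]
    exact hts s hs

lemma cs_en {α : Type*} [MeasurableSpace α] (μ : Measure α) {ι : Type*} (s : Finset ι) {f g : ι → α → ℝ≥0∞}
    (hf : ∀ i, AEMeasurable (f i) μ) (hg : ∀ i, AEMeasurable (g i) μ) :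
    (∫⁻ x, ∑ j ∈ s, f j x * g j x ∂μ) ^ 2 ≤ (∫⁻ x, ∑ j ∈ s, f j x ^ 2 ∂μ) * ∫⁻ x, ∑ j ∈ s, g j x ^ 2 ∂μ := by
  have hpq : (2:ℝ).HolderConjugate 2 := Real.HolderConjugate.two_two
  have m1 : AEMeasurable (fun x => (∑ j ∈ s, f j x ^ (2:ℝ)) ^ (1/2:ℝ)) μ :=
    (Finset.aemeasurable_fun_sum _ (fun j _ => (hf j).pow_const _)).pow_const _
  have m2 : AEMeasurable (fun x => (∑ j ∈ s, g j x ^ (2:ℝ)) ^ (1/2:ℝ)) μ :=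
    (Finset.aemeasurable_fun_sum _ (fun j _ => (hg j).pow_const _)).pow_const _
  have h1 : ∫⁻ x, ∑ j ∈ s, f j x * g j x ∂μ ≤ ∫⁻ x, ((∑ j ∈ s, f j x ^ (2:ℝ)) ^ (1/2:ℝ)) * ((∑ j ∈ s, g j x ^ (2:ℝ)) ^ (1/2:ℝ)) ∂μ :=
    lintegral_mono fun x => ENNReal.inner_le_Lp_mul_Lq s _ _ hpq
  have h2 := ENNReal.lintegral_mul_le_Lp_mul_Lq μ hpq m1 m2
  have h3 := pow_le_pow_left' (h1.trans h2) 2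
  refine h3.trans (le_of_eq ?_)
  rw [mul_pow]
  have e : ∀ x : ℝ≥0∞, (x ^ (1/2:ℝ)) ^ 2 = x := by
    intro x; rw [← ENNReal.rpow_natCast, ← ENNReal.rpow_mul]; norm_num
  have e' : ∀ x : ℝ≥0∞, (x ^ (1/2:ℝ)) ^ (2:ℝ) = x := by
    intro x; rw [← ENNReal.rpow_mul]; norm_num
  simp only [e, e']
  simp

lemma riesz_abs {V H : Type*} [AddCommGroup V] [Module ℂ V] [NormedAddCommGroup H] [InnerProductSpace ℂ H] [CompleteSpace H]
    (l : V →ₗ[ℂ] ℂ) (A : V →ₗ[ℂ] H) {C : ℝ} (hC : 0 ≤ C) (h : ∀ v, ‖l v‖ ≤ C * ‖A v‖) :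
    ∃ k : H, ‖k‖ ≤ C ∧ ∀ v, l v = inner ℂ k (A v) := by
  obtain ⟨g, hg⟩ := A.rangeRestrict.exists_rightInverse_of_surjective A.range_rangeRestrict
  have hg' : ∀ y, A (g y) = y := fun y => by
    have := LinearMap.congr_fun hg y
    simpa using congrArg Subtype.val this
  let m : A.range →L[ℂ] ℂ := (l.comp g).mkContinuous C (fun y => by
    have := h (g y); rw [hg'] at this; exact this)
  obtain ⟨M, hM1, hM2⟩ := exists_extension_norm_eq A.range m
  refine ⟨(InnerProductSpace.toDual ℂ H).symm M, ?_, ?_⟩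
  · rw [LinearIsometryEquiv.norm_map, hM2]
    exact LinearMap.mkContinuous_norm_le _ hC _
  · intro v
    rw [InnerProductSpace.toDual_symm_apply]
    have := hM1 ⟨A v, LinearMap.mem_range_self A v⟩
    rw [this]
    change l v = l (g ⟨A v, _⟩)
    have h0 := h (v - g ⟨A v, LinearMap.mem_range_self A v⟩)
    rw [map_sub A, hg', sub_self, norm_zero, mul_zero] at h0
    have := norm_le_zero_iff.1 h0
    rw [map_sub, sub_eq_zero] at this
    exact this
end helpers

section hor
variable {n : ℕ}

noncomputable def ex (Φ : (Fin n → ℂ) → ℝ) (c : ℝ) (x : Fin n → ℂ) : ℂ := ((Real.exp (c * Φ x) : ℝ) : ℂ)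

lemma ex_mul (Φ : (Fin n → ℂ) → ℝ) (c d : ℝ) (x) : ex Φ c x * ex Φ d x = ex Φ (c + d) x := by
  simp only [ex]; rw [← Complex.ofReal_mul, ← Real.exp_add, add_mul]

lemma ex_sm {Φ : (Fin n → ℂ) → ℝ} (hΦ : ContDiff ℝ (⊤ : ℕ∞) Φ) (c) : Sm (ex Φ c) :=
  cr_sm (Real.contDiff_exp.comp (contDiff_const.mul hΦ))

lemma ex_conj (Φ : (Fin n → ℂ) → ℝ) (c : ℝ) (x) : (starRingEnd ℂ) (ex Φ c x) = ex Φ c x := by simp only [ex, Complex.conj_ofReal]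

lemma dz_ex {Φ : (Fin n → ℂ) → ℝ} {x} (hf : DifferentiableAt ℝ Φ x) (c : ℝ) (v) :
    dz v (ex Φ c) x = c * dz v (cr Φ) x * ex Φ c x := by
  have : HasDerivAt (fun t : ℝ => Real.exp (c * t)) (Real.exp (c * Φ x) * c) (Φ x) := by
    simpa using ((hasDerivAt_id (Φ x)).const_mul c).exp
  have h := dz_comp v hf this
  change dz v (cr (fun y => Real.exp (c * Φ y))) x = _
  rw [h, ex]; push_cast; ring

lemma ex_norm (Φ : (Fin n → ℂ) → ℝ) (c : ℝ) (x) : ‖ex Φ c x‖ = Real.exp (c * Φ x) := by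
  simp only [ex]; rw [Complex.norm_real]; exact abs_of_pos (Real.exp_pos _)

lemma memLp_mul_cs {f c : (Fin n → ℂ) → ℂ} (hf : MemLp f 2) (hc : Continuous c) (hs : HasCompactSupport c) :
    MemLp (fun x => f x * c x) 2 :=
  (hc.memLp_of_hasCompactSupport hs (p := ⊤)).mul' hf

lemma cr_ts {χ : (Fin n → ℂ) → ℝ} : tsupport (cr χ) = tsupport χ := by
  unfold tsupport; congr 1; ext x; simp [cr]

lemma cr_cs {χ : (Fin n → ℂ) → ℝ} (h : HasCompactSupport χ) : HasCompactSupport (cr χ) := by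
  unfold HasCompactSupport; rw [cr_ts]; exact h

lemma int_mul_cs {f c : (Fin n → ℂ) → ℂ} (hf : MemLp f 2) (hc : Continuous c) (hs : HasCompactSupport c) :
    Integrable (fun x => f x * c x) := locint_mul (memLp_locint hf) hc hs

lemma int_add3 {f g h : (Fin n → ℂ) → ℂ} (hf : Integrable f) (hg : Integrable g) (hh : Integrable h) :
    (∫ x, f x) + (∫ x, g x) + ∫ x, h x = ∫ x, (f x + g x + h x) := by
  rw [← integral_add hf hg]; exact (integral_add (hf.add hg) hh).symm

lemma la_div {Φ : (Fin n → ℂ) → ℝ} (hΦ : ContDiff ℝ (⊤ : ℕ∞) Φ)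
    {χ : (Fin n → ℂ) → ℝ} (hχ : ContDiff ℝ (⊤ : ℕ∞) χ) (hχc : HasCompactSupport χ)
    {f : Fin n → (Fin n → ℂ) → ℂ} (hf : ∀ j, MemLp (f j) 2) {δ : (Fin n → ℂ) → ℂ} (hδ : MemLp δ 2)
    (hd : ∀ ψ, Sm ψ → HasCompactSupport ψ → tsupport ψ ⊆ tsupport χ →
      ∑ j, ∫ x, f j x * ex Φ (-1/2) x * dz (ee j) ψ x = - ∫ x, δ x * ψ x)
    (ψ) (hψ : Sm ψ) (hψc : HasCompactSupport ψ) :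
    -∑ j, ∫ x, (f j x * (χ x * ex Φ (1/2) x)) * dz (ee j) ψ x =
      ∫ x, ((δ x * (χ x * ex Φ 1 x) + ∑ j, f j x * (dz (ee j) (cr χ) x * ex Φ (1/2) x)) +
        ∑ j, (f j x * (χ x * ex Φ (1/2) x)) * dz (ee j) (cr Φ) x) * ψ x := by
  have hcs : HasCompactSupport (cr χ) := cr_cs hχc
  have hts : tsupport (cr χ) ⊆ tsupport χ := cr_ts.le
  have hχs := cr_sm hχ
  set θ : (Fin n → ℂ) → ℂ := fun x => (cr χ x * ex Φ 1 x) * ψ x with hθ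
  have h1 : Sm θ := Sm.mul' (Sm.mul' hχs (ex_sm hΦ 1)) hψ
  have h2 : ∀ x, x ∉ tsupport (cr χ) → θ x = 0 := fun x hx => by
    simp only [hθ]; rw [image_eq_zero_of_notMem_tsupport hx]; simp
  have h3 := hd θ h1 (hcs_of_supp hcs h2) ((tsupport_of_supp h2).trans hts)
  have ce : ∀ c, Continuous (ex Φ c) := fun c => (ex_sm hΦ c).continuous
  have cχ : Continuous (cr χ) := hχs.continuous
  have cψ := hψ.continuous
  have cΦd : ∀ j : Fin n, Continuous (dz (ee j) (cr Φ)) := fun j => ((cr_sm hΦ).dz (ee j)).continuous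
  have cχd : ∀ j : Fin n, Continuous (dz (ee j) (cr χ)) := fun j => (hχs.dz (ee j)).continuous
  have cψd : ∀ j : Fin n, Continuous (dz (ee j) ψ) := fun j => (hψ.dz (ee j)).continuous
  -- pieces
  have i1 : ∀ j, Integrable (fun x => f j x * (cr χ x * ex Φ (1/2) x * dz (ee j) ψ x)) := fun j =>
    int_mul_cs (hf j) ((cχ.mul (ce _)).mul (cψd j)) (hcs_of_supp hcs (fun x hx => by
      rw [image_eq_zero_of_notMem_tsupport hx]; simp))
  have i2 : ∀ j, Integrable (fun x => f j x * (dz (ee j) (cr χ) x * ex Φ (1/2) x * ψ x)) := fun j =>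
    int_mul_cs (hf j) (((cχd j).mul (ce _)).mul cψ) (hcs_of_supp hcs (fun x hx => by
      rw [dz_supp _ hx]; simp))
  have i3 : ∀ j, Integrable (fun x => f j x * (cr χ x * ex Φ (1/2) x * dz (ee j) (cr Φ) x * ψ x)) := fun j =>
    int_mul_cs (hf j) (((cχ.mul (ce _)).mul (cΦd j)).mul cψ) (hcs_of_supp hcs (fun x hx => by
      rw [image_eq_zero_of_notMem_tsupport hx]; simp))
  have i4 : Integrable (fun x => δ x * θ x) := int_mul_cs hδ h1.continuous (hcs_of_supp hcs h2)
  have hx1 : ∀ x, ex Φ (-1/2) x * ex Φ 1 x = ex Φ (1/2) x := fun x => by rw [ex_mul]; norm_num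
  have e1 : ∀ j, ∫ x, f j x * ex Φ (-1/2) x * dz (ee j) θ x =
      (∫ x, f j x * (cr χ x * ex Φ (1/2) x * dz (ee j) ψ x)) + (∫ x, f j x * (dz (ee j) (cr χ) x * ex Φ (1/2) x * ψ x))
      + ∫ x, f j x * (cr χ x * ex Φ (1/2) x * dz (ee j) (cr Φ) x * ψ x) := by
    intro j
    rw [int_add3 (i1 j) (i2 j) (i3 j)]
    congr 1; ext x
    rw [hθ, dz_mul _ ((Sm.mul' hχs (ex_sm hΦ 1)).da x) (hψ.da x), dz_mul _ (hχs.da x) ((ex_sm hΦ 1).da x),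
      dz_ex (hΦ.differentiable (by simp)).differentiableAt, ← hx1]
    push_cast; ring
  simp_rw [e1] at h3
  rw [Finset.sum_add_distrib, Finset.sum_add_distrib] at h3
  have e2 : ∫ x, ((δ x * (χ x * ex Φ 1 x) + ∑ j, f j x * (dz (ee j) (cr χ) x * ex Φ (1/2) x)) +
        ∑ j, (f j x * (χ x * ex Φ (1/2) x)) * dz (ee j) (cr Φ) x) * ψ x = (∫ x, δ x * θ x) +
        (∑ j, ∫ x, f j x * (dz (ee j) (cr χ) x * ex Φ (1/2) x * ψ x)) +
        ∑ j, ∫ x, f j x * (cr χ x * ex Φ (1/2) x * dz (ee j) (cr Φ) x * ψ x) := by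
    rw [← integral_finsetSum _ (fun j _ => i2 j), ← integral_finsetSum _ (fun j _ => i3 j)]
    rw [int_add3 i4 (integrable_finsetSum _ (fun j _ => i2 j)) (integrable_finsetSum _ (fun j _ => i3 j))]
    congr 1; ext x
    simp only [hθ, add_mul, Finset.sum_mul, Pi.add_apply]
    congr 1
    · congr 1
      · ring
      · exact Finset.sum_congr rfl (fun j _ => by ring)
    · exact Finset.sum_congr rfl (fun j _ => by ring)
  rw [e2]
  have e3 : ∀ j, ∫ x, (f j x * (χ x * ex Φ (1/2) x)) * dz (ee j) ψ x = ∫ x, f j x * (cr χ x * ex Φ (1/2) x * dz (ee j) ψ x) :=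
    fun j => by congr 1; ext x; ring
  simp_rw [e3]
  linear_combination -h3

lemma la_curl {Φ : (Fin n → ℂ) → ℝ} (hΦ : ContDiff ℝ (⊤ : ℕ∞) Φ)
    {χ : (Fin n → ℂ) → ℝ} (hχ : ContDiff ℝ (⊤ : ℕ∞) χ) (hχc : HasCompactSupport χ)
    {f : Fin n → (Fin n → ℂ) → ℂ} (hf : ∀ j, MemLp (f j) 2)
    (hc : ∀ j k ψ, Sm ψ → HasCompactSupport ψ → tsupport ψ ⊆ tsupport χ →
      ∫ x, f j x * ex Φ (1/2) x * dzb (ee k) ψ x = ∫ x, f k x * ex Φ (1/2) x * dzb (ee j) ψ x)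
    (j k ψ) (hψ : Sm ψ) (hψc : HasCompactSupport ψ) :
    -(∫ x, (f j x * (χ x * ex Φ (1/2) x)) * dzb (ee k) ψ x) + ∫ x, (f k x * (χ x * ex Φ (1/2) x)) * dzb (ee j) ψ x
      = ∫ x, (f j x * (dzb (ee k) (cr χ) x * ex Φ (1/2) x) - f k x * (dzb (ee j) (cr χ) x * ex Φ (1/2) x)) * ψ x := by
  have hcs : HasCompactSupport (cr χ) := cr_cs hχc
  have hts : tsupport (cr χ) ⊆ tsupport χ := cr_ts.le
  have hχs := cr_sm hχ
  set θ : (Fin n → ℂ) → ℂ := fun x => cr χ x * ψ x with hθ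
  have h1 : Sm θ := Sm.mul' hχs hψ
  have h2 : ∀ x, x ∉ tsupport (cr χ) → θ x = 0 := fun x hx => by
    simp only [hθ]; rw [image_eq_zero_of_notMem_tsupport hx]; simp
  have h3 := hc j k θ h1 (hcs_of_supp hcs h2) ((tsupport_of_supp h2).trans hts)
  have ce : ∀ c, Continuous (ex Φ c) := fun c => (ex_sm hΦ c).continuous
  have cχ : Continuous (cr χ) := hχs.continuous
  have cψ := hψ.continuous
  have cχd : ∀ j : Fin n, Continuous (dzb (ee j) (cr χ)) := fun j => (hχs.dzb (ee j)).continuous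
  have cψd : ∀ j : Fin n, Continuous (dzb (ee j) ψ) := fun j => (hψ.dzb (ee j)).continuous
  have i1 : ∀ j k, Integrable (fun x => f j x * (cr χ x * ex Φ (1/2) x * dzb (ee k) ψ x)) := fun j k =>
    int_mul_cs (hf j) ((cχ.mul (ce _)).mul (cψd k)) (hcs_of_supp hcs (fun x hx => by
      rw [image_eq_zero_of_notMem_tsupport hx]; simp))
  have i2 : ∀ j k, Integrable (fun x => f j x * (dzb (ee k) (cr χ) x * ex Φ (1/2) x * ψ x)) := fun j k =>
    int_mul_cs (hf j) (((cχd k).mul (ce _)).mul cψ) (hcs_of_supp hcs (fun x hx => by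
      rw [dzb_supp _ hx]; simp))
  have e1 : ∀ j k, ∫ x, f j x * ex Φ (1/2) x * dzb (ee k) θ x =
      (∫ x, f j x * (cr χ x * ex Φ (1/2) x * dzb (ee k) ψ x)) + (∫ x, f j x * (dzb (ee k) (cr χ) x * ex Φ (1/2) x * ψ x)) := by
    intro j k
    rw [← integral_add (i1 j k) (i2 j k)]
    congr 1; ext x
    rw [hθ, dzb_mul _ (hχs.da x) (hψ.da x)]
    ring
  rw [e1, e1] at h3
  have e2 : ∫ x, (f j x * (dzb (ee k) (cr χ) x * ex Φ (1/2) x) - f k x * (dzb (ee j) (cr χ) x * ex Φ (1/2) x)) * ψ x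
      = (∫ x, f j x * (dzb (ee k) (cr χ) x * ex Φ (1/2) x * ψ x)) - ∫ x, f k x * (dzb (ee j) (cr χ) x * ex Φ (1/2) x * ψ x) := by
    rw [← integral_sub (i2 j k) (i2 k j)]
    congr 1; ext x; ring
  rw [e2]
  have e3 : ∀ j k, ∫ x, (f j x * (χ x * ex Φ (1/2) x)) * dzb (ee k) ψ x = ∫ x, f j x * (cr χ x * ex Φ (1/2) x * dzb (ee k) ψ x) :=
    fun j k => by congr 1; ext x; ring
  rw [e3, e3]
  linear_combination -h3
end hor

section hor
variable {n : ℕ}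

lemma p1_aux {a e C : ℝ} {δ : ℂ} {f c : Fin n → ℂ} {χ : ℝ} {E1 E2 : ℂ} (ha : 0 ≤ a) (h01 : χ ∈ Icc (0:ℝ) 1)
    (he : 0 < e) (hE1 : ‖E1‖ = e) (hE2 : ‖E2‖ ^ 2 = e) (hC : ∀ j, a * ‖c j‖ ^ 2 ≤ C * e⁻¹) :
    a * ‖δ * (χ * E1) + ∑ j, f j * (c j * E2)‖ ^ 2 ≤ 2 * (a * e ^ 2 * ‖δ‖ ^ 2) + 2 * n * C * ∑ j, ‖f j‖ ^ 2 := by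
  have h1 : ‖δ * (χ * E1) + ∑ j, f j * (c j * E2)‖ ^ 2 ≤ 2 * ‖δ * (χ * E1)‖ ^ 2 + 2 * ‖∑ j, f j * (c j * E2)‖ ^ 2 := by
    have := norm_add_le (δ * (χ * E1)) (∑ j, f j * (c j * E2))
    nlinarith [norm_nonneg (δ * (χ * E1) + ∑ j, f j * (c j * E2)), sq_nonneg (‖δ * (χ * E1)‖ - ‖∑ j, f j * (c j * E2)‖)]
  have h2 : ‖δ * (χ * E1)‖ ^ 2 ≤ e ^ 2 * ‖δ‖ ^ 2 := by
    rw [norm_mul, norm_mul, hE1, Complex.norm_real, Real.norm_of_nonneg h01.1, mul_pow, mul_pow]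
    have : χ ^ 2 ≤ 1 := by nlinarith [h01.1, h01.2]
    nlinarith [mul_nonneg (sq_nonneg ‖δ‖) (sq_nonneg e)]
  have h3 : ‖∑ j, f j * (c j * E2)‖ ^ 2 ≤ n * ∑ j, ‖f j * (c j * E2)‖ ^ 2 := by
    calc ‖∑ j, f j * (c j * E2)‖ ^ 2 ≤ (∑ j, ‖f j * (c j * E2)‖) ^ 2 := by gcongr; exact norm_sum_le _ _
      _ ≤ _ := by simpa using sq_sum_le_card_mul_sum_sq (s := Finset.univ) (f := fun j => ‖f j * (c j * E2)‖)
  have h4 : a * ∑ j, ‖f j * (c j * E2)‖ ^ 2 ≤ C * ∑ j, ‖f j‖ ^ 2 := by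
    rw [Finset.mul_sum, Finset.mul_sum]
    refine Finset.sum_le_sum fun j _ => ?_
    rw [norm_mul, norm_mul, mul_pow, mul_pow, hE2]
    have := mul_le_mul_of_nonneg_right (hC j) (mul_nonneg he.le (sq_nonneg ‖f j‖))
    have e1 : C * e⁻¹ * (e * ‖f j‖ ^ 2) = C * ‖f j‖ ^ 2 := by field_simp
    rw [e1] at this
    linarith
  have := mul_le_mul_of_nonneg_left h1 ha
  have h3' := mul_le_mul_of_nonneg_left h3 ha
  have h2' := mul_le_mul_of_nonneg_left h2 ha
  have h4' := mul_le_mul_of_nonneg_left h4 (Nat.cast_nonneg (α := ℝ) n)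
  linarith

lemma p2_aux {e w C : ℝ} {f c : Fin n → ℂ} {E2 : ℂ} (hw : 0 ≤ w)
    (he : 0 < e) (hE2 : ‖E2‖ ^ 2 = e) (hC : ∀ j, w * ‖c j‖ ^ 2 ≤ C * e⁻¹) :
    w * ∑ j, ∑ k, ‖f j * (c k * E2) - f k * (c j * E2)‖ ^ 2 ≤ 4 * n * C * ∑ j, ‖f j‖ ^ 2 := by
  have h1 : ∀ j k, w * ‖f j * (c k * E2) - f k * (c j * E2)‖ ^ 2 ≤ 2 * C * ‖f j‖ ^ 2 + 2 * C * ‖f k‖ ^ 2 := by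
    intro j k
    have h0 : ∀ j k, w * ‖f j * (c k * E2)‖ ^ 2 ≤ C * ‖f j‖ ^ 2 := by
      intro j k
      rw [norm_mul, norm_mul, mul_pow, mul_pow, hE2]
      have := mul_le_mul_of_nonneg_right (hC k) (mul_nonneg he.le (sq_nonneg ‖f j‖))
      have e1 : C * e⁻¹ * (e * ‖f j‖ ^ 2) = C * ‖f j‖ ^ 2 := by field_simp
      rw [e1] at this
      linarith
    have h1 : ‖f j * (c k * E2) - f k * (c j * E2)‖ ^ 2 ≤ 2 * ‖f j * (c k * E2)‖ ^ 2 + 2 * ‖f k * (c j * E2)‖ ^ 2 := by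
      have := norm_sub_le (f j * (c k * E2)) (f k * (c j * E2))
      nlinarith [norm_nonneg (f j * (c k * E2) - f k * (c j * E2)), sq_nonneg (‖f j * (c k * E2)‖ - ‖f k * (c j * E2)‖)]
    have := mul_le_mul_of_nonneg_left h1 hw
    linarith [h0 j k, h0 k j]
  rw [Finset.mul_sum]
  simp_rw [Finset.mul_sum _ _ w]
  calc _ ≤ ∑ j, ∑ k, (2 * C * ‖f j‖ ^ 2 + 2 * C * ‖f k‖ ^ 2) := Finset.sum_le_sum fun j _ => Finset.sum_le_sum fun k _ => h1 j k
    _ = _ := by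
      simp only [Finset.sum_add_distrib, Finset.sum_const, Finset.card_univ, Fintype.card_fin, ← Finset.mul_sum, nsmul_eq_mul]
      ring

lemma esq_sum_ofReal {s : Finset (Fin n)} (f : Fin n → ℂ) : ∑ j ∈ s, ‖f j‖ₑ ^ 2 = ENNReal.ofReal (∑ j ∈ s, ‖f j‖ ^ 2) := by
  rw [ENNReal.ofReal_sum_of_nonneg (fun _ _ => by positivity)]
  simp_rw [esq_ofReal]

lemma la {Ξ Φ : (Fin n → ℂ) → ℝ} (hΞ : ContDiff ℝ (⊤ : ℕ∞) Ξ) (hΦ : ContDiff ℝ (⊤ : ℕ∞) Φ)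
    {χ : (Fin n → ℂ) → ℝ} (hχ : ContDiff ℝ (⊤ : ℕ∞) χ) (hχc : HasCompactSupport χ) (h01 : ∀ x, χ x ∈ Icc (0:ℝ) 1)
    {a b : (Fin n → ℂ) → ℝ} {K : Set (Fin n → ℂ)} {d : ℝ} (hd : 0 < d)
    (hKd : K = cthickening d (tsupport χ)) (ha : ContinuousOn a K) (hb : ContinuousOn b K)
    (a0 : ∀ x ∈ K, 0 ≤ a x) (b0 : ∀ x ∈ K, 0 ≤ b x) (J : Finset (Fin n)) (hyp : ∀ x ∈ K, Hyp Ξ Φ a b J x)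
    {C : ℝ} (hC0 : 0 ≤ C) (hC : ∀ x ∈ K, ∀ j, (a x + wt Ξ x) * ‖dz (ee j) (cr χ) x‖ ^ 2 ≤ C * wt Φ x)
    {f : Fin n → (Fin n → ℂ) → ℂ} (hf : ∀ j, MemLp (f j) 2) {δ : (Fin n → ℂ) → ℂ} (hδ : MemLp δ 2)
    (hd' : ∀ ψ, Sm ψ → HasCompactSupport ψ → tsupport ψ ⊆ tsupport χ →
      ∑ j, ∫ x, f j x * ex Φ (-1/2) x * dz (ee j) ψ x = - ∫ x, δ x * ψ x)
    (hc : ∀ j k ψ, Sm ψ → HasCompactSupport ψ → tsupport ψ ⊆ tsupport χ →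
      ∫ x, f j x * ex Φ (1/2) x * dzb (ee k) ψ x = ∫ x, f k x * ex Φ (1/2) x * dzb (ee j) ψ x) :
    ∫⁻ x in K, ENNReal.ofReal (b x * Real.exp (Φ x) * χ x ^ 2) * ∑ j ∈ J, ‖f j x‖ₑ ^ 2 ≤
      8 * (∫⁻ x in K, ENNReal.ofReal (a x * Real.exp (Φ x) ^ 2) * ‖δ x‖ₑ ^ 2) +
      ENNReal.ofReal (24 * n * C) * ∫⁻ x, {x | ∃ j : Fin n, dz (ee j) (cr χ) x ≠ 0}.indicator (fun x => ∑ j, ‖f j x‖ₑ ^ 2) x := by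
  set N := {x | ∃ j : Fin n, dz (ee j) (cr χ) x ≠ 0} with hN
  have hK : IsCompact K := hKd ▸ hχc.isCompact.cthickening
  have hKm := hK.measurableSet
  have hχs := cr_sm hχ
  have hcs := cr_cs hχc
  have cχd : ∀ j : Fin n, Continuous (dz (ee j) (cr χ)) := fun j => (hχs.dz (ee j)).continuous
  have cχd' : ∀ j : Fin n, Continuous (dzb (ee j) (cr χ)) := fun j => (hχs.dzb (ee j)).continuous
  have ce : ∀ c, Continuous (ex Φ c) := fun c => (ex_sm hΦ c).continuous
  have cχ : Continuous (cr χ) := hχs.continuous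
  have hNo : IsOpen N := by
    have : N = ⋃ j : Fin n, {x | dz (ee j) (cr χ) x ≠ 0} := by ext x; simp [hN]
    rw [this]
    exact isOpen_iUnion fun j => isOpen_ne_fun (cχd j) continuous_const
  have hbb : ∀ j x, ‖dzb (ee j) (cr χ) x‖ = ‖dz (ee j) (cr χ) x‖ := fun j x => by
    rw [← conj_dz_cr _ (hχ.differentiable (by simp)).differentiableAt]; simp
  have mp : ∀ j, MemLp (fun x => f j x * (χ x * ex Φ (1/2) x)) 2 := fun j =>
    memLp_mul_cs (hf j) (cχ.mul (ce _)) (hcs_of_supp hcs (fun x hx => by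
      rw [cr_ts] at hx; rw [image_eq_zero_of_notMem_tsupport hx]; simp))
  have mR : MemLp (fun x => δ x * (χ x * ex Φ 1 x) + ∑ j, f j x * (dz (ee j) (cr χ) x * ex Φ (1/2) x)) 2 := by
    refine MemLp.add (memLp_mul_cs hδ (cχ.mul (ce _)) (hcs_of_supp hcs (fun x hx => by
      rw [cr_ts] at hx; rw [image_eq_zero_of_notMem_tsupport hx]; simp))) (memLp_finsetSum _ fun j _ => ?_)
    exact memLp_mul_cs (hf j) ((cχd j).mul (ce _)) (hcs_of_supp hcs (fun x hx => by rw [dz_supp _ hx]; simp))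
  have mq : ∀ j k, MemLp (fun x => f j x * (dzb (ee k) (cr χ) x * ex Φ (1/2) x) - f k x * (dzb (ee j) (cr χ) x * ex Φ (1/2) x)) 2 := by
    intro j k
    refine MemLp.sub ?_ ?_
    · exact memLp_mul_cs (hf j) ((cχd' k).mul (ce _)) (hcs_of_supp hcs (fun x hx => by rw [dzb_supp _ hx]; simp))
    · exact memLp_mul_cs (hf k) ((cχd' j).mul (ce _)) (hcs_of_supp hcs (fun x hx => by rw [dzb_supp _ hx]; simp))
  have S := starL2 hΞ hΦ hχc.isCompact hd hKd ha hb a0 b0 J hyp mp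
    (fun j x hx => by rw [image_eq_zero_of_notMem_tsupport hx]; simp) mR mq (la_div hΦ hχ hχc hf hδ hd') (la_curl hΦ hχ hχc hf hc)
  have hE2 : ∀ x, ‖ex Φ (1/2) x‖ ^ 2 = Real.exp (Φ x) := fun x => by
    rw [ex_norm, ← Real.exp_nat_mul]; congr 1; push_cast; ring
  have hE1 : ∀ x, ‖ex Φ 1 x‖ = Real.exp (Φ x) := fun x => by rw [ex_norm, one_mul]
  have hwt : ∀ x, wt Φ x = (Real.exp (Φ x))⁻¹ := fun x => by rw [wt, Real.exp_neg]
  have hL : ∫⁻ x in K, ENNReal.ofReal (b x * Real.exp (Φ x) * χ x ^ 2) * ∑ j ∈ J, ‖f j x‖ₑ ^ 2 =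
      ∫⁻ x in K, ENNReal.ofReal (b x) * ∑ j ∈ J, ‖f j x * (χ x * ex Φ (1/2) x)‖ₑ ^ 2 := by
    refine setLIntegral_congr_fun hKm fun x hx => ?_
    simp only [esq_sum_ofReal]
    rw [← ENNReal.ofReal_mul (b0 x hx), ← ENNReal.ofReal_mul (mul_nonneg (mul_nonneg (b0 x hx) (Real.exp_pos _).le) (sq_nonneg _))]
    congr 1
    rw [mul_assoc, mul_assoc, Finset.mul_sum, Finset.mul_sum]
    congr 1
    refine Finset.sum_congr rfl fun j _ => ?_
    rw [norm_mul, norm_mul, mul_pow, mul_pow, hE2, Complex.norm_real, Real.norm_eq_abs, sq_abs]; ring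
  have hC1 : ∀ x ∈ K, ∀ j, a x * ‖dz (ee j) (cr χ) x‖ ^ 2 ≤ C * (Real.exp (Φ x))⁻¹ := fun x hx j => by
    rw [← hwt]; refine le_trans ?_ (hC x hx j)
    have : 0 ≤ wt Ξ x := (Real.exp_pos _).le
    nlinarith [mul_nonneg this (sq_nonneg ‖dz (ee j) (cr χ) x‖)]
  have hC2 : ∀ x ∈ K, ∀ j, wt Ξ x * ‖dzb (ee j) (cr χ) x‖ ^ 2 ≤ C * (Real.exp (Φ x))⁻¹ := fun x hx j => by
    rw [← hwt, hbb]; refine le_trans ?_ (hC x hx j)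
    nlinarith [mul_nonneg (a0 x hx) (sq_nonneg ‖dz (ee j) (cr χ) x‖)]
  set Fi : (Fin n → ℂ) → ℝ≥0∞ := N.indicator (fun x => ∑ j, ‖f j x‖ₑ ^ 2) with hFi
  have hFm : AEMeasurable Fi := by
    refine AEMeasurable.indicator ?_ hNo.measurableSet
    exact Finset.aemeasurable_fun_sum _ (fun j _ => ((hf j).1.enorm.pow_const _))
  have b1 : ∀ x ∈ K, ENNReal.ofReal (a x) * ‖δ x * (χ x * ex Φ 1 x) + ∑ j, f j x * (dz (ee j) (cr χ) x * ex Φ (1/2) x)‖ₑ ^ 2 ≤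
      2 * (ENNReal.ofReal (a x * Real.exp (Φ x) ^ 2) * ‖δ x‖ₑ ^ 2) + ENNReal.ofReal (2 * n * C) * Fi x := by
    intro x hx
    by_cases hxN : x ∈ N
    · have := p1_aux (δ := δ x) (f := fun j => f j x) (a0 x hx) (h01 x) (Real.exp_pos _) (hE1 x) (hE2 x) (hC1 x hx)
      rw [hFi, indicator_of_mem hxN]
      simp only [esq_sum_ofReal]; simp only [esq_ofReal]
      rw [← ENNReal.ofReal_mul (a0 x hx), ← ENNReal.ofReal_mul (mul_nonneg (a0 x hx) (sq_nonneg _)), ← ENNReal.ofReal_mul (by positivity),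
        show (2:ℝ≥0∞) = ENNReal.ofReal 2 by simp, ← ENNReal.ofReal_mul (by norm_num), ← ENNReal.ofReal_add]
      · exact ENNReal.ofReal_le_ofReal this
      · have := a0 x hx; positivity
      · positivity
    · have h0 : ∀ j, dz (ee j) (cr χ) x = 0 := fun j => by by_contra h; exact hxN ⟨j, h⟩
      simp only [h0, zero_mul, mul_zero, Finset.sum_const_zero, add_zero]
      refine le_trans ?_ (le_add_of_nonneg_right zero_le)
      simp only [esq_ofReal]
      rw [← ENNReal.ofReal_mul (a0 x hx), ← ENNReal.ofReal_mul (mul_nonneg (a0 x hx) (sq_nonneg _)),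
        show (2:ℝ≥0∞) = ENNReal.ofReal 2 by simp, ← ENNReal.ofReal_mul (by norm_num)]
      apply ENNReal.ofReal_le_ofReal
      have := p1_aux (C := C) (δ := δ x) (f := fun j : Fin n => 0) (c := fun j => 0) (a0 x hx) (h01 x) (Real.exp_pos _) (hE1 x) (hE2 x) (by
        intro j; simp; positivity)
      simpa using this
  have b2 : ∀ x ∈ K, ENNReal.ofReal (wt Ξ x) * ∑ j, ∑ k, ‖f j x * (dzb (ee k) (cr χ) x * ex Φ (1/2) x) - f k x * (dzb (ee j) (cr χ) x * ex Φ (1/2) x)‖ₑ ^ 2 ≤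
      ENNReal.ofReal (4 * n * C) * Fi x := by
    intro x hx
    by_cases hxN : x ∈ N
    · have := p2_aux (f := fun j => f j x) (w := wt Ξ x) (Real.exp_pos _).le (Real.exp_pos _) (hE2 x) (hC2 x hx)
      rw [hFi, indicator_of_mem hxN]
      simp only [esq_sum_ofReal]
      rw [← ENNReal.ofReal_sum_of_nonneg (fun _ _ => by positivity), ← ENNReal.ofReal_mul (show 0 ≤ wt Ξ x from (Real.exp_pos _).le), ← ENNReal.ofReal_mul (by positivity)]
      exact ENNReal.ofReal_le_ofReal this
    · have h0 : ∀ j, dzb (ee j) (cr χ) x = 0 := fun j => by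
        by_contra h
        refine hxN ⟨j, fun h' => h ?_⟩
        rw [← norm_eq_zero, hbb, h', norm_zero]
      simp [h0]
  rw [hL]
  refine S.trans ?_
  have I1 : ∫⁻ x in K, ENNReal.ofReal (a x) * ‖δ x * (χ x * ex Φ 1 x) + ∑ j, f j x * (dz (ee j) (cr χ) x * ex Φ (1/2) x)‖ₑ ^ 2 ≤
      2 * (∫⁻ x in K, ENNReal.ofReal (a x * Real.exp (Φ x) ^ 2) * ‖δ x‖ₑ ^ 2) + ENNReal.ofReal (2 * n * C) * ∫⁻ x, Fi x := by
    refine (setLIntegral_mono_ae' hKm (Eventually.of_forall b1)).trans ?_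
    rw [lintegral_add_right' _ (hFm.restrict.const_mul _), lintegral_const_mul' 2 _ ENNReal.ofNat_ne_top, lintegral_const_mul' _ _ ENNReal.ofReal_ne_top]
    gcongr
    exact Measure.restrict_le_self
  have I2 : ∫⁻ x in K, ENNReal.ofReal (wt Ξ x) * ∑ j, ∑ k, ‖f j x * (dzb (ee k) (cr χ) x * ex Φ (1/2) x) - f k x * (dzb (ee j) (cr χ) x * ex Φ (1/2) x)‖ₑ ^ 2 ≤
      ENNReal.ofReal (4 * n * C) * ∫⁻ x, Fi x := by
    refine (setLIntegral_mono_ae' hKm (Eventually.of_forall b2)).trans ?_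
    rw [lintegral_const_mul' _ _ ENNReal.ofReal_ne_top]
    gcongr
    exact Measure.restrict_le_self
  refine (add_le_add (mul_le_mul_right I1 4) (mul_le_mul_right I2 4)).trans (le_of_eq ?_)
  have hc3 : ENNReal.ofReal (24 * n * C) = 4 * ENNReal.ofReal (2 * n * C) + 4 * ENNReal.ofReal (4 * n * C) := by
    rw [show (4:ℝ≥0∞) = ENNReal.ofReal 4 by simp, ← ENNReal.ofReal_mul (by norm_num), ← ENNReal.ofReal_mul (by norm_num), ← ENNReal.ofReal_add (by positivity) (by positivity)]
    congr 1; ring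
  rw [hc3]
  ring
end hor

section hor
variable {n : ℕ}

lemma dzb_comm {f : (Fin n → ℂ) → ℂ} (hf : Sm f) (v w x : Fin n → ℂ) :
    dzb v (dzb w f) x = dzb w (dzb v f) x := by
  have key : ∀ a, DifferentiableAt ℝ (fun y => fderiv ℝ f y a) x := fun a => (hf.fd a).da x
  have e1 : ∀ w u, fderiv ℝ (dzb w f) x u = (1/2) * (fderiv ℝ (fun y => fderiv ℝ f y w) x u +
      Complex.I * fderiv ℝ (fun y => fderiv ℝ f y (Complex.I • w)) x u) := by
    intro w u
    have : HasFDerivAt (dzb w f) _ x :=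
      (((key w).hasFDerivAt).add (((key (Complex.I • w)).hasFDerivAt).const_mul Complex.I)).const_mul (1/2)
    rw [this.fderiv]; simp; ring
  conv_lhs => rw [dzb]
  conv_rhs => rw [dzb]
  rw [e1, e1, e1, e1, dz_fderiv hf w v 0, dz_fderiv hf w (Complex.I • v) 0,
    dz_fderiv hf (Complex.I • w) v 0, dz_fderiv hf (Complex.I • w) (Complex.I • v) 0]
  ring

lemma ex_sm_supp {Φ : (Fin n → ℂ) → ℝ} {U : Set (Fin n → ℂ)} (hU : IsOpen U) (hΦ : ContDiffOn ℝ (⊤ : ℕ∞) Φ U) (c : ℝ)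
    {g : (Fin n → ℂ) → ℂ} (hg : Sm g) (hs : tsupport g ⊆ U) : Sm (fun x => ex Φ c x * g x) := by
  unfold Sm
  rw [contDiff_iff_contDiffAt]
  intro x
  by_cases hx : x ∈ tsupport g
  · have h1 : ContDiffAt ℝ (⊤ : ℕ∞) Φ x := hΦ.contDiffAt (hU.mem_nhds (hs hx))
    have h2 : ContDiffAt ℝ (⊤ : ℕ∞) (ex Φ c) x :=
      Complex.ofRealCLM.contDiff.contDiffAt.comp x (Real.contDiff_exp.contDiffAt.comp x (contDiffAt_const.mul h1))
    exact h2.mul hg.contDiffAt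
  · have : (fun x => ex Φ c x * g x) =ᶠ[𝓝 x] fun _ => 0 := by
      filter_upwards [notMem_tsupport_iff_eventuallyEq.1 hx] with y hy
      simp [hy]
    exact contDiffAt_const.congr_of_eventuallyEq this

lemma test_memLp {g : (Fin n → ℂ) → ℂ} (hg : Continuous g) (hc : HasCompactSupport g) : MemLp g 2 :=
  hg.memLp_of_hasCompactSupport hc

lemma exm_cs {Φ : (Fin n → ℂ) → ℝ} (c : ℝ) {g : (Fin n → ℂ) → ℂ} (hc : HasCompactSupport g) :
    HasCompactSupport (fun x => ex Φ c x * g x) := hc.mul_left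

lemma conj_cs {g : (Fin n → ℂ) → ℂ} (hc : HasCompactSupport g) : HasCompactSupport (fun x => (starRingEnd ℂ) (g x)) :=
  hcs_of_supp hc (fun x hx => by rw [image_eq_zero_of_notMem_tsupport hx]; simp)

lemma conj_ts {g : (Fin n → ℂ) → ℂ} : tsupport (fun x => (starRingEnd ℂ) (g x)) ⊆ tsupport g :=
  tsupport_of_supp (fun x hx => by rw [image_eq_zero_of_notMem_tsupport hx]; simp)

lemma hor_f1 {D : Set (Fin n → ℂ)} (hD : IsOpen D) {Φ : (Fin n → ℂ) → ℝ} (hΦ : ContDiffOn ℝ (⊤ : ℕ∞) Φ D)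
    {h : (Fin n → ℂ) → ℂ} (hh : Sm h) (hα : ∀ j, MemLp (D.indicator (fun x => ex Φ (-1/2) x * dzb (ee j) h x)) 2)
    {G : Fin n → (Fin n → ℂ) → ℂ} (hG : ∀ j, Sm (G j)) (hGc : ∀ j, HasCompactSupport (G j)) (hGD : ∀ j, tsupport (G j) ⊆ D) :
    ∃ f : Fin n → (Fin n → ℂ) → ℂ, (∀ j, MemLp (f j) 2) ∧
      (∀ ψ, Sm ψ → HasCompactSupport ψ → tsupport ψ ⊆ D →
        ∑ j, ∫ x, f j x * ex Φ (-1/2) x * dz (ee j) ψ x = - ∫ x, (∑ j, dz (ee j) (G j) x) * ψ x) ∧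
      (∀ j k ψ, Sm ψ → HasCompactSupport ψ → tsupport ψ ⊆ D →
        ∫ x, f j x * ex Φ (1/2) x * dzb (ee k) ψ x = ∫ x, f k x * ex Φ (1/2) x * dzb (ee j) ψ x) ∧
      ∑ j, ∫ x, f j x * (starRingEnd ℂ) (D.indicator (fun x => ex Φ (-1/2) x * dzb (ee j) h x) x) =
        ∑ j, ∫ x, G j x * (starRingEnd ℂ) (dzb (ee j) h x) := by
  classical
  let sf : ((Fin n → ℂ) → ℂ) → Fin n → Fin n → Fin n → (Fin n → ℂ) → ℂ := fun ψ j k i x =>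
    (if i = j then (starRingEnd ℂ) (ex Φ (1/2) x * dzb (ee k) ψ x) else 0) -
    (if i = k then (starRingEnd ℂ) (ex Φ (1/2) x * dzb (ee j) ψ x) else 0)
  let T : ((Fin n → ℂ) → ℂ) → Prop := fun ψ => Sm ψ ∧ HasCompactSupport ψ ∧ tsupport ψ ⊆ D
  have hts : ∀ ψ (k : Fin n), tsupport (dzb (ee k) ψ) ⊆ tsupport ψ := fun ψ k => tsupport_of_supp (fun _ h => dzb_supp _ h)
  have htz : ∀ ψ (k : Fin n), tsupport (dz (ee k) ψ) ⊆ tsupport ψ := fun ψ k => tsupport_of_supp (fun _ h => dz_supp _ h)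
  have cE : ∀ ψ, T ψ → ∀ k : Fin n, Continuous (fun x => ex Φ (1/2) x * dzb (ee k) ψ x) := fun ψ hψ k =>
    (ex_sm_supp hD hΦ _ (hψ.1.dzb _) ((hts ψ k).trans hψ.2.2)).continuous
  have cC : ∀ ψ, T ψ → ∀ k : Fin n, HasCompactSupport (fun x => ex Φ (1/2) x * dzb (ee k) ψ x) := fun ψ hψ k =>
    exm_cs _ (hcs_dzb hψ.2.1 _)
  have mS : ∀ ψ, T ψ → ∀ j k i, MemLp (sf ψ j k i) 2 := by
    intro ψ hψ j k i
    refine MemLp.sub ?_ ?_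
    · by_cases hij : i = j
      · simp only [hij, if_true]; exact (test_memLp (Complex.continuous_conj.comp (cE ψ hψ k)) (conj_cs (cC ψ hψ k)))
      · simp only [hij, if_false]; exact MemLp.zero
    · by_cases hij : i = k
      · simp only [hij, if_true]; exact (test_memLp (Complex.continuous_conj.comp (cE ψ hψ j)) (conj_cs (cC ψ hψ j)))
      · simp only [hij, if_false]; exact MemLp.zero
  have eS : ∀ ψ, T ψ → ∀ j k, ∀ t : Fin n → (Fin n → ℂ) → ℂ, (∀ i, MemLp (t i) 2) →
      ∑ i, ∫ x, t i x * (starRingEnd ℂ) (sf ψ j k i x) =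
      (∫ x, t j x * ex Φ (1/2) x * dzb (ee k) ψ x) - ∫ x, t k x * ex Φ (1/2) x * dzb (ee j) ψ x := by
    intro ψ hψ j k t ht
    have e1 : ∀ i, ∫ x, t i x * (starRingEnd ℂ) (sf ψ j k i x) =
        (if i = j then (∫ x, t i x * ex Φ (1/2) x * dzb (ee k) ψ x) else 0) - (if i = k then ∫ x, t i x * ex Φ (1/2) x * dzb (ee j) ψ x else 0) := by
      intro i
      have i1 : Integrable (fun x => t i x * (if i = j then (ex Φ (1/2) x * dzb (ee k) ψ x) else 0)) := by
        by_cases hij : i = j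
        · simp only [hij, if_true]; exact int_mul_cs (ht _) (cE ψ hψ k) (cC ψ hψ k)
        · simp [hij]
      have i2 : Integrable (fun x => t i x * (if i = k then (ex Φ (1/2) x * dzb (ee j) ψ x) else 0)) := by
        by_cases hij : i = k
        · simp only [hij, if_true]; exact int_mul_cs (ht _) (cE ψ hψ j) (cC ψ hψ j)
        · simp [hij]
      have : ∀ x, t i x * (starRingEnd ℂ) (sf ψ j k i x) = t i x * (if i = j then (ex Φ (1/2) x * dzb (ee k) ψ x) else 0)
          - t i x * (if i = k then (ex Φ (1/2) x * dzb (ee j) ψ x) else 0) := by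
        intro x
        simp only [sf, map_sub, mul_sub]
        congr 1 <;> split_ifs <;> simp
      simp_rw [this]
      rw [integral_sub i1 i2]
      congr 1
      · split_ifs
        · simp only [mul_assoc]
        · simp
      · split_ifs
        · simp only [mul_assoc]
        · simp
    simp_rw [e1]
    rw [Finset.sum_sub_distrib]
    simp
  have hx1 : ∀ x, ex Φ (-1/2) x * ex Φ (1/2) x = 1 := fun x => by rw [ex_mul]; norm_num [ex]
  have adm : ∀ H, Sm H → (∀ j, MemLp (D.indicator (fun x => ex Φ (-1/2) x * dzb (ee j) H x)) 2) → ∀ ψ, T ψ → ∀ j k : Fin n,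
      ∑ i, ∫ x, D.indicator (fun x => ex Φ (-1/2) x * dzb (ee i) H x) x * (starRingEnd ℂ) (sf ψ j k i x) = 0 := by
    intro H hH mH ψ hψ j k
    rw [eS ψ hψ j k (fun j => D.indicator (fun x => ex Φ (-1/2) x * dzb (ee j) H x)) mH]
    have e : ∀ j k : Fin n, ∫ x, D.indicator (fun x => ex Φ (-1/2) x * dzb (ee j) H x) x * ex Φ (1/2) x * dzb (ee k) ψ x
        = ∫ x, dzb (ee j) H x * dzb (ee k) ψ x := by
      intro j k
      congr 1; ext x
      by_cases hx : x ∈ D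
      · rw [indicator_of_mem hx]
        linear_combination (dzb (ee j) H x * dzb (ee k) ψ x) * hx1 x
      · rw [dzb_supp _ (fun h => hx (hψ.2.2 h))]; simp
    rw [e, e, ibp_dzb (hH.dzb _) hψ.1 hψ.2.1, ibp_dzb (hH.dzb _) hψ.1 hψ.2.1]
    simp_rw [dzb_comm hH (ee k) (ee j)]
    ring
  obtain ⟨f, mf, hf1, hf2⟩ := proj_fun {s | ∃ ψ j k, T ψ ∧ s = sf ψ j k} (by rintro _ ⟨ψ, j, k, hψ, rfl⟩ i; exact mS ψ hψ j k i)
    (fun j x => ex Φ (1/2) x * G j x) (fun j => test_memLp (ex_sm_supp hD hΦ _ (hG j) (hGD j)).continuous (exm_cs _ (hGc j)))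
  have use : ∀ H, Sm H → (∀ j, MemLp (D.indicator (fun x => ex Φ (-1/2) x * dzb (ee j) H x)) 2) →
      ∑ j, ∫ x, f j x * (starRingEnd ℂ) (D.indicator (fun x => ex Φ (-1/2) x * dzb (ee j) H x) x) =
        ∑ j, ∫ x, G j x * (starRingEnd ℂ) (dzb (ee j) H x) := by
    intro H hH mH
    rw [hf2 _ mH (by rintro _ ⟨ψ, j, k, hψ, rfl⟩; exact adm H hH mH ψ hψ j k)]
    refine Finset.sum_congr rfl fun j _ => ?_
    congr 1; ext x
    by_cases hx : x ∈ D
    · rw [indicator_of_mem hx, map_mul, ex_conj]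
      linear_combination (G j x * (starRingEnd ℂ) (dzb (ee j) H x)) * hx1 x
    · rw [image_eq_zero_of_notMem_tsupport (f := G j) (fun h => hx (hGD j h))]; simp
  refine ⟨f, mf, ?_, ?_, use h hh hα⟩
  · intro ψ h1 h2 h3
    have hT : T ψ := ⟨h1, h2, h3⟩
    have hind : ∀ j : Fin n, D.indicator (fun x => ex Φ (-1/2) x * dzb (ee j) (fun x => (starRingEnd ℂ) (ψ x)) x) =
        fun x => ex Φ (-1/2) x * dzb (ee j) (fun x => (starRingEnd ℂ) (ψ x)) x := by
      intro j; ext x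
      by_cases hx : x ∈ D
      · rw [indicator_of_mem hx]
      · rw [indicator_of_notMem hx, dzb_supp _ (fun h => hx (h3 (conj_ts h)))]; simp
    have u := use _ h1.conj (fun j => by
      rw [hind]
      exact test_memLp (ex_sm_supp hD hΦ _ (h1.conj.dzb _) ((hts _ j).trans (conj_ts.trans h3))).continuous (exm_cs _ (hcs_dzb (conj_cs h2) _)))
    simp_rw [hind, dzb_conj _ (h1.da _), map_mul, ex_conj, Complex.conj_conj, ← mul_assoc] at u
    rw [u]
    simp_rw [Finset.sum_mul]
    rw [integral_finsetSum _ (fun j _ => int_cs (((hG j).dz (ee j)).mul' h1).continuous h2.mul_left), ← Finset.sum_neg_distrib]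
    exact Finset.sum_congr rfl fun j _ => ibp_dz (hG j) h1 h2 _
  · intro j k ψ h1 h2 h3
    have := hf1 _ ⟨ψ, j, k, ⟨h1, h2, h3⟩, rfl⟩
    rw [eS ψ ⟨h1, h2, h3⟩ j k f mf, sub_eq_zero] at this
    exact this
end hor

section hor
variable {n : ℕ}

lemma cr_ev {f g : (Fin n → ℂ) → ℝ} {x} (h : f =ᶠ[𝓝 x] g) : cr f =ᶠ[𝓝 x] cr g := by
  filter_upwards [h] with y hy; simp only [cr, hy]

lemma Lv_congr {f g : (Fin n → ℂ) → ℝ} {x} (h : f =ᶠ[𝓝 x] g) (ξ) : Lv f x ξ = Lv g x ξ := by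
  unfold Lv
  refine Finset.sum_congr rfl fun j _ => Finset.sum_congr rfl fun k _ => ?_
  rw [dzb_congr (f := dz (ee j) (cr f)) (g := dz (ee j) (cr g))]
  filter_upwards [eventually_eventuallyEq_nhds.2 (cr_ev h)] with y hy
  exact dz_congr _ hy

lemma Hyp_congr {Ξ Φ Ξ' Φ' a b : (Fin n → ℂ) → ℝ} {J x} (h1 : Ξ' =ᶠ[𝓝 x] Ξ) (h2 : Φ' =ᶠ[𝓝 x] Φ)
    (h : Hyp Ξ Φ a b J x) : Hyp Ξ' Φ' a b J x := by
  intro ξ S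
  have := h ξ S
  simp only [wt, Lv_congr h1, dz_congr _ (cr_ev h1), dz_congr _ (cr_ev h2), h1.eq_of_nhds] at this ⊢
  exact this

structure HD (D : Set (Fin n → ℂ)) (Ξ Φ a b : (Fin n → ℂ) → ℝ) (J : Finset (Fin n)) (χ : ℕ → (Fin n → ℂ) → ℝ) (C : ℝ) : Prop where
  hD : IsOpen D
  hΞ : ContDiffOn ℝ (⊤ : ℕ∞) Ξ D
  hΦ : ContDiffOn ℝ (⊤ : ℕ∞) Φ D
  ha : ContinuousOn a D
  hb : ContinuousOn b D
  a0 : ∀ x ∈ D, 0 < a x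
  b0 : ∀ x ∈ D, 0 < b x
  hyp : ∀ x ∈ D, Hyp Ξ Φ a b J x
  hχ : ∀ ν, ContDiff ℝ (⊤ : ℕ∞) (χ ν)
  hχc : ∀ ν, HasCompactSupport (χ ν)
  hχD : ∀ ν, tsupport (χ ν) ⊆ D
  h01 : ∀ ν x, χ ν x ∈ Icc (0:ℝ) 1
  hχ1 : ∀ x ∈ D, ∀ᶠ ν in atTop, χ ν =ᶠ[𝓝 x] fun _ => 1
  hC0 : 0 ≤ C
  hC : ∀ ν, ∀ x ∈ D, ∀ j, (a x + wt Ξ x) * ‖dz (ee j) (cr (χ ν)) x‖ ^ 2 ≤ C * wt Φ x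

lemma hor_nu {D : Set (Fin n → ℂ)} {Ξ Φ a b : (Fin n → ℂ) → ℝ} {J : Finset (Fin n)} {χ : ℕ → (Fin n → ℂ) → ℝ} {C : ℝ}
    (H : HD D Ξ Φ a b J χ C) {f : Fin n → (Fin n → ℂ) → ℂ} (hf : ∀ j, MemLp (f j) 2) {δ : (Fin n → ℂ) → ℂ} (hδ : MemLp δ 2)
    (hd' : ∀ ψ, Sm ψ → HasCompactSupport ψ → tsupport ψ ⊆ D →
      ∑ j, ∫ x, f j x * ex Φ (-1/2) x * dz (ee j) ψ x = - ∫ x, δ x * ψ x)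
    (hc : ∀ j k ψ, Sm ψ → HasCompactSupport ψ → tsupport ψ ⊆ D →
      ∫ x, f j x * ex Φ (1/2) x * dzb (ee k) ψ x = ∫ x, f k x * ex Φ (1/2) x * dzb (ee j) ψ x) (ν : ℕ) :
    ∫⁻ x in D, ENNReal.ofReal (b x * Real.exp (Φ x) * χ ν x ^ 2) * ∑ j ∈ J, ‖f j x‖ₑ ^ 2 ≤
      8 * (∫⁻ x in D, ENNReal.ofReal (a x * Real.exp (Φ x) ^ 2) * ‖δ x‖ₑ ^ 2) +
      ENNReal.ofReal (24 * n * C) * ∫⁻ x, {x | ∃ j : Fin n, dz (ee j) (cr (χ ν)) x ≠ 0}.indicator (fun x => ∑ j, ‖f j x‖ₑ ^ 2) x := by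
  obtain ⟨d, hd, hdD⟩ := (H.hχc ν).isCompact.exists_cthickening_subset_open H.hD (H.hχD ν)
  set K := cthickening d (tsupport (χ ν)) with hKdef
  have hK : IsCompact K := (H.hχc ν).isCompact.cthickening
  have hK0 : tsupport (χ ν) ⊆ K := self_subset_cthickening _
  obtain ⟨Ξ', hΞ', eΞ⟩ := ext_sm hK H.hD hdD H.hΞ
  obtain ⟨Φ', hΦ', eΦ⟩ := ext_sm hK H.hD hdD H.hΦ
  have eΦ0 : ∀ x ∈ K, Φ' x = Φ x := fun x hx => (eΦ x hx).eq_of_nhds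
  have exE : ∀ c, ∀ x ∈ K, ex Φ' c x = ex Φ c x := fun c x hx => by simp only [ex, eΦ0 x hx]
  have L := la hΞ' hΦ' (H.hχ ν) (H.hχc ν) (H.h01 ν) hd hKdef (H.ha.mono hdD) (H.hb.mono hdD) (fun x hx => (H.a0 x (hdD hx)).le)
    (fun x hx => (H.b0 x (hdD hx)).le) J (fun x hx => Hyp_congr (eΞ x hx) (eΦ x hx) (H.hyp x (hdD hx))) H.hC0
    (fun x hx j => by
      have := H.hC ν x (hdD hx) j
      simp only [wt, (eΞ x hx).eq_of_nhds, (eΦ x hx).eq_of_nhds] at this ⊢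
      exact this) hf hδ
    (fun ψ h1 h2 h3 => by
      rw [← hd' ψ h1 h2 (h3.trans (H.hχD ν))]
      refine Finset.sum_congr rfl fun j _ => ?_
      congr 1; ext x
      by_cases hx : x ∈ K
      · rw [exE _ x hx]
      · rw [dz_supp _ (fun h => hx (hK0 (h3 h)))]; simp)
    (fun j k ψ h1 h2 h3 => by
      have e : ∀ j k : Fin n, ∫ x, f j x * ex Φ' (1/2) x * dzb (ee k) ψ x = ∫ x, f j x * ex Φ (1/2) x * dzb (ee k) ψ x := by
        intro j k
        congr 1; ext x
        by_cases hx : x ∈ K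
        · rw [exE _ x hx]
        · rw [dzb_supp _ (fun h => hx (hK0 (h3 h)))]; simp
      rw [e, e, hc j k ψ h1 h2 (h3.trans (H.hχD ν))])
  have l1 : ∫⁻ x in D, ENNReal.ofReal (b x * Real.exp (Φ x) * χ ν x ^ 2) * ∑ j ∈ J, ‖f j x‖ₑ ^ 2 =
      ∫⁻ x in K, ENNReal.ofReal (b x * Real.exp (Φ' x) * χ ν x ^ 2) * ∑ j ∈ J, ‖f j x‖ₑ ^ 2 := by
    have s1 := setLIntegral_congr_fun (μ := volume) hK.measurableSet (f := fun x => ENNReal.ofReal (b x * Real.exp (Φ' x) * χ ν x ^ 2) * ∑ j ∈ J, ‖f j x‖ₑ ^ 2)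
      (g := fun x => ENNReal.ofReal (b x * Real.exp (Φ x) * χ ν x ^ 2) * ∑ j ∈ J, ‖f j x‖ₑ ^ 2) (fun x hx => by simp only [eΦ0 x hx])
    rw [s1]
    have hz : ∀ x, x ∉ K → ENNReal.ofReal (b x * Real.exp (Φ x) * χ ν x ^ 2) * ∑ j ∈ J, ‖f j x‖ₑ ^ 2 = 0 := fun x hx => by
      rw [image_eq_zero_of_notMem_tsupport (fun h => hx (hK0 h))]; simp
    rw [← lintegral_indicator hK.measurableSet, ← lintegral_indicator H.hD.measurableSet]
    congr 1; ext x
    by_cases hx : x ∈ K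
    · rw [indicator_of_mem hx, indicator_of_mem (hdD hx)]
    · rw [indicator_of_notMem hx]
      by_cases hx' : x ∈ D
      · rw [indicator_of_mem hx', hz x hx]
      · rw [indicator_of_notMem hx']
  rw [l1]
  refine L.trans (add_le_add (mul_le_mul_right ?_ 8) le_rfl)
  have s2 := setLIntegral_congr_fun (μ := volume) hK.measurableSet (f := fun x => ENNReal.ofReal (a x * Real.exp (Φ' x) ^ 2) * ‖δ x‖ₑ ^ 2)
      (g := fun x => ENNReal.ofReal (a x * Real.exp (Φ x) ^ 2) * ‖δ x‖ₑ ^ 2) (fun x hx => by simp only [eΦ0 x hx])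
  rw [s2]
  exact lintegral_mono_set hdD

lemma hor_bound {D : Set (Fin n → ℂ)} {Ξ Φ a b : (Fin n → ℂ) → ℝ} {J : Finset (Fin n)} {χ : ℕ → (Fin n → ℂ) → ℝ} {C : ℝ}
    (H : HD D Ξ Φ a b J χ C) {h : (Fin n → ℂ) → ℂ} (hh : Sm h)
    (hα : ∀ j, MemLp (D.indicator (fun x => ex Φ (-1/2) x * dzb (ee j) h x)) 2)
    (hJ : ∀ j, j ∉ J → ∀ x ∈ D, dzb (ee j) h x = 0) {Bd : ℝ≥0∞} (hBt : Bd ≠ ⊤)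
    (hB : ∫⁻ x in D, ENNReal.ofReal (wt Φ x ^ 2 / b x) * ∑ j ∈ J, ‖dzb (ee j) h x‖ₑ ^ 2 ≤ Bd)
    {G : Fin n → (Fin n → ℂ) → ℂ} (hG : ∀ j, Sm (G j)) (hGc : ∀ j, HasCompactSupport (G j)) (hGD : ∀ j, tsupport (G j) ⊆ D) :
    ‖∑ j, ∫ x, G j x * (starRingEnd ℂ) (dzb (ee j) h x)‖ₑ ^ 2 ≤
      8 * (∫⁻ x in D, ENNReal.ofReal (a x * Real.exp (Φ x) ^ 2) * ‖∑ j, dz (ee j) (G j) x‖ₑ ^ 2) * Bd := by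
  obtain ⟨f, mf, hd, hc, hp⟩ := hor_f1 H.hD H.hΦ hh hα hG hGc hGD
  set α : Fin n → (Fin n → ℂ) → ℂ := fun j => D.indicator (fun x => ex Φ (-1/2) x * dzb (ee j) h x) with hαd
  have mδ : MemLp (fun x => ∑ j, dz (ee j) (G j) x) 2 :=
    memLp_finsetSum _ fun j _ => test_memLp ((hG j).dz _).continuous (hcs_dz (hGc j) _)
  have N := hor_nu H mf mδ hd hc
  rw [← hp]
  have hp1 : ∑ j, ∫ x, f j x * (starRingEnd ℂ) (α j x) = ∑ j ∈ J, ∫ x, f j x * (starRingEnd ℂ) (α j x) := by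
    symm
    apply Finset.sum_subset (Finset.subset_univ _)
    intro j _ hj
    have : ∀ x, α j x = 0 := fun x => by
      by_cases hx : x ∈ D
      · simp only [hαd, indicator_of_mem hx, hJ j hj x hx, mul_zero]
      · simp only [hαd, indicator_of_notMem hx]
    simp [this]
  rw [hp1]
  -- limit of the pairings
  have lim1 : Tendsto (fun ν => ∑ j ∈ J, ∫ x, χ ν x * (f j x * (starRingEnd ℂ) (α j x))) atTop
      (𝓝 (∑ j ∈ J, ∫ x, f j x * (starRingEnd ℂ) (α j x))) := by
    refine tendsto_finsetSum _ fun j _ => ?_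
    have int : Integrable (fun x => f j x * (starRingEnd ℂ) (α j x)) := (mf j).integrable_mul (hα j).star
    refine tendsto_integral_of_dominated_convergence (fun x => ‖f j x * (starRingEnd ℂ) (α j x)‖) (fun ν => ?_) int.norm (fun ν => ?_) ?_
    · exact (cr_sm (H.hχ ν)).continuous.aestronglyMeasurable.mul int.1
    · refine Eventually.of_forall fun x => ?_
      rw [norm_mul, Complex.norm_real, Real.norm_of_nonneg (H.h01 ν x).1]
      exact mul_le_of_le_one_left (norm_nonneg _) (H.h01 ν x).2
    · refine Eventually.of_forall fun x => ?_
      by_cases hx : x ∈ D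
      · refine tendsto_const_nhds.congr' ?_
        filter_upwards [H.hχ1 x hx] with ν hν
        rw [hν.eq_of_nhds]; simp
      · have : α j x = 0 := by simp only [hαd, indicator_of_notMem hx]
        simp [this]
  -- limit of the error
  set Nn : ℕ → Set (Fin n → ℂ) := fun ν => {x | ∃ j : Fin n, dz (ee j) (cr (χ ν)) x ≠ 0} with hNn
  have hNo : ∀ ν, MeasurableSet (Nn ν) := by
    intro ν
    have : Nn ν = ⋃ j : Fin n, {x | dz (ee j) (cr (χ ν)) x ≠ 0} := by ext x; simp [hNn]
    rw [this]
    exact (isOpen_iUnion fun j => isOpen_ne_fun ((cr_sm (H.hχ ν)).dz (ee j)).continuous continuous_const).measurableSet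
  have mF : AEMeasurable (fun x => ∑ j, ‖f j x‖ₑ ^ 2) :=
    Finset.aemeasurable_fun_sum _ (fun j _ => ((mf j).1.enorm.pow_const _))
  have lim2 : Tendsto (fun ν => ∫⁻ x, (Nn ν).indicator (fun x => ∑ j, ‖f j x‖ₑ ^ 2) x) atTop (𝓝 0) := by
    have : (0:ℝ≥0∞) = ∫⁻ x : Fin n → ℂ, 0 := by simp
    rw [this]
    refine tendsto_lintegral_of_dominated_convergence' (fun x => ∑ j, ‖f j x‖ₑ ^ 2) (fun ν => mF.indicator (hNo ν))
      (fun ν => Eventually.of_forall fun x => indicator_le_self _ _ x) ?_ ?_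
    · rw [lintegral_finsetSum' _ (fun j _ => ((mf j).1.enorm.pow_const _))]
      exact (ENNReal.sum_lt_top.2 fun j _ => l2_lt_top (mf j)).ne
    · refine Eventually.of_forall fun x => ?_
      by_cases hx : x ∈ D
      · refine tendsto_const_nhds.congr' ?_
        filter_upwards [H.hχ1 x hx] with ν hν
        rw [indicator_of_notMem]
        rintro ⟨j, hj⟩
        apply hj
        rw [dz_congr _ (cr_ev hν)]
        simp [dz, cr]
      · refine tendsto_const_nhds.congr' (Eventually.of_forall fun ν => ?_)
        beta_reduce; rw [indicator_of_notMem]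
        rintro ⟨j, hj⟩
        exact hj (dz_supp _ (fun h => hx (H.hχD ν (cr_ts (n := n) ▸ h))))
  have hΦc := H.hΦ.continuousOn
  have hDm := H.hD.measurableSet
  -- per ν bound
  have bd : ∀ ν, ‖∑ j ∈ J, ∫ x, χ ν x * (f j x * (starRingEnd ℂ) (α j x))‖ₑ ^ 2 ≤
      (8 * (∫⁻ x in D, ENNReal.ofReal (a x * Real.exp (Φ x) ^ 2) * ‖∑ j, dz (ee j) (G j) x‖ₑ ^ 2) +
      ENNReal.ofReal (24 * n * C) * ∫⁻ x, (Nn ν).indicator (fun x => ∑ j, ‖f j x‖ₑ ^ 2) x) * Bd := by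
    intro ν
    set F : Fin n → (Fin n → ℂ) → ℝ≥0∞ := fun j x => ENNReal.ofReal (√(b x) * Real.exp (Φ x / 2) * χ ν x) * ‖f j x‖ₑ with hF
    set Q : Fin n → (Fin n → ℂ) → ℝ≥0∞ := fun j x => ENNReal.ofReal (wt Φ x / √(b x)) * ‖dzb (ee j) h x‖ₑ with hQ
    have mFF : ∀ j, AEMeasurable (F j) (volume.restrict D) := fun j =>
      ((((H.hb.sqrt.mul (Real.continuous_exp.comp_continuousOn (hΦc.div_const 2))).mul (H.hχ ν).continuous.continuousOn).aemeasurable hDm).ennreal_ofReal).mul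
        (mf j).1.enorm.restrict
    have mQ : ∀ j, AEMeasurable (Q j) (volume.restrict D) := fun j => by
      refine AEMeasurable.mul ?_ ((hh.dzb (ee j)).continuous.aestronglyMeasurable.enorm.restrict)
      refine (ContinuousOn.aemeasurable ?_ hDm).ennreal_ofReal
      exact ((Real.continuous_exp.comp_continuousOn hΦc.neg)).div H.hb.sqrt (fun x hx => (Real.sqrt_pos.2 (H.b0 x hx)).ne')
    have c1 : ‖∑ j ∈ J, ∫ x, χ ν x * (f j x * (starRingEnd ℂ) (α j x))‖ₑ ≤ ∫⁻ x in D, ∑ j ∈ J, F j x * Q j x := by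
      rw [lintegral_finsetSum' (f := fun j x => F j x * Q j x) _ (fun j _ => (mFF j).mul (mQ j))]
      refine (enorm_sum_le _ _).trans (Finset.sum_le_sum fun j _ => ?_)
      refine (enorm_integral_le_lintegral_enorm _).trans ?_
      rw [← lintegral_indicator hDm]
      refine lintegral_mono fun x => ?_
      by_cases hx : x ∈ D
      · rw [indicator_of_mem hx]
        simp only [hαd, indicator_of_mem hx, hF, hQ]
        have hbs := Real.sqrt_pos.2 (H.b0 x hx)
        have key : ‖(χ ν x : ℂ)‖ₑ * ‖ex Φ (-1/2) x‖ₑ = ENNReal.ofReal (√(b x) * Real.exp (Φ x / 2) * χ ν x) * ENNReal.ofReal (wt Φ x / √(b x)) := by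
          rw [← ENNReal.ofReal_mul (by have := (H.h01 ν x).1; positivity), ← ofReal_norm, ← ofReal_norm, ← ENNReal.ofReal_mul (norm_nonneg _)]
          congr 1
          rw [ex_norm, Complex.norm_real, Real.norm_of_nonneg (H.h01 ν x).1, wt]
          have : Real.exp (-1/2 * Φ x) = Real.exp (Φ x / 2) * Real.exp (-Φ x) := by rw [← Real.exp_add]; ring_nf
          rw [this]; field_simp
        rw [enorm_mul, enorm_mul, map_mul, enorm_mul, ex_conj]
        rw [show ‖(starRingEnd ℂ) (dzb (ee j) h x)‖ₑ = ‖dzb (ee j) h x‖ₑ by rw [← ofReal_norm, ← ofReal_norm]; simp]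
        refine le_of_eq ?_
        calc _ = (‖(χ ν x : ℂ)‖ₑ * ‖ex Φ (-1/2) x‖ₑ) * (‖f j x‖ₑ * ‖dzb (ee j) h x‖ₑ) := by ring
          _ = _ := by rw [key]; ring
      · have : α j x = 0 := by simp only [hαd, indicator_of_notMem hx]
        simp [this]
    have c2 := cs_en (volume.restrict D) J mFF mQ
    have c3 : ∫⁻ x in D, ∑ j ∈ J, F j x ^ 2 = ∫⁻ x in D, ENNReal.ofReal (b x * Real.exp (Φ x) * χ ν x ^ 2) * ∑ j ∈ J, ‖f j x‖ₑ ^ 2 := by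
      refine setLIntegral_congr_fun hDm fun x hx => ?_
      simp only [hF, mul_pow, ← Finset.mul_sum]
      rw [← ENNReal.ofReal_pow (by have := (H.h01 ν x).1; positivity)]
      congr 2
      rw [mul_pow, mul_pow, Real.sq_sqrt (H.b0 x hx).le, ← Real.exp_nat_mul]
      congr 3; push_cast; ring
    have c4 : ∫⁻ x in D, ∑ j ∈ J, Q j x ^ 2 = ∫⁻ x in D, ENNReal.ofReal (wt Φ x ^ 2 / b x) * ∑ j ∈ J, ‖dzb (ee j) h x‖ₑ ^ 2 := by
      refine setLIntegral_congr_fun hDm fun x hx => ?_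
      simp only [hQ, mul_pow, ← Finset.mul_sum]
      rw [← ENNReal.ofReal_pow (show 0 ≤ wt Φ x / √(b x) from div_nonneg (Real.exp_pos _).le (Real.sqrt_nonneg _)), div_pow, Real.sq_sqrt (H.b0 x hx).le]
    calc _ ≤ (∫⁻ x in D, ∑ j ∈ J, F j x * Q j x) ^ 2 := by gcongr
      _ ≤ _ := c2
      _ ≤ _ := by
        rw [c3, c4]
        exact mul_le_mul' (N ν) hB
  refine le_of_tendsto_of_tendsto' ((ENNReal.continuous_pow 2).continuousAt.tendsto.comp ((continuous_enorm.tendsto _).comp lim1)) ?_ bd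
  refine ENNReal.Tendsto.mul_const ?_ (Or.inr hBt)
  have := (tendsto_const_nhds (x := 8 * (∫⁻ x in D, ENNReal.ofReal (a x * Real.exp (Φ x) ^ 2) * ‖∑ j, dz (ee j) (G j) x‖ₑ ^ 2)) (f := atTop (α := ℕ))).add
    (ENNReal.Tendsto.const_mul (a := ENNReal.ofReal (24 * n * C)) lim2 (Or.inr ENNReal.ofReal_ne_top))
  simpa using this
end hor

section hor2
variable {n : ℕ}

lemma cont_supp {c g : (Fin n → ℂ) → ℂ} {U : Set (Fin n → ℂ)} (hU : IsOpen U) (hc : ContinuousOn c U) (hg : Continuous g)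
    (hs : tsupport g ⊆ U) : Continuous (fun x => c x * g x) := by
  rw [continuous_iff_continuousAt]
  intro x
  by_cases hx : x ∈ tsupport g
  · exact (hc.continuousAt (hU.mem_nhds (hs hx))).mul hg.continuousAt
  · have : (fun x => c x * g x) =ᶠ[𝓝 x] fun _ => 0 := by
      filter_upwards [notMem_tsupport_iff_eventuallyEq.1 hx] with y hy
      simp [hy]
    exact continuousAt_const.congr this.symm

def TT (D : Set (Fin n → ℂ)) : Submodule ℂ (Fin n → (Fin n → ℂ) → ℂ) where
  carrier := {G | ∀ j, Sm (G j) ∧ HasCompactSupport (G j) ∧ tsupport (G j) ⊆ D}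
  add_mem' := fun {G H} hG hH j => ⟨(hG j).1.add (hH j).1, (hG j).2.1.add (hH j).2.1,
    (tsupport_add _ _).trans (union_subset (hG j).2.2 (hH j).2.2)⟩
  zero_mem' := fun j => ⟨contDiff_const, by simpa using HasCompactSupport.zero, by simp⟩
  smul_mem' := fun c G hG j => ⟨(contDiff_const (c := c)).mul (hG j).1, (hG j).2.1.mul_left (f := fun _ => c),
    (tsupport_mul_subset_right (f := fun _ => c)).trans (hG j).2.2⟩

lemma hor_solve {D : Set (Fin n → ℂ)} {Ξ Φ a b : (Fin n → ℂ) → ℝ} {J : Finset (Fin n)} {χ : ℕ → (Fin n → ℂ) → ℝ} {C : ℝ}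
    (H : HD D Ξ Φ a b J χ C) {h : (Fin n → ℂ) → ℂ} (hh : Sm h)
    (hα : ∀ j, MemLp (D.indicator (fun x => ex Φ (-1/2) x * dzb (ee j) h x)) 2)
    (hJ : ∀ j, j ∉ J → ∀ x ∈ D, dzb (ee j) h x = 0) {Bd : ℝ≥0∞} (hBt : Bd ≠ ⊤)
    (hB : ∫⁻ x in D, ENNReal.ofReal (wt Φ x ^ 2 / b x) * ∑ j ∈ J, ‖dzb (ee j) h x‖ₑ ^ 2 ≤ Bd) :
    ∃ k : (Fin n → ℂ) → ℂ, MemLp k 2 ∧ ∫⁻ x, ‖k x‖ₑ ^ 2 ≤ 8 * Bd ∧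
      WkHol (fun x => h x + k x * ((√(a x) * Real.exp (Φ x) : ℝ) : ℂ)) D := by
  set w : (Fin n → ℂ) → ℂ := fun x => ((√(a x) * Real.exp (Φ x) : ℝ) : ℂ) with hw
  have hwc : ContinuousOn w D := Complex.continuous_ofReal.comp_continuousOn
    ((Real.continuous_sqrt.comp_continuousOn H.ha).mul (Real.continuous_exp.comp_continuousOn H.hΦ.continuousOn))
  have hdv : ∀ G : TT D, Continuous (fun x => w x * ∑ j, dz (ee j) (G.1 j) x) ∧ HasCompactSupport (fun x => w x * ∑ j, dz (ee j) (G.1 j) x) := by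
    intro G
    have e : (fun x => w x * ∑ j, dz (ee j) (G.1 j) x) = fun x => ∑ j, w x * dz (ee j) (G.1 j) x := by
      ext x; rw [Finset.mul_sum]
    refine ⟨?_, ?_⟩
    · rw [e]
      exact continuous_finsetSum _ fun j _ => cont_supp H.hD hwc ((G.2 j).1.dz _).continuous
        ((tsupport_of_supp fun x hx => dz_supp _ hx).trans (G.2 j).2.2)
    · refine HasCompactSupport.intro (K := ⋃ j, tsupport (G.1 j)) (isCompact_iUnion fun j => (G.2 j).2.1) ?_
      intro x hx
      simp only [mem_iUnion, not_exists] at hx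
      simp [fun j => dz_supp (ee j) (hx j)]
  let A : TT D →ₗ[ℂ] Lp ℂ 2 (volume : Measure (Fin n → ℂ)) :=
    { toFun := fun G => (test_memLp (hdv G).1 (hdv G).2).toLp _
      map_add' := fun G K => by
        rw [← MemLp.toLp_add]
        congr 1; ext x
        simp only [Submodule.coe_add, Pi.add_apply, ← mul_add, ← Finset.sum_add_distrib]
        congr 1; refine Finset.sum_congr rfl fun j _ => ?_
        exact dz_add _ ((G.2 j).1.da _) ((K.2 j).1.da _)
      map_smul' := fun c G => by
        rw [RingHom.id_apply, ← MemLp.toLp_const_smul]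
        congr 1; ext x
        simp only [SetLike.val_smul, Pi.smul_apply, smul_eq_mul, Finset.mul_sum]
        refine Finset.sum_congr rfl fun j _ => ?_
        have : dz (ee j) (c • G.1 j) x = c * dz (ee j) (G.1 j) x := by
          have := dz_mul (f := fun _ => c) (x := x) (ee j) (by fun_prop) ((G.2 j).1.da _)
          simp only [dz, fderiv_const, fderiv_fun_const] at this ⊢
          rw [show (c • G.1 j) = fun y => c * G.1 j y from rfl, this]; simp
        rw [this]; ring }
  let l : TT D →ₗ[ℂ] ℂ :=
    { toFun := fun G => ∑ j, ∫ x, G.1 j x * (starRingEnd ℂ) (dzb (ee j) h x)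
      map_add' := fun G K => by
        rw [← Finset.sum_add_distrib]
        refine Finset.sum_congr rfl fun j _ => ?_
        rw [← integral_add]
        · simp [add_mul]
        · exact int_cs ((G.2 j).1.mul' (hh.dzb _).conj).continuous ((G.2 j).2.1.mul_right)
        · exact int_cs ((K.2 j).1.mul' (hh.dzb _).conj).continuous ((K.2 j).2.1.mul_right)
      map_smul' := fun c G => by
        rw [RingHom.id_apply, smul_eq_mul, Finset.mul_sum]
        refine Finset.sum_congr rfl fun j _ => ?_
        rw [← integral_const_mul]; simp [mul_assoc] }
  have hA : ∀ G : TT D, ‖A G‖ₑ ^ 2 = ∫⁻ x in D, ENNReal.ofReal (a x * Real.exp (Φ x) ^ 2) * ‖∑ j, dz (ee j) (G.1 j) x‖ₑ ^ 2 := by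
    intro G
    rw [show ‖A G‖ₑ = ‖(test_memLp (hdv G).1 (hdv G).2).toLp _‖ₑ from rfl, Lp.enorm_toLp, eLpNorm_eq_lintegral_rpow_enorm_toReal (by simp) (by simp), ← ENNReal.rpow_natCast, ← ENNReal.rpow_mul]
    norm_num
    rw [← setLIntegral_eq_of_support_subset (s := D)]
    · refine setLIntegral_congr_fun H.hD.measurableSet fun x hx => ?_
      simp only [enorm_mul, mul_pow]
      congr 1
      rw [esq_ofReal, hw, Complex.norm_real, Real.norm_eq_abs, sq_abs, mul_pow, Real.sq_sqrt (H.a0 x hx).le]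
    · intro x hx
      by_contra hx'
      apply hx
      simp only []
      rw [Finset.sum_eq_zero (fun j _ => dz_supp (ee j) fun h => hx' ((G.2 j).2.2 h))]; simp
  have hb : ∀ G, ‖l G‖ ≤ √(8 * Bd.toReal) * ‖A G‖ := by
    intro G
    have := hor_bound H hh hα hJ hBt hB (fun j => (G.2 j).1) (fun j => (G.2 j).2.1) (fun j => (G.2 j).2.2)
    rw [← hA] at this
    have h2 : ‖l G‖ ^ 2 ≤ (√(8 * Bd.toReal) * ‖A G‖) ^ 2 := by
      have h3 := ENNReal.toReal_mono (by finiteness) this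
      simp only [ENNReal.toReal_mul, ENNReal.toReal_pow, toReal_enorm] at h3
      rw [mul_pow, Real.sq_sqrt (by positivity)]
      simp at h3
      calc _ ≤ _ := h3
        _ = _ := by ring
    exact le_of_sq_le_sq h2 (by positivity)
  obtain ⟨k, hk1, hk2⟩ := riesz_abs l A (Real.sqrt_nonneg _) hb
  have hkm : MemLp k 2 := Lp.memLp k
  refine ⟨k, hkm, ?_, ?_⟩
  · have h1 : ‖k‖ ^ 2 ≤ 8 * Bd.toReal := by
      rw [← Real.sq_sqrt (show 0 ≤ 8 * Bd.toReal by positivity)]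
      gcongr
    have h2 : ∫⁻ x, ‖k x‖ₑ ^ 2 = ‖k‖ₑ ^ 2 := by
      rw [Lp.enorm_def, eLpNorm_eq_lintegral_rpow_enorm_toReal (by simp) (by simp), ← ENNReal.rpow_natCast, ← ENNReal.rpow_mul]
      norm_num
    rw [h2, ← ofReal_norm, ← ENNReal.ofReal_pow (norm_nonneg _)]
    calc _ ≤ ENNReal.ofReal (8 * Bd.toReal) := ENNReal.ofReal_le_ofReal h1
      _ = _ := by rw [ENNReal.ofReal_mul (by norm_num), ENNReal.ofReal_toReal hBt]; norm_num
  · intro j ψ hψ hψc hψD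
    set G : TT D := ⟨fun i => if i = j then (fun x => (starRingEnd ℂ) (ψ x)) else 0, fun i => by
      by_cases hi : i = j
      · simp only [hi, if_true]; exact ⟨hψ.conj, conj_cs hψc, conj_ts.trans hψD⟩
      · simp only [hi, if_false]; exact (0 : TT D).2 i⟩ with hG
    have e := hk2 G
    have el : l G = ∫ x, (starRingEnd ℂ) (ψ x) * (starRingEnd ℂ) (dzb (ee j) h x) := by
      change ∑ i, ∫ x, (if i = j then (fun x => (starRingEnd ℂ) (ψ x)) else 0 : (Fin n → ℂ) → ℂ) x * _ = _
      rw [Finset.sum_eq_single j]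
      · simp
      · intro i _ hi; simp [hi]
      · simp
    have eA : inner ℂ k (A G) = ∫ x, (w x * (starRingEnd ℂ) (dzb (ee j) ψ x)) * (starRingEnd ℂ) (k x) := by
      have := inner_lp hkm (test_memLp (hdv G).1 (hdv G).2)
      rw [Lp.toLp_coeFn] at this
      refine this.trans ?_
      congr 1; ext x
      congr 2
      change ∑ i, dz (ee i) (if i = j then (fun x => (starRingEnd ℂ) (ψ x)) else 0 : (Fin n → ℂ) → ℂ) x = _
      rw [Finset.sum_eq_single j]
      · simp only [if_true]; exact dz_conj _ (hψ.da _)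
      · intro i _ hi; simp only [hi, if_false]; simp [dz]
      · simp
    rw [el, eA] at e
    have e2 := congrArg (starRingEnd ℂ) e
    rw [← integral_conj, ← integral_conj] at e2
    simp only [map_mul, Complex.conj_conj] at e2
    have hwr : ∀ x, (starRingEnd ℂ) (w x) = w x := fun x => Complex.conj_ofReal _
    simp only [hwr] at e2
    have i1 := ibp_dzb (μ := volume) hh hψ hψc (ee j)
    have i2 : Integrable (fun x => k x * (w x * dzb (ee j) ψ x)) := int_mul_cs hkm
      (cont_supp H.hD hwc (hψ.dzb _).continuous ((tsupport_of_supp fun x hx => dzb_supp _ hx).trans hψD)) (hcs_dzb hψc _).mul_left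
    have i3 : Integrable (fun x => h x * dzb (ee j) ψ x) := int_cs (hh.mul' (hψ.dzb _)).continuous (hcs_dzb hψc _).mul_left
    calc _ = ∫ x, (h x * dzb (ee j) ψ x + k x * (w x * dzb (ee j) ψ x)) := by congr 1; ext x; ring
      _ = _ := by
        rw [integral_add i3 i2, i1]
        rw [show (fun x => k x * (w x * dzb (ee j) ψ x)) = fun x => w x * dzb (ee j) ψ x * k x from by ext x; ring, ← e2]
        simp only [mul_comm (ψ _)]; ring
end hor2

section wk
variable {n : ℕ}

lemma weak_lim {H : Type*} [NormedAddCommGroup H] [InnerProductSpace ℂ H] [CompleteSpace H] (x : ℕ → H) {C : ℝ}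
    (hx : ∀ k, ‖x k‖ ≤ C) (𝒰 : Ultrafilter ℕ) : ∃ y : H, ∀ g, Tendsto (fun k => inner ℂ (x k) g) 𝒰 (𝓝 (inner ℂ y g)) := by
  let T := fun k => StrongDual.toWeakDual (InnerProductSpace.toDual ℂ H (x k))
  have hc := WeakDual.isCompact_closedBall (𝕜 := ℂ) (E := H) 0 C
  obtain ⟨φ, -, hφ⟩ := hc.ultrafilter_le_nhds (𝒰.map T) (by
    rw [le_principal_iff]
    exact Filter.mem_map.2 (Filter.mem_of_superset univ_mem fun k _ => by simpa [T] using hx k))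
  refine ⟨(InnerProductSpace.toDual ℂ H).symm (WeakDual.toStrongDual φ), fun g => ?_⟩
  rw [InnerProductSpace.toDual_symm_apply]
  have := (WeakDual.eval_continuous (𝕜 := ℂ) (E := H) g).tendsto φ
  exact this.comp (show Tendsto T 𝒰 (𝓝 φ) from hφ)

lemma weak_holo {F : ℕ → (Fin n → ℂ) → ℂ} {U : ℕ → Set (Fin n → ℂ)} {D : Set (Fin n → ℂ)} {C : ℝ≥0∞} (hC : C ≠ ⊤)
    (hF : ∀ k, MemLp (F k) 2) (hB : ∀ k, ∫⁻ x, ‖F k x‖ₑ ^ 2 ≤ C) (hw : ∀ k, WkHol (F k) (U k)) (hD : IsOpen D)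
    (hU : ∀ K ⊆ D, IsCompact K → ∀ᶠ k in atTop, K ⊆ U k) (𝒰 : Ultrafilter ℕ) (h𝒰 : (𝒰 : Filter ℕ) ≤ atTop) :
    ∃ G : (Fin n → ℂ) → ℂ, G ∈ L2h D ∧ ∀ ε p, 0 < ε → closedBall p (2 * ε) ⊆ D →
      Tendsto (fun k => moll ε (F k) p) 𝒰 (𝓝 (G p)) := by
  have hn : ∀ k, ‖(hF k).toLp (F k)‖ ≤ √C.toReal := by
    intro k
    refine Real.le_sqrt_of_sq_le ?_
    have h2 : ∫⁻ x, ‖F k x‖ₑ ^ 2 = ‖(hF k).toLp (F k)‖ₑ ^ 2 := by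
      rw [Lp.enorm_toLp, eLpNorm_eq_lintegral_rpow_enorm_toReal (by simp) (by simp), ← ENNReal.rpow_natCast, ← ENNReal.rpow_mul]
      norm_num
    have := ENNReal.toReal_mono hC (hB k)
    rw [h2] at this
    simpa using this
  obtain ⟨y, hy⟩ := weak_lim _ hn 𝒰
  have hym : MemLp y 2 := Lp.memLp y
  have hy' : ∀ c : (Fin n → ℂ) → ℂ, Continuous c → HasCompactSupport c →
      Tendsto (fun k => ∫ x, F k x * c x) 𝒰 (𝓝 (∫ x, y x * c x)) := by
    intro c hc hs
    have key : ∀ f : (Fin n → ℂ) → ℂ, ∀ hf : MemLp f 2, ∫ x, f x * c x =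
        (starRingEnd ℂ) (inner ℂ (hf.toLp f) ((test_memLp hc.star (conj_cs hs)).toLp _)) := by
      intro f hf
      rw [inner_lp, ← integral_conj]
      congr 1; ext x; simp [mul_comm]
    have h1 := key y hym
    rw [Lp.toLp_coeFn] at h1
    rw [h1]
    simp only [fun k => key (F k) (hF k)]
    exact (Complex.continuous_conj.tendsto _).comp (hy _)
  have hwk : WkHol y D := by
    intro j ψ hψ hc hs
    refine tendsto_nhds_unique (hy' _ (hψ.dzb _).continuous (hcs_dzb hc _)) ?_
    refine tendsto_const_nhds.congr' ?_
    filter_upwards [h𝒰 (hU _ hs hc)] with k hk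
    exact (hw k j ψ hψ hc hk).symm
  obtain ⟨G, h1, h2, h3⟩ := weyl hD hym hwk
  refine ⟨G, ⟨h1, ?_⟩, fun ε p hε hp => ?_⟩
  · calc ∫⁻ z in D, (‖G z‖₊ : ℝ≥0∞) ^ 2 = ∫⁻ z in D, ‖y z‖ₑ ^ 2 := by
          refine setLIntegral_congr_fun_ae hD.measurableSet ?_
          filter_upwards [h2] with x hx hxD
          rw [hx hxD]; rfl
      _ ≤ ∫⁻ z, ‖y z‖ₑ ^ 2 := setLIntegral_le_lintegral _ _
      _ < ⊤ := l2_lt_top hym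
  · rw [h3 ε p hε hp]
    exact hy' _ ((sm_refl (cr_sm (mk_sm ε)) p).continuous) (cs_refl (crmk_cs hε) p)
end wk

section jets
variable {n : ℕ}

lemma cda_dz {g : (Fin n → ℂ) → ℂ} {x} (hg : ContDiffAt ℝ (⊤ : ℕ∞) g x) (v) : DifferentiableAt ℝ (dz v g) x := by
  have h : DifferentiableAt ℝ (fderiv ℝ g) x := (hg.fderiv_right (m := (⊤ : ℕ∞)) (by simp)).differentiableAt (by simp)
  unfold dz
  fun_prop

lemma cda_ev {f : (Fin n → ℂ) → ℝ} {x} (hg : ContDiffAt ℝ (⊤ : ℕ∞) f x) : ∀ᶠ y in 𝓝 x, DifferentiableAt ℝ f y := by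
  filter_upwards [(hg.of_le (m := 1) (by exact_mod_cast le_top)).eventually (by simp)] with y hy
  exact hy.differentiableAt (by simp)

lemma cda_cr {f : (Fin n → ℂ) → ℝ} {x} (hf : ContDiffAt ℝ (⊤ : ℕ∞) f x) : ContDiffAt ℝ (⊤ : ℕ∞) (cr f) x :=
  Complex.ofRealCLM.contDiff.contDiffAt.comp x hf

structure J2 (f : (Fin n → ℂ) → ℝ) (x ξ : Fin n → ℂ) (d : ℂ) (q : ℝ) : Prop where
  sm : ContDiffAt ℝ (⊤ : ℕ∞) f x
  hd : ∑ j, ξ j * dz (ee j) (cr f) x = d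
  hq : (Lv f x ξ).re = q

lemma J2.add {f g : (Fin n → ℂ) → ℝ} {x ξ d q d' q'} (h : J2 f x ξ d q) (h' : J2 g x ξ d' q') :
    J2 (fun y => f y + g y) x ξ (d + d') (q + q') := by
  have e : ∀ j, ∀ᶠ y in 𝓝 x, dz (ee j) (cr fun y => f y + g y) y = dz (ee j) (cr f) y + dz (ee j) (cr g) y := by
    intro j
    filter_upwards [cda_ev h.sm, cda_ev h'.sm] with y h1 h2
    rw [← dz_add _ (cr_da h1) (cr_da h2)]; congr 1; ext; simp [cr]
  refine ⟨h.sm.add h'.sm, ?_, ?_⟩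
  · rw [← h.hd, ← h'.hd, ← Finset.sum_add_distrib]
    refine Finset.sum_congr rfl fun j _ => ?_
    rw [(e j).self_of_nhds, mul_add]
  · rw [← h.hq, ← h'.hq, ← Complex.add_re]
    congr 1
    unfold Lv
    simp only [← Finset.sum_add_distrib]
    refine Finset.sum_congr rfl fun j _ => Finset.sum_congr rfl fun k _ => ?_
    rw [dzb_congr _ (e j), dzb_add _ (cda_dz (cda_cr h.sm) _) (cda_dz (cda_cr h'.sm) _)]
    ring

lemma J2.comp {f : (Fin n → ℂ) → ℝ} {x ξ d q} (h : J2 f x ξ d q) {g g1 : ℝ → ℝ} {g2 : ℝ} (hg : ContDiffAt ℝ (⊤ : ℕ∞) g (f x))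
    (h1 : ∀ᶠ t in 𝓝 (f x), HasDerivAt g (g1 t) t) (h2 : HasDerivAt g1 g2 (f x)) :
    J2 (fun y => g (f y)) x ξ (g1 (f x) * d) (g1 (f x) * q + g2 * ‖d‖ ^ 2) := by
  have hfd := h.sm.differentiableAt (by simp)
  have e : ∀ j, ∀ᶠ y in 𝓝 x, dz (ee j) (cr fun y => g (f y)) y = cr (fun y => g1 (f y)) y * dz (ee j) (cr f) y := by
    intro j
    filter_upwards [cda_ev h.sm, h.sm.continuousAt.eventually h1] with y hy1 hy2
    exact dz_comp _ hy1 hy2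
  refine ⟨hg.comp x h.sm, ?_, ?_⟩
  · rw [← h.hd, Finset.mul_sum]
    refine Finset.sum_congr rfl fun j _ => ?_
    rw [(e j).self_of_nhds]; simp only [cr]; ring
  · have : Lv (fun y => g (f y)) x ξ = g1 (f x) * Lv f x ξ + g2 * (d * (starRingEnd ℂ) d) := by
      have e2 : d * (starRingEnd ℂ) d = ∑ j, ∑ k, (ξ j * dz (ee j) (cr f) x) * ((starRingEnd ℂ) (ξ k) * dzb (ee k) (cr f) x) := by
        rw [← h.hd, map_sum, Finset.sum_mul_sum]
        simp only [map_mul, conj_dz_cr _ hfd]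
      rw [e2]
      unfold Lv
      simp only [Finset.mul_sum, ← Finset.sum_add_distrib]
      refine Finset.sum_congr rfl fun j _ => Finset.sum_congr rfl fun k _ => ?_
      have dd : DifferentiableAt ℝ (fun y => g1 (f y)) x := h2.differentiableAt.comp x hfd
      rw [dzb_congr _ (e j), dzb_mul _ (cr_da dd) (cda_dz (cda_cr h.sm) _), dzb_comp _ hfd h2]
      simp only [cr]; ring
    rw [this, Complex.mul_conj, Complex.normSq_eq_norm_sq, Complex.add_re, Complex.re_ofReal_mul, Complex.re_ofReal_mul, Complex.ofReal_re, h.hq]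

lemma J2.mul {f : (Fin n → ℂ) → ℝ} {x ξ d q} (h : J2 f x ξ d q) (c : ℝ) : J2 (fun y => c * f y) x ξ (c * d) (c * q) := by
  have := h.comp (g := fun t => c * t) (g1 := fun _ => c) (g2 := 0) (by fun_prop)
    (Eventually.of_forall fun t => by simpa using (hasDerivAt_id t).const_mul c) (hasDerivAt_const _ _)
  simpa using this

lemma J2.cadd {f : (Fin n → ℂ) → ℝ} {x ξ d q} (h : J2 f x ξ d q) (c : ℝ) : J2 (fun y => f y + c) x ξ d q := by
  have := h.comp (g := fun t => t + c) (g1 := fun _ => 1) (g2 := 0) (by fun_prop)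
    (Eventually.of_forall fun t => (hasDerivAt_id t).add_const c) (hasDerivAt_const _ _)
  simpa using this

lemma J2.log {f : (Fin n → ℂ) → ℝ} {x ξ d q} (h : J2 f x ξ d q) (h0 : 0 < f x) :
    J2 (fun y => Real.log (f y)) x ξ ((f x)⁻¹ * d : ℂ) ((f x)⁻¹ * q - ((f x) ^ 2)⁻¹ * ‖d‖ ^ 2) := by
  have := h.comp (g := Real.log) (g1 := fun t => t⁻¹) (g2 := -((f x) ^ 2)⁻¹) (Real.contDiffAt_log.2 h0.ne')
    (by filter_upwards [lt_mem_nhds h0] with t ht using Real.hasDerivAt_log ht.ne') (hasDerivAt_inv h0.ne')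
  simpa [sub_eq_add_neg] using this

lemma J2.invsq {f : (Fin n → ℂ) → ℝ} {x ξ d q} (h : J2 f x ξ d q) (h0 : 0 < f x) :
    J2 (fun y => ((f y) ^ 2)⁻¹) x ξ (-2 / (f x) ^ 3 * d : ℂ) (-2 / (f x) ^ 3 * q + 6 / (f x) ^ 4 * ‖d‖ ^ 2) := by
  have := h.comp (g := fun t => (t ^ 2)⁻¹) (g1 := fun t => -2 / t ^ 3) (g2 := 6 / (f x) ^ 4)
    ((contDiffAt_id.pow 2).inv (by positivity))
    (by
      filter_upwards [lt_mem_nhds h0] with t ht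
      have := (hasDerivAt_pow 2 t).inv (by positivity)
      refine this.congr_deriv ?_
      push_cast; field_simp)
    (by
      have := ((hasDerivAt_pow 3 (f x)).inv (by positivity)).const_mul (-2 : ℝ)
      refine (this.congr_deriv ?_).congr_of_eventuallyEq (Eventually.of_forall fun t => div_eq_mul_inv _ _)
      push_cast; field_simp; norm_num)
  simpa using this

lemma J2.of_sm {f : (Fin n → ℂ) → ℝ} (hf : ContDiff ℝ (⊤ : ℕ∞) f) (x ξ) : J2 f x ξ (∑ j, ξ j * dz (ee j) (cr f) x) (Lv f x ξ).re :=
  ⟨hf.contDiffAt, rfl, rfl⟩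

noncomputable def sw (J : Finset (Fin n)) (x : Fin n → ℂ) : ℝ := ∑ i ∈ J, ‖x i‖ ^ 2

lemma sw_sm (J : Finset (Fin n)) : ContDiff ℝ (⊤ : ℕ∞) (sw J) :=
  ContDiff.sum fun i _ => (contDiff_apply ℝ ℂ i).norm_sq ℂ

lemma cr_sw (J : Finset (Fin n)) : cr (sw J) = fun x => ∑ i ∈ J, x i * (starRingEnd ℂ) (x i) := by
  ext x; simp [cr, sw, Complex.mul_conj, Complex.normSq_eq_norm_sq]

lemma fd_sw (J : Finset (Fin n)) (x v : Fin n → ℂ) : fderiv ℝ (cr (sw J)) x v = ∑ i ∈ J, (v i * (starRingEnd ℂ) (x i) + x i * (starRingEnd ℂ) (v i)) := by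
  have : HasFDerivAt (cr (sw J)) (∑ i ∈ J, ((x i) • (Complex.conjCLE.toContinuousLinearMap.comp (ContinuousLinearMap.proj (R := ℝ) (φ := fun _ : Fin n => ℂ) i)) +
      ((starRingEnd ℂ) (x i)) • (ContinuousLinearMap.proj (R := ℝ) (φ := fun _ : Fin n => ℂ) i))) x := by
    rw [cr_sw]
    refine HasFDerivAt.fun_sum fun i _ => ?_
    have h1 : HasFDerivAt (fun y : Fin n → ℂ => y i) (ContinuousLinearMap.proj (R := ℝ) (φ := fun _ : Fin n => ℂ) i) x := hasFDerivAt_apply i x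
    exact h1.mul (Complex.conjCLE.toContinuousLinearMap.hasFDerivAt.comp x h1)
  rw [this.fderiv]
  simp [mul_comm, add_comm]

lemma dz_sw (J : Finset (Fin n)) (x) (j : Fin n) : dz (ee j) (cr (sw J)) x = if j ∈ J then (starRingEnd ℂ) (x j) else 0 := by
  have : ∀ i : Fin n, Complex.I * (Complex.I * ee j i * (starRingEnd ℂ) (x i) + x i * (starRingEnd ℂ) (Complex.I * ee j i)) =
    - (ee j i * (starRingEnd ℂ) (x i)) + x i * (starRingEnd ℂ) (ee j i) := fun i => by
      simp only [map_mul, Complex.conj_I]; linear_combination (ee j i * (starRingEnd ℂ) (x i) - x i * (starRingEnd ℂ) (ee j i)) * Complex.I_mul_I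
  rw [dz, fd_sw, fd_sw, Finset.mul_sum]
  simp only [Pi.smul_apply, smul_eq_mul, this, ← Finset.sum_sub_distrib]
  rw [Finset.mul_sum, Finset.sum_congr rfl (g := fun i => if i = j then (starRingEnd ℂ) (x j) else 0), Finset.sum_ite_eq']
  intro i _
  by_cases h : i = j
  · subst h; simp [ee]; ring
  · simp [ee, h]

lemma dzb_sw (J : Finset (Fin n)) (x) (j : Fin n) : dzb (ee j) (cr (sw J)) x = if j ∈ J then x j else 0 := by
  rw [← conj_dz_cr _ ((sw_sm J).contDiffAt.differentiableAt (by simp)), dz_sw]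
  split_ifs <;> simp

lemma J2_sw (J : Finset (Fin n)) (x ξ) : J2 (sw J) x ξ (∑ j ∈ J, ξ j * (starRingEnd ℂ) (x j)) (sw J ξ) := by
  refine ⟨(sw_sm J).contDiffAt, ?_, ?_⟩
  · simp only [dz_sw, mul_ite, mul_zero]
    rw [Finset.sum_ite_mem, Finset.univ_inter]
  · have : ∀ j k : Fin n, dzb (ee k) (dz (ee j) (cr (sw J))) x = if j = k ∧ j ∈ J then 1 else 0 := by
      intro j k
      rw [show dz (ee j) (cr (sw J)) = fun x => if j ∈ J then (starRingEnd ℂ) (x j) else 0 from funext fun x => dz_sw J x j]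
      by_cases hj : j ∈ J
      · simp only [hj, if_true, and_true]
        have h1 : HasFDerivAt (𝕜 := ℝ) (fun y : Fin n → ℂ => y j) (ContinuousLinearMap.proj (R := ℝ) (φ := fun _ : Fin n => ℂ) j) x := hasFDerivAt_apply j x
        rw [dzb_conj _ h1.differentiableAt, dz, h1.fderiv]
        simp only [ContinuousLinearMap.proj_apply, Pi.smul_apply, smul_eq_mul, ← mul_assoc, Complex.I_mul_I, ee, Pi.single_apply]
        split_ifs <;> simp [map_ofNat] <;> norm_num
      · simp [hj, dzb]
    unfold Lv
    simp only [this, ite_mul, zero_mul, one_mul, ite_and]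
    rw [Finset.sum_congr rfl (g := fun j => if j ∈ J then ((‖ξ j‖ ^ 2 : ℝ) : ℂ) else 0)]
    · rw [Finset.sum_ite_mem, Finset.univ_inter, ← Complex.ofReal_sum, Complex.ofReal_re, sw]
    · intro j _
      rw [Finset.sum_ite_eq]
      simp [Complex.mul_conj, Complex.normSq_eq_norm_sq]
end jets

section wts
variable {n : ℕ}

lemma alg_w (S dΨ Y : ℂ) {η lam qφ qκ qη bw : ℝ} (hη : 1 ≤ η) (hl : 0 < lam) (hφ : 0 ≤ qφ)
    (hκ : 2 * (η + lam) * ‖dΨ‖ ^ 2 ≤ qκ) (hY : bw + ‖Y‖ ^ 2 / lam ≤ -qη) :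
    ‖S - (dΨ - ((η⁻¹ : ℝ) : ℂ) * Y)‖ ^ 2 * η + bw ≤ 2 * (η + lam) * ‖S‖ ^ 2 + (qφ + qκ - (η⁻¹ * qη - (η ^ 2)⁻¹ * ‖Y‖ ^ 2)) * η := by
  have h0 : 0 < η := by linarith
  have h1 : ‖S - (dΨ - ((η⁻¹ : ℝ) : ℂ) * Y)‖ ≤ ‖S - dΨ‖ + η⁻¹ * ‖Y‖ := by
    have : S - (dΨ - ((η⁻¹ : ℝ) : ℂ) * Y) = (S - dΨ) + ((η⁻¹ : ℝ) : ℂ) * Y := by ring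
    rw [this]
    refine (norm_add_le _ _).trans_eq ?_
    rw [norm_mul, Complex.norm_real, Real.norm_of_nonneg (by positivity)]
  have h2 : ‖S - dΨ‖ ^ 2 ≤ 2 * ‖S‖ ^ 2 + 2 * ‖dΨ‖ ^ 2 := by
    have := norm_sub_le S dΨ
    nlinarith [sq_nonneg (‖S‖ - ‖dΨ‖), norm_nonneg (S - dΨ), norm_nonneg S, norm_nonneg dΨ]
  set X := ‖S - dΨ‖
  set y := ‖Y‖
  have h3 : ‖S - (dΨ - ((η⁻¹ : ℝ) : ℂ) * Y)‖ ^ 2 * η ≤ (X + η⁻¹ * y) ^ 2 * η := by gcongr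
  have h4 : (X + η⁻¹ * y) ^ 2 * η = η * X ^ 2 + 2 * X * y + y ^ 2 / η := by field_simp; ring
  have h5 : 2 * X * y ≤ lam * X ^ 2 + y ^ 2 / lam := by
    have : lam * X ^ 2 + y ^ 2 / lam - 2 * X * y = (lam * X - y) ^ 2 / lam := by field_simp; ring
    have : 0 ≤ (lam * X - y) ^ 2 / lam := by positivity
    linarith
  have h6 : (qφ + qκ - (η⁻¹ * qη - (η ^ 2)⁻¹ * y ^ 2)) * η = η * qφ + η * qκ - qη + y ^ 2 / η := by field_simp; ring
  have h7 : 0 ≤ η * qφ := by positivity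
  have h8 : qκ ≤ η * qκ := by
    have : 0 ≤ qκ := le_trans (by positivity) hκ
    nlinarith
  have h9 : (η + lam) * X ^ 2 ≤ (η + lam) * (2 * ‖S‖ ^ 2 + 2 * ‖dΨ‖ ^ 2) := by gcongr
  rw [h6]
  nlinarith

variable (J : Finset (Fin n)) (m : ℕ) (T ε σ τ B : ℝ) (ρ : (Fin n → ℂ) → ℝ)
noncomputable def wT (x : Fin n → ℂ) : ℝ := T - Real.log (sw J x + ε ^ 2)
noncomputable def wE (x : Fin n → ℂ) : ℝ := wT J T ε x + Real.log (wT J T ε x)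
noncomputable def wP (x : Fin n → ℂ) : ℝ := m * Real.log (sw J x + σ ^ 2)
noncomputable def wK (x : Fin n → ℂ) : ℝ := (B * τ) * ((ρ x) ^ 2)⁻¹
noncomputable def wS (x : Fin n → ℂ) : ℝ := 2 * (Real.log (ρ x + τ) - Real.log (ρ x))
noncomputable def wX (x : Fin n → ℂ) : ℝ := wP J m σ x + wK τ B ρ x - Real.log (wE J T ε x)
noncomputable def wF (x : Fin n → ℂ) : ℝ := wP J m σ x + wK τ B ρ x - wS τ ρ x
noncomputable def wL (x : Fin n → ℂ) : ℝ := wE J T ε x + (1 + wT J T ε x) ^ 2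
noncomputable def wa (x : Fin n → ℂ) : ℝ := 2 * wL J T ε x * Real.exp (-(wP J m σ x + wK τ B ρ x))
noncomputable def wb (x : Fin n → ℂ) : ℝ := ε ^ 2 / (sw J x + ε ^ 2) ^ 2 * Real.exp (-(wP J m σ x + wK τ B ρ x))

lemma sw_nonneg (x : Fin n → ℂ) : 0 ≤ sw J x := Finset.sum_nonneg fun _ _ => by positivity

lemma sw_cs (x ξ : Fin n → ℂ) : ‖∑ j ∈ J, ξ j * (starRingEnd ℂ) (x j)‖ ^ 2 ≤ sw J x * sw J ξ := by
  calc _ ≤ (∑ j ∈ J, ‖ξ j‖ * ‖x j‖) ^ 2 := by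
        gcongr
        refine (norm_sum_le _ _).trans_eq ?_
        simp
    _ ≤ _ := by
        rw [mul_comm]
        exact Finset.sum_mul_sq_le_sq_mul_sq _ _ _

variable {J m T ε σ τ B ρ}

lemma J2.sub {f g : (Fin n → ℂ) → ℝ} {x ξ d q d' q'} (h : J2 f x ξ d q) (h' : J2 g x ξ d' q') :
    J2 (fun y => f y - g y) x ξ (d - d') (q - q') := by
  have := h.add (h'.mul (-1))
  simpa [sub_eq_add_neg] using this

lemma wE_ge {x} (h : 1 ≤ wT J T ε x) : 1 ≤ wE J T ε x := by
  have := Real.log_nonneg h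
  unfold wE; linarith

lemma log_quad {s e w dd : ℝ} (hs : 0 ≤ s) (he : 0 < e) (hw : 0 ≤ w) (hd : dd ≤ s * w) :
    e / (s + e) ^ 2 * w ≤ (s + e)⁻¹ * w - ((s + e) ^ 2)⁻¹ * dd := by
  have : (s + e)⁻¹ * w - ((s + e) ^ 2)⁻¹ * dd - e / (s + e) ^ 2 * w = (s * w - dd) / (s + e) ^ 2 := by field_simp; ring
  have : 0 ≤ (s * w - dd) / (s + e) ^ 2 := div_nonneg (by linarith) (by positivity)
  linarith

lemma hyp_w (hε : 0 < ε) (hσ : 0 < σ) (hτ : 0 < τ) (hB : 0 < B) {x : Fin n → ℂ} (hT : 1 ≤ wT J T ε x) (hρ : ContDiff ℝ (⊤ : ℕ∞) ρ)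
    (h0 : 0 < ρ x) {γ M : ℝ} (hγ : ∀ ξ, γ * ∑ j, ‖ξ j‖ ^ 2 ≤ -(Lv ρ x ξ).re)
    (hM : ∀ ξ : Fin n → ℂ, ‖∑ j, ξ j * dz (ee j) (cr ρ) x‖ ^ 2 ≤ M * ∑ j, ‖ξ j‖ ^ 2)
    (hBM : 4 * wL J T ε x * M ≤ B * γ) : Hyp (wX J m T ε σ τ B ρ) (wF J m σ τ B ρ) (wa J m T ε σ τ B ρ) (wb J m ε σ τ B ρ) J x := by
  intro ξ S
  have hs := sw_nonneg J x
  have hw := sw_nonneg J ξ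
  have hε2 : 0 < ε ^ 2 := by positivity
  have hσ2 : 0 < σ ^ 2 := by positivity
  have hcs := sw_cs J x ξ
  have js := J2_sw J x ξ
  have jt := ((js.cadd (ε ^ 2)).log (by positivity)).mul (-1) |>.cadd T
  have hte : (fun y => -1 * Real.log (sw J y + ε ^ 2) + T) = wT J T ε := by ext y; unfold wT; ring
  have jt' := jt
  rw [hte] at jt'
  have hT0 : 0 < wT J T ε x := by linarith
  have jE : J2 (wE J T ε) x ξ _ _ := jt'.add (jt'.log hT0)
  have hE := wE_ge hT
  have jlE := jE.log (by linarith)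
  have jP : J2 (wP J m σ) x ξ _ _ := ((js.cadd (σ ^ 2)).log (by positivity)).mul m
  have jr := J2.of_sm hρ x ξ
  have jK : J2 (wK τ B ρ) x ξ _ _ := (jr.invsq h0).mul (B * τ)
  have jS : J2 (wS τ ρ) x ξ _ _ := (((jr.cadd τ).log (by positivity)).sub (jr.log h0)).mul 2
  have jX : J2 (wX J m T ε σ τ B ρ) x ξ _ _ := (jP.add jK).sub jlE
  have jF : J2 (wF J m σ τ B ρ) x ξ _ _ := (jP.add jK).sub jS
  have e1 : ∑ j, ξ j * (dz (ee j) (cr (wX J m T ε σ τ B ρ)) x - dz (ee j) (cr (wF J m σ τ B ρ)) x) =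
    ∑ j, ξ j * dz (ee j) (cr (wX J m T ε σ τ B ρ)) x - ∑ j, ξ j * dz (ee j) (cr (wF J m σ τ B ρ)) x := by
    rw [← Finset.sum_sub_distrib]; simp only [mul_sub]
  rw [e1, jX.hd, jF.hd, jX.hq]
  set ds := ∑ j ∈ J, ξ j * (starRingEnd ℂ) (x j)
  set dr := ∑ j, ξ j * dz (ee j) (cr ρ) x with hdr
  set s := sw J x
  set w := sw J ξ with hwd
  set t := wT J T ε x with ht
  set η := wE J T ε x with hη
  have hwt : wt (wX J m T ε σ τ B ρ) x = η * Real.exp (-(wP J m σ x + wK τ B ρ x)) := by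
    simp only [wt, wX]
    rw [← hη, show -(wP J m σ x + wK τ B ρ x - Real.log η) = Real.log η + -(wP J m σ x + wK τ B ρ x) by ring, Real.exp_add, Real.exp_log (by linarith)]
  rw [hwt]
  set e := Real.exp (-(wP J m σ x + wK τ B ρ x)) with he
  have he0 : 0 < e := Real.exp_pos _
  set dt : ℂ := ((-1 : ℝ) : ℂ) * ((((s + ε ^ 2)⁻¹ : ℝ) : ℂ) * ds) with hdt
  set qt : ℝ := -1 * ((s + ε ^ 2)⁻¹ * w - ((s + ε ^ 2) ^ 2)⁻¹ * ‖ds‖ ^ 2) with hqt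
  set dΨ : ℂ := ((2 : ℝ) : ℂ) * ((((ρ x + τ)⁻¹ : ℝ) : ℂ) * dr - (((ρ x)⁻¹ : ℝ) : ℂ) * dr) with hdΨ
  set Y : ℂ := dt + ((t⁻¹ : ℝ) : ℂ) * dt with hY
  set qη := qt + (t⁻¹ * qt - (t ^ 2)⁻¹ * ‖dt‖ ^ 2) with hqη
  set qφ := (m : ℝ) * ((s + σ ^ 2)⁻¹ * w - ((s + σ ^ 2) ^ 2)⁻¹ * ‖ds‖ ^ 2) with hqφ
  set qr := (Lv ρ x ξ).re with hqr
  set qκ := B * τ * (-2 / ρ x ^ 3 * qr + 6 / ρ x ^ 4 * ‖dr‖ ^ 2) with hqκ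
  have hlam : 0 < (1 + t) ^ 2 := by positivity
  have hL : wL J T ε x = η + (1 + t) ^ 2 := rfl
  rw [hL] at hBM
  have a1 : 0 ≤ qφ := by
    have := log_quad hs hσ2 hw hcs
    have h2 : 0 ≤ σ ^ 2 / (s + σ ^ 2) ^ 2 * w := by positivity
    rw [hqφ]; exact mul_nonneg (by positivity) (by linarith)
  have a2 : 2 * (η + (1 + t) ^ 2) * ‖dΨ‖ ^ 2 ≤ qκ := by
    have e2 : dΨ = ((-(2 * τ) / (ρ x * (ρ x + τ)) : ℝ) : ℂ) * dr := by
      have : (ρ x : ℂ) ≠ 0 := by exact_mod_cast h0.ne'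
      have : (ρ x : ℂ) + τ ≠ 0 := by exact_mod_cast (by positivity : ρ x + τ ≠ 0)
      rw [hdΨ]; push_cast; field_simp; ring
    have e3 : ‖dΨ‖ ^ 2 ≤ 4 * τ / ρ x ^ 3 * ‖dr‖ ^ 2 := by
      rw [e2, norm_mul, mul_pow, Complex.norm_real, Real.norm_eq_abs, sq_abs]
      gcongr
      rw [div_pow, div_le_div_iff₀ (by positivity) (by positivity)]
      have : 0 ≤ 4 * τ * ρ x ^ 2 * (ρ x ^ 2 + ρ x * τ + τ ^ 2) := by positivity
      nlinarith
    have e4 := hM ξ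
    have e5 := hγ ξ
    rw [← hdr] at e4
    set N := ∑ j, ‖ξ j‖ ^ 2
    have hN : 0 ≤ N := Finset.sum_nonneg fun _ _ => by positivity
    have e6 : 2 * B * τ * γ * N / ρ x ^ 3 ≤ qκ := by
      have h1 : 0 ≤ B * τ * (6 / ρ x ^ 4 * ‖dr‖ ^ 2) := by positivity
      have h2 : 2 * B * τ / ρ x ^ 3 * (γ * N) ≤ 2 * B * τ / ρ x ^ 3 * (-qr) := by gcongr
      calc _ = 2 * B * τ / ρ x ^ 3 * (γ * N) := by ring
        _ ≤ _ := h2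
        _ ≤ 2 * B * τ / ρ x ^ 3 * (-qr) + B * τ * (6 / ρ x ^ 4 * ‖dr‖ ^ 2) := by linarith
        _ = _ := by rw [hqκ]; ring
    refine le_trans ?_ e6
    have hη0 : 0 < η + (1 + t) ^ 2 := by linarith
    calc 2 * (η + (1 + t) ^ 2) * ‖dΨ‖ ^ 2 ≤ 2 * (η + (1 + t) ^ 2) * (4 * τ / ρ x ^ 3 * (M * N)) := by
          gcongr; exact e3.trans (by gcongr)
      _ = 2 * τ / ρ x ^ 3 * N * (4 * (η + (1 + t) ^ 2) * M) := by ring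
      _ ≤ 2 * τ / ρ x ^ 3 * N * (B * γ) := by gcongr
      _ = _ := by ring
  have a3 : ε ^ 2 / (s + ε ^ 2) ^ 2 * w + ‖Y‖ ^ 2 / (1 + t) ^ 2 ≤ -qη := by
    have h1 := log_quad hs hε2 hw hcs
    have h2 : ‖Y‖ ^ 2 = (1 + t) ^ 2 / t ^ 2 * ‖dt‖ ^ 2 := by
      have : Y = (((1 + t) / t : ℝ) : ℂ) * dt := by
        have : (t : ℂ) ≠ 0 := by exact_mod_cast hT0.ne'
        rw [hY]; push_cast; field_simp; ring
      rw [this, norm_mul, mul_pow, Complex.norm_real, Real.norm_eq_abs, sq_abs, div_pow]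
    have h3 : ‖Y‖ ^ 2 / (1 + t) ^ 2 = (t ^ 2)⁻¹ * ‖dt‖ ^ 2 := by rw [h2]; field_simp
    have h4 : ε ^ 2 / (s + ε ^ 2) ^ 2 * w ≤ -qt := by rw [hqt]; linarith
    have h5 : 0 ≤ t⁻¹ * (-qt) := mul_nonneg (by positivity) (le_trans (by positivity) h4)
    rw [h3, hqη]; linarith
  have key := alg_w S dΨ Y hE hlam a1 a2 a3
  have : wa J m T ε σ τ B ρ x = 2 * (η + (1 + t) ^ 2) * e := rfl
  rw [this]
  have : wb J m ε σ τ B ρ x = ε ^ 2 / (s + ε ^ 2) ^ 2 * e := rfl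
  rw [this, show ∑ j ∈ J, ‖ξ j‖ ^ 2 = w from rfl]
  have h2 := mul_le_mul_of_nonneg_right key he0.le
  refine le_of_eq_of_le ?_ (h2.trans_eq ?_)
  · have hz : ∀ z z' : ℂ, z = z' → ‖z‖ ^ 2 * (η * e) = ‖z'‖ ^ 2 * η * e := by rintro z _ rfl; ring
    rw [add_mul]
    congr 1
    · exact hz _ _ (by ring)
    · ring
  · ring
end wts

section hdw
variable {n : ℕ}

lemma sT_deriv : ∃ C : ℝ, 0 ≤ C ∧ (∀ t, |deriv Real.smoothTransition t| ≤ C) ∧ (∀ t, 1 < t → deriv Real.smoothTransition t = 0) ∧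
    ∀ t, t < 0 → deriv Real.smoothTransition t = 0 := by
  have hc : Continuous (deriv Real.smoothTransition) :=
    (Real.smoothTransition.contDiff (n := 1)).continuous_deriv le_rfl
  have h1 : ∀ t, 1 < t → deriv Real.smoothTransition t = 0 := fun t ht => by
    have : Real.smoothTransition =ᶠ[𝓝 t] fun _ => 1 := by
      filter_upwards [lt_mem_nhds ht] with y hy using Real.smoothTransition.one_of_one_le hy.le
    rw [this.deriv_eq]; simp
  have h0 : ∀ t, t < 0 → deriv Real.smoothTransition t = 0 := fun t ht => by
    have : Real.smoothTransition =ᶠ[𝓝 t] fun _ => 0 := by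
      filter_upwards [gt_mem_nhds ht] with y hy using Real.smoothTransition.zero_of_nonpos hy.le
    rw [this.deriv_eq]; simp
  obtain ⟨C, hC⟩ := (isCompact_Icc (a := (0:ℝ)) (b := 1)).exists_bound_of_continuousOn hc.continuousOn
  have hC0 : 0 ≤ C := (norm_nonneg _).trans (hC 0 (by simp))
  refine ⟨C, hC0, fun t => ?_, h1, h0⟩
  by_cases ha : 1 < t
  · rw [h1 t ha]; simpa using hC0
  · by_cases hb : t < 0
    · rw [h0 t hb]; simpa using hC0
    · exact hC t ⟨by linarith, by linarith⟩

lemma sT_hd (t : ℝ) : HasDerivAt Real.smoothTransition (deriv Real.smoothTransition t) t :=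
  ((Real.smoothTransition.contDiff (n := 1)).differentiable (by simp)).differentiableAt.hasDerivAt

structure RH (ρ : (Fin n → ℂ) → ℝ) (γ M : ℝ) : Prop where
  sm : ContDiff ℝ (⊤ : ℕ∞) ρ
  cpt : IsCompact {x | 0 ≤ ρ x}
  γ0 : 0 < γ
  lev : ∀ x, 0 < ρ x → ∀ ξ : Fin n → ℂ, γ * ∑ j, ‖ξ j‖ ^ 2 ≤ -(Lv ρ x ξ).re
  M0 : 0 ≤ M
  hM : ∀ x, 0 < ρ x → ∀ j, ‖dz (ee j) (cr ρ) x‖ ^ 2 ≤ M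

lemma RH_ex {ρ : (Fin n → ℂ) → ℝ} {γ : ℝ} (sm : ContDiff ℝ (⊤ : ℕ∞) ρ) (cpt : IsCompact {x | 0 ≤ ρ x}) (γ0 : 0 < γ)
    (lev : ∀ x, 0 < ρ x → ∀ ξ : Fin n → ℂ, γ * ∑ j, ‖ξ j‖ ^ 2 ≤ -(Lv ρ x ξ).re) : ∃ M, RH ρ γ M := by
  have hc : Continuous (fun x => ∑ j, ‖dz (ee j) (cr ρ) x‖ ^ 2) :=
    continuous_finsetSum _ fun j _ => (((cr_sm sm).dz _).continuous.norm.pow 2)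
  obtain ⟨C, hC⟩ := cpt.exists_bound_of_continuousOn hc.continuousOn
  refine ⟨max C 0, sm, cpt, γ0, lev, le_max_right _ _, fun x hx j => ?_⟩
  refine le_trans ?_ (((Real.le_norm_self _).trans (hC x hx.le)).trans (le_max_left _ _))
  exact Finset.single_le_sum (f := fun j => ‖dz (ee j) (cr ρ) x‖ ^ 2) (fun i _ => by positivity) (Finset.mem_univ j)

lemma RH.cs {ρ : (Fin n → ℂ) → ℝ} {γ M : ℝ} (h : RH ρ γ M) {x} (hx : 0 < ρ x) (ξ : Fin n → ℂ) :
    ‖∑ j, ξ j * dz (ee j) (cr ρ) x‖ ^ 2 ≤ (n * M) * ∑ j, ‖ξ j‖ ^ 2 := by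
  calc _ ≤ (∑ j, ‖ξ j‖ * ‖dz (ee j) (cr ρ) x‖) ^ 2 := by
        gcongr
        refine (norm_sum_le _ _).trans_eq ?_
        simp
    _ ≤ (∑ j, ‖ξ j‖ ^ 2) * ∑ j, ‖dz (ee j) (cr ρ) x‖ ^ 2 := Finset.sum_mul_sq_le_sq_mul_sq _ _ _
    _ ≤ (∑ j, ‖ξ j‖ ^ 2) * ∑ j : Fin n, M := by gcongr; exact h.hM x hx _
    _ = _ := by simp; ring

variable {J : Finset (Fin n)} {m : ℕ} {ε σ τ B S0 : ℝ} {ρ : (Fin n → ℂ) → ℝ} {γ M : ℝ}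

lemma wT_ge {x : Fin n → ℂ} (hε : 0 < ε) (h : sw J x + ε ^ 2 ≤ S0) : 1 ≤ wT J (1 + Real.log S0) ε x := by
  have h0 : 0 < sw J x + ε ^ 2 := add_pos_of_nonneg_of_pos (sw_nonneg J x) (by positivity)
  have := Real.log_le_log h0 h
  unfold wT; linarith

lemma wL_le {x : Fin n → ℂ} (hε : 0 < ε) (h : sw J x + ε ^ 2 ≤ S0) :
    wL J (1 + Real.log S0) ε x ≤ 6 * (wT J (1 + Real.log S0) ε x) ^ 2 := by
  have h1 := wT_ge hε h
  have := Real.log_le_sub_one_of_pos (show 0 < wT J (1 + Real.log S0) ε x by linarith)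
  unfold wL wE; nlinarith

lemma wT_le {x : Fin n → ℂ} (hε : 0 < ε) : wT J (1 + Real.log S0) ε x ≤ 1 + Real.log S0 - Real.log (ε ^ 2) := by
  have := Real.log_le_log (by positivity : 0 < ε ^ 2) (by linarith [sw_nonneg J x] : ε ^ 2 ≤ sw J x + ε ^ 2)
  unfold wT; linarith

lemma exp_wS {x : Fin n → ℂ} (hτ : 0 < τ) (hx : 0 < ρ x) : Real.exp (wS τ ρ x) = (1 + τ / ρ x) ^ 2 := by
  rw [wS, ← Real.log_div (by positivity) hx.ne', mul_comm, ← Real.rpow_def_of_pos (by positivity)]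
  norm_cast
  rw [add_div, div_self hx.ne']

lemma cda_w {x : Fin n → ℂ} (hε : 0 < ε) (hσ : 0 < σ) (hτ : 0 < τ) (hr : ContDiff ℝ (⊤ : ℕ∞) ρ)
    (hx : 0 < ρ x) (h : sw J x + ε ^ 2 ≤ S0) : ContDiffAt ℝ (⊤ : ℕ∞) (wT J (1 + Real.log S0) ε) x ∧ ContDiffAt ℝ (⊤ : ℕ∞) (wE J (1 + Real.log S0) ε) x ∧
     ContDiffAt ℝ (⊤ : ℕ∞) (wP J m σ) x ∧ ContDiffAt ℝ (⊤ : ℕ∞) (wK τ B ρ) x ∧ ContDiffAt ℝ (⊤ : ℕ∞) (wS τ ρ) x := by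
  have h0 := sw_nonneg J x
  have hs := (sw_sm J).contDiffAt (x := x)
  have ht : ContDiffAt ℝ (⊤ : ℕ∞) (wT J (1 + Real.log S0) ε) x :=
    contDiffAt_const.sub ((hs.add contDiffAt_const).log (by positivity))
  have h1 := wT_ge hε h
  refine ⟨ht, ht.add (ht.log (by linarith)), ?_, ?_, ?_⟩
  · exact contDiffAt_const.mul ((hs.add contDiffAt_const).log (by positivity))
  · exact contDiffAt_const.mul ((hr.contDiffAt.pow 2).inv (by positivity))
  · exact contDiffAt_const.mul (((hr.contDiffAt.add contDiffAt_const).log (by positivity)).sub (hr.contDiffAt.log hx.ne'))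

lemma HDw (hR : RH ρ γ M) (hε : 0 < ε) (hS : ∀ x, 0 < ρ x → sw J x + ε ^ 2 ≤ S0) :
    ∃ B0 : ℝ, ∀ B, B0 ≤ B → 0 < B → ∀ σ, 0 < σ → ∀ τ, 0 < τ → ∃ C, HD {x | 0 < ρ x} (wX J m (1 + Real.log S0) ε σ τ B ρ) (wF J m σ τ B ρ)
      (wa J m (1 + Real.log S0) ε σ τ B ρ) (wb J m ε σ τ B ρ) J (fun ν x => Real.smoothTransition (((ν : ℝ) + 1) * ρ x - 1)) C := by
  set T := 1 + Real.log S0 with hT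
  set Tm := T - Real.log (ε ^ 2) with hTm
  set Lm := 6 * Tm ^ 2 with hLm
  have hLb : ∀ x, 0 < ρ x → wL J T ε x ≤ Lm := fun x hx => by
    refine (wL_le hε (hS x hx)).trans ?_
    have h1 := wT_ge hε (hS x hx)
    have h2 := wT_le (J := J) (S0 := S0) (x := x) hε
    rw [hLm]; gcongr
  have hLp : ∀ x, 0 < ρ x → 0 < wL J T ε x ∧ wE J T ε x ≤ wL J T ε x := fun x hx => by
    have h1 := wE_ge (wT_ge hε (hS x hx))
    have h2 : 0 ≤ (1 + wT J T ε x) ^ 2 := by positivity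
    unfold wL; constructor <;> linarith
  obtain ⟨C1, hC10, hC1, hC1', -⟩ := sT_deriv
  refine ⟨4 * Lm * (n * M) / γ, fun B hB hB0 σ hσ τ hτ => ⟨12 * Lm * C1 ^ 2 * M / τ ^ 2, ?_⟩⟩
  have hγ := hR.γ0
  have hM0 := hR.M0
  have hopen : IsOpen {x | 0 < ρ x} := isOpen_lt continuous_const hR.sm.continuous
  have hcd := fun x (hx : 0 < ρ x) => cda_w (m := m) (B := B) hε hσ hτ hR.sm hx (hS x hx)
  have hE : ∀ x, 0 < ρ x → 1 ≤ wE J T ε x := fun x hx => wE_ge (wT_ge hε (hS x hx))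
  have hts : ∀ ν : ℕ, tsupport (fun x => Real.smoothTransition (((ν : ℝ) + 1) * ρ x - 1)) ⊆ {x | 1 ≤ ((ν : ℝ) + 1) * ρ x} := fun ν => by
    refine closure_minimal (fun x hx => ?_) (isClosed_le continuous_const (continuous_const.mul hR.sm.continuous))
    by_contra h
    simp only [mem_setOf_eq, not_le] at h
    exact hx (Real.smoothTransition.zero_of_nonpos (by linarith))
  refine ⟨hopen, ?_, ?_, ?_, ?_, ?_, ?_, ?_, ?_, ?_, ?_, ?_, ?_, ?_, ?_⟩
  · intro x hx
    obtain ⟨h1, h2, h3, h4, h5⟩ := hcd x hx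
    exact ((h3.add h4).sub (h2.log (by linarith [hE x hx]))).contDiffWithinAt
  · intro x hx
    obtain ⟨h1, h2, h3, h4, h5⟩ := hcd x hx
    exact ((h3.add h4).sub h5).contDiffWithinAt
  · intro x hx
    obtain ⟨h1, h2, h3, h4, h5⟩ := hcd x hx
    exact (((continuousAt_const.mul (h2.continuousAt.add ((continuousAt_const.add h1.continuousAt).pow 2))).mul
      (Real.continuous_exp.continuousAt.comp (h3.add h4).neg.continuousAt)).continuousWithinAt)
  · intro x hx
    obtain ⟨h1, h2, h3, h4, h5⟩ := hcd x hx
    have h0 := sw_nonneg J x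
    have hs := (sw_sm J).continuous.continuousAt (x := x)
    have hne : (sw J x + ε ^ 2) ^ 2 ≠ 0 := by positivity
    exact (((continuousAt_const.div ((hs.add continuousAt_const).pow 2) hne).mul
      (Real.continuous_exp.continuousAt.comp (h3.add h4).neg.continuousAt)).continuousWithinAt)
  · intro x hx
    exact mul_pos (mul_pos two_pos (hLp x hx).1) (Real.exp_pos _)
  · intro x hx
    have h0 := sw_nonneg J x
    exact mul_pos (by positivity) (Real.exp_pos _)
  · intro x hx
    refine hyp_w hε hσ hτ hB0 (wT_ge hε (hS x hx)) hR.sm hx (hR.lev x hx) (hR.cs hx) ?_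
    rw [div_le_iff₀ hγ] at hB
    have := hLb x hx
    refine le_trans ?_ hB
    gcongr
  · intro ν
    exact Real.smoothTransition.contDiff.comp ((contDiff_const.mul hR.sm).sub contDiff_const)
  · intro ν
    refine hR.cpt.of_isClosed_subset (isClosed_tsupport _) fun x hx => ?_
    have := hts ν hx
    simp only [mem_setOf_eq] at this ⊢
    by_contra h
    have : 0 ≤ ((ν : ℝ) + 1) * (- ρ x) := mul_nonneg (by positivity) (by linarith)
    linarith
  · intro ν x hx
    have := hts ν hx
    simp only [mem_setOf_eq] at this ⊢
    by_contra h
    have : 0 ≤ ((ν : ℝ) + 1) * (- ρ x) := mul_nonneg (by positivity) (by linarith)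
    linarith
  · exact fun ν x => ⟨Real.smoothTransition.nonneg _, Real.smoothTransition.le_one _⟩
  · intro x hx
    obtain ⟨N, hN⟩ := exists_nat_gt (2 / ρ x)
    filter_upwards [eventually_ge_atTop N] with ν hν
    have h1 : 2 < ((ν : ℝ) + 1) * ρ x := by
      rw [div_lt_iff₀ hx] at hN
      have : (N : ℝ) ≤ ν := by exact_mod_cast hν
      simp only [mem_setOf_eq] at hx
      nlinarith
    have hc : Continuous fun y => ((ν : ℝ) + 1) * ρ y := continuous_const.mul hR.sm.continuous
    filter_upwards [hc.continuousAt.eventually (lt_mem_nhds h1)] with y hy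
    exact Real.smoothTransition.one_of_one_le (by linarith)
  · positivity
  · intro ν x hx j
    simp only [mem_setOf_eq] at hx
    have hρd := hR.sm.contDiffAt (x := x) |>.differentiableAt (by simp)
    have e1 : dz (ee j) (cr fun x => Real.smoothTransition (((ν : ℝ) + 1) * ρ x - 1)) x =
        ((deriv Real.smoothTransition (((ν : ℝ) + 1) * ρ x - 1) * ((ν : ℝ) + 1) : ℝ) : ℂ) * dz (ee j) (cr ρ) x := by
      refine dz_comp (h := fun t => Real.smoothTransition (((ν : ℝ) + 1) * t - 1)) _ hρd ?_
      refine (sT_hd _).comp (ρ x) ?_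
      simpa using ((hasDerivAt_id (ρ x)).const_mul ((ν : ℝ) + 1)).sub_const 1
    have e2 : ‖dz (ee j) (cr fun x => Real.smoothTransition (((ν : ℝ) + 1) * ρ x - 1)) x‖ ^ 2 ≤ (C1 * (2 / ρ x)) ^ 2 * M := by
      rw [e1, norm_mul, mul_pow, Complex.norm_real, Real.norm_eq_abs]
      refine mul_le_mul ?_ (hR.hM x hx j) (by positivity) (by positivity)
      refine pow_le_pow_left₀ (abs_nonneg _) ?_ 2
      by_cases h : 1 < ((ν : ℝ) + 1) * ρ x - 1
      · rw [hC1' _ h]; simp; positivity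
      · rw [abs_mul]
        refine mul_le_mul (hC1 _) ?_ (abs_nonneg _) hC10
        rw [abs_of_nonneg (by positivity), le_div_iff₀ hx]; linarith
    set e := Real.exp (-(wP J m σ x + wK τ B ρ x)) with he
    have he0 : 0 < e := Real.exp_pos _
    have e3 : wt (wX J m T ε σ τ B ρ) x = wE J T ε x * e := by
      simp only [wt, wX]
      rw [show -(wP J m σ x + wK τ B ρ x - Real.log (wE J T ε x)) = Real.log (wE J T ε x) + -(wP J m σ x + wK τ B ρ x) by ring,
        Real.exp_add, Real.exp_log (by linarith [hE x hx])]
    have e4 : wt (wF J m σ τ B ρ) x = (1 + τ / ρ x) ^ 2 * e := by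
      simp only [wt, wF]
      rw [← exp_wS hτ hx, ← Real.exp_add]; congr 1; ring
    have e5 : wa J m T ε σ τ B ρ x = 2 * wL J T ε x * e := rfl
    rw [e3, e4, e5]
    have e6 : 2 * wL J T ε x * e + wE J T ε x * e ≤ 3 * Lm * e := by
      have := hLb x hx
      have := (hLp x hx).2
      nlinarith
    have hL0 : 0 ≤ Lm := by positivity
    calc _ ≤ 3 * Lm * e * ((C1 * (2 / ρ x)) ^ 2 * M) := by gcongr
      _ = 12 * Lm * C1 ^ 2 * M / τ ^ 2 * ((τ / ρ x) ^ 2 * e) := by field_simp; ring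
      _ ≤ _ := by gcongr; linarith
end hdw

section
variable {n : ℕ}

lemma pi_box (i0 : Fin n) (ε : ℝ) (A : Set ℂ) :
    volume ({x : Fin n → ℂ | ∀ i ∈ Finset.univ.erase i0, ‖x i‖ ≤ ε} ∩ (fun x => x i0) ⁻¹' A)
      = volume (closedBall (0 : ℂ) ε) ^ (n - 1) * volume A := by
  have h : ({x : Fin n → ℂ | ∀ i ∈ Finset.univ.erase i0, ‖x i‖ ≤ ε} ∩ (fun x => x i0) ⁻¹' A)
      = Set.pi univ (fun i => if i = i0 then A else closedBall (0 : ℂ) ε) := by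
    ext x
    simp only [Finset.mem_erase, Finset.mem_univ, and_true, mem_inter_iff, mem_preimage, Set.mem_pi, mem_univ, true_implies]
    constructor
    · rintro ⟨h1, h2⟩ i
      by_cases hi : i = i0
      · subst hi; simpa using h2
      · simpa [hi] using h1 i hi
    · intro h
      refine ⟨fun i hi => by simpa [hi] using h i, by simpa using h i0⟩
  rw [h, volume_pi_pi, ← Finset.mul_prod_erase _ _ (Finset.mem_univ i0), mul_comm]
  simp only [if_true]
  congr 1
  rw [Finset.prod_congr rfl (g := fun _ => volume (closedBall (0 : ℂ) ε)) (fun i hi => by simp [Finset.ne_of_mem_erase hi])]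
  simp

lemma pi_fub (i0 : Fin n) (ε : ℝ) {g : ℂ → ℝ≥0∞} (hg : Measurable g) :
    ∫⁻ x in {x : Fin n → ℂ | ∀ i ∈ Finset.univ.erase i0, ‖x i‖ ≤ ε}, g (x i0)
      = volume (closedBall (0 : ℂ) ε) ^ (n - 1) * ∫⁻ z, g z := by
  have hm : Measurable (fun x : Fin n → ℂ => x i0) := measurable_pi_apply i0
  rw [← lintegral_map hg hm, ← smul_eq_mul, ← lintegral_smul_measure]
  congr 1
  ext A hA
  rw [Measure.map_apply hm hA, Measure.restrict_apply (hm hA), inter_comm, pi_box]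
  rfl

lemma geo_le {m : ℕ} (hm : 1 ≤ m) {q : ℝ} (hq : 0 ≤ q) (N : ℕ) :
    ∑ j ∈ Finset.range N, (if q ≤ (1 / 4 : ℝ) ^ j then ((4 : ℝ) ^ m) ^ j else 0) ≤ 2 / (max q ((1 / 4 : ℝ) ^ N)) ^ m := by
  induction N with
  | zero => simp only [Finset.range_zero, Finset.sum_empty]; positivity
  | succ N ih =>
    by_cases h : q ≤ (1 / 4 : ℝ) ^ N
    · have h4 : (4 : ℝ) ≤ 4 ^ m := by simpa using pow_le_pow_right₀ (by norm_num : (1 : ℝ) ≤ 4) hm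
      have h1 : ∑ j ∈ Finset.range (N + 1), (if q ≤ (1 / 4 : ℝ) ^ j then ((4 : ℝ) ^ m) ^ j else 0) ≤ 2 * ((4 : ℝ) ^ m) ^ N := by
        refine (Finset.sum_le_sum (g := fun j => ((4 : ℝ) ^ m) ^ j) fun j _ => by split_ifs <;> first | exact le_rfl | positivity).trans ?_
        clear h ih
        induction N with
        | zero => simp
        | succ N ih =>
          rw [Finset.sum_range_succ]
          have : 0 < ((4 : ℝ) ^ m) ^ N := by positivity
          rw [pow_succ ((4 : ℝ) ^ m) N] at *
          nlinarith
      refine h1.trans ?_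
      have h2 : max q ((1 / 4 : ℝ) ^ (N + 1)) ≤ (1 / 4) ^ N := max_le h (pow_le_pow_of_le_one (by norm_num) (by norm_num) (by omega))
      rw [le_div_iff₀ (by positivity)]
      calc 2 * ((4 : ℝ) ^ m) ^ N * (max q ((1 / 4 : ℝ) ^ (N + 1))) ^ m ≤ 2 * ((4 : ℝ) ^ m) ^ N * ((1 / 4) ^ N) ^ m := by gcongr
        _ = 2 * (4 * (1 / 4) : ℝ) ^ (m * N) := by rw [mul_pow, ← pow_mul, ← pow_mul]; ring
        _ = 2 := by norm_num
    · rw [Finset.sum_range_succ, if_neg h, add_zero]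
      refine ih.trans (le_of_eq ?_)
      push Not at h
      have : (1 / 4 : ℝ) ^ (N + 1) ≤ (1 / 4) ^ N := pow_le_pow_of_le_one (by norm_num) (by norm_num) (by omega)
      rw [max_eq_left h.le, max_eq_left (this.trans h.le)]

noncomputable def sk (i0 : Fin n) (r σ : ℝ) : (Fin n → ℂ) → ℝ :=
  (closedBall 0 r).indicator (fun y => ((sw (Finset.univ.erase i0) y + σ ^ 2) ^ (n - 1))⁻¹)

lemma sk_int (i0 : Fin n) (r : ℝ) {σ : ℝ} (hσ : 0 < σ) : Integrable (sk i0 r σ) := by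
  refine IntegrableOn.integrable_indicator (ContinuousOn.integrableOn_compact (isCompact_closedBall _ _) ?_) measurableSet_closedBall
  have := (sw_sm (Finset.univ.erase i0)).continuous
  refine Continuous.continuousOn (((this.add continuous_const).pow _).inv₀ fun x => ?_)
  exact (pow_pos (add_pos_of_nonneg_of_pos (sw_nonneg _ x) (pow_pos hσ 2)) _).ne'

lemma sk_big (hn : 2 ≤ n) (i0 : Fin n) {r : ℝ} (hr : 0 < r) (M : ℝ) {ε : ℝ} (hε : 0 < ε) :
    ∃ σ, 0 < σ ∧ σ ≤ ε ∧ M ≤ ∫ y, sk i0 r σ y := by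
  set J := Finset.univ.erase i0 with hJ
  obtain ⟨m, hm⟩ : ∃ m, m = n - 1 := ⟨_, rfl⟩
  have hm1 : 1 ≤ m := by omega
  have hJc : J.card = m := by rw [hJ, Finset.card_erase_of_mem (Finset.mem_univ _)]; simp [hm]
  set c : ℝ := (volume (closedBall (0 : ℂ) r)).toReal with hc
  have hcp : 0 < c := ENNReal.toReal_pos (measure_closedBall_pos _ _ hr).ne' measure_closedBall_lt_top.ne
  set A : ℝ := (2 * (m * r ^ 2)) ^ m * 2 with hA
  have hAp : 0 < A := by have : (0 : ℝ) < m := by exact_mod_cast hm1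
                         positivity
  obtain ⟨N1, hN1⟩ := exists_nat_gt (M * A / c ^ (m + 1))
  obtain ⟨N2, hN2⟩ := exists_pow_lt_of_lt_one (div_pos hε hr) (by norm_num : (1 / 2 : ℝ) < 1)
  set N := max N1 N2
  have hNM : M ≤ A⁻¹ * (N * c ^ (m + 1)) := by
    have : (N1 : ℝ) ≤ N := by exact_mod_cast le_max_left _ _
    rw [div_lt_iff₀ (by positivity)] at hN1
    rw [inv_mul_eq_div, le_div_iff₀ hAp]
    nlinarith [pow_pos hcp (m + 1)]
  refine ⟨r * (1 / 2) ^ N, by positivity, ?_, hNM.trans ?_⟩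
  · rw [lt_div_iff₀ hr] at hN2
    have : (1 / 2 : ℝ) ^ N ≤ (1 / 2) ^ N2 := pow_le_pow_of_le_one (by norm_num) (by norm_num) (le_max_right _ _)
    nlinarith
  set V : ℕ → Set (Fin n → ℂ) := fun j => {x | ∀ i ∈ J, ‖x i‖ ≤ r * (1 / 2) ^ j} ∩ (fun x => x i0) ⁻¹' (closedBall 0 r) with hV
  have hVm : ∀ j, MeasurableSet (V j) := fun j => by
    refine MeasurableSet.inter ?_ (measurable_pi_apply i0 measurableSet_closedBall)
    have : {x : Fin n → ℂ | ∀ i ∈ J, ‖x i‖ ≤ r * (1 / 2) ^ j} = ⋂ i ∈ J, {x | ‖x i‖ ≤ r * (1 / 2) ^ j} := by ext; simp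
    rw [this]
    exact Finset.measurableSet_biInter _ fun i _ => (isClosed_le (continuous_apply i).norm continuous_const).measurableSet
  have hVv : ∀ j, (volume (V j)).toReal = c ^ (m + 1) * (((4 : ℝ) ^ m) ^ j)⁻¹ := fun j => by
    rw [hV]; dsimp only; rw [pi_box, ENNReal.toReal_mul, ENNReal.toReal_pow, ← hc, ← hm, pow_succ]
    have : (volume (closedBall (0 : ℂ) (r * (1 / 2) ^ j))).toReal = c * (4 ^ j)⁻¹ := by
      rw [hc, Complex.volume_closedBall, Complex.volume_closedBall, ENNReal.ofReal_mul hr.le, mul_pow]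
      simp only [ENNReal.toReal_mul, ENNReal.toReal_pow]
      rw [ENNReal.toReal_ofReal (by positivity : (0 : ℝ) ≤ (1 / 2) ^ j), ← pow_mul, mul_comm j 2, pow_mul]
      have : ((1 / 2 : ℝ) ^ 2) ^ j = (4 ^ j)⁻¹ := by rw [← inv_pow]; norm_num
      rw [this]; ring
    rw [this, mul_pow, inv_pow, ← pow_mul, ← pow_mul, mul_comm j m]; ring
  have hVt : ∀ j, volume (V j) ≠ ⊤ := fun j => by
    rw [hV]; dsimp only; rw [pi_box]
    exact ENNReal.mul_ne_top (ENNReal.pow_ne_top measure_closedBall_lt_top.ne) measure_closedBall_lt_top.ne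
  have hVi : ∀ j ∈ Finset.range N, Integrable ((V j).indicator (fun _ => ((4 : ℝ) ^ m) ^ j)) := fun j _ =>
    (integrable_indicator_iff (hVm j)).2 (integrableOn_const (hVt j))
  have hI : ∫ y, A⁻¹ * ∑ j ∈ Finset.range N, (V j).indicator (fun _ => ((4 : ℝ) ^ m) ^ j) y = A⁻¹ * (N * c ^ (m + 1)) := by
    rw [integral_const_mul, integral_finsetSum _ hVi]
    congr 1
    rw [Finset.sum_congr rfl (g := fun _ => c ^ (m + 1))]
    · simp
    · intro j _
      rw [integral_indicator (hVm j), setIntegral_const, measureReal_def, hVv, smul_eq_mul, mul_assoc, inv_mul_cancel₀ (by positivity), mul_one]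
  rw [← hI]
  refine integral_mono ((integrable_finsetSum _ hVi).const_mul _) (sk_int i0 r (by positivity)) fun y => ?_
  dsimp only [sk]
  rw [← hJ, ← hm]
  by_cases hy : y ∈ closedBall (0 : Fin n → ℂ) r
  · rw [indicator_of_mem hy]
    have hs := sw_nonneg J y
    have hmp : (0 : ℝ) < m * r ^ 2 := by have : (0 : ℝ) < m := by exact_mod_cast hm1
                                         positivity
    set q := sw J y / (m * r ^ 2) with hq
    have hsq : sw J y = m * r ^ 2 * q := by rw [hq]; field_simp
    have hq0 : 0 ≤ q := by positivity
    have h1 := geo_le hm1 hq0 N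
    have h2 : ∑ j ∈ Finset.range N, (V j).indicator (fun _ => ((4 : ℝ) ^ m) ^ j) y
        ≤ ∑ j ∈ Finset.range N, (if q ≤ (1 / 4 : ℝ) ^ j then ((4 : ℝ) ^ m) ^ j else 0) := by
      refine Finset.sum_le_sum fun j _ => ?_
      by_cases hj : y ∈ V j
      · rw [indicator_of_mem hj, if_pos]
        rw [hq, div_le_iff₀ hmp]
        calc sw J y ≤ ∑ i ∈ J, (r * (1 / 2) ^ j) ^ 2 := Finset.sum_le_sum fun i hi => by
              have := hj.1 i hi
              gcongr
          _ = _ := by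
              rw [Finset.sum_const, hJc, nsmul_eq_mul, mul_pow, ← pow_mul, mul_comm j 2, pow_mul]; norm_num; ring
      · rw [indicator_of_notMem hj]; split_ifs <;> positivity
    set a := (1 / 4 : ℝ) ^ N with ha
    have ha0 : 0 < a := by positivity
    have hmx : 0 < max q a := lt_max_of_lt_right ha0
    have h3 : sw J y + (r * (1 / 2) ^ N) ^ 2 ≤ 2 * (m * r ^ 2) * max q a := by
      have e : (r * (1 / 2 : ℝ) ^ N) ^ 2 = r ^ 2 * a := by rw [ha, mul_pow, ← pow_mul, mul_comm N 2, pow_mul]; norm_num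
      rw [e, hsq]
      have e1 : r ^ 2 * a ≤ m * r ^ 2 * max q a := by
        have : (1 : ℝ) ≤ m := by exact_mod_cast hm1
        have : r ^ 2 ≤ m * r ^ 2 := by nlinarith [sq_nonneg r]
        have := le_max_right q a
        gcongr
      have e2 : m * r ^ 2 * q ≤ m * r ^ 2 * max q a := by have := le_max_left q a; gcongr
      linarith
    have h4 : A⁻¹ * (2 / (max q a) ^ m) = ((2 * (m * r ^ 2) * max q a) ^ m)⁻¹ := by
      rw [hA, mul_pow _ (max q a)]; field_simp
    have h5 : 0 < (r * (1 / 2 : ℝ) ^ N) ^ 2 := by positivity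
    calc _ ≤ A⁻¹ * (2 / (max q a) ^ m) := by gcongr; exact h2.trans h1
      _ = _ := h4
      _ ≤ _ := by gcongr
  · rw [indicator_of_notMem hy]
    refine le_of_eq ?_
    rw [Finset.sum_eq_zero, mul_zero]
    intro j _
    refine indicator_of_notMem (fun h => hy ?_) _
    rw [mem_closedBall_zero_iff, pi_norm_le_iff_of_nonneg hr.le]
    intro i
    by_cases hi : i = i0
    · subst hi; simpa using h.2
    · refine (h.1 i (by simp [hJ, hi])).trans ?_
      have : (1 / 2 : ℝ) ^ j ≤ 1 := pow_le_one₀ (by norm_num) (by norm_num)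
      nlinarith
end

section
variable {n : ℕ}

lemma exp_wP (J : Finset (Fin n)) (m : ℕ) {σ : ℝ} (hσ : 0 < σ) (x) : Real.exp (wP J m σ x) = (sw J x + σ ^ 2) ^ m := by
  have h : 0 < sw J x + σ ^ 2 := add_pos_of_nonneg_of_pos (sw_nonneg J x) (by positivity)
  rw [wP, ← Real.log_pow, Real.exp_log (by positivity)]

lemma wK_le {τ B : ℝ} {ρ : (Fin n → ℂ) → ℝ} {x} (hτ : 0 < τ) (hB : τ ≤ B) (hx : 0 < ρ x) :
    (1 + τ / ρ x) * Real.exp (-(wK τ B ρ x) / 4) ≤ Real.exp 1 := by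
  have h1 : 1 + τ / ρ x ≤ Real.exp (τ / ρ x) := by linarith [Real.add_one_le_exp (τ / ρ x)]
  have h2 : (τ / ρ x) ^ 2 ≤ wK τ B ρ x := by
    rw [wK, div_pow, div_eq_mul_inv]; gcongr; nlinarith
  calc _ ≤ Real.exp (τ / ρ x) * Real.exp (-(wK τ B ρ x) / 4) := by gcongr
    _ = Real.exp (τ / ρ x + -(wK τ B ρ x) / 4) := by rw [Real.exp_add]
    _ ≤ _ := Real.exp_le_exp.2 (by nlinarith [sq_nonneg (τ / ρ x - 2)])

lemma w_hB {J : Finset (Fin n)} {m : ℕ} {ε σ τ B : ℝ} {ρ : (Fin n → ℂ) → ℝ} {x} (hε : 0 < ε) (hσ : 0 < σ) (hτ : 0 < τ) (hB : τ ≤ B)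
    (hx : 0 < ρ x) : wt (wF J m σ τ B ρ) x ^ 2 / wb J m ε σ τ B ρ x
      ≤ ((sw J x + σ ^ 2) ^ m)⁻¹ * Real.exp 4 * ((sw J x + ε ^ 2) ^ 2 / ε ^ 2) := by
  have h0 := sw_nonneg J x
  have h1 : wt (wF J m σ τ B ρ) x = Real.exp (-(wP J m σ x + wK τ B ρ x)) * (1 + τ / ρ x) ^ 2 := by
    rw [← exp_wS hτ hx, ← Real.exp_add]; unfold wt wF; congr 1; ring
  have h2 := wK_le hτ hB hx
  have h3 : ((1 + τ / ρ x) * Real.exp (-(wK τ B ρ x) / 4)) ^ 4 ≤ Real.exp 4 := by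
    have : Real.exp 4 = Real.exp 1 ^ 4 := by rw [← Real.exp_nat_mul]; norm_num
    rw [this]; gcongr
  rw [mul_pow, ← Real.exp_nat_mul] at h3
  have e1 : Real.exp (((4 : ℕ) : ℝ) * (-(wK τ B ρ x) / 4)) = Real.exp (-(wK τ B ρ x)) := by congr 1; push_cast; ring
  rw [e1] at h3
  have e2 : Real.exp (-(wP J m σ x + wK τ B ρ x)) = ((sw J x + σ ^ 2) ^ m)⁻¹ * Real.exp (-(wK τ B ρ x)) := by
    rw [neg_add, Real.exp_add, Real.exp_neg (wP J m σ x), exp_wP J m hσ]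
  have hp : 0 < (sw J x + σ ^ 2) ^ m := by positivity
  have hk := Real.exp_pos (-(wK τ B ρ x))
  have e3 : wt (wF J m σ τ B ρ) x ^ 2 / wb J m ε σ τ B ρ x
      = ((sw J x + σ ^ 2) ^ m)⁻¹ * ((1 + τ / ρ x) ^ 4 * Real.exp (-(wK τ B ρ x))) * ((sw J x + ε ^ 2) ^ 2 / ε ^ 2) := by
    rw [h1, wb, e2]
    have : 0 < sw J x + ε ^ 2 := by positivity
    generalize (1 + τ / ρ x) = y
    generalize (sw J x + σ ^ 2) ^ m = p at *
    generalize Real.exp (-(wK τ B ρ x)) = k at *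
    field_simp
  rw [e3]; gcongr

lemma w_u {J : Finset (Fin n)} {m : ℕ} {ε σ τ B S0 : ℝ} {ρ : (Fin n → ℂ) → ℝ} {x} (hε : 0 < ε) (hσ : 0 < σ) (hτ : 0 < τ)
    (hx : 0 < ρ x) (hS : sw J x + ε ^ 2 ≤ S0) (hK : wK τ B ρ x ≤ 1) :
    (√(wa J m (1 + Real.log S0) ε σ τ B ρ x) * Real.exp (wF J m σ τ B ρ x)) ^ 2
      ≤ 12 * Real.exp 1 * wT J (1 + Real.log S0) ε x ^ 2 * (sw J x + σ ^ 2) ^ m := by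
  have h1 := wL_le hε hS
  have h2 := wE_ge (wT_ge hε hS)
  have hL : 0 ≤ wL J (1 + Real.log S0) ε x := by
    have : 0 ≤ (1 + wT J (1 + Real.log S0) ε x) ^ 2 := by positivity
    unfold wL; linarith
  have h0 := sw_nonneg J x
  have ha : 0 ≤ wa J m (1 + Real.log S0) ε σ τ B ρ x := by unfold wa; positivity
  rw [mul_pow, Real.sq_sqrt ha, wa, mul_assoc, ← Real.exp_nat_mul, ← Real.exp_add]
  have e : Real.exp (-(wP J m σ x + wK τ B ρ x) + ((2 : ℕ) : ℝ) * wF J m σ τ B ρ x)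
      ≤ (sw J x + σ ^ 2) ^ m * Real.exp 1 := by
    rw [← exp_wP J m hσ, ← Real.exp_add]
    refine Real.exp_le_exp.2 ?_
    have : 0 ≤ wS τ ρ x := by
      unfold wS
      have := Real.log_le_log hx (by linarith : ρ x ≤ ρ x + τ)
      linarith
    unfold wF; push_cast; linarith
  calc _ ≤ 2 * (6 * wT J (1 + Real.log S0) ε x ^ 2) * ((sw J x + σ ^ 2) ^ m * Real.exp 1) := by gcongr
    _ = _ := by ring

lemma w_T {J : Finset (Fin n)} {m : ℕ} (hm : 1 ≤ m) {ε σ S0 : ℝ} {x} (hε : 0 < ε) (hσ : 0 < σ) (hσε : σ ≤ ε)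
    (hS : sw J x + ε ^ 2 ≤ S0) :
    wT J (1 + Real.log S0) ε x ^ 2 * (sw J x + σ ^ 2) ^ m ≤ 2 * Real.exp 1 * S0 ^ m := by
  have h0 := sw_nonneg J x
  have h1 := wT_ge hε hS
  have hp : 0 < sw J x + ε ^ 2 := by positivity
  have hS0 : 0 < S0 := hp.trans_le hS
  have h2 : sw J x + ε ^ 2 = Real.exp 1 * S0 * Real.exp (-(wT J (1 + Real.log S0) ε x)) := by
    have : Real.exp 1 * S0 = Real.exp (1 + Real.log S0) := by rw [Real.exp_add, Real.exp_log hS0]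
    rw [this, ← Real.exp_add]
    nth_rw 1 [← Real.exp_log hp]
    congr 1; unfold wT; ring
  set t := wT J (1 + Real.log S0) ε x with ht
  have h3 : t ^ 2 ≤ 2 * Real.exp t := by
    have := Real.quadratic_le_exp_of_nonneg (by linarith : 0 ≤ t); linarith
  obtain ⟨k, rfl⟩ : ∃ k, m = k + 1 := ⟨m - 1, by omega⟩
  calc t ^ 2 * (sw J x + σ ^ 2) ^ (k + 1) ≤ (2 * Real.exp t) * (S0 ^ k * (sw J x + ε ^ 2)) := by
        rw [pow_succ (sw J x + σ ^ 2)]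
        have a : sw J x + σ ^ 2 ≤ sw J x + ε ^ 2 := by gcongr
        have b : sw J x + σ ^ 2 ≤ S0 := a.trans hS
        gcongr
    _ = 2 * Real.exp 1 * S0 ^ (k + 1) := by
        rw [h2, Real.exp_neg]; field_simp; ring

noncomputable def hx0 (i0 : Fin n) (ε : ℝ) (f : ℂ → ℂ) : (Fin n → ℂ) → ℂ :=
  fun x => cr (fun y => Real.smoothTransition (2 - 2 * (sw (Finset.univ.erase i0) y / ε ^ 2))) x * f (x i0)

lemma ev_sm (i0 : Fin n) {f : ℂ → ℂ} (hf : ContDiff ℝ (⊤ : ℕ∞) f) : Sm (fun x : Fin n → ℂ => f (x i0)) :=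
  hf.comp (contDiff_apply ℝ ℂ i0)

lemma ch_sm (i0 : Fin n) (ε : ℝ) :
    ContDiff ℝ (⊤ : ℕ∞) (fun y => Real.smoothTransition (2 - 2 * (sw (Finset.univ.erase i0) y / ε ^ 2))) :=
  Real.smoothTransition.contDiff.comp (contDiff_const.sub (contDiff_const.mul ((sw_sm _).div_const _)))

lemma hx0_sm (i0 : Fin n) (ε : ℝ) {f : ℂ → ℂ} (hf : ContDiff ℝ (⊤ : ℕ∞) f) : Sm (hx0 i0 ε f) :=
  Sm.mul' (cr_sm (ch_sm i0 ε)) (ev_sm i0 hf)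

lemma hx0_dzb (i0 : Fin n) {ε : ℝ} (hε : 0 < ε) {f : ℂ → ℂ} (hf : ContDiff ℝ (⊤ : ℕ∞) f) (j : Fin n) (x) :
    dzb (ee j) (hx0 i0 ε f) x =
      ((deriv Real.smoothTransition (2 - 2 * (sw (Finset.univ.erase i0) x / ε ^ 2)) * (-2 / ε ^ 2) : ℝ) : ℂ) *
        (if j ∈ Finset.univ.erase i0 then x j else 0) * f (x i0) +
      cr (fun y => Real.smoothTransition (2 - 2 * (sw (Finset.univ.erase i0) y / ε ^ 2))) x *
        dzb (ee j) (fun x => f (x i0)) x := by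
  unfold hx0
  rw [dzb_mul _ ((cr_sm (ch_sm i0 ε)).da _) ((ev_sm i0 hf).da _)]
  congr 2
  rw [← dzb_sw, dzb_comp (h := fun s => Real.smoothTransition (2 - 2 * (s / ε ^ 2))) _ (((sw_sm _).differentiable (by simp)) x)]
  have h1 : HasDerivAt (fun s : ℝ => 2 - 2 * (s / ε ^ 2)) (-2 / ε ^ 2) (sw (Finset.univ.erase i0) x) := by
    have := (((hasDerivAt_id (sw (Finset.univ.erase i0) x)).div_const (ε ^ 2)).const_mul 2).const_sub 2
    exact this.congr_deriv (by ring)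
  exact (sT_hd _).comp _ h1

lemma ev_dzb {i0 j : Fin n} (hj : j ≠ i0) {f : ℂ → ℂ} (hf : ContDiff ℝ (⊤ : ℕ∞) f) (x : Fin n → ℂ) :
    dzb (ee j) (fun x => f (x i0)) x = 0 := by
  have h : ∀ c : ℂ, fderiv ℝ (fun x : Fin n → ℂ => f (x i0)) x (c • ee j) = 0 := fun c => by
    have h1 : HasFDerivAt (fun x : Fin n → ℂ => x i0) (ContinuousLinearMap.proj (R := ℝ) (φ := fun _ : Fin n => ℂ) i0) x :=
      (ContinuousLinearMap.proj (R := ℝ) (φ := fun _ : Fin n => ℂ) i0).hasFDerivAt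
    have h2 := ((hf.differentiable (by simp)) (x i0)).hasFDerivAt.comp x h1
    rw [show (fun x : Fin n → ℂ => f (x i0)) = f ∘ fun x => x i0 from rfl, h2.fderiv]
    simp [ee, Ne.symm hj]
  have h1 := h 1
  have h2 := h Complex.I
  rw [one_smul] at h1
  unfold dzb; rw [h1, h2]; simp

lemma hx0_le (i0 : Fin n) {ε : ℝ} (hε : 0 < ε) {f : ℂ → ℂ} (hf : ContDiff ℝ (⊤ : ℕ∞) f) {C : ℝ}
    (hC : ∀ t, |deriv Real.smoothTransition t| ≤ C) (hC1 : ∀ t, 1 < t → deriv Real.smoothTransition t = 0)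
    (hC0 : ∀ t, t < 0 → deriv Real.smoothTransition t = 0) (x) :
    let J := Finset.univ.erase i0
    ∑ j ∈ J, ‖dzb (ee j) (hx0 i0 ε f) x‖ ^ 2 ≤ (4 * C ^ 2 / ε ^ 2) * ‖f (x i0)‖ ^ 2 ∧
    (¬ (ε ^ 2 / 2 ≤ sw J x ∧ sw J x ≤ ε ^ 2) → ∑ j ∈ J, ‖dzb (ee j) (hx0 i0 ε f) x‖ ^ 2 = 0) := by
  intro J
  set d := deriv Real.smoothTransition (2 - 2 * (sw J x / ε ^ 2)) with hd
  have h1 : ∑ j ∈ J, ‖dzb (ee j) (hx0 i0 ε f) x‖ ^ 2 = (d * (-2 / ε ^ 2)) ^ 2 * sw J x * ‖f (x i0)‖ ^ 2 := by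
    rw [sw, Finset.mul_sum, Finset.sum_mul]
    refine Finset.sum_congr rfl fun j hj => ?_
    rw [hx0_dzb i0 hε hf, ev_dzb (Finset.ne_of_mem_erase hj) hf, if_pos hj, mul_zero, add_zero, norm_mul, norm_mul,
      Complex.norm_real, mul_pow, mul_pow, Real.norm_eq_abs, sq_abs]
  have h0 := sw_nonneg J x
  have h2 : ¬ (ε ^ 2 / 2 ≤ sw J x ∧ sw J x ≤ ε ^ 2) → d = 0 := fun h => by
    rw [not_and_or] at h
    rcases h with h | h
    · refine hC1 _ ?_
      have : sw J x / ε ^ 2 < 1 / 2 := by rw [div_lt_iff₀ (by positivity)]; linarith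
      linarith
    · refine hC0 _ ?_
      have : 1 < sw J x / ε ^ 2 := by rw [lt_div_iff₀ (by positivity)]; linarith
      linarith
  rw [h1]
  refine ⟨?_, fun h => by rw [h2 h]; ring⟩
  by_cases h : ε ^ 2 / 2 ≤ sw J x ∧ sw J x ≤ ε ^ 2
  · have h3 : d ^ 2 ≤ C ^ 2 := sq_le_sq' (abs_le.1 (hC _)).1 (abs_le.1 (hC _)).2
    calc _ = d ^ 2 * (4 / ε ^ 4) * sw J x * ‖f (x i0)‖ ^ 2 := by ring
      _ ≤ C ^ 2 * (4 / ε ^ 4) * ε ^ 2 * ‖f (x i0)‖ ^ 2 := by gcongr; exact h.2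
      _ = _ := by field_simp
  · rw [h2 h]; simp only [zero_mul, ne_eq, OfNat.ofNat_ne_zero, not_false_eq_true, zero_pow]; positivity
end

section
variable {n : ℕ}

def bx (i0 : Fin n) (ε : ℝ) : Set (Fin n → ℂ) := {x | ∀ i ∈ Finset.univ.erase i0, ‖x i‖ ≤ ε}

lemma bx_meas (i0 : Fin n) (ε : ℝ) : MeasurableSet (bx i0 ε) := by
  have : bx i0 ε = ⋂ i ∈ Finset.univ.erase i0, {x | ‖x i‖ ≤ ε} := by ext; simp [bx]
  rw [this]
  exact Finset.measurableSet_biInter _ fun i _ => (isClosed_le (continuous_apply i).norm continuous_const).measurableSet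

lemma bx_of {i0 : Fin n} {ε : ℝ} (hε : 0 < ε) {x} (h : sw (Finset.univ.erase i0) x ≤ ε ^ 2) : x ∈ bx i0 ε := fun i hi => by
  have h1 : ‖x i‖ ^ 2 ≤ sw (Finset.univ.erase i0) x :=
    Finset.single_le_sum (f := fun i => ‖x i‖ ^ 2) (fun i _ => by positivity) hi
  exact abs_le_of_sq_le_sq' (h1.trans h) hε.le |>.2

lemma ot_h (i0 : Fin n) {ε : ℝ} (hε : 0 < ε) (hε1 : ε ≤ 1) {f : ℂ → ℂ} (hf : ContDiff ℝ (⊤ : ℕ∞) f) :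
    ∫⁻ x, ‖hx0 i0 ε f x‖ₑ ^ 2 ≤ volume (closedBall (0 : ℂ) 1) ^ (n - 1) * ∫⁻ z, ‖f z‖ₑ ^ 2 := by
  have h1 : ∀ x, ‖hx0 i0 ε f x‖ₑ ^ 2 ≤ (bx i0 ε).indicator (fun x => ‖f (x i0)‖ₑ ^ 2) x := fun x => by
    by_cases h : sw (Finset.univ.erase i0) x ≤ ε ^ 2
    · rw [indicator_of_mem (bx_of hε h), esq_ofReal, esq_ofReal]
      refine ENNReal.ofReal_le_ofReal ?_
      have : ‖hx0 i0 ε f x‖ ≤ 1 * ‖f (x i0)‖ := by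
        rw [hx0, norm_mul, Complex.norm_real, Real.norm_of_nonneg (Real.smoothTransition.nonneg _)]
        gcongr; exact Real.smoothTransition.le_one _
      rw [one_mul] at this
      gcongr
    · have : hx0 i0 ε f x = 0 := by
        rw [hx0, cr, Real.smoothTransition.zero_of_nonpos]; simp
        have : 1 < sw (Finset.univ.erase i0) x / ε ^ 2 := by rw [lt_div_iff₀ (by positivity)]; linarith
        linarith
      rw [this]; simp
  refine (lintegral_mono h1).trans ?_
  rw [lintegral_indicator (bx_meas i0 ε), bx, pi_fub i0 ε (g := fun z => ‖f z‖ₑ ^ 2) (hf.continuous.enorm.measurable.pow_const 2)]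
  gcongr

lemma ot_B (hn : 2 ≤ n) (i0 : Fin n) : ∃ Cb : ℝ≥0∞, Cb ≠ ⊤ ∧ ∀ {ε σ τ B : ℝ} {ρ : (Fin n → ℂ) → ℝ} {f : ℂ → ℂ}, Continuous ρ →
    0 < ε → 0 < σ → 0 < τ → τ ≤ B → ContDiff ℝ (⊤ : ℕ∞) f →
    ∫⁻ x in {x | 0 < ρ x}, ENNReal.ofReal (wt (wF (Finset.univ.erase i0) (n - 1) σ τ B ρ) x ^ 2 / wb (Finset.univ.erase i0) (n - 1) ε σ τ B ρ x) *
      ∑ j ∈ Finset.univ.erase i0, ‖dzb (ee j) (hx0 i0 ε f) x‖ₑ ^ 2 ≤ Cb * ∫⁻ z, ‖f z‖ₑ ^ 2 := by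
  obtain ⟨C, hC0, hC, hC1, hC2⟩ := sT_deriv
  set J := Finset.univ.erase i0
  obtain ⟨m, hm⟩ : ∃ m, m = n - 1 := ⟨_, rfl⟩
  rw [← hm]
  refine ⟨ENNReal.ofReal (16 * C ^ 2 * Real.exp 4 * 2 ^ m) * volume (closedBall (0 : ℂ) 1) ^ m,
    ENNReal.mul_ne_top ENNReal.ofReal_ne_top (ENNReal.pow_ne_top measure_closedBall_lt_top.ne), ?_⟩
  intro ε σ τ B ρ f hρ hε hσ hτ hB hf
  set A := 16 * C ^ 2 * Real.exp 4 * 2 ^ m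
  have hA : 0 ≤ A := by positivity
  have h1 : ∀ x ∈ {x | 0 < ρ x}, ENNReal.ofReal (wt (wF J m σ τ B ρ) x ^ 2 / wb J m ε σ τ B ρ x) *
      ∑ j ∈ J, ‖dzb (ee j) (hx0 i0 ε f) x‖ₑ ^ 2 ≤
      (bx i0 ε).indicator (fun x => ENNReal.ofReal (A * ((ε ^ 2) ^ m)⁻¹) * ‖f (x i0)‖ₑ ^ 2) x := fun x hx => by
    obtain ⟨ha, hb⟩ := hx0_le i0 hε hf hC hC1 hC2 x
    rw [esq_sum_ofReal]
    by_cases h : ε ^ 2 / 2 ≤ sw J x ∧ sw J x ≤ ε ^ 2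
    · rw [indicator_of_mem (bx_of hε h.2), esq_ofReal, ← ENNReal.ofReal_mul' (by positivity), ← ENNReal.ofReal_mul (by positivity)]
      refine ENNReal.ofReal_le_ofReal ?_
      have h2 := w_hB (J := J) (m := m) hε hσ hτ hB hx
      have h0 := sw_nonneg J x
      calc _ ≤ (((ε ^ 2 / 2) ^ m)⁻¹ * Real.exp 4 * ((ε ^ 2 + ε ^ 2) ^ 2 / ε ^ 2)) * ((4 * C ^ 2 / ε ^ 2) * ‖f (x i0)‖ ^ 2) := by
            refine mul_le_mul (h2.trans ?_) ha (by positivity) (by positivity)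
            have e1 : ε ^ 2 / 2 ≤ sw J x + σ ^ 2 := by nlinarith [h.1]
            have e2 := h.2
            gcongr
        _ = _ := by rw [div_pow]; simp only [A]; field_simp; ring
    · rw [hb h]; simp
  refine (setLIntegral_mono' (isOpen_lt continuous_const hρ).measurableSet h1).trans ?_
  refine (setLIntegral_le_lintegral _ _).trans ?_
  rw [lintegral_indicator (bx_meas i0 ε), bx,
    pi_fub i0 ε (g := fun z => ENNReal.ofReal (A * ((ε ^ 2) ^ m)⁻¹) * ‖f z‖ₑ ^ 2) ((hf.continuous.enorm.measurable.pow_const 2).const_mul _),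
    lintegral_const_mul _ (hf.continuous.enorm.measurable.pow_const 2), ← mul_assoc, ← hm]
  refine mul_le_mul_left (le_of_eq ?_) _
  rw [Complex.volume_closedBall, Complex.volume_closedBall, ENNReal.ofReal_mul hA, mul_pow]
  have e : (ENNReal.ofReal ε ^ 2) ^ m * ENNReal.ofReal ((ε ^ 2) ^ m)⁻¹ = 1 := by
    rw [← ENNReal.ofReal_pow hε.le, ← ENNReal.ofReal_pow (by positivity), ← ENNReal.ofReal_mul (by positivity), mul_inv_cancel₀ (by positivity), ENNReal.ofReal_one]
  calc _ = ((ENNReal.ofReal ε ^ 2) ^ m * ENNReal.ofReal ((ε ^ 2) ^ m)⁻¹) * (ENNReal.ofReal A * (NNReal.pi : ℝ≥0∞) ^ m) := by ring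
    _ = _ := by rw [e]; simp

lemma ot_α (i0 : Fin n) {ε σ τ B S0 : ℝ} {ρ : (Fin n → ℂ) → ℝ} {γ M : ℝ} (hR : RH ρ γ M) (hε : 0 < ε) (hσ : 0 < σ) (hτ : 0 < τ) (hB : τ ≤ B)
    {J : Finset (Fin n)} {m : ℕ} (hS : ∀ x, 0 < ρ x → sw J x + ε ^ 2 ≤ S0) {g : (Fin n → ℂ) → ℂ} (hg : Continuous g) :
    MemLp ({x | 0 < ρ x}.indicator (fun x => ex (wF J m σ τ B ρ) (-1/2) x * g x)) 2 := by
  have ho : MeasurableSet {x | 0 < ρ x} := (isOpen_lt continuous_const hR.sm.continuous).measurableSet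
  obtain ⟨C, hC⟩ := hR.cpt.exists_bound_of_continuousOn hg.continuousOn
  rw [memLp_indicator_iff_restrict ho]
  have hfin : IsFiniteMeasure (volume.restrict {x | 0 < ρ x}) :=
    ⟨by rw [Measure.restrict_apply_univ]
        exact (measure_mono (fun x (hx : 0 < ρ x) => (hx.le : 0 ≤ ρ x))).trans_lt hR.cpt.measure_lt_top⟩
  refine MemLp.of_bound (ContinuousOn.aestronglyMeasurable (fun x hx => ?_) ho) (((σ ^ 2) ^ m)⁻¹ + 1 + Real.exp 1 * (((σ ^ 2) ^ m)⁻¹ + 1) * C) ?_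
  · obtain ⟨h1, h2, h3, h4, h5⟩ := cda_w (m := m) (B := B) hε hσ hτ hR.sm hx (hS x hx)
    refine ContinuousAt.continuousWithinAt (ContinuousAt.mul ?_ hg.continuousAt)
    exact Complex.continuous_ofReal.continuousAt.comp (Real.continuous_exp.continuousAt.comp
      (continuousAt_const.mul ((h3.add h4).sub h5).continuousAt))
  · filter_upwards [ae_restrict_mem ho] with x hx
    have hx' : 0 < ρ x := hx
    have h0 := sw_nonneg J x
    have hCx := hC x hx'.le
    have hC0 : 0 ≤ C := (norm_nonneg _).trans hCx
    have h1 := wK_le hτ hB hx'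
    have h2 : Real.exp (-1 / 2 * wF J m σ τ B ρ x) = Real.exp (-(wP J m σ x) / 2) * Real.exp (-(wK τ B ρ x) / 2) * (1 + τ / ρ x) := by
      have : 1 + τ / ρ x = Real.exp (wS τ ρ x / 2) := by
        have e := exp_wS hτ hx'
        have : Real.exp (wS τ ρ x / 2) ^ 2 = (1 + τ / ρ x) ^ 2 := by rw [← e, ← Real.exp_nat_mul]; congr 1; push_cast; ring
        exact ((sq_eq_sq₀ (by positivity) (by positivity)).1 this).symm
      rw [this, ← Real.exp_add, ← Real.exp_add]; congr 1; unfold wF; ring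
    have hK : 0 ≤ wK τ B ρ x := by unfold wK; have : 0 ≤ B := hτ.le.trans hB; positivity
    have h3 : Real.exp (-(wK τ B ρ x) / 2) * (1 + τ / ρ x) ≤ Real.exp 1 := by
      refine le_trans ?_ h1
      rw [mul_comm]
      exact mul_le_mul_of_nonneg_left (Real.exp_le_exp.2 (by linarith)) (by positivity)
    have h4 : Real.exp (-(wP J m σ x) / 2) ≤ ((σ ^ 2) ^ m)⁻¹ + 1 := by
      have e : Real.exp (-(wP J m σ x) / 2) ^ 2 = ((sw J x + σ ^ 2) ^ m)⁻¹ := by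
        rw [← exp_wP J m hσ, ← Real.exp_neg, ← Real.exp_nat_mul]; congr 1; push_cast; ring
      have e2 : ((sw J x + σ ^ 2) ^ m)⁻¹ ≤ ((σ ^ 2) ^ m)⁻¹ := by gcongr; linarith
      nlinarith [sq_nonneg (Real.exp (-(wP J m σ x) / 2) - 1)]
    rw [norm_mul, ex, Complex.norm_real, Real.norm_of_nonneg (Real.exp_pos _).le, h2, mul_assoc (Real.exp _)]
    have h5 : 0 ≤ ((σ ^ 2) ^ m)⁻¹ := by positivity
    calc _ ≤ (((σ ^ 2) ^ m)⁻¹ + 1) * Real.exp 1 * C := by gcongr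
      _ ≤ _ := by nlinarith
end

section
variable {n : ℕ}

lemma enorm_cast_sq (w : ℝ) : ‖(w : ℂ)‖ₑ ^ 2 = ENNReal.ofReal (w ^ 2) := by
  rw [esq_ofReal, Complex.norm_real, Real.norm_eq_abs, sq_abs]

theorem ot0 (hn : 2 ≤ n) (i0 : Fin n) (S0 : ℝ) : ∃ C0 : ℝ≥0∞, C0 ≠ ⊤ ∧
    ∀ {ρ : (Fin n → ℂ) → ℝ} {γ M : ℝ}, RH ρ γ M → ∀ {ε : ℝ}, 0 < ε → ε ≤ 1 →
    (∀ x, 0 < ρ x → sw (Finset.univ.erase i0) x + ε ^ 2 ≤ S0) →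
    ∀ {f : ℂ → ℂ}, ContDiff ℝ (⊤ : ℕ∞) f →
    (∀ x, 0 < ρ x → sw (Finset.univ.erase i0) x ≤ ε ^ 2 → DifferentiableAt ℂ f (x i0)) →
    (∫⁻ z, ‖f z‖ₑ ^ 2 ≠ ⊤) → ∀ {ρ0 tol r : ℝ}, 0 < ρ0 → 0 < tol → 0 < r →
    ∃ F : (Fin n → ℂ) → ℂ, MemLp F 2 ∧ ∫⁻ x, ‖F x‖ₑ ^ 2 ≤ C0 * ∫⁻ z, ‖f z‖ₑ ^ 2 ∧ WkHol F {x | ρ0 < ρ x} ∧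
      ∀ (l : ℂ) (ε' : ℝ), 0 < ε' → closedBall (l • ee i0) r ⊆ {x | ρ0 < ρ x} →
        closedBall (l • ee i0) (2 * ε') ⊆ {x | ρ0 < ρ x} → ‖moll ε' F (l • ee i0) - f l‖ ≤ tol := by
  obtain ⟨Cb, hCb, hB⟩ := ot_B hn i0
  set J := Finset.univ.erase i0 with hJ
  obtain ⟨m, hm⟩ : ∃ m, m = n - 1 := ⟨_, rfl⟩
  have hm1 : 1 ≤ m := by omega
  rw [← hm] at hB
  set V1 := volume (closedBall (0 : ℂ) 1) ^ (n - 1) with hV1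
  have hV1t : V1 ≠ ⊤ := ENNReal.pow_ne_top measure_closedBall_lt_top.ne
  set A1 := 12 * Real.exp 1 * (2 * Real.exp 1 * S0 ^ m)
  refine ⟨2 * V1 + 2 * (ENNReal.ofReal A1 * (8 * Cb)), ENNReal.add_ne_top.2
    ⟨ENNReal.mul_ne_top ENNReal.ofNat_ne_top hV1t, ENNReal.mul_ne_top ENNReal.ofNat_ne_top (ENNReal.mul_ne_top ENNReal.ofReal_ne_top
      (ENNReal.mul_ne_top ENNReal.ofNat_ne_top hCb))⟩, ?_⟩
  intro ρ γ M hR ε hε hε1 hS f hf hfh hft ρ0 tol r hρ0 htol hr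
  set M1 := ∫⁻ z, ‖f z‖ₑ ^ 2 with hM1
  set T := 1 + Real.log S0 with hT
  set Tm := T - Real.log (ε ^ 2) with hTm
  set N : ℝ := (ENNReal.ofReal (12 * Real.exp 1 * Tm ^ 2) * (8 * (Cb * M1))).toReal with hN
  have hNt : ENNReal.ofReal (12 * Real.exp 1 * Tm ^ 2) * (8 * (Cb * M1)) ≠ ⊤ :=
    ENNReal.mul_ne_top ENNReal.ofReal_ne_top (ENNReal.mul_ne_top ENNReal.ofNat_ne_top (ENNReal.mul_ne_top hCb hft))
  have hn0 : (2 : ℝ) ≤ n := by exact_mod_cast hn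
  set r0 := min r (ε / (2 * n)) with hr0
  have hr0p : 0 < r0 := lt_min hr (by positivity)
  obtain ⟨σ, hσ, hσε, hI⟩ := sk_big hn i0 hr0p (N / tol ^ 2 + 1) hε
  obtain ⟨B0, hB0⟩ := HDw (J := J) (m := m) hR hε hS
  set B := max B0 1 with hBd
  have hB1 : 1 ≤ B := le_max_right _ _
  have hBp : 0 < B := by linarith
  set τ := min 1 (ρ0 ^ 2 / B) with hτd
  have hτ : 0 < τ := lt_min one_pos (by positivity)
  have hτB : τ ≤ B := (min_le_left _ _).trans hB1
  have hK : ∀ x, ρ0 < ρ x → wK τ B ρ x ≤ 1 := fun x hx => by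
    have h1 : B * τ ≤ ρ0 ^ 2 := by
      have := min_le_right 1 (ρ0 ^ 2 / B)
      rw [← hτd, le_div_iff₀ hBp] at this; linarith
    rw [wK, ← div_eq_mul_inv, div_le_one (pow_pos (hρ0.trans hx) 2)]
    exact h1.trans (by gcongr)
  obtain ⟨C, H⟩ := hB0 B (le_max_left _ _) hBp σ hσ τ hτ
  have hhs := hx0_sm i0 ε hf
  set h := hx0 i0 ε f with hh
  obtain ⟨k, hk, hkb, hkw⟩ := hor_solve H hhs (fun j => ot_α i0 hR hε hσ hτ hτB hS (hhs.dzb _).continuous)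
    (fun j hj x hx => by
      have hj0 : j = i0 := by by_contra hne; exact hj (Finset.mem_erase.2 ⟨hne, Finset.mem_univ _⟩)
      rw [hh, hx0_dzb i0 hε hf, if_neg hj, mul_zero, zero_mul, zero_add]
      by_cases hs : sw J x ≤ ε ^ 2
      · rw [dz_holo (f := fun x : Fin n → ℂ => f (x i0)) _ ((hfh x hx hs).comp x (differentiableAt_apply i0 x)), mul_zero]
      · rw [cr, Real.smoothTransition.zero_of_nonpos]; simp
        have : 1 < sw (Finset.univ.erase i0) x / ε ^ 2 := by rw [lt_div_iff₀ (by positivity)]; linarith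
        linarith)
    (ENNReal.mul_ne_top hCb hft) (hB hR.sm.continuous hε hσ hτ hτB hf)
  set wr : (Fin n → ℂ) → ℝ := fun x => √(wa J m T ε σ τ B ρ x) * Real.exp (wF J m σ τ B ρ x) with hwr
  set Q := {x | ρ0 < ρ x} with hQ
  have hQo : IsOpen Q := isOpen_lt continuous_const hR.sm.continuous
  have hQD : Q ⊆ {x | 0 < ρ x} := fun x hx => hρ0.trans hx
  have hwc : ContinuousOn (fun x => ((wr x : ℝ) : ℂ)) {x | 0 < ρ x} := Complex.continuous_ofReal.comp_continuousOn
    ((Real.continuous_sqrt.comp_continuousOn H.ha).mul (Real.continuous_exp.comp_continuousOn H.hΦ.continuousOn))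
  have hw1 : ∀ x ∈ Q, wr x ^ 2 ≤ 12 * Real.exp 1 * wT J T ε x ^ 2 * (sw J x + σ ^ 2) ^ m := fun x hx =>
    w_u hε hσ hτ (hQD hx) (hS x (hQD hx)) (hK x hx)
  have hw2 : ∀ x ∈ Q, wr x ^ 2 ≤ A1 := fun x hx => by
    refine (hw1 x hx).trans ?_
    rw [mul_assoc]
    have := w_T hm1 hε hσ hσε (hS x (hQD hx))
    exact mul_le_mul_of_nonneg_left this (by positivity)
  set F := Q.indicator (fun x => h x + k x * (wr x : ℂ)) with hF
  have hFm : AEStronglyMeasurable F volume := by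
    rw [hF, aestronglyMeasurable_indicator_iff hQo.measurableSet]
    exact hhs.continuous.aestronglyMeasurable.add (hk.1.restrict.mul ((hwc.mono hQD).aestronglyMeasurable hQo.measurableSet))
  have hF2 : ∫⁻ x, ‖F x‖ₑ ^ 2 ≤ (2 * V1 + 2 * (ENNReal.ofReal A1 * (8 * Cb))) * M1 := by
    calc _ ≤ ∫⁻ x, (2 * ‖h x‖ₑ ^ 2 + 2 * (ENNReal.ofReal A1 * ‖k x‖ₑ ^ 2)) := by
          refine lintegral_mono fun x => ?_
          by_cases hx : x ∈ Q
          · rw [hF, indicator_of_mem hx]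
            refine (esq_norm_add _ _).trans ?_
            rw [enorm_mul, mul_pow, mul_comm (‖k x‖ₑ ^ 2), enorm_cast_sq]
            gcongr
            exact hw2 x hx
          · rw [hF, indicator_of_notMem hx]; simp
      _ ≤ 2 * (V1 * M1) + 2 * (ENNReal.ofReal A1 * (8 * (Cb * M1))) := by
          rw [lintegral_add_left ((hhs.continuous.enorm.measurable.pow_const 2).const_mul _), lintegral_const_mul _ (hhs.continuous.enorm.measurable.pow_const 2),
            lintegral_const_mul' _ _ ENNReal.ofNat_ne_top, lintegral_const_mul' _ _ ENNReal.ofReal_ne_top]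
          gcongr
          exact ot_h i0 hε hε1 hf
      _ = _ := by ring
  have hFL : MemLp F 2 := memLp2_of hFm (hF2.trans_lt (lt_top_iff_ne_top.2 (ENNReal.mul_ne_top (ENNReal.add_ne_top.2
    ⟨ENNReal.mul_ne_top ENNReal.ofNat_ne_top hV1t, ENNReal.mul_ne_top ENNReal.ofNat_ne_top (ENNReal.mul_ne_top ENNReal.ofReal_ne_top
      (ENNReal.mul_ne_top ENNReal.ofNat_ne_top hCb))⟩) hft)))
  have hFw : WkHol F Q := by
    intro j ψ hψ hc hs
    rw [← hkw j ψ hψ hc (hs.trans hQD)]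
    refine integral_congr_ae (Eventually.of_forall fun x => ?_)
    by_cases hx : x ∈ Q
    · simp only [hF, indicator_of_mem hx]; rfl
    · have : dzb (ee j) ψ x = 0 := dzb_supp _ (fun h => hx (hs h))
      simp only [this, mul_zero]
  refine ⟨F, hFL, hF2, hFw, fun l ε' hε' hc1 hc2 => ?_⟩
  obtain ⟨G, hGd, hGe, hGm⟩ := weyl hQo hFL hFw
  rw [← hGm ε' _ hε' hc2]
  set p : Fin n → ℂ := l • ee i0 with hp
  have hpi : p i0 = l := by simp [hp, ee]
  have hpj : ∀ i ∈ J, p i = 0 := fun i hi => by simp [hp, ee, Finset.ne_of_mem_erase hi]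
  have hsp : ∀ y, sw J (p - y) = sw J y := fun y => Finset.sum_congr rfl fun i hi => by simp [hpj i hi]
  set U := Q ∩ {x | sw J x < ε ^ 2 / 2} with hU
  have hUo : IsOpen U := hQo.inter (isOpen_lt (sw_sm J).continuous continuous_const)
  have hsr : ∀ y : Fin n → ℂ, ‖y‖ ≤ r0 → sw J y < ε ^ 2 / 2 := fun y hy => by
    have h1 : ‖y‖ ≤ ε / (2 * n) := hy.trans (min_le_right _ _)
    calc sw J y ≤ ∑ i : Fin n, (ε / (2 * n)) ^ 2 := by
          refine (Finset.sum_le_sum_of_subset_of_nonneg (Finset.subset_univ J) fun _ _ _ => by positivity).trans (Finset.sum_le_sum fun i _ => ?_)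
          have := (norm_le_pi_norm y i).trans h1
          gcongr
      _ = ε ^ 2 / (4 * n) := by simp; field_simp; ring
      _ < _ := by rw [div_lt_div_iff₀ (by positivity) (by positivity)]; nlinarith [pow_pos hε 2]
  have hcU : closedBall p r0 ⊆ U := fun x hx => ⟨hc1 (closedBall_subset_closedBall (min_le_left _ _) hx), by
    show sw J x < _
    rw [← hsp x]
    rw [mem_closedBall, dist_comm, dist_eq_norm] at hx
    exact hsr _ hx⟩
  have hHd : DifferentiableOn ℂ (fun x => G x - f (x i0)) U := fun x hx => by
    refine DifferentiableWithinAt.sub ((hGd x hx.1).mono inter_subset_left) (DifferentiableAt.differentiableWithinAt ?_)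
    have h2 : sw J x < ε ^ 2 / 2 := hx.2
    exact (hfh x (hQD hx.1) (by nlinarith [pow_pos hε 2])).comp x (differentiableAt_apply i0 x)
  have hmv := mean_value_sq hUo hHd hcU (sk_int i0 r0 hσ) (fun y hy => indicator_of_notMem (by simpa using hy) _)
    (fun y => indicator_nonneg (fun y _ => by have := sw_nonneg (Finset.univ.erase i0) y; positivity) y)
    (fun c hc y => by
      unfold sk
      have e1 : sw (Finset.univ.erase i0) (c • y) = sw (Finset.univ.erase i0) y := by simp [sw, hc]
      have e2 : c • y ∈ closedBall (0 : Fin n → ℂ) r0 ↔ y ∈ closedBall (0 : Fin n → ℂ) r0 := by simp [norm_smul, hc]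
      by_cases hy : y ∈ closedBall (0 : Fin n → ℂ) r0
      · rw [indicator_of_mem hy, indicator_of_mem (e2.2 hy), e1]
      · rw [indicator_of_notMem hy, indicator_of_notMem (fun h => hy (e2.1 h))])
  have hae : ∀ᵐ y, p - y ∈ Q → G (p - y) = F (p - y) :=
    (quasiMeasurePreserving_sub_left_of_right_invariant volume p).ae hGe
  have hbd : ∫ y, ‖G (p - y) - f ((p - y) i0)‖ ^ 2 * sk i0 r0 σ y ≤ N := by
    refine (Real.le_norm_self _).trans ?_
    rw [← toReal_enorm]
    refine ENNReal.toReal_mono hNt ((enorm_integral_le_lintegral_enorm _).trans ?_)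
    calc _ ≤ ∫⁻ y, ENNReal.ofReal (12 * Real.exp 1 * Tm ^ 2) * ‖k (p - y)‖ₑ ^ 2 := by
          refine lintegral_mono_ae ?_
          filter_upwards [hae] with y hy
          by_cases hyr : y ∈ closedBall (0 : Fin n → ℂ) r0
          · have hyU : p - y ∈ U := hcU (by simpa using hyr)
            have hs : sw J (p - y) < ε ^ 2 / 2 := hyU.2
            have hh1 : h (p - y) = f ((p - y) i0) := by
              rw [hh, hx0, cr, Real.smoothTransition.one_of_one_le]; simp
              have : sw (Finset.univ.erase i0) (p - y) / ε ^ 2 ≤ 1 / 2 := by rw [div_le_iff₀ (by positivity)]; linarith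
              linarith
            rw [hy hyU.1, hF, indicator_of_mem hyU.1, hh1, add_sub_cancel_left, sk, indicator_of_mem hyr, ← hJ, ← hm, ← hsp y,
              esq_ofReal, ← ENNReal.ofReal_mul (by positivity), Real.enorm_eq_ofReal]
            · refine ENNReal.ofReal_le_ofReal ?_
              have h0 := sw_nonneg J (p - y)
              have hpp : 0 < (sw J (p - y) + σ ^ 2) ^ m := by positivity
              rw [norm_mul, Complex.norm_real, mul_pow, Real.norm_eq_abs, sq_abs, mul_assoc, ← div_eq_mul_inv, mul_comm]
              refine mul_le_mul_of_nonneg_right ?_ (by positivity)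
              rw [div_le_iff₀ hpp]
              refine (hw1 _ hyU.1).trans ?_
              have e1 := wT_ge hε (hS _ (hQD hyU.1))
              have e2 := wT_le (J := J) (S0 := S0) (x := p - y) hε
              rw [← hT] at e1 e2
              gcongr
            · have h0 := sw_nonneg J (p - y)
              positivity
          · rw [sk, indicator_of_notMem hyr]; simp
      _ ≤ _ := by
          rw [lintegral_const_mul' _ _ ENNReal.ofReal_ne_top, lintegral_sub_left_eq_self (fun y => ‖k y‖ₑ ^ 2) p]
          gcongr
  have hfin := hmv.trans hbd
  simp only [hpi] at hfin
  by_contra hcon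
  push Not at hcon
  have hN0 : 0 ≤ N := ENNReal.toReal_nonneg
  have h1 : tol ^ 2 < ‖G p - f l‖ ^ 2 := by gcongr
  have h2 : tol ^ 2 * (N / tol ^ 2 + 1) ≤ N := by
    refine le_trans ?_ hfin
    exact mul_le_mul h1.le hI (by positivity) (by positivity)
  have h3 : tol ^ 2 * (N / tol ^ 2 + 1) = N + tol ^ 2 := by field_simp
  nlinarith [pow_pos htol 2]
end

section
variable {n : ℕ}

lemma cut1 {K : Set ℂ} (hK : IsCompact K) (hKn : K.Nonempty) {f : ℂ → ℂ} (hf : DifferentiableOn ℂ f Kᶜ) {d R : ℝ} (hd : 0 < d) :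
    ∃ f1 : ℂ → ℂ, ContDiff ℝ (⊤ : ℕ∞) f1 ∧ (∀ z, d < infDist z K → ‖z‖ < R → f1 =ᶠ[𝓝 z] f) ∧
      ∀ z, ‖f1 z‖ₑ ≤ ({z | d / 2 ≤ infDist z K} ∩ closedBall 0 (R + 1)).indicator (fun z => ‖f z‖ₑ) z := by
  have hc : Continuous (fun z => infDist z K) := continuous_infDist_pt K
  obtain ⟨χ, h1, h2, h3, h4⟩ := cutoff (s := {z : ℂ | infDist z K ≤ d / 2} ∪ {z | R + 1 ≤ ‖z‖}) (t := {z | d ≤ infDist z K} ∩ {z | ‖z‖ ≤ R})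
    ((isClosed_le hc continuous_const).union (isClosed_le continuous_const continuous_norm))
    ((isClosed_le continuous_const hc).inter (isClosed_le continuous_norm continuous_const)) (by
      rw [disjoint_left]
      rintro z (hz | hz) ⟨hz1, hz2⟩ <;> simp only [mem_setOf_eq] at hz hz1 hz2 <;> linarith)
  rw [eventually_nhdsSet_iff_forall] at h2 h3
  refine ⟨fun z => (χ z : ℂ) * f z, contDiff_iff_contDiffAt.2 fun z => ?_, fun z hz hz' => ?_, fun z => ?_⟩
  · by_cases hz : z ∈ K
    · have : (fun z => (χ z : ℂ) * f z) =ᶠ[𝓝 z] fun _ => 0 := by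
        filter_upwards [h2 z (Or.inl (by simp [infDist_zero_of_mem hz]; positivity))] with y hy
        simp [hy]
      exact contDiffAt_const.congr_of_eventuallyEq this
    · exact (cr_sm h1).contDiffAt.mul (((hf.contDiffOn hK.isClosed.isOpen_compl).contDiffAt
        (hK.isClosed.isOpen_compl.mem_nhds hz)).restrict_scalars ℝ)
  · filter_upwards [h3 z ⟨hz.le, hz'.le⟩] with y hy
    simp [hy]
  · by_cases hz : z ∈ {z | d / 2 ≤ infDist z K} ∩ closedBall 0 (R + 1)
    · rw [indicator_of_mem hz, enorm_mul]
      refine mul_le_of_le_one_left (zero_le) ?_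
      rw [← ofReal_norm, Complex.norm_real, Real.norm_of_nonneg (h4 z).1]
      exact ENNReal.ofReal_le_one.2 (h4 z).2
    · have : χ z = 0 := by
        refine (h2 z ?_).self_of_nhds
        rw [mem_inter_iff, not_and_or] at hz
        rcases hz with hz | hz
        · left; simp only [mem_setOf_eq, not_le] at hz ⊢; exact hz.le
        · right; simp only [mem_closedBall_zero_iff, not_le] at hz; exact hz.le
      simp [this]

theorem ot1 (hn : 2 ≤ n) (i0 : Fin n) {D : Set (Fin n → ℂ)} (hD : IsOpen D) {R : ℝ} (hDR : D ⊆ ball 0 R)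
    (hRH : ∀ Q ⊆ D, IsCompact Q → ∃ ρ γ M, RH ρ γ M ∧ {x | 0 ≤ ρ x} ⊆ D ∧ Q ⊆ {x | 0 < ρ x})
    {K : Set ℂ} (hK : IsCompact K) (hKn : K.Nonempty) (hKD : ∀ l ∈ K, l • ee i0 ∉ D)
    {f : ℕ → ℂ → ℂ} (hf : ∀ N, DifferentiableOn ℂ (f N) Kᶜ) {M0 : ℝ≥0∞} (hM0 : M0 ≠ ⊤)
    (hfM : ∀ N : ℕ, ∫⁻ z in {z | 1 / ((N : ℝ) + 1) ≤ infDist z K} ∩ closedBall 0 (R + 1), ‖f N z‖ₑ ^ 2 ≤ M0) :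
    ∃ G ∈ L2h D, ∃ φ : ℕ → ℕ, ∀ l : ℂ, l • ee i0 ∈ D → Tendsto (fun k => f (φ k) l) (hyperfilter ℕ) (𝓝 (G (l • ee i0))) := by
  set J := Finset.univ.erase i0 with hJ
  obtain ⟨l0, hl0⟩ := hKn
  have hDc : (Dᶜ).Nonempty := ⟨_, hKD l0 hl0⟩
  set S0 : ℝ := n * R ^ 2 + 1 with hS0
  obtain ⟨C0, hC0, hot⟩ := ot0 hn i0 S0
  have hsp : ∀ l : ℂ, sw J (l • ee i0) = 0 := fun l => Finset.sum_eq_zero fun i hi => by simp [ee, Finset.ne_of_mem_erase hi]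
  have main : ∀ k : ℕ, ∃ (N : ℕ) (F : (Fin n → ℂ) → ℂ) (U : Set (Fin n → ℂ)), {x | 1 / ((k : ℝ) + 1) ≤ infDist x Dᶜ} ⊆ U ∧
      MemLp F 2 ∧ ∫⁻ x, ‖F x‖ₑ ^ 2 ≤ C0 * M0 ∧ WkHol F U ∧ ∀ (l : ℂ) (ε' : ℝ), 0 < ε' → closedBall (l • ee i0) (1 / ((k : ℝ) + 1)) ⊆ U →
        closedBall (l • ee i0) (2 * ε') ⊆ U → ‖moll ε' F (l • ee i0) - f N l‖ ≤ 1 / ((k : ℝ) + 1) := by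
    intro k
    set Q := {x | 1 / ((k : ℝ) + 1) ≤ infDist x Dᶜ} with hQ
    have hk0 : (0 : ℝ) < 1 / ((k : ℝ) + 1) := by positivity
    have hQD : Q ⊆ D := fun x hx => by
      by_contra h
      have := infDist_zero_of_mem (show x ∈ Dᶜ from h)
      rw [hQ, mem_setOf_eq, this] at hx
      linarith
    have hQc : IsCompact Q := isCompact_of_isClosed_isBounded (isClosed_le continuous_const (continuous_infDist_pt _))
      (isBounded_ball.subset (hQD.trans hDR))
    obtain ⟨ρ, γ, M, hR, hρD, hρQ⟩ := hRH Q hQD hQc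
    obtain ⟨ρ0, hρ0, hρ0Q⟩ : ∃ ρ0, 0 < ρ0 ∧ Q ⊆ {x | ρ0 < ρ x} := by
      rcases Q.eq_empty_or_nonempty with h | h
      · exact ⟨1, one_pos, by simp [h]⟩
      · obtain ⟨x, hx, hx'⟩ := hQc.exists_isMinOn h hR.sm.continuous.continuousOn
        have := hρQ hx
        simp only [mem_setOf_eq] at this
        exact ⟨ρ x / 2, by linarith, fun y hy => by have := hx' hy; simp only [mem_setOf_eq] at this ⊢; linarith⟩
    obtain ⟨d, hd, hdD⟩ := hR.cpt.exists_thickening_subset_open hD hρD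
    have hdK : ∀ x, 0 ≤ ρ x → ∀ l ∈ K, d ≤ dist (l • ee i0) x := fun x hx l hl => by
      by_contra h
      push Not at h
      exact hKD l hl (hdD (mem_thickening_iff.2 ⟨x, hx, h⟩))
    set ε := min 1 (d / 2) with hε
    have hε0 : 0 < ε := lt_min one_pos (by positivity)
    have hxi : ∀ x, 0 < ρ x → sw J x ≤ ε ^ 2 → d ≤ infDist (x i0) K := fun x hx hs => by
      refine (le_infDist ⟨l0, hl0⟩).2 fun l hl => ?_
      have h1 := hdK x hx.le l hl
      by_contra h
      push Not at h
      have hlt : dist (l • ee i0) x < d := by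
        rw [dist_pi_lt_iff hd]
        intro i
        by_cases hi : i = i0
        · subst hi; rw [dist_comm]; simpa [ee] using h
        · have h2 := bx_of hε0 hs i (Finset.mem_erase.2 ⟨hi, Finset.mem_univ _⟩)
          have h3 : ε ≤ d / 2 := min_le_right _ _
          have : dist ((l • ee i0) i) (x i) = ‖x i‖ := by simp [ee, hi]
          rw [this]; linarith
      linarith
    obtain ⟨N, hN⟩ := exists_nat_one_div_lt (show 0 < d / 4 by positivity)
    obtain ⟨f1, hf1, hf1e, hf1b⟩ := cut1 hK ⟨l0, hl0⟩ (hf N) (R := R) (show 0 < d / 2 by positivity)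
    have hb : ∫⁻ z, ‖f1 z‖ₑ ^ 2 ≤ M0 := by
      refine le_trans ?_ (hfM N)
      rw [← lintegral_indicator (((isClosed_le continuous_const (continuous_infDist_pt K)).inter isClosed_closedBall).measurableSet)]
      refine lintegral_mono fun z => ?_
      refine (pow_le_pow_left' (hf1b z) 2).trans ?_
      by_cases hz : z ∈ {z | d / 2 / 2 ≤ infDist z K} ∩ closedBall 0 (R + 1)
      · rw [indicator_of_mem hz, indicator_of_mem]
        refine ⟨?_, hz.2⟩
        have := hz.1
        simp only [mem_setOf_eq] at this ⊢
        linarith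
      · rw [indicator_of_notMem hz]; simp
    have hfx : ∀ x, 0 < ρ x → sw J x ≤ ε ^ 2 → f1 =ᶠ[𝓝 (x i0)] f N := fun x hx hs => by
      refine hf1e _ (lt_of_lt_of_le (by linarith) (hxi x hx hs)) ?_
      have := hDR (hρD (show 0 ≤ ρ x from hx.le))
      rw [mem_ball_zero_iff] at this
      exact (norm_le_pi_norm x i0).trans_lt this
    obtain ⟨F, hF1, hF2, hF3, hF4⟩ := hot hR hε0 (min_le_left _ _) (fun x hx => by
        have h1 := hDR (hρD (show 0 ≤ ρ x from hx.le))
        rw [mem_ball_zero_iff] at h1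
        have h2 : sw (Finset.univ.erase i0) x ≤ n * R ^ 2 := by
          calc _ ≤ ∑ i : Fin n, R ^ 2 := by
                refine (Finset.sum_le_sum_of_subset_of_nonneg (Finset.subset_univ J) fun _ _ _ => by positivity).trans (Finset.sum_le_sum fun i _ => ?_)
                have := (norm_le_pi_norm x i).trans h1.le
                gcongr
            _ = _ := by simp
        have h3 : ε ^ 2 ≤ 1 := pow_le_one₀ hε0.le (min_le_left _ _)
        linarith) hf1 (fun x hx hs => by
        refine DifferentiableAt.congr_of_eventuallyEq ?_ (hfx x hx hs)
        refine (hf N).differentiableAt (hK.isClosed.isOpen_compl.mem_nhds fun h => ?_)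
        have := hxi x hx hs
        rw [infDist_zero_of_mem h] at this
        linarith) (hb.trans_lt (lt_top_iff_ne_top.2 hM0)).ne hρ0 hk0 hk0
    refine ⟨N, F, {x | ρ0 < ρ x}, hρ0Q, hF1, hF2.trans (by gcongr), hF3, fun l ε' hε' h1 h2 => ?_⟩
    have h3 := hF4 l ε' hε' h1 h2
    have h4 : ρ0 < ρ (l • ee i0) := h1 (mem_closedBall_self hk0.le)
    have h5 := (hfx (l • ee i0) (hρ0.trans h4) (by rw [hsp]; positivity)).self_of_nhds
    rw [show (l • ee i0 : Fin n → ℂ) i0 = l by simp [ee]] at h5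
    rwa [← h5]
  choose φ F U hU hF1 hF2 hF3 hF4 using main
  have hex : ∀ K ⊆ D, IsCompact K → ∀ᶠ k : ℕ in atTop, K ⊆ U k := fun A hA hAc => by
    rcases A.eq_empty_or_nonempty with h | h
    · simp [h]
    obtain ⟨x, hx, hx'⟩ := hAc.exists_isMinOn h (continuous_infDist_pt Dᶜ).continuousOn
    have hp : 0 < infDist x Dᶜ := (hD.isClosed_compl.notMem_iff_infDist_pos hDc).1 (fun h => h (hA hx))
    obtain ⟨N, hN⟩ := exists_nat_one_div_lt hp
    filter_upwards [eventually_ge_atTop N] with k hk y hy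
    refine hU k ?_
    have h1 := hx' hy
    simp only [mem_setOf_eq] at h1 ⊢
    have : 1 / ((k : ℝ) + 1) ≤ 1 / (N + 1) := by gcongr
    linarith
  obtain ⟨G, hG, hGt⟩ := weak_holo (ENNReal.mul_ne_top hC0 hM0) hF1 hF2 hF3 hD hex (hyperfilter ℕ) Nat.hyperfilter_le_atTop
  refine ⟨G, hG, φ, fun l hl => ?_⟩
  obtain ⟨e, he, heD⟩ := nhds_basis_closedBall.mem_iff.1 (hD.mem_nhds hl)
  have h1 := hGt (e / 2) _ (by positivity) (by rwa [mul_div_cancel₀ _ two_ne_zero])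
  have h2 : Tendsto (fun k => moll (e / 2) (F k) (l • ee i0) - f (φ k) l) atTop (𝓝 0) := by
    refine squeeze_zero_norm' ?_ tendsto_one_div_add_atTop_nhds_zero_nat
    obtain ⟨N, hN⟩ := exists_nat_one_div_lt he
    filter_upwards [eventually_ge_atTop N, hex _ heD (isCompact_closedBall _ _)] with k hk hk2
    refine hF4 k l (e / 2) (by positivity) ((closedBall_subset_closedBall ?_).trans hk2) (by rwa [mul_div_cancel₀ _ two_ne_zero])
    have : 1 / ((k : ℝ) + 1) ≤ 1 / (N + 1) := by gcongr
    linarith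
  simpa using h1.sub (h2.mono_left Nat.hyperfilter_le_atTop)
end

section psh
variable {n : ℕ}

lemma Lv_dir {f : (Fin n → ℂ) → ℝ} (hf : ContDiff ℝ (⊤ : ℕ∞) f) (x ξ : Fin n → ℂ) :
    4 * (Lv f x ξ).re = fderiv ℝ (fderiv ℝ f) x ξ ξ + fderiv ℝ (fderiv ℝ f) x (Complex.I • ξ) (Complex.I • ξ) := by
  have hg := cr_sm hf
  have lin : ∀ (L : (Fin n → ℂ) →L[ℝ] ℂ) (c : ℂ) (v : Fin n → ℂ), L (c • v) = c.re * L v + c.im * L (Complex.I • v) := by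
    intro L c v
    have : c • v = c.re • v + c.im • (Complex.I • v) := by
      ext i; simp only [Pi.smul_apply, smul_eq_mul, Pi.add_apply, Complex.real_smul]
      rw [← mul_assoc, ← add_mul, Complex.re_add_im]
    rw [this, map_add, map_smul, map_smul]; simp
  have hI : ∀ v : Fin n → ℂ, Complex.I • Complex.I • v = -v := fun v => by rw [smul_smul, Complex.I_mul_I]; simp
  have dzs : ∀ (g : (Fin n → ℂ) → ℂ) y (c : ℂ) v, dz (c • v) g y = c * dz v g y := by
    intro g y c v
    rw [dz, dz, smul_comm, lin _ c v, lin _ c (Complex.I • v), hI, map_neg]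
    conv_rhs => rw [← Complex.re_add_im c]
    linear_combination (1/2) * c.im * fderiv ℝ g y (Complex.I • v) * Complex.I_mul_I
  have dzbs : ∀ (g : (Fin n → ℂ) → ℂ) y (c : ℂ) v, dzb (c • v) g y = (starRingEnd ℂ) c * dzb v g y := by
    intro g y c v
    rw [dzb, dzb, smul_comm, lin _ c v, lin _ c (Complex.I • v), hI, map_neg]
    conv_rhs => rw [← Complex.re_add_im c]
    simp only [map_add, map_mul, Complex.conj_ofReal, Complex.conj_I]
    linear_combination (1/2) * c.im * fderiv ℝ g y (Complex.I • v) * Complex.I_mul_I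
  have hξ : ξ = ∑ j, ξ j • ee j := by
    ext i; simp [ee, Finset.sum_apply, Pi.single_apply]
  have dzsum : ∀ (g : (Fin n → ℂ) → ℂ) y, dz ξ g y = ∑ j, ξ j * dz (ee j) g y := by
    intro g y
    have : ∀ s : Finset (Fin n), dz (∑ j ∈ s, ξ j • ee j) g y = ∑ j ∈ s, ξ j * dz (ee j) g y := by
      intro s
      induction s using Finset.induction_on with
      | empty => simp [dz]
      | insert a s ha ih => rw [Finset.sum_insert ha, Finset.sum_insert ha, ← ih, ← dzs]; simp only [dz, smul_add, map_add]; ring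
    conv_lhs => rw [hξ]
    exact this _
  have dzbsum : ∀ (g : (Fin n → ℂ) → ℂ) y, dzb ξ g y = ∑ j, (starRingEnd ℂ) (ξ j) * dzb (ee j) g y := by
    intro g y
    have : ∀ s : Finset (Fin n), dzb (∑ j ∈ s, ξ j • ee j) g y = ∑ j ∈ s, (starRingEnd ℂ) (ξ j) * dzb (ee j) g y := by
      intro s
      induction s using Finset.induction_on with
      | empty => simp [dzb]
      | insert a s ha ih => rw [Finset.sum_insert ha, Finset.sum_insert ha, ← ih, ← dzbs]; simp only [dzb, smul_add, map_add]; ring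
    conv_lhs => rw [hξ]
    exact this _
  have e1 : Lv f x ξ = dz ξ (dzb ξ (cr f)) x := by
    rw [dz_dzb_comm hg, dzbsum, Lv, Finset.sum_comm]
    refine Finset.sum_congr rfl fun k _ => ?_
    rw [← dz_dzb_comm hg, dzsum, Finset.mul_sum]
    refine Finset.sum_congr rfl fun j _ => ?_
    rw [dz_dzb_comm hg]; ring
  have key : ∀ a, DifferentiableAt ℝ (fun y => fderiv ℝ (cr f) y a) x := fun a => (hg.fd a).da x
  have e2 : ∀ u, fderiv ℝ (dzb ξ (cr f)) x u = (1/2) * (fderiv ℝ (fun y => fderiv ℝ (cr f) y ξ) x u +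
      Complex.I * fderiv ℝ (fun y => fderiv ℝ (cr f) y (Complex.I • ξ)) x u) := by
    intro u
    have : HasFDerivAt (dzb ξ (cr f)) _ x :=
      (((key ξ).hasFDerivAt).add (((key (Complex.I • ξ)).hasFDerivAt).const_mul Complex.I)).const_mul (1/2)
    rw [this.fderiv]; simp; ring
  have hd : DifferentiableAt ℝ (fderiv ℝ f) x :=
    ((hf.fderiv_right (m := (⊤ : ℕ∞)) (by simp)).differentiable (by simp)).differentiableAt
  have e3 : ∀ u v, fderiv ℝ (fun y => fderiv ℝ (cr f) y u) x v = (fderiv ℝ (fderiv ℝ f) x v u : ℂ) := by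
    intro u v
    have : (fun y => fderiv ℝ (cr f) y u) = cr (fun y => fderiv ℝ f y u) := funext fun y =>
      fderiv_cr u ((hf.differentiable (by simp)).differentiableAt)
    have h2 := hd.hasFDerivAt.clm_apply (hasFDerivAt_const u x)
    rw [this, fderiv_cr v h2.differentiableAt, h2.fderiv]; simp
  rw [e1, dz, e2, e2, e3, e3, e3, e3]
  simp; ring

lemma sec_diff {E : Type*} [NormedAddCommGroup E] [NormedSpace ℝ E] {f : E → ℝ} (hf : ContDiff ℝ (⊤ : ℕ∞) f) {x η : E} {ε δ : ℝ}
    (hB : ∀ y ∈ ball x δ, ‖fderiv ℝ (fderiv ℝ f) y - fderiv ℝ (fderiv ℝ f) x‖ ≤ ε) (hη : ‖η‖ < δ) :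
    f (x + η) + f (x - η) - 2 * f x ≤ fderiv ℝ (fderiv ℝ f) x η η + ε * ‖η‖ ^ 2 := by
  set A := fderiv ℝ (fderiv ℝ f) x η η + ε * ‖η‖ ^ 2 with hA
  have h1 : ∀ s : ℝ, HasDerivAt (fun s : ℝ => A / 2 * s ^ 2 - f (x + s • η)) (A * s - fderiv ℝ f (x + s • η) η) s := by
    intro s
    have hl : HasDerivAt (fun s : ℝ => x + s • η) η s := by
      simpa using ((hasDerivAt_id s).smul_const η).const_add x
    have := (((hasDerivAt_id s).pow 2).const_mul (A / 2)).sub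
      (((hf.differentiable (by simp)).differentiableAt (x := x + s • η)).hasFDerivAt.comp_hasDerivAt s hl)
    exact this.congr_deriv (by simp; ring)
  have h2 : ∀ s : ℝ, HasDerivAt (fun s : ℝ => A * s - fderiv ℝ f (x + s • η) η) (A - fderiv ℝ (fderiv ℝ f) (x + s • η) η η) s := by
    intro s
    have hl : HasDerivAt (fun s : ℝ => x + s • η) η s := by
      simpa using ((hasDerivAt_id s).smul_const η).const_add x
    have hd : DifferentiableAt ℝ (fderiv ℝ f) (x + s • η) :=
      ((hf.fderiv_right (m := (⊤ : ℕ∞)) (by simp)).differentiable (by simp)).differentiableAt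
    have h3 := (hd.hasFDerivAt.clm_apply (hasFDerivAt_const η _)).comp_hasDerivAt s hl
    have := ((hasDerivAt_id s).const_mul A).sub h3
    exact this.congr_deriv (by simp)
  have hc : ConvexOn ℝ (Icc (-1) 1) (fun s : ℝ => A / 2 * s ^ 2 - f (x + s • η)) := by
    refine convexOn_of_hasDerivWithinAt2_nonneg (f' := fun s => A * s - fderiv ℝ f (x + s • η) η)
      (f'' := fun s => A - fderiv ℝ (fderiv ℝ f) (x + s • η) η η) (convex_Icc _ _)
      (fun s _ => (h1 s).continuousAt.continuousWithinAt)
      (fun s _ => (h1 s).hasDerivWithinAt) (fun s _ => (h2 s).hasDerivWithinAt) fun s hs => ?_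
    rw [interior_Icc] at hs
    have hs1 : |s| ≤ 1 := abs_le.2 ⟨hs.1.le, hs.2.le⟩
    have hy : x + s • η ∈ ball x δ := by
      rw [mem_ball, dist_eq_norm, add_sub_cancel_left, norm_smul, Real.norm_eq_abs]
      nlinarith [norm_nonneg η]
    have := (ContinuousLinearMap.le_opNorm₂ (fderiv ℝ (fderiv ℝ f) (x + s • η) - fderiv ℝ (fderiv ℝ f) x) η η).trans
      (mul_le_mul_of_nonneg_right (mul_le_mul_of_nonneg_right (hB _ hy) (norm_nonneg _)) (norm_nonneg _))
    have h3 := (le_abs_self _).trans this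
    simp only [ContinuousLinearMap.sub_apply] at h3
    rw [hA]; nlinarith
  have := hc.2 (show (-1 : ℝ) ∈ Icc (-1 : ℝ) 1 by simp) (show (1 : ℝ) ∈ Icc (-1 : ℝ) 1 by simp)
    (show (0:ℝ) ≤ 1/2 by norm_num) (show (0:ℝ) ≤ 1/2 by norm_num) (by norm_num)
  simp [← sub_eq_add_neg] at this
  linarith

lemma B_cont {E : Type*} [NormedAddCommGroup E] [NormedSpace ℝ E] {f : E → ℝ} (hf : ContDiff ℝ (⊤ : ℕ∞) f) (x : E) {ε : ℝ} (hε : 0 < ε) :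
    ∃ δ > 0, ∀ y ∈ ball x δ, ‖fderiv ℝ (fderiv ℝ f) y - fderiv ℝ (fderiv ℝ f) x‖ ≤ ε := by
  have hcB : ContinuousAt (fderiv ℝ (fderiv ℝ f)) x :=
    ((hf.fderiv_right (m := (⊤ : ℕ∞)) (by simp)).continuous_fderiv (by simp)).continuousAt
  obtain ⟨δ, hδ, hB⟩ := (Metric.continuousAt_iff (f := fderiv ℝ (fderiv ℝ f)) (a := x)).1 hcB ε hε
  exact ⟨δ, hδ, fun y hy => ((dist_eq_norm (fderiv ℝ (fderiv ℝ f) y) (fderiv ℝ (fderiv ℝ f) x)).symm.trans_le (hB hy).le)⟩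

lemma psh_lev {f : (Fin n → ℂ) → ℝ} (hf : ContDiff ℝ (⊤ : ℕ∞) f) {x ξ : Fin n → ℂ} {t0 : ℝ} (ht0 : 0 < t0)
    (h : ∀ t : ℝ, 0 < t → t < t0 → 2 * Real.pi * f x ≤ ∫ θ in (0:ℝ)..(2 * Real.pi), f (x + Complex.exp (θ * Complex.I) • ((t : ℂ) • ξ))) :
    0 ≤ (Lv f x ξ).re := by
  by_contra hq
  push Not at hq
  set q := (Lv f x ξ).re with hqd
  set ε := -q / (‖ξ‖ ^ 2 + 1) with hε
  have hε0 : 0 < ε := div_pos (by linarith) (by positivity)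
  have hεξ : ε * ‖ξ‖ ^ 2 < -q := by
    rw [hε, div_mul_eq_mul_div, div_lt_iff₀ (by positivity)]; nlinarith
  obtain ⟨δ, hδ, hB⟩ := B_cont hf x hε0
  obtain ⟨t, ht, htt, htδ⟩ : ∃ t : ℝ, 0 < t ∧ t < t0 ∧ t * ‖ξ‖ < δ := by
    refine ⟨min (t0 / 2) (δ / (2 * (‖ξ‖ + 1))), by positivity, (min_le_left _ _).trans_lt (by linarith), ?_⟩
    calc _ ≤ δ / (2 * (‖ξ‖ + 1)) * ‖ξ‖ := by gcongr; exact min_le_right _ _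
      _ < δ := by rw [div_mul_eq_mul_div, div_lt_iff₀ (by positivity)]; nlinarith [norm_nonneg ξ]
  have hH := h t ht htt
  set F : ℝ → ℝ := fun θ => f (x + Complex.exp (θ * Complex.I) • ((t : ℂ) • ξ)) with hF
  have hFc : Continuous F := by
    have := hf.continuous
    fun_prop
  have hper : Function.Periodic F (2 * Real.pi) := by
    intro θ
    have : Complex.exp (((θ + 2 * Real.pi : ℝ) : ℂ) * Complex.I) = Complex.exp (θ * Complex.I) := by
      push_cast; rw [add_mul, Complex.exp_add, Complex.exp_two_pi_mul_I, mul_one]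
    simp only [hF, this]
  have hsh : ∀ a : ℝ, ∫ θ in (0:ℝ)..(2 * Real.pi), F (θ + a) = ∫ θ in (0:ℝ)..(2 * Real.pi), F θ := by
    intro a
    rw [intervalIntegral.integral_comp_add_right]
    have := hper.intervalIntegral_add_eq a 0
    simpa [add_comm] using this
  have hFi : ∀ a : ℝ, IntervalIntegrable (fun θ => F (θ + a)) volume 0 (2 * Real.pi) := fun a =>
    (hFc.comp (continuous_id.add continuous_const)).intervalIntegrable _ _
  have hpt : ∀ θ : ℝ, F (θ + 0) + F (θ + Real.pi) + F (θ + Real.pi / 2) + F (θ + (Real.pi + Real.pi / 2)) ≤ 4 * f x + 2 * t ^ 2 * q := by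
    intro θ
    set η : Fin n → ℂ := Complex.exp (θ * Complex.I) • ((t : ℂ) • ξ) with hη
    have hηn : ‖η‖ = t * ‖ξ‖ := by
      rw [hη, norm_smul, norm_smul, Complex.norm_exp_ofReal_mul_I]; simp [abs_of_pos ht]
    have e : ∀ a : ℝ, F (θ + a) = f (x + Complex.exp (a * Complex.I) • η) := by
      intro a; simp only [hF, hη]; rw [smul_smul (Complex.exp (a * Complex.I)), ← Complex.exp_add]; congr 4; push_cast; ring
    have ex1 : Complex.exp ((Real.pi / 2 : ℝ) * Complex.I) = Complex.I := by push_cast; exact Complex.exp_pi_div_two_mul_I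
    have ex2 : Complex.exp ((Real.pi + Real.pi / 2 : ℝ) * Complex.I) = -Complex.I := by
      push_cast; rw [add_mul, Complex.exp_add, Complex.exp_pi_mul_I, Complex.exp_pi_div_two_mul_I]; simp
    rw [e, e, e, e, ex1, ex2, Complex.exp_pi_mul_I]
    have s1 := sec_diff (ε := ε) hf hB (hηn.trans_lt htδ)
    have s2 := sec_diff (η := Complex.I • η) (ε := ε) hf hB
      (by rw [norm_smul, Complex.norm_I, one_mul]; exact hηn.trans_lt htδ)
    have s3 := Lv_dir hf x η
    have s4 : Lv f x η = (t ^ 2 : ℝ) * Lv f x ξ := by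
      simp only [Lv, Finset.mul_sum]
      refine Finset.sum_congr rfl fun j _ => Finset.sum_congr rfl fun k _ => ?_
      have : Complex.exp (θ * Complex.I) * (starRingEnd ℂ) (Complex.exp (θ * Complex.I)) = 1 := by
        rw [Complex.mul_conj, Complex.normSq_eq_norm_sq, Complex.norm_exp_ofReal_mul_I]; simp
      simp only [hη, Pi.smul_apply, smul_eq_mul, map_mul, Complex.conj_ofReal]
      push_cast
      linear_combination (dzb (ee k) (dz (ee j) (cr f)) x * t ^ 2 * ξ j * (starRingEnd ℂ) (ξ k)) * this
    rw [s4, Complex.re_ofReal_mul, ← hqd] at s3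
    rw [norm_smul, Complex.norm_I, one_mul, hηn] at s2
    rw [hηn] at s1
    have s5 : ε * (t * ‖ξ‖) ^ 2 ≤ t ^ 2 * (-q) := by nlinarith [sq_nonneg t]
    simp only [Complex.ofReal_zero, zero_mul, Complex.exp_zero, one_smul, neg_smul, ← sub_eq_add_neg]
    linarith
  have hint := intervalIntegral.integral_mono_on (by positivity) ((((hFi 0).add (hFi Real.pi)).add (hFi (Real.pi / 2))).add (hFi (Real.pi + Real.pi / 2)))
    (intervalIntegrable_const (c := 4 * f x + 2 * t ^ 2 * q)) (fun θ _ => hpt θ)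
  rw [intervalIntegral.integral_add (((hFi 0).add (hFi Real.pi)).add (hFi (Real.pi / 2))) (hFi _),
    intervalIntegral.integral_add ((hFi 0).add (hFi Real.pi)) (hFi _), intervalIntegral.integral_add (hFi 0) (hFi Real.pi),
    hsh, hsh, hsh, hsh, intervalIntegral.integral_const, smul_eq_mul] at hint
  have : 0 < Real.pi := Real.pi_pos
  have : 0 < Real.pi * (t ^ 2 * (-q)) := by have : 0 < -q := by linarith
                                            positivity
  nlinarith
end psh

section psh2
variable {n : ℕ}

noncomputable def rmoll (ε : ℝ) (w : (Fin n → ℂ) → ℝ) (x : Fin n → ℂ) : ℝ := ∫ y, w (x - y) * mkn ε y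

lemma rmoll_sm {ε : ℝ} (hε : 0 < ε) {w : (Fin n → ℂ) → ℝ} (hw : Continuous w) : ContDiff ℝ (⊤ : ℕ∞) (rmoll ε w) := by
  have h := moll_sm (n := n) hε (f := cr w) (Complex.continuous_ofReal.comp hw).locallyIntegrable
  have e : rmoll ε w = fun x => (moll ε (cr w) x).re := by
    ext x
    rw [moll_def', rmoll]
    have : ∀ y, (cr w (x - y)) * (mkn ε y : ℂ) = ((w (x - y) * mkn ε y : ℝ) : ℂ) := fun y => by push_cast; rfl
    simp_rw [this]
    rw [integral_complex_ofReal, Complex.ofReal_re]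
  rw [e]
  exact Complex.reCLM.contDiff.comp h

lemma rmoll_int {ε : ℝ} (hε : 0 < ε) {w : (Fin n → ℂ) → ℝ} (hw : Continuous w) (x : Fin n → ℂ) :
    Integrable (fun y => w (x - y) * mkn ε y) := by
  have h1 := (mk_sm (n := n) ε).continuous
  exact (by fun_prop : Continuous (fun y => w (x - y) * mkn ε y)).integrable_of_hasCompactSupport (mk_cs hε).mul_left

lemma rmoll_close {ε η : ℝ} (hε : 0 < ε) {w : (Fin n → ℂ) → ℝ} (hw : Continuous w) (x : Fin n → ℂ)
    (h : ∀ y, ‖y‖ < ε → |w (x - y) - w x| ≤ η) : |rmoll ε w x - w x| ≤ η := by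
  have e : rmoll ε w x - w x = ∫ y, (w (x - y) - w x) * mkn ε y := by
    simp_rw [sub_mul]
    rw [integral_sub (rmoll_int hε hw x) ((mk_int hε).const_mul _), integral_const_mul, mk_int1 hε, mul_one, rmoll]
  rw [e]
  have := norm_integral_le_of_norm_le (f := fun y => (w (x - y) - w x) * mkn ε y) ((mk_int (n := n) hε).const_mul η)
    (Eventually.of_forall fun y => by
      rw [norm_mul, Real.norm_eq_abs, Real.norm_eq_abs, abs_of_nonneg (mk_nonneg hε y)]
      by_cases hy : ‖y‖ < ε
      · exact mul_le_mul_of_nonneg_right (h y hy) (mk_nonneg hε y)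
      · simp [mk_supp hε (not_lt.1 hy)])
  rwa [integral_const_mul, mk_int1 hε, mul_one, Real.norm_eq_abs] at this

lemma rmoll_sub {ε : ℝ} (hε : 0 < ε) {w : (Fin n → ℂ) → ℝ} (hw : Continuous w) {C : ℝ} (hC : ∀ x, ‖w x‖ ≤ C) {x η : Fin n → ℂ}
    (h : ∀ y, ‖y‖ < ε → 2 * Real.pi * w (x - y) ≤ ∫ θ in (0:ℝ)..(2 * Real.pi), w (x - y + Complex.exp (θ * Complex.I) • η)) :
    2 * Real.pi * rmoll ε w x ≤ ∫ θ in (0:ℝ)..(2 * Real.pi), rmoll ε w (x + Complex.exp (θ * Complex.I) • η) := by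
  have hp : (0:ℝ) ≤ 2 * Real.pi := by positivity
  have hm := (mk_sm (n := n) ε).continuous
  have hi : Integrable (Function.uncurry fun (θ : ℝ) (y : Fin n → ℂ) => w (x + Complex.exp (θ * Complex.I) • η - y) * mkn ε y)
      ((volume.restrict (Ioc 0 (2 * Real.pi))).prod volume) := by
    refine (((mk_int (n := n) hε).const_mul C).comp_snd (volume.restrict (Ioc (0:ℝ) (2 * Real.pi)))).mono' ?_ (Eventually.of_forall fun p => ?_)
    · refine Continuous.aestronglyMeasurable ?_
      unfold Function.uncurry
      fun_prop
    · simp only [Function.uncurry]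
      rw [norm_mul, Real.norm_eq_abs (mkn ε _), abs_of_nonneg (mk_nonneg hε _)]
      exact mul_le_mul_of_nonneg_right (hC _) (mk_nonneg hε _)
  rw [intervalIntegral.integral_of_le hp]
  simp only [rmoll]
  rw [integral_integral_swap hi, ← integral_const_mul]
  refine integral_mono ((rmoll_int hε hw x).const_mul _) hi.integral_prod_right fun y => ?_
  rw [integral_mul_const, ← mul_assoc]
  by_cases hy : ‖y‖ < ε
  · refine mul_le_mul_of_nonneg_right ?_ (mk_nonneg hε y)
    rw [← intervalIntegral.integral_of_le hp]
    simp_rw [add_sub_right_comm]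
    exact h y hy
  · simp [mk_supp hε (not_lt.1 hy)]

lemma RH_of_psh {D : Set (Fin n → ℂ)} {R : ℝ} (hD : IsOpen D) (hDR : D ⊆ ball 0 R) {v : (Fin n → ℂ) → ℝ} (hv : ContinuousOn v D)
    (hcp : ∀ c, IsCompact {x | x ∈ D ∧ v x ≤ c})
    (hsm : ∀ a η : Fin n → ℂ, (∀ l : ℂ, ‖l‖ ≤ 1 → a + l • η ∈ D) →
      2 * Real.pi * v a ≤ ∫ θ in (0:ℝ)..(2 * Real.pi), v (a + Complex.exp (θ * Complex.I) • η)) :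
    ∀ Q ⊆ D, IsCompact Q → ∃ ρ γ M, RH ρ γ M ∧ {x | 0 ≤ ρ x} ⊆ D ∧ Q ⊆ {x | 0 < ρ x} := by
  intro Q hQD hQ
  obtain ⟨c, hc⟩ : ∃ c, ∀ x ∈ Q, v x ≤ c := by
    obtain ⟨c, hc⟩ := hQ.exists_bound_of_continuousOn (hv.mono hQD)
    exact ⟨c, fun x hx => (le_abs_self _).trans (hc x hx)⟩
  set S := {x | x ∈ D ∧ v x ≤ c + 2} with hS
  have hSc : IsCompact S := hcp _
  have hSD : S ⊆ D := fun x hx => hx.1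
  obtain ⟨χ, hχ, h0, h1, h01⟩ := cutoff hD.isClosed_compl hSc.isClosed (by
    rw [disjoint_compl_left_iff_subset]; exact hSD)
  set w : (Fin n → ℂ) → ℝ := fun x => χ x * v x with hw
  have hwc : Continuous w := by
    rw [continuous_iff_continuousAt]
    intro x
    by_cases hx : x ∈ D
    · exact hχ.continuous.continuousAt.mul (hv.continuousAt (hD.mem_nhds hx))
    · have := (eventually_nhdsSet_iff_forall.1 h0) x hx
      exact (continuousAt_const (y := (0:ℝ))).congr (by filter_upwards [this] with y hy; simp [hw, hy])
  have hwcs : HasCompactSupport w := by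
    refine HasCompactSupport.intro (isCompact_closedBall 0 R) fun x hx => ?_
    have : x ∈ Dᶜ := fun h => hx (ball_subset_closedBall (hDR h))
    simp [hw, (eventually_nhdsSet_iff_forall.1 h0 x this).self_of_nhds]
  obtain ⟨C, hC⟩ := hwcs.exists_bound_of_continuous hwc
  obtain ⟨U, hU, hSU, hUχ⟩ : ∃ U, IsOpen U ∧ S ⊆ U ∧ ∀ x ∈ U, x ∈ D ∧ χ x = 1 := by
    obtain ⟨U, hU, h2, h3⟩ := eventually_nhdsSet_iff_exists.1 h1
    exact ⟨U ∩ D, hU.inter hD, subset_inter h2 hSD, fun x hx => ⟨hx.2, h3 x hx.1⟩⟩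
  obtain ⟨δ, hδ, hδU⟩ := hSc.exists_thickening_subset_open hU hSU
  obtain ⟨ε0, hε0, hun⟩ := Metric.uniformContinuous_iff.1 (hwcs.uniformContinuous_of_continuous hwc) (1/2) (by norm_num)
  set ε := min ε0 (δ / 2) with hε
  have hεp : 0 < ε := lt_min hε0 (by positivity)
  set u := rmoll ε w with hu
  have husm := rmoll_sm hεp hwc
  have hcl : ∀ x, |u x - w x| ≤ 1 / 2 := fun x => rmoll_close hεp hwc x fun y hy => by
    have := hun (show dist (x - y) x < ε0 by rw [dist_eq_norm]; simpa using hy.trans_le (min_le_left _ _))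
    exact this.le
  have hwv : ∀ x ∈ S, w x = v x := fun x hx => by simp [hw, (hUχ x (hSU hx)).2]
  have hlev : ∀ x ∈ S, ∀ ξ, 0 ≤ (Lv u x ξ).re := by
    intro x hx ξ
    refine psh_lev husm (t0 := δ / 2 / (‖ξ‖ + 1)) (by positivity) fun t ht htt => rmoll_sub hεp hwc hC fun y hy => ?_
    have hin : ∀ l : ℂ, ‖l‖ ≤ 1 → x - y + l • ((t : ℂ) • ξ) ∈ U := by
      intro l hl
      refine hδU (mem_thickening_iff.2 ⟨x, hx, ?_⟩)
      rw [dist_eq_norm]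
      have e1 : ‖(t : ℂ) • ξ‖ < δ / 2 := by
        rw [norm_smul, Complex.norm_real, Real.norm_eq_abs, abs_of_pos ht]
        rw [lt_div_iff₀ (by positivity)] at htt
        nlinarith [norm_nonneg ξ]
      calc ‖x - y + l • ((t : ℂ) • ξ) - x‖ = ‖l • ((t : ℂ) • ξ) - y‖ := by congr 1; abel
        _ ≤ ‖l • ((t : ℂ) • ξ)‖ + ‖y‖ := norm_sub_le _ _
        _ < δ := by
          have e2 : ‖l • ((t : ℂ) • ξ)‖ ≤ ‖(t : ℂ) • ξ‖ := by
            rw [norm_smul]; exact mul_le_of_le_one_left (norm_nonneg _) hl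
          have e3 : ‖y‖ < δ / 2 := hy.trans_le (min_le_right _ _)
          linarith
    have hww : ∀ l : ℂ, ‖l‖ ≤ 1 → w (x - y + l • ((t : ℂ) • ξ)) = v (x - y + l • ((t : ℂ) • ξ)) := fun l hl => by
      simp only [hw]
      rw [(hUχ _ (hin l hl)).2, one_mul]
    have h0' := hww 0 (by simp)
    simp only [zero_smul, add_zero] at h0'
    rw [h0', intervalIntegral.integral_congr (g := fun θ : ℝ => v (x - y + Complex.exp (θ * Complex.I) • ((t : ℂ) • ξ)))
      fun θ _ => hww _ (Complex.norm_exp_ofReal_mul_I θ).le]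
    exact hsm _ _ fun l hl => (hUχ _ (hin l hl)).1
  set B := (n : ℝ) * R ^ 2 + 1 with hB
  have hB0 : 0 < B := by positivity
  have hsw : ∀ x ∈ D, sw Finset.univ x ≤ B := fun x hx => by
    have hx' := hDR hx
    rw [mem_ball_zero_iff] at hx'
    calc sw Finset.univ x ≤ ∑ i : Fin n, R ^ 2 := Finset.sum_le_sum fun i _ =>
          pow_le_pow_left₀ (norm_nonneg _) ((norm_le_pi_norm x i).trans hx'.le) 2
      _ ≤ B := by simp [hB]
  have hsw0 : ∀ x : Fin n → ℂ, 0 ≤ sw Finset.univ x := fun x => Finset.sum_nonneg fun i _ => by positivity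
  set γ := 1 / (4 * B) with hγ
  have hγ0 : 0 < γ := by positivity
  have hγs : ∀ x ∈ D, γ * sw Finset.univ x ≤ 1 / 4 := fun x hx => by
    calc _ ≤ γ * B := mul_le_mul_of_nonneg_left (hsw x hx) hγ0.le
      _ = 1 / 4 := by rw [hγ]; field_simp
  set ρ0 : (Fin n → ℂ) → ℝ := fun x => (c + 1) - (u x + γ * sw Finset.univ x) with hρ0
  have hρsm : ContDiff ℝ (⊤ : ℕ∞) ρ0 := contDiff_const.sub (husm.add (contDiff_const.mul (sw_sm _)))
  set A := S ∩ {x | 0 ≤ ρ0 x} with hA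
  have hAc : IsCompact A := hSc.inter_right (isClosed_le continuous_const hρsm.continuous)
  have hAv : ∀ x ∈ A, v x < c + 2 := fun x hx => by
    have h1 := abs_le.1 (hcl x)
    have h2 := hx.2
    simp only [hρ0, mem_setOf_eq] at h2
    have h3 := mul_nonneg hγ0.le (hsw0 x)
    rw [hwv x hx.1] at h1
    linarith [h1.1]
  set V := {x | x ∈ D ∧ v x < c + 2} with hV
  have hVo : IsOpen V := by
    have := hv.isOpen_inter_preimage hD (isOpen_Iio (a := c + 2))
    exact this
  have hVS : V ⊆ S := fun x hx => ⟨hx.1, hx.2.le⟩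
  have hAV : A ⊆ V := fun x hx => ⟨hx.1.1, hAv x hx⟩
  obtain ⟨χ0, hχ0, g0, g1, g01⟩ := cutoff hVo.isClosed_compl hAc.isClosed (by
    rw [disjoint_compl_left_iff_subset]; exact hAV)
  set ρ : (Fin n → ℂ) → ℝ := fun x => χ0 x * ρ0 x - (1 - χ0 x) with hρ
  have hρsm' : ContDiff ℝ (⊤ : ℕ∞) ρ := (hχ0.mul hρsm).sub (contDiff_const.sub hχ0)
  have hsub : {x | 0 ≤ ρ x} ⊆ A := by
    intro x hx
    simp only [hρ, mem_setOf_eq] at hx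
    have hxV : x ∈ V := by
      by_contra h
      have := (eventually_nhdsSet_iff_forall.1 g0 x h).self_of_nhds
      rw [this] at hx; linarith
    refine ⟨hVS hxV, ?_⟩
    by_contra h
    simp only [mem_setOf_eq, not_le] at h
    have := g01 x
    rcases this.1.eq_or_lt with h' | h'
    · rw [← h'] at hx; linarith
    · nlinarith [this.2]
  have hev : ∀ x ∈ A, ρ =ᶠ[𝓝 x] ρ0 := fun x hx => by
    filter_upwards [eventually_nhdsSet_iff_forall.1 g1 x hx] with y hy
    simp [hρ, hy]
  obtain ⟨M, hM⟩ := RH_ex hρsm' (hAc.of_isClosed_subset (isClosed_le continuous_const hρsm'.continuous) hsub) hγ0 fun x hx ξ => by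
    have hxA := hsub hx.le
    have hJ := (J2_sw (Finset.univ : Finset (Fin n)) x ξ).mul γ
    have hJ2 := ((((J2.of_sm husm x ξ).add hJ).mul (-1)).cadd (c + 1)).hq
    have e : (fun y => -1 * (u y + γ * sw Finset.univ y) + (c + 1)) = ρ0 := by ext y; simp only [hρ0]; ring
    rw [e, ← Lv_congr (hev x hxA)] at hJ2
    have := hlev x hxA.1 ξ
    rw [hJ2]
    have e2 : sw Finset.univ ξ = ∑ j, ‖ξ j‖ ^ 2 := rfl
    rw [← e2]
    linarith
  refine ⟨ρ, γ, M, hM, fun x hx => (hsub hx).1.1, fun x hx => ?_⟩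
  have hxS : x ∈ S := ⟨hQD hx, (hc x hx).trans (by linarith)⟩
  have hp : 0 < ρ0 x := by
    have h1 := abs_le.1 (hcl x)
    rw [hwv x hxS] at h1
    have := hγs x (hQD hx)
    simp only [hρ0]
    linarith [hc x hx, h1.2]
  show 0 < ρ x
  rw [(hev x ⟨hxS, hp.le⟩).self_of_nhds]
  exact hp
end psh2

section aff
variable {n : ℕ}

noncomputable def linA (i0 : Fin n) (b : Fin n → ℂ) (hb : b i0 ≠ 0) : (Fin n → ℂ) ≃L[ℂ] (Fin n → ℂ) :=
  LinearEquiv.toContinuousLinearEquiv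
    { toFun := fun x => x + x i0 • (b - ee i0)
      map_add' := fun x y => by simp only [Pi.add_apply, add_smul]; abel
      map_smul' := fun c x => by simp only [Pi.smul_apply, smul_eq_mul, mul_smul, smul_add, RingHom.id_apply]
      invFun := fun y => y - (y i0 / b i0) • (b - ee i0)
      left_inv := fun x => by
        have : (x + x i0 • (b - ee i0)) i0 = x i0 * b i0 := by simp [ee]; ring
        simp only [this]
        rw [mul_div_cancel_right₀ _ hb]; simp
      right_inv := fun y => by
        have : (y - (y i0 / b i0) • (b - ee i0)) i0 = y i0 / b i0 := by simp [ee]; field_simp; ring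
        simp only [this]; simp }

lemma linA_ee (i0 : Fin n) (b : Fin n → ℂ) (hb : b i0 ≠ 0) (l : ℂ) : linA i0 b hb (l • ee i0) = l • b := by
  show l • ee i0 + (l • ee i0) i0 • (b - ee i0) = l • b
  simp [ee, smul_sub]

lemma ot2 (hn : 2 ≤ n) {D : Set (Fin n → ℂ)} (hD : IsOpen D) (hbd : Bornology.IsBounded D) (hps : IsPseudoconvex D)
    (z b : Fin n → ℂ) (hb : b ≠ 0) {K : Set ℂ} {f : ℕ → ℂ → ℂ} (hK : IsCompact K) (hKn : K.Nonempty)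
    (hKD : ∀ l ∈ K, z + l • b ∉ D) (hf : ∀ N, DifferentiableOn ℂ (f N) Kᶜ)
    (hfM : ∀ R : ℝ, ∃ M0 : ℝ≥0∞, M0 ≠ ⊤ ∧ ∀ N : ℕ, ∫⁻ z in {z | 1 / ((N : ℝ) + 1) ≤ infDist z K} ∩ closedBall 0 R, ‖f N z‖ₑ ^ 2 ≤ M0) :
    ∃ G ∈ L2h D, ∃ φ : ℕ → ℕ, ∀ l, z + l • b ∈ D → Tendsto (fun k => f (φ k) l) (hyperfilter ℕ) (𝓝 (G (z + l • b))) := by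
  obtain ⟨i0, hi0⟩ : ∃ i, b i ≠ 0 := by by_contra h; push Not at h; exact hb (funext h)
  set A := linA i0 b hi0 with hA
  set D' : Set (Fin n → ℂ) := {x | z + A x ∈ D} with hD'
  have hcA : Continuous (fun x => z + A x) := continuous_const.add A.continuous
  have hD'o : IsOpen D' := hD.preimage hcA
  have hinv : ∀ x, A.symm ((z + A x) - z) = x := fun x => by simp
  have hinv2 : ∀ y, z + A (A.symm (y - z)) = y := fun x => by simp
  obtain ⟨R, hR⟩ : ∃ R, D' ⊆ ball 0 R := by
    have h1 := hbd.isCompact_closure.image (A.symm.continuous.comp (continuous_id.sub continuous_const : Continuous fun y => y - z))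
    obtain ⟨R, hR⟩ := h1.isBounded.subset_ball 0
    exact ⟨R, fun x hx => hR ⟨z + A x, subset_closure hx, hinv x⟩⟩
  have hne : (Dᶜ).Nonempty := by
    obtain ⟨l, hl⟩ := hKn
    exact ⟨_, hKD l hl⟩
  have hpos : ∀ y, y ∈ D ↔ 0 < infDist y Dᶜ := fun y => by
    rw [← hD.isClosed_compl.notMem_iff_infDist_pos hne, notMem_compl_iff]
  set v : (Fin n → ℂ) → ℝ := fun x => - Real.log (infDist (z + A x) Dᶜ) with hv
  have hvc : ContinuousOn v D' := fun x hx => by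
    refine ContinuousAt.continuousWithinAt ?_
    exact (((continuous_infDist_pt Dᶜ).comp hcA).continuousAt.log ((hpos _).1 hx).ne').neg
  have hcp : ∀ c, IsCompact {x | x ∈ D' ∧ v x ≤ c} := by
    intro c
    have e : {x | x ∈ D' ∧ v x ≤ c} = {x | Real.exp (-c) ≤ infDist (z + A x) Dᶜ} := by
      ext x
      constructor
      · rintro ⟨h1, h2⟩
        simp only [hv] at h2
        exact (Real.le_log_iff_exp_le ((hpos _).1 h1)).1 (by linarith)
      · intro h
        have h1 := (Real.exp_pos (-c)).trans_le h
        refine ⟨(hpos _).2 h1, ?_⟩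
        have := (Real.le_log_iff_exp_le h1).2 h
        simp only [hv]; linarith
    refine isCompact_of_isClosed_isBounded ?_ (isBounded_ball.subset (fun x hx => hR hx.1))
    rw [e]
    exact isClosed_le continuous_const ((continuous_infDist_pt Dᶜ).comp hcA)
  have hsm : ∀ a η : Fin n → ℂ, (∀ l : ℂ, ‖l‖ ≤ 1 → a + l • η ∈ D') →
      2 * Real.pi * v a ≤ ∫ θ in (0:ℝ)..(2 * Real.pi), v (a + Complex.exp (θ * Complex.I) • η) := by
    intro a η h
    have e0 : ∀ l : ℂ, z + A (a + l • η) = (z + A a) + l • A η := fun l => by simp [add_assoc]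
    have h1 := (hps.2.2 (z + A a) (A η)).2.2 0 (by have := h 0 (by simp); simpa [hD'] using this) 1 one_pos (fun l hl => by
      have := h l (by simpa using hl)
      rw [hD', mem_setOf_eq, e0] at this
      exact this)
    have hcc : ContinuousOn (fun l : ℂ => v (a + l • η)) (closedBall 0 1) :=
      hvc.comp (by fun_prop) fun l hl => h l (by simpa using hl)
    obtain ⟨C, hC⟩ := (isCompact_closedBall (0:ℂ) 1).exists_bound_of_continuousOn hcc
    obtain ⟨N, hN⟩ := exists_nat_ge C
    have h2 := h1.trans (iInf_le _ N)
    rw [EReal.coe_le_coe_iff, circleAvgTrunc] at h2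
    have e1 : ∀ θ : ℝ, (max (((- Real.log (Metric.infDist (z + A a + ((0:ℂ) + (1:ℝ) * Complex.exp (θ * Complex.I)) • A η) Dᶜ) : ℝ) : EReal)) (-(N : ℝ) : EReal)).toReal
        = v (a + Complex.exp (θ * Complex.I) • η) := by
      intro θ
      have hθ : Complex.exp (θ * Complex.I) ∈ closedBall (0:ℂ) 1 := by simp [Complex.norm_exp_ofReal_mul_I]
      have := (abs_le.1 (hC _ hθ)).1
      rw [max_eq_left]
      · rw [EReal.toReal_coe]; simp only [hv, e0]; simp
      · rw [← EReal.coe_neg, EReal.coe_le_coe_iff]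
        simp only [hv, e0] at this
        simp only [Complex.ofReal_one, one_mul, zero_add]
        linarith
    simp_rw [e1] at h2
    have hpi : 0 < 2 * Real.pi := by positivity
    rw [inv_mul_eq_div, le_div_iff₀ hpi] at h2
    simp only [zero_smul, add_zero] at h2
    simp only [hv] at h2 ⊢
    linarith
  have hRH := RH_of_psh hD'o hR hvc hcp hsm
  obtain ⟨M0, hM0, hM⟩ := hfM (R + 1)
  obtain ⟨G, hG, φ, hφ⟩ := ot1 hn i0 hD'o hR hRH hK hKn (fun l hl h => hKD l hl (by
    rw [hD', mem_setOf_eq, linA_ee] at h; exact h)) hf hM0 hM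
  have hcs : Continuous (fun y => A.symm (y - z)) := A.symm.continuous.comp (continuous_id.sub continuous_const)
  refine ⟨fun y => G (A.symm (y - z)), ⟨?_, ?_⟩, φ, fun l hl => ?_⟩
  · exact hG.1.comp ((A.symm.differentiable.comp (differentiable_id.sub_const z)).differentiableOn)
      (fun y hy => by show z + A _ ∈ D; simpa using hy)
  · let T : (Fin n → ℂ) ≃ₜ (Fin n → ℂ) := (Homeomorph.subRight z).trans A.symm.toHomeomorph
    have hT : ∀ y, T y = A.symm (y - z) := fun y => rfl
    have hTm : MeasurableEmbedding T := T.measurableEmbedding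
    obtain ⟨c, hc⟩ : ∃ c : ℝ≥0, Measure.map T volume = c • (volume : Measure (Fin n → ℂ)) := by
      have h1 : Measure.map T volume = Measure.map A.symm (volume : Measure (Fin n → ℂ)) := by
        have : (T : (Fin n → ℂ) → (Fin n → ℂ)) = A.symm ∘ (fun y => y - z) := rfl
        rw [this, ← Measure.map_map A.symm.continuous.measurable (measurable_sub_const z), (measurePreserving_sub_right volume z).map_eq]
      rw [h1]
      exact ⟨_, Measure.isAddLeftInvariant_eq_smul _ volume⟩
    have e2 : T ⁻¹' D' = D := by ext y; simp [hD', hT]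
    have e1 : ∫⁻ y in D, (‖G (A.symm (y - z))‖₊ : ℝ≥0∞) ^ 2 = c * ∫⁻ x in D', (‖G x‖₊ : ℝ≥0∞) ^ 2 := by
      calc _ = ∫⁻ x, (‖G x‖₊ : ℝ≥0∞) ^ 2 ∂(Measure.map T (volume.restrict D)) := by
            rw [hTm.lintegral_map]; rfl
        _ = _ := by
            conv_lhs => rw [← e2]
            rw [← hTm.restrict_map, hc, Measure.restrict_smul, lintegral_smul_measure]; rfl
    rw [e1]
    exact ENNReal.mul_lt_top ENNReal.coe_lt_top hG.2
  · have h1 := hφ l (by rw [hD', mem_setOf_eq, linA_ee]; exact hl)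
    have : A.symm (z + l • b - z) = l • ee i0 := by rw [← linA_ee i0 b hi0]; simp [hA]
    show Tendsto _ _ (𝓝 (G (A.symm (z + l • b - z))))
    rw [this]
    exact h1
end aff

section pol

noncomputable def ell (a x : ℂ) : ℝ≥0∞ := (-(ENNReal.log ‖x - a‖ₑ)).toENNReal

lemma ell_cont (a : ℂ) : Continuous (ell a) := by
  unfold ell
  exact EReal.continuous_toENNReal.comp ((continuous_neg (G := EReal)).comp
    (ENNReal.continuous_log.comp (by fun_prop : Continuous fun x : ℂ => ‖x - a‖ₑ)))

lemma ell_self (a : ℂ) : ell a a = ⊤ := by simp [ell]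

lemma ell_of_ne {a x : ℂ} (h : x ≠ a) : ell a x = ENNReal.ofReal (-Real.log ‖x - a‖) := by
  unfold ell
  rw [← ofReal_norm, ENNReal.log_ofReal_of_pos (norm_pos_iff.2 (sub_ne_zero.2 h)), ← EReal.coe_neg,
    EReal.toENNReal_of_ne_top (EReal.coe_ne_top _), EReal.toReal_coe]

lemma ell_circ {a c : ℂ} {R : ℝ} (hR : 0 < R) (h : ∀ θ, ‖circleMap c R θ - a‖ ≤ 1) :
    ∫⁻ θ in Ioc 0 (2 * Real.pi), ell a (circleMap c R θ) ≤ ENNReal.ofReal (2 * Real.pi * (-Real.log R)) ∧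
    ∫⁻ θ in Ioc 0 (2 * Real.pi), ell a (circleMap c R θ) ≤ ENNReal.ofReal (2 * Real.pi) * ell a c := by
  have hpi := Real.pi_pos
  have hint : CircleIntegrable (fun x => Real.log ‖x - a‖) c R := circleIntegrable_log_norm_sub_const R
  have hint' : IntegrableOn (fun θ => -Real.log ‖circleMap c R θ - a‖) (Ioc 0 (2 * Real.pi)) :=
    ((intervalIntegrable_iff_integrableOn_Ioc_of_le (by positivity)).1 hint).neg
  have hav := circleAverage_log_norm_sub_const_eq_log_radius_add_posLog (a := a) (c := c) hR.ne'
  rw [Real.circleAverage_def, smul_eq_mul, intervalIntegral.integral_of_le (by positivity)] at hav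
  have e : ∫⁻ θ in Ioc 0 (2 * Real.pi), ell a (circleMap c R θ) =
      ENNReal.ofReal (2 * Real.pi * -(Real.log R + Real.posLog (R⁻¹ * ‖c - a‖))) := by
    rw [← hav]
    have : 2 * Real.pi * -((2 * Real.pi)⁻¹ * ∫ θ in Ioc 0 (2 * Real.pi), Real.log ‖circleMap c R θ - a‖) =
        ∫ θ in Ioc 0 (2 * Real.pi), -Real.log ‖circleMap c R θ - a‖ := by
      rw [integral_neg]; field_simp
    rw [this, ofReal_integral_eq_lintegral_ofReal hint' (ae_of_all _ fun θ => by
      simpa using Real.log_nonpos (norm_nonneg _) (h θ))]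
    refine lintegral_congr_ae ?_
    rw [Filter.EventuallyEq, ae_restrict_iff' measurableSet_Ioc]
    have hs : ({θ | θ ∈ Ioc 0 (2 * Real.pi) ∧ circleMap c R θ = a}).Subsingleton := fun x hx y hy =>
      injOn_circleMap_of_abs_sub_le (a := 0) (b := 2 * Real.pi) hR.ne' (by
        rw [zero_sub, abs_neg, abs_of_pos (by positivity)])
        (by rw [uIoc_of_le (by positivity)]; exact hx.1) (by rw [uIoc_of_le (by positivity)]; exact hy.1)
        (hx.2.trans hy.2.symm)
    have h0 := hs.measure_zero volume
    rw [measure_eq_zero_iff_ae_notMem] at h0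
    filter_upwards [h0] with θ h1 h2
    exact ell_of_ne fun h3 => h1 ⟨h2, h3⟩
  have hp : 0 ≤ Real.posLog (R⁻¹ * ‖c - a‖) := Real.posLog_nonneg
  rw [e]
  constructor
  · exact ENNReal.ofReal_le_ofReal (by nlinarith)
  · by_cases hc : c = a
    · rw [hc, ell_self, ENNReal.mul_top (by simpa using hpi)]; exact le_top
    · rw [ell_of_ne hc, ← ENNReal.ofReal_mul (by positivity)]
      refine ENNReal.ofReal_le_ofReal (mul_le_mul_of_nonneg_left (neg_le_neg ?_) (by positivity))
      have hn : 0 < ‖c - a‖ := norm_pos_iff.2 (sub_ne_zero.2 hc)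
      have : Real.log (R⁻¹ * ‖c - a‖) ≤ Real.posLog (R⁻¹ * ‖c - a‖) := le_max_right _ _
      rw [Real.log_mul (by positivity) hn.ne', Real.log_inv] at this
      linarith

lemma sub_of_circ {s : ℂ → ℝ≥0∞} {U : Set ℂ} (hs : LowerSemicontinuous s)
    (h : ∀ c ∈ U, ∀ R : ℝ, 0 < R → closedBall c R ⊆ U →
      ∫⁻ θ in Ioc 0 (2 * Real.pi), s (circleMap c R θ) ≤ ENNReal.ofReal (2 * Real.pi) * s c) :
    SubharmonicOn (fun x => -(s x : EReal)) U := by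
  have hpi := Real.pi_pos
  refine ⟨?_, ?_, ?_⟩
  · have h1 : LowerSemicontinuous (fun x => ((s x : ℝ≥0∞) : EReal)) :=
      continuous_coe_ennreal_ereal.comp_lowerSemicontinuous hs (fun _ _ h => EReal.coe_ennreal_le_coe_ennreal_iff.2 h)
    exact ((continuous_neg (G := EReal)).comp_lowerSemicontinuous_antitone h1 (fun _ _ h => EReal.neg_le_neg_iff.2 h)).upperSemicontinuousOn _
  · intro z _
    rw [lt_top_iff_ne_top]; simp [EReal.neg_eq_top_iff]
  · intro c hc R hR hB
    refine le_iInf fun n => ?_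
    by_cases ht : s c = ⊤
    · simp [ht]
    have hm : ∀ θ : ℝ, (max (-(s (c + R * Complex.exp (θ * Complex.I)) : EReal)) (-(n : ℝ) : EReal)).toReal
        = -(min (s (circleMap c R θ)) n).toReal := by
      intro θ
      show (max (-(s (circleMap c R θ) : EReal)) _).toReal = _
      set t := s (circleMap c R θ)
      have h2 : ((-((n : ℝ) : EReal)) : EReal) = -(((n : ℝ≥0∞)) : EReal) := by
        rw [← EReal.coe_ennreal_toReal (ENNReal.natCast_ne_top n), ENNReal.toReal_natCast]
      rw [h2]
      rcases le_total t n with h | h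
      · rw [min_eq_left h, max_eq_left (EReal.neg_le_neg_iff.2 (EReal.coe_ennreal_le_coe_ennreal_iff.2 h)),
          EReal.toReal_neg_eq, EReal.toReal_coe_ennreal]
      · rw [min_eq_right h, max_eq_right (EReal.neg_le_neg_iff.2 (EReal.coe_ennreal_le_coe_ennreal_iff.2 h)),
          EReal.toReal_neg_eq, EReal.toReal_coe_ennreal]
    unfold circleAvgTrunc
    simp_rw [hm]
    have hmeas : Measurable fun θ => min (s (circleMap c R θ)) (n : ℝ≥0∞) :=
      (hs.measurable.comp (continuous_circleMap c R).measurable).min measurable_const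
    rw [intervalIntegral.integral_of_le (by positivity), integral_neg, integral_toReal hmeas.aemeasurable
      (ae_of_all _ fun θ => (min_le_right _ _).trans_lt (ENNReal.natCast_lt_top n))]
    have h3 : ∫⁻ θ in Ioc 0 (2 * Real.pi), min (s (circleMap c R θ)) n ≤ ENNReal.ofReal (2 * Real.pi) * s c :=
      (lintegral_mono fun θ => min_le_left _ _).trans (h c hc R hR hB)
    have h4 := ENNReal.toReal_mono (ENNReal.mul_ne_top ENNReal.ofReal_ne_top ht) h3
    rw [ENNReal.toReal_mul, ENNReal.toReal_ofReal (by positivity)] at h4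
    have h5 : (-(s c : EReal)) = ((-(s c).toReal : ℝ) : EReal) := by
      rw [EReal.coe_neg, EReal.coe_ennreal_toReal ht]
    rw [h5, EReal.coe_le_coe_iff, mul_neg, neg_le_neg_iff, inv_mul_le_iff₀ (by positivity)]
    exact h4

lemma polar_local {K : Set ℂ} {q : ℂ} {r : ℝ} (hr : 0 < r) (hr2 : r ≤ 1 / 2) (hKB : K ⊆ closedBall q r)
    (hK : K.Nonempty)
    (hA : ∀ κ : ℝ, 0 < κ → ∃ (N : ℕ) (ζ : ℕ → ℂ), (∀ i < N, ζ i ∈ K) ∧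
      ∀ x ∈ K, ∏ i ∈ Finset.range N, ‖x - ζ i‖ < κ ^ N) :
    ∃ u : ℂ → EReal, SubharmonicOn u (ball q r) ∧ (∃ x ∈ ball q r, u x ≠ ⊥) ∧ ∀ x ∈ K, u x = ⊥ := by
  have hpi := Real.pi_pos
  choose N ζ hζ hlt using fun k : ℕ => hA (Real.exp (-(2 ^ k))) (Real.exp_pos _)
  have hN : ∀ k, N k ≠ 0 := fun k h => by
    obtain ⟨x, hx⟩ := hK
    have := hlt k x hx
    rw [h] at this; simp at this
  let a : ℕ → ℝ := fun k => (2 ^ k)⁻¹ / N k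
  have ha : ∀ k, 0 < a k := fun k => div_pos (by positivity) (by exact_mod_cast Nat.pos_of_ne_zero (hN k))
  have haN : ∀ k, a k * N k = (2 ^ k)⁻¹ := fun k => by
    have : (N k : ℝ) ≠ 0 := by exact_mod_cast hN k
    simp only [a]; field_simp
  let A : ℕ → ℝ≥0∞ := fun k => ENNReal.ofReal (a k)
  let g : ℕ → ℂ → ℝ≥0∞ := fun k x => ∑ i ∈ Finset.range (N k), A k * ell (ζ k i) x
  have hgc : ∀ k, Continuous (g k) := fun k => continuous_finsetSum _ fun i _ =>
    (ENNReal.continuous_const_mul ENNReal.ofReal_ne_top).comp (ell_cont _)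
  let s : ℂ → ℝ≥0∞ := fun x => ∑' k, g k x
  have hs : LowerSemicontinuous s := lowerSemicontinuous_tsum fun k => (hgc k).lowerSemicontinuous
  have hswap : ∀ c R, ∫⁻ θ in Ioc 0 (2 * Real.pi), s (circleMap c R θ) =
      ∑' k, ∑ i ∈ Finset.range (N k), A k * ∫⁻ θ in Ioc 0 (2 * Real.pi), ell (ζ k i) (circleMap c R θ) := by
    intro c R
    have hm : ∀ k i, Measurable fun θ => ell (ζ k i) (circleMap c R θ) := fun k i =>
      ((ell_cont _).comp (continuous_circleMap c R)).measurable
    refine (lintegral_tsum fun k => ((hgc k).comp (continuous_circleMap c R)).measurable.aemeasurable).trans ?_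
    refine tsum_congr fun k => ?_
    refine (lintegral_finsetSum _ fun i _ => (hm k i).const_mul _).trans ?_
    exact Finset.sum_congr rfl fun i _ => lintegral_const_mul _ (hm k i)
  have hd : ∀ {c R}, 0 < R → closedBall c R ⊆ closedBall q r → ∀ k, ∀ i ∈ Finset.range (N k), ∀ θ,
      ‖circleMap c R θ - ζ k i‖ ≤ 1 := by
    intro c R hR hB k i hi θ
    have h1 := hB (circleMap_mem_closedBall c hR.le θ)
    have h2 := hKB (hζ k i (Finset.mem_range.1 hi))
    rw [← dist_eq_norm]
    rw [mem_closedBall] at h1 h2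
    have := dist_triangle_right (circleMap c R θ) (ζ k i) q
    linarith
  refine ⟨fun x => -(s x : EReal), sub_of_circ hs ?_, ?_, ?_⟩
  · intro c hc R hR hB
    rw [hswap, ← ENNReal.tsum_mul_left]
    refine ENNReal.tsum_le_tsum fun k => ?_
    rw [Finset.mul_sum]
    refine Finset.sum_le_sum fun i hi => ?_
    rw [mul_left_comm]
    gcongr
    exact (ell_circ hR (hd hR (hB.trans ball_subset_closedBall) k i hi)).2
  · have hR : 0 < r / 2 := by positivity
    have hfin : ∫⁻ θ in Ioc 0 (2 * Real.pi), s (circleMap q (r / 2) θ) < ⊤ := by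
      rw [hswap]
      set B := 2 * Real.pi * (-Real.log (r / 2))
      have hB : 0 ≤ B := mul_nonneg (by positivity) (by
        simpa using Real.log_nonpos (by positivity) (by linarith))
      have : ∀ k, ∑ i ∈ Finset.range (N k), A k * ∫⁻ θ in Ioc 0 (2 * Real.pi), ell (ζ k i) (circleMap q (r / 2) θ)
          ≤ ENNReal.ofReal ((1 / 2) ^ k * B) := by
        intro k
        calc _ ≤ ∑ i ∈ Finset.range (N k), A k * ENNReal.ofReal B := by
              refine Finset.sum_le_sum fun i hi => ?_
              gcongr
              exact (ell_circ hR (hd hR (closedBall_subset_closedBall (by linarith)) k i hi)).1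
          _ = _ := by
              rw [Finset.sum_const, Finset.card_range, nsmul_eq_mul, ← ENNReal.ofReal_mul (ha k).le,
                ← ENNReal.ofReal_natCast, ← ENNReal.ofReal_mul (by positivity)]
              congr 1
              have := haN k
              rw [one_div, inv_pow, ← this]; ring
      refine (ENNReal.tsum_le_tsum this).trans_lt ?_
      rw [← ENNReal.ofReal_tsum_of_nonneg (fun k => by positivity)
        ((summable_geometric_of_lt_one (by norm_num) (by norm_num)).mul_right B)]
      exact ENNReal.ofReal_lt_top
    obtain ⟨θ, hθ⟩ : ∃ θ, s (circleMap q (r / 2) θ) ≠ ⊤ := by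
      by_contra! hc
      simp_rw [hc] at hfin
      simp [hpi] at hfin
    refine ⟨circleMap q (r / 2) θ, ?_, by simpa [EReal.neg_eq_bot_iff] using hθ⟩
    rw [mem_ball, dist_eq_norm, circleMap_sub_center, norm_circleMap_zero, abs_of_pos hR]; linarith
  · intro x hx
    have h1 : ∀ k, 1 ≤ g k x := by
      intro k
      by_cases he : ∃ i ∈ Finset.range (N k), x = ζ k i
      · obtain ⟨i, hi, he⟩ := he
        refine le_trans ?_ (Finset.single_le_sum (f := fun i => A k * ell (ζ k i) x) (fun _ _ => zero_le) hi)
        simp only [← he, ell_self]; rw [ENNReal.mul_top (by simpa [A] using ha k)]; exact le_top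
      · push Not at he
        have hp : ∀ i ∈ Finset.range (N k), ‖x - ζ k i‖ ≠ 0 := fun i hi =>
          norm_ne_zero_iff.2 (sub_ne_zero.2 (he i hi))
        have h3 := Real.log_lt_log (Finset.prod_pos fun i hi => lt_of_le_of_ne (norm_nonneg _) (hp i hi).symm) (hlt k x hx)
        rw [Real.log_prod hp, Real.log_pow, Real.log_exp] at h3
        have h4 : ∀ i ∈ Finset.range (N k), A k * ell (ζ k i) x = ENNReal.ofReal (a k * -Real.log ‖x - ζ k i‖) :=
          fun i hi => by rw [ell_of_ne (he i hi), ← ENNReal.ofReal_mul (ha k).le]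
        show 1 ≤ ∑ i ∈ Finset.range (N k), A k * ell (ζ k i) x
        have hnn : ∀ i ∈ Finset.range (N k), 0 ≤ a k * -Real.log ‖x - ζ k i‖ := fun i hi => by
          refine mul_nonneg (ha k).le ?_
          have h5 := mem_closedBall.1 (hKB hx)
          have h6 := mem_closedBall.1 (hKB (hζ k i (Finset.mem_range.1 hi)))
          have h7 := dist_triangle_right x (ζ k i) q
          rw [dist_eq_norm x] at h7
          simpa using Real.log_nonpos (norm_nonneg _) (by linarith)
        rw [Finset.sum_congr rfl h4, ← ENNReal.ofReal_sum_of_nonneg hnn, ← ENNReal.ofReal_one]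
        refine ENNReal.ofReal_le_ofReal ?_
        rw [← Finset.mul_sum, Finset.sum_neg_distrib]
        calc (1 : ℝ) = (a k * N k) * 2 ^ k := by rw [haN]; field_simp
          _ ≤ _ := by rw [mul_assoc]; exact mul_le_mul_of_nonneg_left (by linarith) (ha k).le
    have h2 : s x = ⊤ := by
      rw [eq_top_iff, ← ENNReal.tsum_const_eq_top_of_ne_zero (α := ℕ) one_ne_zero]
      exact ENNReal.tsum_le_tsum h1
    simp [h2]
end pol

section leja

lemma leja_seq {K : Set ℂ} {κ : ℝ}
    (hB : ∀ (N : ℕ) (ζ : ℕ → ℂ), (∀ i < N, ζ i ∈ K) → ∃ x ∈ K, κ ^ N ≤ ∏ i ∈ Finset.range N, ‖x - ζ i‖) :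
    ∃ ζ : ℕ → ℂ, (∀ i, ζ i ∈ K) ∧ ∀ k, κ ^ k ≤ ∏ i ∈ Finset.range k, ‖ζ k - ζ i‖ := by
  have : ∀ (N : ℕ) (ζ : ℕ → ℂ), ∃ x, (∀ i < N, ζ i ∈ K) → x ∈ K ∧ κ ^ N ≤ ∏ i ∈ Finset.range N, ‖x - ζ i‖ := by
    intro N ζ
    by_cases h : ∀ i < N, ζ i ∈ K
    · obtain ⟨x, hx⟩ := hB N ζ h; exact ⟨x, fun _ => hx⟩
    · exact ⟨0, fun h' => absurd h' h⟩
  choose X hX using this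
  let g : ℕ → ℕ → ℂ := fun k => Nat.rec (fun _ => 0) (fun k g => Function.update g k (X k g)) k
  have hg : ∀ k, g (k + 1) = Function.update (g k) k (X k (g k)) := fun k => rfl
  have h1 : ∀ k, ∀ i < k, g k i = g (i + 1) i := by
    intro k
    induction k with
    | zero => intro i hi; omega
    | succ k ih =>
      intro i hi
      rcases Nat.lt_succ_iff_lt_or_eq.1 hi with h | h
      · rw [hg k, Function.update_of_ne h.ne, ih i h]
      · rw [h]
  have h2 : ∀ k, g (k + 1) k = X k (g k) := fun k => by rw [hg]; simp
  have h3 : ∀ k, g (k + 1) k ∈ K ∧ κ ^ k ≤ ∏ i ∈ Finset.range k, ‖g (k + 1) k - g (i + 1) i‖ := by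
    intro k
    induction k using Nat.strong_induction_on with
    | _ k ih =>
      have := hX k (g k) (fun i hi => by rw [h1 k i hi]; exact (ih i hi).1)
      rw [h2 k]
      refine ⟨this.1, this.2.trans_eq (Finset.prod_congr rfl fun i hi => by rw [h1 k i (Finset.mem_range.1 hi)])⟩
  exact ⟨fun k => g (k + 1) k, fun k => (h3 k).1, fun k => (h3 k).2⟩

noncomputable def Hh (R δ : ℝ) (w : ℂ) : ℝ≥0∞ := if ‖w‖ < R then ENNReal.ofReal (1 / (‖w‖ * max ‖w‖ δ)) else 0

lemma Hh_meas (R δ : ℝ) : Measurable (Hh R δ) :=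
  Measurable.ite (measurableSet_lt measurable_norm measurable_const) (by fun_prop) measurable_const

lemma Hh_int {R δ : ℝ} (hδ : 0 < δ) (hR : δ ≤ R) (a : ℂ) :
    ∫⁻ w, Hh R δ (w - a) ≤ ENNReal.ofReal (2 * Real.pi * (1 + Real.log (R / δ))) := by
  have hpi := Real.pi_pos
  have hR0 := hδ.trans_le hR
  rw [lintegral_sub_right_eq_self (Hh R δ) a, ← Complex.lintegral_comp_polarCoord_symm]
  let k : ℝ → ℝ≥0∞ := fun ρ => (Ioc 0 R).indicator (fun ρ => ENNReal.ofReal (1 / max ρ δ)) ρ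
  have hk : Measurable k := Measurable.indicator (by fun_prop) measurableSet_Ioc
  have h1 : ∀ p ∈ polarCoord.target, ENNReal.ofReal p.1 • Hh R δ (Complex.polarCoord.symm p) ≤ k p.1 := by
    rintro ⟨ρ, θ⟩ hp
    rw [polarCoord_target] at hp
    have hρ : 0 < ρ := hp.1
    have hn : ‖Complex.polarCoord.symm (ρ, θ)‖ = ρ := by
      rw [Complex.norm_polarCoord_symm, abs_of_pos hρ]
    simp only [Hh, hn, k]
    split_ifs with h
    · rw [indicator_of_mem (show ρ ∈ Ioc 0 R from ⟨hρ, h.le⟩), smul_eq_mul, ← ENNReal.ofReal_mul hρ.le]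
      refine ENNReal.ofReal_le_ofReal (le_of_eq ?_)
      have : 0 < max ρ δ := lt_max_of_lt_left hρ
      field_simp
    · simp
  have h2 : ∫⁻ ρ, k ρ ≤ ENNReal.ofReal (1 + Real.log (R / δ)) := by
    rw [lintegral_indicator measurableSet_Ioc, ← Ioc_union_Ioc_eq_Ioc hδ.le hR]
    refine (lintegral_union_le _ _ _).trans ?_
    rw [ENNReal.ofReal_add zero_le_one (Real.log_nonneg (by rwa [one_le_div hδ]))]
    refine add_le_add ?_ ?_
    · calc _ ≤ ∫⁻ ρ in Ioc 0 δ, ENNReal.ofReal (1 / δ) := lintegral_mono fun ρ => ENNReal.ofReal_le_ofReal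
            (one_div_le_one_div_of_le hδ (le_max_right _ _))
        _ = _ := by
          rw [setLIntegral_const, Real.volume_Ioc, ← ENNReal.ofReal_mul (by positivity)]
          congr 1; field_simp; simp
    · have hii : IntervalIntegrable (fun x : ℝ => 1 / x) volume δ R :=
        intervalIntegral.intervalIntegrable_one_div (fun x hx => by
          rw [uIcc_of_le hR] at hx; exact (hδ.trans_le hx.1).ne') continuousOn_id
      have hi := (intervalIntegrable_iff_integrableOn_Ioc_of_le hR).1 hii
      calc _ ≤ ∫⁻ ρ in Ioc δ R, ENNReal.ofReal (1 / ρ) := setLIntegral_mono (by fun_prop) fun ρ hρ =>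
            ENNReal.ofReal_le_ofReal (one_div_le_one_div_of_le (hδ.trans hρ.1) (le_max_left _ _))
        _ = _ := by
          rw [← ofReal_integral_eq_lintegral_ofReal hi, ← intervalIntegral.integral_of_le hR, integral_one_div_of_pos hδ hR0]
          rw [EventuallyLE, ae_restrict_iff' measurableSet_Ioc]
          exact ae_of_all _ fun ρ hρ => (one_div_pos.2 (hδ.trans hρ.1)).le
  calc _ ≤ ∫⁻ p in polarCoord.target, k p.1 :=
        setLIntegral_mono (hk.comp measurable_fst) h1
    _ ≤ ∫⁻ p in (univ : Set ℝ) ×ˢ Ioo (-Real.pi) Real.pi, k p.1 :=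
        lintegral_mono_set (by rw [polarCoord_target]; exact prod_mono (subset_univ _) subset_rfl)
    _ = (∫⁻ ρ, k ρ) * ENNReal.ofReal (2 * Real.pi) := by
        rw [Measure.volume_eq_prod, ← Measure.prod_restrict, lintegral_prod _ (by fun_prop), Measure.restrict_univ]
        simp only [lintegral_const, Measure.restrict_apply_univ, Real.volume_Ioo]
        rw [lintegral_mul_const _ hk]
        congr 2; ring
    _ ≤ _ := by
        rw [mul_comm, ENNReal.ofReal_mul (p := 2 * Real.pi) (by positivity)]
        exact mul_le_mul_right h2 _

lemma Hh_pair {R : ℝ} {a b x : ℂ} (hab : a ≠ b) (ha : x ≠ a) (hb : x ≠ b) (h1 : ‖x - a‖ < R) (h2 : ‖x - b‖ < R) :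
    ‖(x - a)⁻¹‖ₑ * ‖(x - b)⁻¹‖ₑ ≤ Hh R (‖a - b‖ / 2) (x - a) + Hh R (‖a - b‖ / 2) (x - b) := by
  have key : ∀ a b : ℂ, x ≠ a → x ≠ b → ‖x - a‖ < R → ‖x - a‖ ≤ ‖x - b‖ →
      ‖(x - a)⁻¹‖ₑ * ‖(x - b)⁻¹‖ₑ ≤ Hh R (‖a - b‖ / 2) (x - a) := by
    intro a b ha hb h1 h
    have pa : 0 < ‖x - a‖ := norm_pos_iff.2 (sub_ne_zero.2 ha)
    rw [Hh, if_pos h1, ← ofReal_norm, ← ofReal_norm, ← ENNReal.ofReal_mul (norm_nonneg _), norm_inv, norm_inv, ← mul_inv, ← one_div]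
    refine ENNReal.ofReal_le_ofReal (one_div_le_one_div_of_le (mul_pos pa (lt_max_of_lt_left pa))
      (mul_le_mul_of_nonneg_left (max_le h ?_) pa.le))
    have := norm_sub_le_norm_sub_add_norm_sub a x b
    rw [norm_sub_rev a x] at this
    linarith
  rcases le_total ‖x - a‖ ‖x - b‖ with h | h
  · exact (key a b ha hb h1 h).trans le_self_add
  · rw [mul_comm, norm_sub_rev a b]
    exact (key b a hb ha h2 h).trans le_add_self

lemma sum_sq_enn (e : ℕ → ℝ≥0∞) (m : ℕ) : (∑ i ∈ Finset.range m, e i) ^ 2 =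
    ∑ i ∈ Finset.range m, (e i ^ 2 + 2 * ∑ j ∈ Finset.range i, e i * e j) := by
  induction m with
  | zero => simp
  | succ m ih => rw [Finset.sum_range_succ, Finset.sum_range_succ, ← ih, ← Finset.mul_sum]; ring

noncomputable def fLeja (ζ : ℕ → ℂ) (N : ℕ) (x : ℂ) : ℂ :=
  ((N : ℂ) + 1)⁻¹ * ∑ i ∈ Finset.range (N + 1), (x - ζ i)⁻¹

lemma leja_bound {K : Set ℂ} {κ : ℝ} (hκ : 0 < κ) (hK : Bornology.IsBounded K) {ζ : ℕ → ℂ} (hζ : ∀ i, ζ i ∈ K)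
    (hp : ∀ k, κ ^ k ≤ ∏ i ∈ Finset.range k, ‖ζ k - ζ i‖) (R : ℝ) : ∃ M0 : ℝ≥0∞, M0 ≠ ⊤ ∧ ∀ N : ℕ,
      ∫⁻ z in {z | 1 / ((N : ℝ) + 1) ≤ infDist z K} ∩ closedBall 0 R, ‖fLeja ζ N z‖ₑ ^ 2 ≤ M0 := by
  have hpi := Real.pi_pos
  obtain ⟨RK, hRK⟩ := hK.subset_closedBall (0 : ℂ)
  obtain ⟨R', hR1, hR2, hR3⟩ : ∃ R' : ℝ, 1 ≤ R' ∧ R + RK < R' ∧ RK ≤ R' :=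
    ⟨1 + |R| + |RK|, by linarith [abs_nonneg R, abs_nonneg RK], by linarith [le_abs_self R, le_abs_self RK],
      by linarith [abs_nonneg R, le_abs_self RK]⟩
  have hR0 : 0 < R' := by linarith
  have hζn : ∀ i, ‖ζ i‖ ≤ RK := fun i => by simpa using hRK (hζ i)
  have hpos : ∀ k, ∀ i ∈ Finset.range k, 0 < ‖ζ k - ζ i‖ := by
    intro k i hi
    rw [norm_pos_iff]; intro h
    have := (pow_pos hκ k).trans_le (hp k)
    rw [Finset.prod_eq_zero hi (by rw [h, norm_zero])] at this
    exact lt_irrefl _ this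
  set T := 1 + Real.log (2 * R') + |Real.log κ| with hT
  have hlR : 0 ≤ Real.log R' := Real.log_nonneg hR1
  have hl2R : 0 ≤ Real.log (2 * R') := Real.log_nonneg (by linarith)
  have hT0 : 0 ≤ T := by positivity
  refine ⟨ENNReal.ofReal (2 * Real.pi * (2 + Real.log R' + 4 * T)), ENNReal.ofReal_ne_top, fun N => ?_⟩
  set m := N + 1 with hm
  have hmr : ((N : ℝ) + 1) = m := by rw [hm]; push_cast; ring
  have hm1 : (1 : ℝ) ≤ m := by rw [← hmr]; linarith [(Nat.cast_nonneg N : (0 : ℝ) ≤ N)]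
  have hm0 : (0 : ℝ) < m := by linarith
  rw [hmr]
  set S := {z | 1 / (m : ℝ) ≤ infDist z K} ∩ closedBall 0 R with hS
  have hSm : MeasurableSet S := ((isClosed_le continuous_const (continuous_infDist_pt K)).inter isClosed_closedBall).measurableSet
  have hfar : ∀ x ∈ S, ∀ i, 1 / (m : ℝ) ≤ ‖x - ζ i‖ := fun x hx i => by
    rw [← dist_eq_norm]; exact hx.1.trans (infDist_le_dist_of_mem (hζ i))
  have hne : ∀ x ∈ S, ∀ i, x ≠ ζ i := fun x hx i h => by
    have := hfar x hx i
    rw [h, sub_self, norm_zero] at this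
    exact absurd this (not_le.2 (by positivity))
  have hnear : ∀ x ∈ S, ∀ i, ‖x - ζ i‖ < R' := fun x hx i => by
    have : ‖x‖ ≤ R := by simpa using hx.2
    exact (norm_sub_le _ _).trans_lt (by linarith [hζn i])
  let Gd : ℕ → ℂ → ℝ≥0∞ := fun i x => Hh R' (1 / m) (x - ζ i)
  let Go : ℕ → ℕ → ℂ → ℝ≥0∞ := fun i j x => Hh R' (‖ζ i - ζ j‖ / 2) (x - ζ i) + Hh R' (‖ζ i - ζ j‖ / 2) (x - ζ j)
  have hHm : ∀ δ a, Measurable fun x => Hh R' δ (x - a) := fun δ a => (Hh_meas R' δ).comp (measurable_sub_const a)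
  have hGom : ∀ i j, Measurable (Go i j) := fun i j => (hHm _ _).add (hHm _ _)
  have hpt : ∀ x ∈ S, ‖fLeja ζ N x‖ₑ ^ 2 ≤ ENNReal.ofReal (1 / m ^ 2) *
      ∑ i ∈ Finset.range m, (Gd i x + 2 * ∑ j ∈ Finset.range i, Go i j x) := by
    intro x hx
    have e0 : ‖((N : ℂ) + 1)⁻¹‖ₑ ^ 2 = ENNReal.ofReal (1 / m ^ 2) := by
      rw [← ofReal_norm, ← ENNReal.ofReal_pow (norm_nonneg _), norm_inv]
      have : ‖(N : ℂ) + 1‖ = m := by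
        rw [← hmr]
        have : ((N : ℂ) + 1) = (((N : ℝ) + 1 : ℝ) : ℂ) := by push_cast; ring
        rw [this, Complex.norm_real, Real.norm_of_nonneg (by positivity)]
      rw [this, inv_pow, one_div]
    rw [fLeja, enorm_mul, mul_pow, e0]
    gcongr
    refine (pow_le_pow_left₀ zero_le (enorm_sum_le _ _) 2).trans ?_
    rw [sum_sq_enn]
    refine Finset.sum_le_sum fun i hi => add_le_add ?_ (mul_le_mul_right (Finset.sum_le_sum fun j hj => ?_) _)
    · simp only [Gd, Hh]
      rw [if_pos (hnear x hx i), max_eq_left (hfar x hx i), ← ofReal_norm, ← ENNReal.ofReal_pow (norm_nonneg _), norm_inv,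
        inv_pow, one_div, sq]
    · exact Hh_pair (sub_ne_zero.1 (norm_pos_iff.1 (hpos i j hj))) (hne x hx i) (hne x hx j) (hnear x hx i) (hnear x hx j)
  have hId : ∀ i, ∫⁻ x in S, Gd i x ≤ ENNReal.ofReal (2 * Real.pi * (1 + Real.log R' + m)) := by
    intro i
    refine (setLIntegral_le_lintegral _ _).trans ((Hh_int (by positivity) ?_ _).trans (ENNReal.ofReal_le_ofReal ?_))
    · exact (div_le_one₀ hm0 |>.2 hm1).trans hR1
    · have : Real.log (R' / (1 / m)) = Real.log R' + Real.log m := by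
        rw [div_div_eq_mul_div, div_one, Real.log_mul hR0.ne' hm0.ne']
      rw [this]
      have := Real.log_le_self hm0.le
      exact mul_le_mul_of_nonneg_left (by linarith) (by positivity)
  have hIo : ∀ i, ∑ j ∈ Finset.range i, ∫⁻ x in S, Go i j x ≤ ENNReal.ofReal (2 * (2 * Real.pi) * (i * T)) := by
    intro i
    have h1 : ∀ j ∈ Finset.range i, ∫⁻ x in S, Go i j x ≤
        ENNReal.ofReal (2 * (2 * Real.pi) * (1 + Real.log (2 * R') - Real.log ‖ζ i - ζ j‖)) := by
      intro j hj
      have hd := hpos i j hj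
      have hd2 : ‖ζ i - ζ j‖ / 2 ≤ R' := by linarith [norm_sub_le (ζ i) (ζ j), hζn i, hζn j]
      have e : Real.log (R' / (‖ζ i - ζ j‖ / 2)) = Real.log (2 * R') - Real.log ‖ζ i - ζ j‖ := by
        rw [← Real.log_div (by positivity) hd.ne']; congr 1; field_simp
      refine (setLIntegral_le_lintegral _ _).trans ?_
      simp only [Go]
      rw [lintegral_add_left (hHm _ _)]
      have h0 : 0 ≤ 1 + Real.log (R' / (‖ζ i - ζ j‖ / 2)) := by
        have := Real.log_nonneg ((one_le_div (by positivity)).2 hd2); linarith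
      refine (add_le_add (Hh_int (by positivity) hd2 _) (Hh_int (by positivity) hd2 _)).trans ?_
      rw [← ENNReal.ofReal_add (by positivity) (by positivity), e]
      exact ENNReal.ofReal_le_ofReal (by linarith)
    refine (Finset.sum_le_sum h1).trans ?_
    rw [← ENNReal.ofReal_sum_of_nonneg]
    · refine ENNReal.ofReal_le_ofReal ?_
      rw [← Finset.mul_sum, Finset.sum_sub_distrib, Finset.sum_const, Finset.card_range, nsmul_eq_mul,
        ← Real.log_prod fun j hj => (hpos i j hj).ne']
      have h2 := Real.log_le_log (pow_pos hκ i) (hp i)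
      rw [Real.log_pow] at h2
      have h3 : -((i : ℝ) * Real.log κ) ≤ i * |Real.log κ| := by
        rw [← mul_neg]; exact mul_le_mul_of_nonneg_left (neg_le_abs _) (Nat.cast_nonneg i)
      refine mul_le_mul_of_nonneg_left ?_ (by positivity)
      rw [hT]; linarith
    · intro j hj
      refine mul_nonneg (by positivity) ?_
      have : Real.log ‖ζ i - ζ j‖ ≤ Real.log (2 * R') := Real.log_le_log (hpos i j hj) (by
        linarith [norm_sub_le (ζ i) (ζ j), hζn i, hζn j])
      linarith
  calc _ ≤ ∫⁻ x in S, ENNReal.ofReal (1 / m ^ 2) * ∑ i ∈ Finset.range m, (Gd i x + 2 * ∑ j ∈ Finset.range i, Go i j x) :=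
        setLIntegral_mono' hSm hpt
    _ = ENNReal.ofReal (1 / m ^ 2) * ∑ i ∈ Finset.range m, (∫⁻ x in S, Gd i x + 2 * ∑ j ∈ Finset.range i, Go i j x) := by
        have hmm : ∀ i, Measurable fun x => Gd i x + 2 * ∑ j ∈ Finset.range i, Go i j x := fun i =>
          (hHm _ _).add ((Finset.measurable_fun_sum _ fun j _ => hGom i j).const_mul 2)
        rw [lintegral_const_mul _ (Finset.measurable_fun_sum _ fun i _ => hmm i), lintegral_finsetSum _ fun i _ => hmm i]
    _ ≤ ENNReal.ofReal (1 / m ^ 2) * ∑ i ∈ Finset.range m, ENNReal.ofReal (2 * Real.pi * (m * (2 + Real.log R' + 4 * T))) := by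
        gcongr with i hi
        rw [lintegral_add_left (hHm _ _), lintegral_const_mul _ (Finset.measurable_fun_sum _ fun j _ => hGom i j),
          lintegral_finsetSum _ fun j _ => hGom i j]
        refine (add_le_add (hId i) (mul_le_mul_right (hIo i) 2)).trans ?_
        rw [show (2 : ℝ≥0∞) = ENNReal.ofReal 2 by simp, ← ENNReal.ofReal_mul (by norm_num), ← ENNReal.ofReal_add (by positivity) (by positivity)]
        refine ENNReal.ofReal_le_ofReal ?_
        have hi' : (i : ℝ) ≤ m := by exact_mod_cast (Finset.mem_range.1 hi).le
        have h1 : (i : ℝ) * T ≤ m * T := by gcongr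
        have h2 : 1 + Real.log R' ≤ m * (1 + Real.log R') := le_mul_of_one_le_left (by positivity) hm1
        have h3 : (1 + Real.log R' + m) + 4 * (i * T) ≤ m * (2 + Real.log R' + 4 * T) := by nlinarith
        nlinarith
    _ = _ := by
        rw [Finset.sum_const, Finset.card_range, nsmul_eq_mul, ← ENNReal.ofReal_natCast, ← ENNReal.ofReal_mul (by positivity),
          ← ENNReal.ofReal_mul (by positivity)]
        congr 1; field_simp
end leja

section fin

lemma ulim_holo {q : ℂ} {r : ℝ} (hr : 0 < r) {ζ : ℕ → ℂ} (hζ : ∀ i, ‖ζ i - q‖ ≤ r) (φ : ℕ → ℕ) :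
    ∃ h : ℂ → ℂ, (∀ x, r < ‖x - q‖ → Tendsto (fun k => fLeja ζ (φ k) x) (hyperfilter ℕ) (𝓝 (h x))) ∧
      DifferentiableOn ℂ h {x | r < ‖x - q‖} ∧ ∀ x, r < ‖x - q‖ → ‖(x - q) * h x - 1‖ ≤ r / (‖x - q‖ - r) := by
  let A : ℕ → (ℕ → ℂ) → ℂ := fun N a => ((N : ℂ) + 1)⁻¹ * ∑ i ∈ Finset.range (N + 1), a i
  have hA : ∀ {a : ℕ → ℂ} {C : ℝ}, (∀ i, ‖a i‖ ≤ C) → ∀ N, ‖A N a‖ ≤ C := by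
    intro a C h N
    have e : ‖(N : ℂ) + 1‖ = N + 1 := by
      have : ((N : ℂ) + 1) = (((N : ℝ) + 1 : ℝ) : ℂ) := by push_cast; ring
      rw [this, Complex.norm_real, Real.norm_of_nonneg (by positivity)]
    have h1 := (norm_sum_le (Finset.range (N + 1)) a).trans (Finset.sum_le_sum fun i _ => h i)
    rw [Finset.sum_const, Finset.card_range, nsmul_eq_mul] at h1
    simp only [A]
    rw [norm_mul, norm_inv, e, inv_mul_le_iff₀ (by positivity)]
    exact_mod_cast h1
  have hex : ∀ a : ℕ → ℂ, ∃ l, (∃ C, ∀ i, ‖a i‖ ≤ C) → Tendsto (fun k => A (φ k) a) (hyperfilter ℕ) (𝓝 l) := by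
    intro a
    by_cases h : ∃ C, ∀ i, ‖a i‖ ≤ C
    · obtain ⟨C, hC⟩ := h
      obtain ⟨l, _, hl⟩ := (isCompact_closedBall (0 : ℂ) C).ultrafilter_le_nhds ((hyperfilter ℕ).map fun k => A (φ k) a)
        (by
          rw [le_principal_iff]
          exact Filter.mem_map.2 (univ_mem' fun k => by simpa using hA hC (φ k)))
      exact ⟨l, fun _ => hl⟩
    · exact ⟨0, fun h' => absurd h' h⟩
  choose L hL using hex
  have hLb : ∀ {a : ℕ → ℂ} {C : ℝ}, (∀ i, ‖a i‖ ≤ C) → ‖L a‖ ≤ C := fun {a C} h =>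
    le_of_tendsto (hL a ⟨C, h⟩).norm (Eventually.of_forall fun k => hA h _)
  have hd : ∀ x i, ‖x - q‖ - r ≤ ‖x - ζ i‖ := fun x i => by
    have := norm_sub_le_norm_sub_add_norm_sub x (ζ i) q
    linarith [hζ i]
  have hinv : ∀ x, r < ‖x - q‖ → ∀ i, ‖(x - ζ i)⁻¹‖ ≤ (‖x - q‖ - r)⁻¹ := fun x hx i => by
    rw [norm_inv]; exact inv_anti₀ (by linarith) (hd x i)
  have hne : ∀ x, r < ‖x - q‖ → ∀ i, x - ζ i ≠ 0 := fun x hx i => norm_pos_iff.1 (by linarith [hd x i])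
  let h : ℂ → ℂ := fun x => L fun i => (x - ζ i)⁻¹
  have hh : ∀ x, r < ‖x - q‖ → Tendsto (fun k => A (φ k) fun i => (x - ζ i)⁻¹) (hyperfilter ℕ) (𝓝 (h x)) :=
    fun x hx => hL _ ⟨_, hinv x hx⟩
  refine ⟨h, hh, ?_, ?_⟩
  · intro x hx
    have hx : r < ‖x - q‖ := hx
    set t := (‖x - q‖ - r) / 2 with ht
    have ht0 : 0 < t := by rw [ht]; linarith
    have hb2 : ∀ i, ‖-((x - ζ i)⁻¹ ^ 2)‖ ≤ (‖x - q‖ - r)⁻¹ ^ 2 := fun i => by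
      rw [norm_neg, norm_pow]; exact pow_le_pow_left₀ (norm_nonneg _) (hinv x hx i) 2
    have hh' := hL (fun i => -((x - ζ i)⁻¹ ^ 2)) ⟨_, hb2⟩
    refine DifferentiableAt.differentiableWithinAt (HasDerivAt.differentiableAt (f' := L fun i => -((x - ζ i)⁻¹ ^ 2)) ?_)
    rw [hasDerivAt_iff_isLittleO]
    have hbig : (fun y => h y - h x - (y - x) • L fun i => -((x - ζ i)⁻¹ ^ 2)) =O[𝓝 x] fun y => (y - x) ^ 2 := by
      refine Asymptotics.IsBigO.of_bound (t⁻¹ * (2 * t)⁻¹ ^ 2) ?_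
      filter_upwards [ball_mem_nhds x ht0] with y hy
      rw [mem_ball, dist_eq_norm] at hy
      have hyr : r + t < ‖y - q‖ := by
        have := norm_sub_le_norm_sub_add_norm_sub x y q
        rw [norm_sub_rev x y] at this
        linarith
      have hyr' : r < ‖y - q‖ := by linarith
      have h3 := ((hh y hyr').sub (hh x hx)).sub (hh'.const_mul (y - x))
      refine le_of_tendsto h3.norm (Eventually.of_forall fun k => ?_)
      have e : A (φ k) (fun i => (y - ζ i)⁻¹) - A (φ k) (fun i => (x - ζ i)⁻¹) - (y - x) * A (φ k) (fun i => -((x - ζ i)⁻¹ ^ 2))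
          = A (φ k) fun i => (y - x) ^ 2 * ((y - ζ i)⁻¹ * (x - ζ i)⁻¹ ^ 2) := by
        simp only [A]
        rw [mul_left_comm (y - x), ← mul_sub, ← mul_sub, Finset.mul_sum, ← Finset.sum_sub_distrib, ← Finset.sum_sub_distrib]
        congr 1
        refine Finset.sum_congr rfl fun i _ => ?_
        have := hne x hx i
        have := hne y hyr' i
        field_simp
        ring
      rw [e]
      refine hA (fun i => ?_) _
      rw [norm_mul, norm_mul, mul_comm, norm_pow (x - ζ i)⁻¹]
      refine mul_le_mul_of_nonneg_right (mul_le_mul ?_ (pow_le_pow_left₀ (norm_nonneg _) ?_ 2) (by positivity) (by positivity)) (norm_nonneg _)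
      · exact (hinv y hyr' i).trans (inv_anti₀ ht0 (by linarith))
      · exact (hinv x hx i).trans_eq (by rw [ht]; congr 1; ring)
    refine hbig.trans_isLittleO ?_
    have : (fun y : ℂ => (y - x) ^ 2) = fun y => (y - x) * (y - x) := by ext; ring
    rw [this]
    have h5 : (fun y : ℂ => y - x) =o[𝓝 x] (fun _ => (1 : ℂ)) := by
      rw [Asymptotics.isLittleO_one_iff]
      exact tendsto_sub_nhds_zero_iff.2 tendsto_id
    simpa using h5.mul_isBigO (Asymptotics.isBigO_refl (fun y : ℂ => y - x) (𝓝 x))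
  · intro x hx
    refine le_of_tendsto (((hh x hx).const_mul (x - q)).sub_const 1).norm (Eventually.of_forall fun k => ?_)
    have e : (x - q) * A (φ k) (fun i => (x - ζ i)⁻¹) - 1 = A (φ k) fun i => (ζ i - q) * (x - ζ i)⁻¹ := by
      have h1 : (1 : ℂ) = A (φ k) fun _ => 1 := by
        simp only [A]; rw [Finset.sum_const, Finset.card_range, nsmul_eq_mul, mul_one]; push_cast
        rw [inv_mul_cancel₀ (Nat.cast_add_one_ne_zero _)]
      conv_lhs => rw [h1]
      simp only [A]
      rw [mul_left_comm (x - q), ← mul_sub, Finset.mul_sum, ← Finset.sum_sub_distrib]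
      congr 1
      refine Finset.sum_congr rfl fun i _ => ?_
      have := hne x hx i
      field_simp
      ring
    rw [e]
    refine hA (fun i => ?_) _
    rw [norm_mul, div_eq_mul_inv]
    exact mul_le_mul (hζ i) (hinv x hx i) (norm_nonneg _) hr.le

lemma glue_false {q : ℂ} {r r0 : ℝ} (hr : 0 < r) (hrr : r < r0) (hrq : r < ‖q‖) {Δ : Set ℂ} (hΔo : IsOpen Δ) (hΔc : Convex ℝ Δ)
    (h0 : (0 : ℂ) ∈ Δ) (hq : ball q r0 ⊆ Δ) {g h : ℂ → ℂ} (hg : DifferentiableOn ℂ g Δ)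
    (hh : DifferentiableOn ℂ h {x | r < ‖x - q‖}) (hb : ∀ x, r < ‖x - q‖ → ‖(x - q) * h x - 1‖ ≤ r / (‖x - q‖ - r))
    (hgh : g =ᶠ[𝓝 0] h) : False := by
  have hO : IsOpen {x : ℂ | r < ‖x - q‖} := isOpen_lt continuous_const (by fun_prop)
  have hq0 : 0 < ‖q‖ := hr.trans hrq
  let Hp : Set ℂ := {x | r * ‖q‖ < ((starRingEnd ℂ) q * (q - x)).re}
  have hHpo : IsOpen Hp := isOpen_lt continuous_const (by fun_prop)
  have hHpc : Convex ℝ Hp := by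
    have : Hp = {x | ((starRingEnd ℂ) q * x).re < ((starRingEnd ℂ) q * q).re - r * ‖q‖} := by
      ext x; simp only [Hp, mem_setOf_eq, mul_sub, Complex.sub_re]; constructor <;> intro <;> linarith
    rw [this]
    exact convex_halfSpace_lt (f := fun x : ℂ => ((starRingEnd ℂ) q * x).re)
      ⟨fun x y => by rw [mul_add, Complex.add_re], fun c x => by simp; ring⟩ _
  have hHpr : ∀ x ∈ Hp, r < ‖x - q‖ := fun x hx => by
    have h1 : ((starRingEnd ℂ) q * (q - x)).re ≤ ‖q‖ * ‖x - q‖ := by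
      refine (Complex.re_le_norm _).trans_eq ?_
      rw [norm_mul, RCLike.norm_conj, norm_sub_rev]
    have h2 : r * ‖q‖ < ‖q‖ * ‖x - q‖ := lt_of_lt_of_le hx h1
    nlinarith
  let An : Set ℂ := ball q r0 ∩ {x | r < ‖x - q‖}
  have hAn : IsPreconnected An := by
    have : An = (fun p : ℝ × ℝ => circleMap q p.1 p.2) '' (Ioo r r0 ×ˢ univ) := by
      ext x
      constructor
      · rintro ⟨h1, h2⟩
        rw [mem_ball, dist_eq_norm] at h1
        refine ⟨(‖x - q‖, (x - q).arg), ⟨⟨h2, h1⟩, mem_univ _⟩, ?_⟩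
        simp [circleMap, Complex.norm_mul_exp_arg_mul_I]
      · rintro ⟨⟨ρ, θ⟩, ⟨⟨h1, h2⟩, -⟩, rfl⟩
        have : ‖circleMap q ρ θ - q‖ = ρ := by
          rw [circleMap_sub_center, norm_circleMap_zero, abs_of_pos (hr.trans h1)]
        exact ⟨by rw [mem_ball, dist_eq_norm]; simp only [this]; exact h2, by simp only [mem_setOf_eq, this]; exact h1⟩
    rw [this]
    exact ((convex_Ioo r r0).prod convex_univ).isPreconnected.image _ (by
      have : Continuous fun p : ℝ × ℝ => circleMap q p.1 p.2 := by unfold circleMap; fun_prop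
      exact this.continuousOn)
  let W : Set ℂ := An ∪ (Δ ∩ Hp)
  have hWo : IsOpen W := (isOpen_ball.inter hO).union (hΔo.inter hHpo)
  have hWΔ : W ⊆ Δ := union_subset (inter_subset_left.trans hq) inter_subset_left
  have hWr : W ⊆ {x | r < ‖x - q‖} := union_subset inter_subset_right fun x hx => hHpr x hx.2
  obtain ⟨ρ, hρ1, hρ2⟩ := exists_between hrr
  have hWc : IsPreconnected W := by
    have hn : ‖q - (ρ / ‖q‖ : ℝ) * q - q‖ = ρ := by
      rw [sub_right_comm, sub_self, zero_sub, norm_neg, norm_mul, Complex.norm_real, Real.norm_of_nonneg (by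
        have := hr.trans hρ1; positivity)]
      field_simp
    have hm : q - (ρ / ‖q‖ : ℝ) * q ∈ ball q r0 := by rw [mem_ball, dist_eq_norm, hn]; exact hρ2
    refine IsPreconnected.union (q - (ρ / ‖q‖ : ℝ) * q) ⟨hm, ?_⟩ ⟨hq hm, ?_⟩ hAn (hΔc.inter hHpc).isPreconnected
    · rw [mem_setOf_eq, hn]; exact hρ1
    · show r * ‖q‖ < _
      rw [sub_sub_cancel, mul_left_comm, ← Complex.normSq_eq_conj_mul_self, ← Complex.ofReal_mul, Complex.ofReal_re,
        Complex.normSq_eq_norm_sq]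
      have : ρ / ‖q‖ * ‖q‖ ^ 2 = ρ * ‖q‖ := by field_simp
      rw [this]; gcongr
  have h0W : (0 : ℂ) ∈ W := Or.inr ⟨h0, by
    show r * ‖q‖ < _
    rw [sub_zero, ← Complex.normSq_eq_conj_mul_self, Complex.ofReal_re, Complex.normSq_eq_norm_sq]; nlinarith⟩
  have heq : EqOn g h W := ((hg.mono hWΔ).analyticOnNhd hWo).eqOn_of_preconnected_of_eventuallyEq
    ((hh.mono hWr).analyticOnNhd hWo) hWc h0W hgh
  let E : ℂ → ℂ := fun x => if ‖x - q‖ < r0 then g x else h x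
  have hEh : ∀ x, r < ‖x - q‖ → E x = h x := fun x hx => by
    simp only [E]
    split_ifs with h1
    · exact heq (Or.inl ⟨by rwa [mem_ball, dist_eq_norm], hx⟩)
    · rfl
  have hE : Differentiable ℂ E := by
    intro x
    by_cases hx : r < ‖x - q‖
    · refine ((hh x hx).differentiableAt (hO.mem_nhds hx)).congr_of_eventuallyEq ?_
      filter_upwards [hO.mem_nhds hx] with y hy using hEh y hy
    · have hx' : x ∈ ball q r0 := by rw [mem_ball, dist_eq_norm]; linarith
      refine ((hg x (hq hx')).differentiableAt (hΔo.mem_nhds (hq hx'))).congr_of_eventuallyEq ?_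
      filter_upwards [isOpen_ball.mem_nhds hx'] with y hy
      rw [mem_ball, dist_eq_norm] at hy
      simp only [E, if_pos hy]
  have hlim : Tendsto E (cocompact ℂ) (𝓝 0) := by
    have ht : Tendsto (fun x : ℂ => ‖x‖ - ‖q‖) (cocompact ℂ) atTop :=
      tendsto_atTop_add_const_right _ _ tendsto_norm_cocompact_atTop
    refine squeeze_zero_norm' ?_ (ht.const_div_atTop 2)
    filter_upwards [ht.eventually_ge_atTop (2 * r)] with x hx
    have h1 : ‖x‖ - ‖q‖ ≤ ‖x - q‖ := norm_sub_norm_le x q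
    have h2 : r < ‖x - q‖ := by linarith
    rw [hEh x h2]
    have h3 := (hb x h2).trans (div_le_one_of_le₀ (by linarith) (by linarith))
    have h4 : ‖(x - q) * h x‖ ≤ 2 := by
      have := norm_add_le ((x - q) * h x - 1) 1
      rw [sub_add_cancel, norm_one] at this
      linarith
    rw [norm_mul] at h4
    rw [le_div_iff₀ (by linarith)]
    nlinarith [norm_nonneg (h x)]
  have hz : ∀ x, E x = 0 := fun x => hE.apply_eq_of_tendsto_cocompact x hlim
  have hn : ‖q + ((3 * r : ℝ) : ℂ) - q‖ = 3 * r := by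
    rw [add_sub_cancel_left, Complex.norm_real, Real.norm_of_nonneg (by positivity)]
  have h1 := hb (q + ((3 * r : ℝ) : ℂ)) (by rw [hn]; linarith)
  rw [← hEh _ (by rw [hn]; linarith), hz, hn, mul_zero, zero_sub, norm_neg, norm_one, le_div_iff₀ (by linarith)] at h1
  linarith
end fin

/-- If `D ⊆ ℂⁿ` (`n ≥ 2`) is a bounded pseudoconvex domain, `P ⊆ D` a polydisc with
`∂P ∩ ∂D ≠ ∅`, `P̃` a polydisc with `P ⋐ P̃`, and every `f ∈ L²ₕ(D)` extends to a bounded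
holomorphic function on `P̃` agreeing with `f` on `P`, then for every `z ∈ P` and every
complex line `L ∋ z` the set `(L ∩ P̃) \ D` is polar (in the line coordinate). -/
theorem lines_polar_of_bounded_extension {n : ℕ} (hn : 2 ≤ n) (D : Set (Fin n → ℂ))
    (hopen : IsOpen D) (hconn : IsConnected D) (hbd : Bornology.IsBounded D)
    (hpsc : IsPseudoconvex D)
    (c c' : Fin n → ℂ) (r r' : Fin n → ℝ) (hr : ∀ i, 0 < r i) (hr' : ∀ i, 0 < r' i)
    (hPD : polydisc c r ⊆ D)
    (hfront : (frontier (polydisc c r) ∩ frontier D).Nonempty)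
    (hPP : closure (polydisc c r) ⊆ polydisc c' r')
    (hext : ∀ f ∈ L2h D, ∃ g : (Fin n → ℂ) → ℂ, DifferentiableOn ℂ g (polydisc c' r') ∧
      (∃ M : ℝ, ∀ z ∈ polydisc c' r', ‖g z‖ ≤ M) ∧ Set.EqOn g f (polydisc c r)) :
    ∀ z ∈ polydisc c r, ∀ b : Fin n → ℂ, b ≠ 0 →
      PolarSet {lam : ℂ | z + lam • b ∈ polydisc c' r' ∧ z + lam • b ∉ D} := by
  intro z hz b hb q ⟨hqΔ, hqD⟩
  have hline : Continuous fun l : ℂ => z + l • b := by fun_prop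
  have hPo : ∀ (c : Fin n → ℂ) (r : Fin n → ℝ), IsOpen (polydisc c r) := fun c r => by
    have : polydisc c r = ⋂ i, {z | ‖z i - c i‖ < r i} := by ext; simp [polydisc]
    rw [this]
    exact isOpen_iInter_of_finite fun i => isOpen_lt (by fun_prop) continuous_const
  have hPc : Convex ℝ (polydisc c' r') := by
    have : polydisc c' r' = Set.univ.pi fun i => ball (c' i) (r' i) := by
      ext; simp [polydisc, dist_eq_norm]
    rw [this]
    exact convex_pi fun i _ => convex_ball _ _
  set Δ : Set ℂ := {l | z + l • b ∈ polydisc c' r'} with hΔ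
  have hΔo : IsOpen Δ := (hPo c' r').preimage hline
  have hΔc : Convex ℝ Δ := by
    intro x hx y hy s t hs ht hst
    have := hPc hx hy hs ht hst
    have e : s • (z + x • b) + t • (z + y • b) = z + (s • x + t • y) • b := by
      rw [smul_add, smul_add, add_smul, smul_assoc, smul_assoc]
      nth_rw 3 [← one_smul ℝ z]
      rw [← hst, add_smul]; abel
    rw [e] at this
    exact this
  have h0Δ : (0 : ℂ) ∈ Δ := by
    show z + (0 : ℂ) • b ∈ polydisc c' r'
    rw [zero_smul, add_zero]; exact hPP (subset_closure hz)
  have hq0 : q ≠ 0 := fun h => hqD (by rw [h, zero_smul, add_zero]; exact hPD hz)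
  have hqn : 0 < ‖q‖ := norm_pos_iff.2 hq0
  obtain ⟨r0, hr0, hB⟩ := Metric.isOpen_iff.1 hΔo q hqΔ
  obtain ⟨ρ, hρ0, hρ1, hρ2, hρ3⟩ : ∃ ρ : ℝ, 0 < ρ ∧ ρ < r0 ∧ ρ < ‖q‖ ∧ ρ ≤ 1 / 2 :=
    ⟨min (min r0 ‖q‖) 1 / 2, by positivity,
      by linarith [min_le_left (min r0 ‖q‖) 1, min_le_left r0 ‖q‖],
      by linarith [min_le_left (min r0 ‖q‖) 1, min_le_right r0 ‖q‖],
      by linarith [min_le_right (min r0 ‖q‖) 1]⟩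
  set K : Set ℂ := closedBall q ρ ∩ {l | z + l • b ∉ D} with hK
  have hKc : IsCompact K := (isCompact_closedBall q ρ).inter_right (hopen.isClosed_compl.preimage hline)
  have hKn : K.Nonempty := ⟨q, mem_closedBall_self hρ0.le, hqD⟩
  refine ⟨ball q ρ, isOpen_ball, (convex_ball q ρ).isConnected ⟨q, mem_ball_self hρ0⟩, mem_ball_self hρ0, ?_⟩
  by_cases hA : ∀ κ : ℝ, 0 < κ → ∃ (N : ℕ) (ζ : ℕ → ℂ), (∀ i < N, ζ i ∈ K) ∧
      ∀ x ∈ K, ∏ i ∈ Finset.range N, ‖x - ζ i‖ < κ ^ N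
  · obtain ⟨u, hu1, hu2, hu3⟩ := polar_local hρ0 hρ3 inter_subset_left hKn hA
    exact ⟨u, hu1, hu2, fun x hx => hu3 x ⟨ball_subset_closedBall hx.2, hx.1.2⟩⟩
  exfalso
  push Not at hA
  obtain ⟨κ, hκ, hκ2⟩ := hA
  obtain ⟨ζ, hζ, hp⟩ := leja_seq hκ2
  obtain ⟨G, hG, φ, hφ⟩ := ot2 hn hopen hbd hpsc z b hb (f := fLeja ζ) hKc hKn (fun l hl => hl.2)
    (fun N x hx => by
      refine DifferentiableAt.differentiableWithinAt ?_
      unfold fLeja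
      refine DifferentiableAt.const_mul (DifferentiableAt.fun_sum fun i _ => ?_) _
      exact (differentiableAt_id.sub_const _).inv (sub_ne_zero.2 fun (h : x = ζ i) => hx (h ▸ hζ i)))
    (leja_bound hκ hKc.isBounded hζ hp)
  obtain ⟨h, hh1, hh2, hh3⟩ := ulim_holo hρ0 (fun i => by
    have := (hζ i).1
    rwa [mem_closedBall, dist_eq_norm] at this) φ
  obtain ⟨g, hg1, -, hg3⟩ := hext G hG
  refine glue_false hρ0 hρ1 hρ2 hΔo hΔc h0Δ hB (g := fun l => g (z + l • b)) (h := h) ?_ hh2 hh3 ?_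
  · exact hg1.comp (by fun_prop) fun l hl => hl
  · have h1 : ∀ᶠ l : ℂ in 𝓝 0, z + l • b ∈ polydisc c r :=
      hline.continuousAt.eventually_mem ((hPo c r).mem_nhds (by simpa using hz))
    have h2 : ∀ᶠ l : ℂ in 𝓝 0, ρ < ‖l - q‖ :=
      (isOpen_lt continuous_const (by fun_prop)).mem_nhds (by simpa using hρ2)
    filter_upwards [h1, h2] with l hl1 hl2
    rw [hg3 hl1]
    exact tendsto_nhds_unique (hφ l (hPD hl1)) (hh1 l hl2)
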